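/- Fix an integer k ≥ 2. For every ε > 0 there exists a constant C > 0 such that for every positive integer U and every nonzero integer h, one has E⁺_h(S_{U,k}) ≤ C · U^{1 + 2/√k + ε}, where S_{U,k} = { u^k : 1 ≤ u ≤ U }. -/

import Mathlib

open scoped BigOperators Classical

/-- The asymmetric additive energy `E⁺_h(S)`. -/
def addEnergyShift (h : ℤ) (S : Finset ℤ) : ℕ :=
  ((S ×ˢ S ×ˢ S ×ˢ S).filter fun x => x.1 + x.2.1 = x.2.2.1 + x.2.2.2 + h).card

section
/-- The fibre count. -/
def Zset (k U : ℕ) (n : ℤ) : Finset (ℕ × ℕ × ℕ) :=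
  ((Finset.Icc 1 U) ×ˢ (Finset.Icc 1 U) ×ˢ (Finset.Icc 1 U)).filter
    fun x => (x.1 : ℤ) ^ k + (x.2.1 : ℤ) ^ k = (x.2.2 : ℤ) ^ k + n ∧ x.1 ≠ x.2.2 ∧ x.2.1 ≠ x.2.2

def CoreBound : Prop := ∀ k : ℕ, 5 ≤ k → ∀ ε : ℝ, 0 < ε → ∃ C : ℝ, 0 < C ∧
  ∀ U : ℕ, 0 < U → ∀ n : ℤ, n ≠ 0 →
    ((Zset k U n).card : ℝ) ≤ C * (U : ℝ) ^ (2 / Real.sqrt k + ε)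

/-- fibre-wise counting helper -/
theorem card_le_fiber {α β : Type*} [DecidableEq β] (A : Finset α) (T : Finset β) (f : α → β) (M : ℝ)
    (hf : ∀ x ∈ A, f x ∈ T) (hM : ∀ t ∈ T, ((A.filter fun x => f x = t).card : ℝ) ≤ M) :
    (A.card : ℝ) ≤ T.card * M := by
  rw [Finset.card_eq_sum_card_fiberwise (f := f) (t := T) hf]
  push_cast
  calc _ ≤ ∑ t ∈ T, M := Finset.sum_le_sum hM
    _ = _ := by simp

end

section
/-- The divisor bound. -/
theorem divisor_bound (ε : ℝ) (hε : 0 < ε) :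
    ∃ C : ℝ, 1 ≤ C ∧ ∀ n : ℕ, n ≠ 0 → ((n.divisors.card : ℕ) : ℝ) ≤ C * (n : ℝ) ^ ε := by
  have hlog2 : 0 < Real.log 2 := Real.log_pos (by norm_num)
  obtain ⟨P, hP⟩ := exists_nat_gt ((2 : ℝ) ^ (1 / ε))
  set K : ℝ := 1 + 1 / (ε * Real.log 2) with hK
  have hK1 : 1 ≤ K := by
    have : 0 < 1 / (ε * Real.log 2) := by positivity
    linarith
  have key : ∀ p a : ℕ, p.Prime → ((a : ℝ) + 1) ≤ (if p < P then K else 1) * (p : ℝ) ^ (ε * a) := by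
    intro p a hp
    have hp2 : (2 : ℝ) ≤ p := by exact_mod_cast hp.two_le
    split_ifs with h
    · have h1 : (2 : ℝ) ^ (ε * a) ≤ (p : ℝ) ^ (ε * a) :=
        Real.rpow_le_rpow (by norm_num) hp2 (by positivity)
      have h2 : 1 + ε * a * Real.log 2 ≤ (2 : ℝ) ^ (ε * a) := by
        rw [Real.rpow_def_of_pos (by norm_num)]
        have := Real.add_one_le_exp (Real.log 2 * (ε * a))
        linarith
      have h3 : (a : ℝ) + 1 ≤ K * (1 + ε * a * Real.log 2) := by
        have e1 : K * (1 + ε * a * Real.log 2) = 1 + 1 / (ε * Real.log 2) + ε * a * Real.log 2 + a := by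
          rw [hK]; field_simp; ring
        rw [e1]
        have : 0 < 1 / (ε * Real.log 2) := by positivity
        have : 0 ≤ ε * a * Real.log 2 := by positivity
        linarith
      calc (a : ℝ) + 1 ≤ K * (1 + ε * a * Real.log 2) := h3
        _ ≤ K * (p : ℝ) ^ (ε * a) := by gcongr; linarith
    · push Not at h
      have h1 : (2 : ℝ) ≤ (p : ℝ) ^ ε := by
        have : (2 : ℝ) ^ (1 / ε) ≤ p := hP.le.trans (by exact_mod_cast h)
        calc (2 : ℝ) = ((2 : ℝ) ^ (1 / ε)) ^ ε := by
              rw [← Real.rpow_mul (by norm_num)]; field_simp; simp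
          _ ≤ _ := Real.rpow_le_rpow (by positivity) this hε.le
      rw [one_mul, Real.rpow_mul (by positivity), Real.rpow_natCast]
      calc (a : ℝ) + 1 ≤ 2 ^ a := by
            have := Nat.lt_two_pow_self (n := a)
            exact_mod_cast this
        _ ≤ _ := by gcongr
  refine ⟨K ^ P, one_le_pow₀ hK1, fun n hn => ?_⟩
  rw [Nat.card_divisors hn]
  push_cast
  calc ∏ p ∈ n.primeFactors, ((n.factorization p : ℝ) + 1)
      ≤ ∏ p ∈ n.primeFactors, ((if p < P then K else 1) * (p : ℝ) ^ (ε * n.factorization p)) := by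
        apply Finset.prod_le_prod
        · intros; positivity
        · intro p hp; exact key p _ (Nat.prime_of_mem_primeFactors hp)
    _ = (∏ p ∈ n.primeFactors, (if p < P then K else 1)) * (n : ℝ) ^ ε := by
        rw [Finset.prod_mul_distrib]
        congr 1
        conv_rhs => rw [← Nat.prod_factorization_pow_eq_self hn]
        rw [Finsupp.prod]
        push_cast
        rw [← Real.finsetProd_rpow _ _ (by intros; positivity)]
        apply Finset.prod_congr (by simp)
        intro p _
        rw [mul_comm, Real.rpow_mul (by positivity), Real.rpow_natCast]
    _ ≤ K ^ P * (n : ℝ) ^ ε := by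
        gcongr
        rw [Finset.prod_ite]
        simp only [Finset.prod_const, one_pow, mul_one]
        apply pow_le_pow_right₀ hK1
        calc _ ≤ (Finset.range P).card := Finset.card_le_card (by intro x; simp)
          _ = P := by simp

theorem pow_diff_strictMono (d : ℤ) (hd : 0 < d) (k : ℕ) (hk : 2 ≤ k) (y z : ℤ) (hy : 0 ≤ y)
    (hyz : y < z) : (y + d) ^ k - y ^ k < (z + d) ^ k - z ^ k := by
  induction k, hk using Nat.le_induction with
  | base => nlinarith
  | succ k hk ih =>
    have e : ∀ w : ℤ, (w + d) ^ (k + 1) - w ^ (k + 1) =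
        (w + d) * ((w + d) ^ k - w ^ k) + d * w ^ k := by intro w; ring
    rw [e, e]
    have h1 : y ^ k ≤ z ^ k := pow_le_pow_left₀ hy hyz.le k
    have h2 : 0 ≤ (y + d) ^ k - y ^ k := by
      have := pow_le_pow_left₀ hy (by linarith : y ≤ y + d) k
      linarith
    have h3 : (y + d) * ((y + d) ^ k - y ^ k) ≤ (y + d) * ((z + d) ^ k - z ^ k) :=
      mul_le_mul_of_nonneg_left ih.le (by linarith)
    have h4 : (y + d) * ((z + d) ^ k - z ^ k) < (z + d) * ((z + d) ^ k - z ^ k) :=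
      mul_lt_mul_of_pos_right (by linarith) (by linarith)
    have h5 := mul_le_mul_of_nonneg_left h1 hd.le
    linarith

/-- Pairs with prescribed nonzero difference of `k`-th powers. -/
theorem pow_diff_count (k : ℕ) (hk : 2 ≤ k) (ε : ℝ) (hε : 0 < ε) :
    ∃ C : ℝ, 1 ≤ C ∧ ∀ U : ℕ, 0 < U → ∀ m : ℤ, m ≠ 0 →
      ((((Finset.Icc 1 U) ×ˢ (Finset.Icc 1 U)).filter
        fun x : ℕ × ℕ => (x.1 : ℤ) ^ k - (x.2 : ℤ) ^ k = m).card : ℝ) ≤ C * (U : ℝ) ^ ε := by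
  obtain ⟨C, hC1, hC⟩ := divisor_bound (ε / k) (by positivity)
  refine ⟨C, hC1, fun U hU m hm => ?_⟩
  set A := ((Finset.Icc 1 U) ×ˢ (Finset.Icc 1 U)).filter
        fun x : ℕ × ℕ => (x.1 : ℤ) ^ k - (x.2 : ℤ) ^ k = m with hA
  have hU0 : (0 : ℝ) < U := by exact_mod_cast hU
  rcases A.eq_empty_or_nonempty with h0 | ⟨x0, hx0⟩
  · rw [h0]; simp; positivity
  have hmU : m.natAbs ≤ U ^ k := by
    simp only [hA, Finset.mem_filter, Finset.mem_product, Finset.mem_Icc] at hx0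
    obtain ⟨⟨⟨h1, h2⟩, h3, h4⟩, h5⟩ := hx0
    have e1 : x0.1 ^ k ≤ U ^ k := Nat.pow_le_pow_left h2 k
    have e2 : x0.2 ^ k ≤ U ^ k := Nat.pow_le_pow_left h4 k
    zify at e1 e2 ⊢
    rw [abs_le]
    constructor
    · have : (0:ℤ) ≤ (x0.1:ℤ)^k := by positivity
      linarith
    · have : (0:ℤ) ≤ (x0.2:ℤ)^k := by positivity
      linarith
  have hcard : A.card ≤ m.natAbs.divisors.card := by
    apply Finset.card_le_card_of_injOn (fun x : ℕ × ℕ => ((x.1 : ℤ) - x.2).natAbs)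
    · intro x hx
      simp only [hA, Finset.coe_filter, Set.mem_ofPred_eq] at hx
      simp only [Finset.mem_coe, Nat.mem_divisors]
      refine ⟨?_, by simpa using hm⟩
      rw [Int.natAbs_dvd_natAbs, ← hx.2]
      exact sub_dvd_pow_sub_pow _ _ _
    · have mono : ∀ x ∈ A, ∀ y ∈ A, ((x.1 : ℤ) - x.2).natAbs = ((y.1 : ℤ) - y.2).natAbs →
          ¬ x.2 < y.2 := by
        intro x hx y hy hxy hlt
        simp only [hA, Finset.mem_filter, Finset.mem_product, Finset.mem_Icc] at hx hy
        obtain ⟨⟨⟨h1, h2⟩, h3, h4⟩, h5⟩ := hx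
        obtain ⟨⟨⟨g1, g2⟩, g3, g4⟩, g5⟩ := hy
        have hk0 : k ≠ 0 := by omega
        have hxm : ∀ z w : ℕ, (z : ℤ) ^ k - (w : ℤ) ^ k = m → (w < z ↔ 0 < m) := by
          intro z w h
          rw [← h, sub_pos]
          constructor
          · intro h; exact_mod_cast Nat.pow_lt_pow_left h hk0
          · intro h
            have h' : w ^ k < z ^ k := by exact_mod_cast h
            exact lt_of_pow_lt_pow_left₀ k (Nat.zero_le _) h'
        have a1 := hxm _ _ h5
        have a2 := hxm _ _ g5
        by_cases hm0 : 0 < m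
        · have b1 := a1.2 hm0
          have b2 := a2.2 hm0
          have b3 : (y.1 : ℤ) = y.2 + ((x.1 : ℤ) - x.2) := by omega
          have b4 : (x.1 : ℤ) = x.2 + ((x.1 : ℤ) - x.2) := by ring
          have := pow_diff_strictMono ((x.1 : ℤ) - x.2) (by omega) k hk x.2 y.2 (by omega)
            (by omega)
          rw [← b3, ← b4] at this
          linarith
        · have c1 : x.1 ≠ x.2 := by rintro e; rw [e] at h5; simp at h5; exact hm h5.symm
          have c2 : y.1 ≠ y.2 := by rintro e; rw [e] at g5; simp at g5; exact hm g5.symm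
          have b1 : ¬ x.2 < x.1 := fun h => hm0 (a1.1 h)
          have b2 : ¬ y.2 < y.1 := fun h => hm0 (a2.1 h)
          have b3 : (y.2 : ℤ) = y.1 + ((x.2 : ℤ) - x.1) := by omega
          have b4 : (x.2 : ℤ) = x.1 + ((x.2 : ℤ) - x.1) := by ring
          have := pow_diff_strictMono ((x.2 : ℤ) - x.1) (by omega) k hk x.1 y.1 (by omega)
            (by omega)
          rw [← b3, ← b4] at this
          linarith
      intro x hx y hy hxy
      have hx' : x ∈ A := hx
      have hy' : y ∈ A := hy
      have e2 : x.2 = y.2 := by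
        have := mono x hx' y hy' hxy
        have := mono y hy' x hx' hxy.symm
        omega
      simp only [hA, Finset.mem_filter] at hx' hy'
      have e1 : x.1 = y.1 := by
        have h := hx'.2.trans hy'.2.symm
        rw [e2] at h
        have h' : x.1 ^ k = y.1 ^ k := by
          have : (x.1 : ℤ) ^ k = (y.1 : ℤ) ^ k := by linarith
          exact_mod_cast this
        exact Nat.pow_left_injective (by omega : k ≠ 0) h'
      exact Prod.ext e1 e2
  calc (A.card : ℝ) ≤ (m.natAbs.divisors.card : ℝ) := by exact_mod_cast hcard
    _ ≤ C * (m.natAbs : ℝ) ^ (ε / k) := hC _ (by simpa using hm)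
    _ ≤ C * ((U : ℝ) ^ k) ^ (ε / k) := by
        gcongr
        exact_mod_cast hmU
    _ = C * (U : ℝ) ^ ε := by
        rw [← Real.rpow_natCast, ← Real.rpow_mul hU0.le]
        congr 2
        field_simp

end

section
/-- Weighted divisibility of determinants whose rows have local expansions. -/
theorem det_dvd {ι μ κ : Type*} [Fintype ι] [DecidableEq ι] [Fintype μ] [Fintype κ]
    (A : Matrix ι ι ℤ) (q : ℤ) (cl : ι → κ) (w : μ → ℕ) (T : ℕ)
    (x : ι → μ → ℤ) (y : κ → μ → ι → ℤ) (e : ι → ι → ℤ)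
    (hA : ∀ i j, A i j = ∑ m, q ^ w m * x i m * y (cl i) m j + q ^ T * e i j) :
    q ^ (Fintype.card ι * T - Fintype.card κ * ∑ m, (T - w m)) ∣ A.det := by
  set W : Option μ → ℕ := fun o => o.elim T w with hW
  set X : ι → Option μ → ℤ := fun i o => o.elim 1 (x i) with hX
  set Y : ι → Option μ → ι → ℤ := fun i o => o.elim (e i) (y (cl i)) with hY
  have hrow : A = fun i => ∑ o : Option μ, (q ^ W o * X i o) • Y i o := by
    funext i j
    rw [hA, Finset.sum_apply, Fintype.sum_option]
    simp [hW, hX, hY]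
    ring
  have hdet : A.det = ∑ f : ι → Option μ, (∏ i, q ^ W (f i) * X i (f i)) *
      Matrix.det (fun i => Y i (f i) : Matrix ι ι ℤ) := by
    conv_lhs => rw [hrow]
    have h1 := MultilinearMap.map_sum (Matrix.detRowAlternating (R := ℤ) (n := ι)).toMultilinearMap
      (fun i (o : Option μ) => (q ^ W o * X i o) • Y i o)
    have h2 : ∀ f : ι → Option μ, (Matrix.detRowAlternating (R := ℤ) (n := ι)).toMultilinearMap
        (fun i => (q ^ W (f i) * X i (f i)) • Y i (f i)) = (∏ i, q ^ W (f i) * X i (f i)) *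
      Matrix.det (fun i => Y i (f i) : Matrix ι ι ℤ) := by
      intro f
      rw [MultilinearMap.map_smul_univ]
      rfl
    simp only [h2] at h1
    exact h1
  rw [hdet]
  apply Finset.dvd_sum
  intro f _
  by_cases hf : ∃ i i', i ≠ i' ∧ cl i = cl i' ∧ f i = f i' ∧ (f i) ≠ none
  · obtain ⟨i, i', hii, hcl, hff, hn⟩ := hf
    have : Matrix.det (fun i => Y i (f i) : Matrix ι ι ℤ) = 0 := by
      apply Matrix.det_zero_of_row_eq hii
      obtain ⟨m, hm⟩ := Option.ne_none_iff_exists'.1 hn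
      show Y i (f i) = Y i' (f i')
      rw [← hff, hm]
      simp [hY, hcl]
    rw [this, mul_zero]
    exact dvd_zero _
  · push Not at hf
    apply Dvd.dvd.mul_right
    rw [Finset.prod_mul_distrib]
    apply Dvd.dvd.mul_right
    rw [Finset.prod_pow_eq_pow_sum]
    apply pow_dvd_pow
    have h1 : ∑ i, (T - W (f i)) ≤ Fintype.card κ * ∑ m, (T - w m) := by
      rw [← Finset.sum_fiberwise (s := Finset.univ) (g := cl)]
      calc ∑ c, ∑ i with cl i = c, (T - W (f i)) ≤ ∑ c : κ, ∑ m, (T - w m) := by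
            apply Finset.sum_le_sum
            intro c _
            have h2 : ∑ i with cl i = c, (T - W (f i)) =
                ∑ i with cl i = c ∧ f i ≠ none, (T - W (f i)) := by
              symm
              apply Finset.sum_subset
              · intro i; simp; tauto
              · intro i hi hi'
                simp only [Finset.mem_filter, Finset.mem_univ, true_and] at hi hi'
                have : f i = none := by tauto
                rw [this]; simp [hW]
            rw [h2]
            have h3 : ∑ m, (T - w m) = ∑ o : Option μ, (T - W o) := by
              rw [Fintype.sum_option]; simp [hW]
            rw [h3]
            have hinj : Set.InjOn f ↑(Finset.univ.filter fun i => cl i = c ∧ f i ≠ none) := by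
              intro i hi i' hi' hh
              simp only [Finset.coe_filter, Finset.mem_univ, true_and, Set.mem_ofPred_eq] at hi hi'
              by_contra hne
              exact hi.2 (hf i i' hne (hi.1.trans hi'.1.symm) hh)
            rw [← Finset.sum_image (f := fun o => T - W o) hinj]
            exact Finset.sum_le_sum_of_subset (Finset.subset_univ _)
        _ = _ := by simp
    have h2 : Fintype.card ι * T = ∑ i : ι, T := by simp
    have h3 : ∑ i : ι, T ≤ ∑ i, (T - W (f i)) + ∑ i, W (f i) := by
      rw [← Finset.sum_add_distrib]
      exact Finset.sum_le_sum fun i _ => by omega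
    omega

theorem dvd_congr_aux {a b c : ℤ} (h : b = c) : a ∣ b ↔ a ∣ c := by rw [h]

/-- Functions on `S` congruent mod `p ^ T` to polynomials in the parameters `t`. -/
def analyticSubring {S σ : Type*} (p : ℤ) (T : ℕ) (t : σ → S → ℤ) : Subring (S → ℤ) where
  carrier := {f | ∃ H : MvPolynomial σ ℤ, ∀ z, p ^ T ∣ f z - MvPolynomial.eval (fun i => t i z) H}
  mul_mem' := by
    rintro f g ⟨H, hH⟩ ⟨K, hK⟩
    refine ⟨H * K, fun z => ?_⟩
    have h1 := (hH z).mul_right (g z)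
    have h2 := (hK z).mul_left (MvPolynomial.eval (fun i => t i z) H)
    have := h1.add h2
    simp only [Pi.mul_apply, map_mul]
    refine (dvd_congr_aux ?_).1 this
    ring
  one_mem' := ⟨1, fun z => by simp⟩
  add_mem' := by
    rintro f g ⟨H, hH⟩ ⟨K, hK⟩
    refine ⟨H + K, fun z => ?_⟩
    have := (hH z).add (hK z)
    simp only [Pi.add_apply, map_add]
    refine (dvd_congr_aux ?_).1 this
    ring
  zero_mem' := ⟨0, fun z => by simp⟩
  neg_mem' := by
    rintro f ⟨H, hH⟩
    refine ⟨-H, fun z => ?_⟩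
    have := (hH z).neg_right
    simp only [Pi.neg_apply, map_neg]
    refine (dvd_congr_aux ?_).1 this
    ring

theorem mem_analytic {S σ : Type*} {p : ℤ} {T : ℕ} {t : σ → S → ℤ} {f : S → ℤ} :
    f ∈ analyticSubring p T t ↔
      ∃ H : MvPolynomial σ ℤ, ∀ z, p ^ T ∣ f z - MvPolynomial.eval (fun i => t i z) H := Iff.rfl

theorem analytic_param {S σ : Type*} (p : ℤ) (T : ℕ) (t : σ → S → ℤ) (i : σ) :
    t i ∈ analyticSubring p T t := ⟨MvPolynomial.X i, fun z => by simp⟩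

theorem analytic_const {S σ : Type*} (p : ℤ) (T : ℕ) (t : σ → S → ℤ) (c : ℤ) :
    (fun _ => c) ∈ analyticSubring p T t := ⟨MvPolynomial.C c, fun z => by simp⟩

theorem analytic_of_congr {S σ : Type*} {p : ℤ} {T : ℕ} {t : σ → S → ℤ} {f g : S → ℤ}
    (hg : g ∈ analyticSubring p T t) (h : ∀ z, p ^ T ∣ f z - g z) :
    f ∈ analyticSubring p T t := by
  obtain ⟨H, hH⟩ := hg
  refine ⟨H, fun z => ?_⟩
  have := (h z).add (hH z)
  refine (dvd_congr_aux ?_).1 this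
  ring

/-- Newton approximation (Hensel): a root of a polynomial with analytic coefficients, which is
constant and simple mod `p`, is analytic. -/
theorem analytic_newton {S σ : Type*} {p : ℤ} {T : ℕ} {t : σ → S → ℤ} {f : S → ℤ}
    (G : Polynomial (S → ℤ)) (hG : ∀ n, G.coeff n ∈ analyticSubring p T t)
    (hf : G.eval f = 0) (a0 w : ℤ) (ha0 : ∀ z, p ∣ f z - a0)
    (hw : ∀ z, p ∣ w * (G.derivative.eval f z) - 1) :
    f ∈ analyticSubring p T t := by
  have key : ∀ j : ℕ, ∃ g ∈ analyticSubring p T t, ∀ z, p ^ (j + 1) ∣ f z - g z := by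
    intro j
    induction j with
    | zero => exact ⟨fun _ => a0, analytic_const _ _ _ _, by simpa using ha0⟩
    | succ j ih =>
      obtain ⟨g, hg, hd⟩ := ih
      refine ⟨g - (fun _ => w) * G.eval g, ?_, ?_⟩
      · apply Subring.sub_mem _ hg
        apply Subring.mul_mem _ (analytic_const _ _ _ _)
        rw [Polynomial.eval_eq_sum]
        exact Subring.sum_mem _ fun n _ => Subring.mul_mem _ (hG n) (Subring.pow_mem _ hg _)
      · intro z
        obtain ⟨c, hc⟩ := Polynomial.binomExpansion G f (g - f)
        rw [add_sub_cancel, hf, zero_add] at hc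
        rw [hc]
        simp only [Pi.sub_apply, Pi.mul_apply, Pi.add_apply, Pi.pow_apply]
        obtain ⟨u, hu⟩ := hd z
        obtain ⟨v, hv⟩ := hw z
        have hgz : g z = f z - p ^ (j + 1) * u := by linarith
        rw [hgz]
        refine ⟨- v * u + w * c z * p ^ j * u ^ 2, ?_⟩
        have hv' : w * (G.derivative.eval f z) = 1 + p * v := by linarith
        have e : f z - (f z - p ^ (j + 1) * u - w * (Polynomial.eval f (Polynomial.derivative G) z * (f z - p ^ (j + 1) * u - f z) + c z * (f z - p ^ (j + 1) * u - f z) ^ 2)) = p ^ (j+1) * u - (w * (G.derivative.eval f z)) * (p ^ (j + 1) * u) + w * c z * (p ^ (j + 1) * u) ^ 2 := by ring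
        rw [e, hv']
        ring
  obtain ⟨g, hg, hd⟩ := key T
  exact analytic_of_congr hg fun z => (pow_dvd_pow p (Nat.le_succ T)).trans (hd z)

/-- Expansion of an analytic function in the scaled parameters. -/
theorem analytic_expand {S σ : Type*} [Fintype σ] [DecidableEq σ] {p : ℤ} {T : ℕ} {t : σ → S → ℤ}
    (t' : σ → S → ℤ) (ht : ∀ i z, t i z = p * t' i z) {f : S → ℤ}
    (hf : f ∈ analyticSubring p T t) :
    ∃ y : (σ → Fin T) → ℤ, ∃ e : S → ℤ, ∀ z,
      f z = ∑ m : σ → Fin T, p ^ (∑ i, (m i : ℕ)) * (∏ i, t' i z ^ (m i : ℕ)) * y m + p ^ T * e z := by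
  obtain ⟨H, hH⟩ := hf
  refine ⟨fun m => H.coeff (Finsupp.equivFunOnFinite.symm fun i => (m i : ℕ)), ?_⟩
  suffices h : ∀ z, ∃ e : ℤ, f z = ∑ m : σ → Fin T, p ^ (∑ i, (m i : ℕ)) * (∏ i, t' i z ^ (m i : ℕ)) *
      H.coeff (Finsupp.equivFunOnFinite.symm fun i => (m i : ℕ)) + p ^ T * e by
    choose e he using h
    exact ⟨e, he⟩
  intro z
  set g : (σ →₀ ℕ) → ℤ := fun d => H.coeff d * ∏ i, t i z ^ d i with hg
  have h1 : MvPolynomial.eval (fun i => t i z) H = ∑ d ∈ H.support, g d := by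
    rw [MvPolynomial.eval_eq']
  have h2 : ∀ d : σ →₀ ℕ, g d = p ^ (∑ i, d i) * (∏ i, t' i z ^ d i) * H.coeff d := by
    intro d
    simp only [hg, ht, mul_pow, Finset.prod_mul_distrib, Finset.prod_pow_eq_pow_sum]
    ring
  have h3 : ∑ m : σ → Fin T, p ^ (∑ i, (m i : ℕ)) * (∏ i, t' i z ^ (m i : ℕ)) *
      H.coeff (Finsupp.equivFunOnFinite.symm fun i => (m i : ℕ)) =
      ∑ d ∈ H.support.filter (fun d => ∀ i, d i < T), g d := by
    have : ∀ m : σ → Fin T, p ^ (∑ i, (m i : ℕ)) * (∏ i, t' i z ^ (m i : ℕ)) *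
      H.coeff (Finsupp.equivFunOnFinite.symm fun i => (m i : ℕ)) =
      g (Finsupp.equivFunOnFinite.symm fun i => (m i : ℕ)) := by
      intro m; rw [h2]; simp
    simp_rw [this]
    have hinj : Function.Injective (fun m : σ → Fin T =>
        (Finsupp.equivFunOnFinite.symm fun i => (m i : ℕ) : σ →₀ ℕ)) := by
      intro m m' h
      have h' := Finsupp.equivFunOnFinite.symm.injective h
      funext i
      exact Fin.ext (congrFun h' i)
    rw [← Finset.sum_image (f := g) hinj.injOn]
    symm
    apply Finset.sum_subset_zero_on_sdiff
    · intro d hd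
      simp only [Finset.mem_filter] at hd
      simp only [Finset.mem_image, Finset.mem_univ, true_and]
      refine ⟨fun i => ⟨d i, hd.2 i⟩, ?_⟩
      ext i; simp
    · intro d hd
      simp only [Finset.mem_sdiff, Finset.mem_image, Finset.mem_univ, true_and, Finset.mem_filter, not_and] at hd
      obtain ⟨⟨m, rfl⟩, h⟩ := hd
      by_contra hne
      have : (Finsupp.equivFunOnFinite.symm fun i => (m i : ℕ) : σ →₀ ℕ) ∈ H.support := by
        rw [MvPolynomial.mem_support_iff]
        intro h0
        apply hne
        simp only [hg]
        rw [h0, zero_mul]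
      exact h this fun i => by simp
    · intros; rfl
  have h4 : p ^ T ∣ ∑ d ∈ H.support.filter (fun d => ¬ ∀ i, d i < T), g d := by
    apply Finset.dvd_sum
    intro d hd
    simp only [Finset.mem_filter, not_forall, not_lt] at hd
    obtain ⟨_, i, hi⟩ := hd
    rw [h2, mul_assoc]
    apply Dvd.dvd.mul_right
    apply pow_dvd_pow
    exact hi.trans (Finset.single_le_sum (f := fun i => d i) (fun _ _ => Nat.zero_le _) (Finset.mem_univ i))
  have h5 := Finset.sum_filter_add_sum_filter_not H.support (fun d => ∀ i, d i < T) g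
  obtain ⟨e1, he1⟩ := h4
  obtain ⟨e2, he2⟩ := hH z
  refine ⟨e1 + e2, ?_⟩
  rw [h3]
  rw [h1, ← h5, he1] at he2
  linarith

end

section
theorem det_dvd_analytic {ι σ κ : Type*} [Fintype ι] [DecidableEq ι] [Fintype σ] [DecidableEq σ] [Fintype κ]
    (A : Matrix ι ι ℤ) (q : ℤ) (cl : ι → κ) (T : ℕ)
    (hloc : ∀ c : κ, ∃ t' : σ → {i // cl i = c} → ℤ, ∀ j,
      (fun i : {i // cl i = c} => A i j) ∈ analyticSubring q T (fun l i => q * t' l i)) :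
    q ^ (Fintype.card ι * T - Fintype.card κ * ∑ m : σ → Fin T, (T - ∑ l, (m l : ℕ))) ∣ A.det := by
  choose t' ht' using hloc
  have := fun c j => analytic_expand (t' c) (fun l i => rfl) (ht' c j)
  choose y e hye using this
  exact det_dvd A q cl (fun m : σ → Fin T => ∑ l, (m l : ℕ)) T
    (fun i m => ∏ l, t' (cl i) l ⟨i, rfl⟩ ^ (m l : ℕ)) (fun c m j => y c j m)
    (fun i j => e (cl i) j ⟨i, rfl⟩) (fun i j => hye (cl i) j ⟨i, rfl⟩)

theorem sum_tri (M T : ℕ) (h : M ≤ T) : 2 * ∑ b ∈ Finset.range T, (M - b) = M * (M + 1) := by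
  induction T, h using Nat.le_induction with
  | base =>
    induction M with
    | zero => simp
    | succ M ih =>
      rw [Finset.sum_range_succ', mul_add]
      simp only [Nat.add_sub_add_right]
      rw [ih]; simp; ring
  | succ T hT ih => rw [Finset.sum_range_succ, Nat.sub_eq_zero_of_le hT, add_zero, ih]

theorem weight_one (T : ℕ) : 2 * ∑ m : Fin 1 → Fin T, (T - ∑ l, (m l : ℕ)) = T * (T + 1) := by
  rw [← sum_tri T T le_rfl, ← Fin.sum_univ_eq_sum_range (fun b => T - b) T]
  congr 1
  apply Fintype.sum_equiv (Equiv.funUnique (Fin 1) (Fin T))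
  intro m; simp

theorem sum_tet (T : ℕ) : 3 * ∑ a ∈ Finset.range T, (T - a) * (T - a + 1) = T * (T + 1) * (T + 2) := by
  induction T with
  | zero => simp
  | succ M ih =>
    rw [Finset.sum_range_succ', mul_add]
    simp only [Nat.add_sub_add_right]
    rw [ih]; simp; ring

theorem weight_two (T : ℕ) :
    6 * ∑ m : Fin 2 → Fin T, (T - ∑ l, (m l : ℕ)) = T * (T + 1) * (T + 2) := by
  have h1 : ∑ m : Fin 2 → Fin T, (T - ∑ l, (m l : ℕ)) =
      ∑ a ∈ Finset.range T, ∑ b ∈ Finset.range T, (T - a - b) := by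
    rw [← Fin.sum_univ_eq_sum_range (fun a => ∑ b ∈ Finset.range T, (T - a - b)) T]
    simp_rw [← Fin.sum_univ_eq_sum_range (fun b => T - _ - b) T]
    rw [← Fintype.sum_prod_type']
    apply Fintype.sum_equiv (finTwoArrowEquiv (Fin T))
    intro m
    simp [Fin.sum_univ_two]
    omega
  rw [h1, ← sum_tet, show 6 = 3 * 2 by rfl, mul_assoc]
  congr 1
  rw [Finset.mul_sum]
  apply Finset.sum_congr rfl
  intro a _
  exact sum_tri (T - a) T (Nat.sub_le _ _)

/-- Local parametrisation of `f ^ k = n + α g ^ k + β h ^ k` near a residue class where `f` is a unit. -/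
theorem local_surface {S : Type*} (p : ℕ) (hp : p.Prime) (T k : ℕ) (hk : ¬ p ∣ k)
    (f g h : S → ℤ) (s0 : S) (hf : ∀ s, (p : ℤ) ∣ f s - f s0) (hg : ∀ s, (p : ℤ) ∣ g s - g s0)
    (hh : ∀ s, (p : ℤ) ∣ h s - h s0) (hu : ¬ (p : ℤ) ∣ f s0) (n α β : ℤ)
    (heq : ∀ s, f s ^ k = n + α * g s ^ k + β * h s ^ k) :
    ∃ t' : Fin 2 → S → ℤ, f ∈ analyticSubring (p : ℤ) T (fun l s => p * t' l s) ∧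
      g ∈ analyticSubring (p : ℤ) T (fun l s => p * t' l s) ∧
      h ∈ analyticSubring (p : ℤ) T (fun l s => p * t' l s) := by
  choose g' hg' using hg
  choose h' hh' using hh
  refine ⟨![g', h'], ?_⟩
  set R := analyticSubring (p : ℤ) T (fun (l : Fin 2) s => p * (![g', h'] : Fin 2 → S → ℤ) l s) with hR
  have mg : g ∈ R := by
    have e : g = (fun s => (p : ℤ) * g' s) + (fun _ => g s0) := by
      funext s; simp only [Pi.add_apply]; linarith [hg' s]
    rw [e]
    exact Subring.add_mem _ (analytic_param (p : ℤ) T _ (0 : Fin 2)) (analytic_const _ _ _ _)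
  have mh : h ∈ R := by
    have e : h = (fun s => (p : ℤ) * h' s) + (fun _ => h s0) := by
      funext s; simp only [Pi.add_apply]; linarith [hh' s]
    rw [e]
    exact Subring.add_mem _ (analytic_param (p : ℤ) T _ (1 : Fin 2)) (analytic_const _ _ _ _)
  refine ⟨?_, mg, mh⟩
  set φ : S → ℤ := (fun _ => n) + (fun _ => α) * g ^ k + (fun _ => β) * h ^ k with hφ
  have mφ : φ ∈ R := by
    refine Subring.add_mem _ (Subring.add_mem _ (analytic_const _ _ _ _) ?_) ?_
    · exact Subring.mul_mem _ (analytic_const _ _ _ _) (Subring.pow_mem _ mg k)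
    · exact Subring.mul_mem _ (analytic_const _ _ _ _) (Subring.pow_mem _ mh k)
  have hpp : Prime (p : ℤ) := Nat.prime_iff_prime_int.1 hp
  have hcop : IsCoprime (p : ℤ) ((k : ℤ) * f s0 ^ (k - 1)) := by
    rw [Prime.coprime_iff_not_dvd hpp]
    intro hd
    rcases hpp.dvd_or_dvd hd with h1 | h1
    · exact hk (by exact_mod_cast h1)
    · exact hu (hpp.dvd_of_dvd_pow h1)
  obtain ⟨u, w, huw⟩ := hcop
  refine analytic_newton (Polynomial.X ^ k - Polynomial.C φ) ?_ ?_ (f s0) w hf ?_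
  · intro m
    rw [Polynomial.coeff_sub, Polynomial.coeff_X_pow, Polynomial.coeff_C]
    apply Subring.sub_mem
    · split_ifs
      · exact Subring.one_mem _
      · exact Subring.zero_mem _
    · split_ifs
      · exact mφ
      · exact Subring.zero_mem _
  · funext s
    simp [hφ, heq s]
  · intro s
    simp only [Polynomial.derivative_sub, Polynomial.derivative_X_pow, Polynomial.derivative_C,
      sub_zero, Polynomial.eval_mul, Polynomial.eval_pow, Polynomial.eval_X, Polynomial.eval_C,
      Pi.mul_apply, Pi.pow_apply, Pi.natCast_apply]
    have h1 : (p : ℤ) ∣ f s ^ (k - 1) - f s0 ^ (k - 1) := (hf s).trans (sub_dvd_pow_sub_pow _ _ _)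
    obtain ⟨v, hv⟩ := h1
    refine ⟨w * k * v - u, ?_⟩
    have : f s ^ (k - 1) = f s0 ^ (k - 1) + p * v := by linarith
    rw [this]
    linear_combination huw

/-- The determinant of monomials at points of the surface is highly divisible by `p`. -/
theorem surf_det {ι κ : Type*} [Fintype ι] [DecidableEq ι] [Fintype κ]
    (p : ℕ) (hp : p.Prime) (k : ℕ) (hk : ¬ p ∣ k) (hk0 : k ≠ 0) (n : ℤ) (hn : ¬ (p : ℤ) ∣ n)
    (a b c : ι → ℤ) (hz : ∀ i, a i ^ k + b i ^ k = c i ^ k + n) (m : ι → ℕ × ℕ × ℕ)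
    (cl : ι → κ) (hcl : ∀ i i', cl i = cl i' → (p : ℤ) ∣ a i - a i' ∧ (p : ℤ) ∣ b i - b i' ∧
      (p : ℤ) ∣ c i - c i') (T : ℕ) :
    (p : ℤ) ^ (Fintype.card ι * T - Fintype.card κ * (T * (T + 1) * (T + 2) / 6)) ∣
      (Matrix.of fun i j => a i ^ (m j).1 * b i ^ (m j).2.1 * c i ^ (m j).2.2).det := by
  have hw : ∑ m : Fin 2 → Fin T, (T - ∑ l, (m l : ℕ)) = T * (T + 1) * (T + 2) / 6 := by
    have := weight_two T
    omega
  rw [← hw]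
  refine det_dvd_analytic (σ := Fin 2) _ (p : ℤ) cl T ?_
  intro x
  by_cases hx : Nonempty {i // cl i = x}
  swap
  · refine ⟨fun _ _ => 0, fun j => ⟨0, fun i => (hx ⟨i⟩).elim⟩⟩
  obtain ⟨s0⟩ := hx
  set f : {i // cl i = x} → ℤ := fun i => a i with hf
  set g : {i // cl i = x} → ℤ := fun i => b i with hg
  set h : {i // cl i = x} → ℤ := fun i => c i with hh
  have cf : ∀ s, (p : ℤ) ∣ f s - f s0 := fun s => (hcl s s0 (s.2.trans s0.2.symm)).1
  have cg : ∀ s, (p : ℤ) ∣ g s - g s0 := fun s => (hcl s s0 (s.2.trans s0.2.symm)).2.1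
  have ch : ∀ s, (p : ℤ) ∣ h s - h s0 := fun s => (hcl s s0 (s.2.trans s0.2.symm)).2.2
  have hmain : ∃ t' : Fin 2 → {i // cl i = x} → ℤ,
      f ∈ analyticSubring (p : ℤ) T (fun l s => p * t' l s) ∧
      g ∈ analyticSubring (p : ℤ) T (fun l s => p * t' l s) ∧
      h ∈ analyticSubring (p : ℤ) T (fun l s => p * t' l s) := by
    by_cases h1 : (p : ℤ) ∣ f s0
    · by_cases h2 : (p : ℤ) ∣ g s0
      · have h3 : ¬ (p : ℤ) ∣ h s0 := by
          intro h3
          apply hn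
          have e : n = f s0 ^ k + g s0 ^ k - h s0 ^ k := by
            have := hz s0; simp only [hf, hg, hh]; linarith
          rw [e]
          exact dvd_sub (dvd_add (dvd_pow h1 hk0) (dvd_pow h2 hk0)) (dvd_pow h3 hk0)
        obtain ⟨t', h4, h5, h6⟩ := local_surface p hp T k hk h f g s0 ch cf cg h3 (-n) 1 1
          (fun s => by have := hz s; simp only [hf, hg, hh]; linarith)
        exact ⟨t', h5, h6, h4⟩
      · obtain ⟨t', h4, h5, h6⟩ := local_surface p hp T k hk g f h s0 cg cf ch h2 n (-1) 1
          (fun s => by have := hz s; simp only [hf, hg, hh]; linarith)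
        exact ⟨t', h5, h4, h6⟩
    · exact local_surface p hp T k hk f g h s0 cf cg ch h1 n (-1) 1
          (fun s => by have := hz s; simp only [hf, hg, hh]; linarith)
  obtain ⟨t', h1, h2, h3⟩ := hmain
  refine ⟨t', fun j => ?_⟩
  exact Subring.mul_mem _ (Subring.mul_mem _ (Subring.pow_mem _ h1 (m j).1)
    (Subring.pow_mem _ h2 (m j).2.1)) (Subring.pow_mem _ h3 (m j).2.2)

end

section
noncomputable def powSum (p k : ℕ) [NeZero p] (t : ZMod p) : ℂ :=
  ∑ x : ZMod p, ZMod.stdAddChar (t * x ^ k)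

theorem stdChar_orth (p : ℕ) [Fact p.Prime] (b : ZMod p) :
    ∑ t : ZMod p, (ZMod.stdAddChar (t * b) : ℂ) = if b = 0 then (p : ℂ) else 0 := by
  have := AddChar.sum_mulShift (R := ZMod p) (R' := ℂ) b (ZMod.isPrimitive_stdAddChar p)
  rw [this, ZMod.card]
  split_ifs <;> simp

theorem stdChar_conj (p : ℕ) [NeZero p] (a : ZMod p) :
    (starRingEnd ℂ) (ZMod.stdAddChar a : ℂ) = ZMod.stdAddChar (-a) := by
  rw [AddChar.map_neg_eq_conj]

theorem roots_count (p k : ℕ) [Fact p.Prime] (hk : 0 < k) (t s : ZMod p) (ht : t ≠ 0) :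
    (Finset.univ.filter fun u : ZMod p => t * u ^ k = s).card ≤ k := by
  have h1 : (Finset.univ.filter fun u : ZMod p => t * u ^ k = s) ⊆
      (Polynomial.nthRoots k (s / t)).toFinset := by
    intro u hu
    simp only [Finset.mem_filter, Finset.mem_univ, true_and] at hu
    rw [Multiset.mem_toFinset, Polynomial.mem_nthRoots hk, eq_div_iff ht, mul_comm, hu]
  exact (Finset.card_le_card h1).trans ((Multiset.toFinset_card_le _).trans
    (Polynomial.card_nthRoots k _))

theorem powSum_normSq_sum (p k : ℕ) [Fact p.Prime] (hk : 0 < k) :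
    ∑ t : ZMod p, ‖powSum p k t‖ ^ 2 ≤ (k : ℝ) * p ^ 2 := by
  have h0 : ∀ t : ZMod p, ((‖powSum p k t‖ ^ 2 : ℝ) : ℂ) =
      ∑ x : ZMod p, ∑ y : ZMod p, ZMod.stdAddChar (t * (x ^ k - y ^ k)) := by
    intro t
    have : ((‖powSum p k t‖ ^ 2 : ℝ) : ℂ) = powSum p k t * (starRingEnd ℂ) (powSum p k t) := by
      rw [Complex.mul_conj, Complex.normSq_eq_norm_sq]
    rw [this]
    unfold powSum
    rw [map_sum, Finset.sum_mul_sum]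
    refine Finset.sum_congr rfl fun x _ => Finset.sum_congr rfl fun y _ => ?_
    rw [stdChar_conj, ← AddChar.map_add_eq_mul]
    congr 1; ring
  have h1 : ((∑ t : ZMod p, ‖powSum p k t‖ ^ 2 : ℝ) : ℂ) =
      ∑ x : ZMod p, ∑ y : ZMod p, if x ^ k - y ^ k = 0 then (p : ℂ) else 0 := by
    rw [Complex.ofReal_sum]
    simp_rw [h0]
    rw [Finset.sum_comm]
    refine Finset.sum_congr rfl fun x _ => ?_
    rw [Finset.sum_comm]
    refine Finset.sum_congr rfl fun y _ => ?_
    exact stdChar_orth p _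
  have h2 : ∑ t : ZMod p, ‖powSum p k t‖ ^ 2 =
      ∑ x : ZMod p, ∑ y : ZMod p, if x ^ k - y ^ k = 0 then (p : ℝ) else 0 := by
    have : ((∑ t : ZMod p, ‖powSum p k t‖ ^ 2 : ℝ) : ℂ) =
      ((∑ x : ZMod p, ∑ y : ZMod p, if x ^ k - y ^ k = 0 then (p : ℝ) else 0 : ℝ) : ℂ) := by
      rw [h1]; push_cast
      refine Finset.sum_congr rfl fun x _ => Finset.sum_congr rfl fun y _ => ?_
      split_ifs <;> simp
    exact_mod_cast this
  rw [h2]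
  calc _ ≤ ∑ x : ZMod p, (k : ℝ) * p := by
        apply Finset.sum_le_sum
        intro x _
        rw [← Finset.sum_filter, Finset.sum_const, nsmul_eq_mul]
        gcongr
        have := roots_count p k hk 1 (x ^ k) one_ne_zero
        refine le_trans (Finset.card_le_card ?_) this
        intro y hy
        simp only [Finset.mem_filter, Finset.mem_univ, true_and] at hy ⊢
        rw [one_mul]; exact (sub_eq_zero.1 hy).symm
    _ = _ := by simp [ZMod.card]; ring

theorem powSum_bound (p k : ℕ) [Fact p.Prime] (hk : 0 < k) (t : ZMod p) (ht : t ≠ 0) :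
    ‖powSum p k t‖ ^ 2 ≤ 2 * (k : ℝ) ^ 2 * p := by
  have hp2 : 2 ≤ p := (Fact.out : p.Prime).two_le
  have hp2' : (2 : ℝ) ≤ p := by exact_mod_cast hp2
  have h1 : ∀ u : ZMod p, u ≠ 0 → powSum p k (t * u ^ k) = powSum p k t := by
    intro u hu
    unfold powSum
    apply Fintype.sum_equiv (Equiv.mulLeft₀ u hu)
    intro x
    simp [mul_pow]
    congr 1; ring
  have h2 : ((p : ℝ) - 1) * ‖powSum p k t‖ ^ 2 =
      ∑ u ∈ Finset.univ.erase (0 : ZMod p), ‖powSum p k (t * u ^ k)‖ ^ 2 := by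
    have : ∑ u ∈ Finset.univ.erase (0 : ZMod p), ‖powSum p k (t * u ^ k)‖ ^ 2 =
      ∑ u ∈ Finset.univ.erase (0 : ZMod p), ‖powSum p k t‖ ^ 2 :=
      Finset.sum_congr rfl fun u hu => by rw [h1 u (Finset.ne_of_mem_erase hu)]
    rw [this, Finset.sum_const, Finset.card_erase_of_mem (Finset.mem_univ _), Finset.card_univ,
      ZMod.card, nsmul_eq_mul, Nat.cast_sub (by omega)]
    simp
  have h3 : ∑ u ∈ Finset.univ.erase (0 : ZMod p), ‖powSum p k (t * u ^ k)‖ ^ 2 ≤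
      k * ∑ s : ZMod p, ‖powSum p k s‖ ^ 2 := by
    calc _ ≤ ∑ u : ZMod p, ‖powSum p k (t * u ^ k)‖ ^ 2 := by
          apply Finset.sum_le_sum_of_subset_of_nonneg (Finset.erase_subset _ _)
          intros; positivity
      _ = ∑ s : ZMod p, ∑ u : ZMod p with t * u ^ k = s, ‖powSum p k (t * u ^ k)‖ ^ 2 :=
          (Finset.sum_fiberwise _ _ _).symm
      _ = ∑ s : ZMod p, ∑ u : ZMod p with t * u ^ k = s, ‖powSum p k s‖ ^ 2 := by
          refine Finset.sum_congr rfl fun s _ => Finset.sum_congr rfl fun u hu => ?_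
          rw [(Finset.mem_filter.1 hu).2]
      _ ≤ _ := by
          rw [Finset.mul_sum]
          refine Finset.sum_le_sum fun s _ => ?_
          rw [Finset.sum_const, nsmul_eq_mul]
          gcongr
          exact roots_count p k hk t s ht
  have h4 := powSum_normSq_sum p k hk
  have h5 : ((p : ℝ) - 1) * ‖powSum p k t‖ ^ 2 ≤ k * (k * p ^ 2) :=
    h2.trans_le (h3.trans (by gcongr))
  have h6 : ((p : ℝ) / 2) * ‖powSum p k t‖ ^ 2 ≤ ((p : ℝ) - 1) * ‖powSum p k t‖ ^ 2 := by
    gcongr; linarith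
  have h7 : (p : ℝ) * ‖powSum p k t‖ ^ 2 ≤ p * (2 * (k : ℝ) ^ 2 * p) := by nlinarith
  exact le_of_mul_le_mul_left h7 (by linarith)

/-- The number of points mod `p` on the surface. -/
theorem modp_count (p k : ℕ) [Fact p.Prime] (hk : 0 < k) (n : ZMod p) :
    (Fintype.card {x : ZMod p × ZMod p × ZMod p // x.1 ^ k + x.2.1 ^ k = x.2.2 ^ k + n} : ℝ) ≤
      (p : ℝ) ^ 2 + 2 * (k : ℝ) ^ 2 * p * Real.sqrt p := by
  have hp0 : (0 : ℝ) < p := by exact_mod_cast (Fact.out : p.Prime).pos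
  set N := Fintype.card {x : ZMod p × ZMod p × ZMod p // x.1 ^ k + x.2.1 ^ k = x.2.2 ^ k + n} with hN
  have h1 : (p : ℂ) * N = ∑ t : ZMod p, powSum p k t * powSum p k t *
      (starRingEnd ℂ (powSum p k t)) * ZMod.stdAddChar (-(t * n)) := by
    have e1 : (p : ℂ) * N = ∑ x : ZMod p × ZMod p × ZMod p,
        if x.1 ^ k + x.2.1 ^ k - x.2.2 ^ k - n = 0 then (p : ℂ) else 0 := by
      rw [← Finset.sum_filter, Finset.sum_const, nsmul_eq_mul, mul_comm, hN, Fintype.card_subtype]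
      congr 3
      ext x
      simp only [Finset.mem_filter, Finset.mem_univ, true_and]
      rw [sub_sub, sub_eq_zero]
    rw [e1]
    rw [Finset.sum_congr rfl fun x _ => (stdChar_orth p
      ((x : ZMod p × ZMod p × ZMod p).1 ^ k + x.2.1 ^ k - x.2.2 ^ k - n)).symm]
    rw [Finset.sum_comm]
    refine Finset.sum_congr rfl fun t _ => ?_
    unfold powSum
    rw [map_sum, Fintype.sum_prod_type, mul_assoc, mul_assoc, Finset.sum_mul]
    refine Finset.sum_congr rfl fun x _ => ?_
    rw [Fintype.sum_prod_type, Finset.sum_mul, Finset.mul_sum]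
    refine Finset.sum_congr rfl fun y _ => ?_
    rw [Finset.sum_mul, Finset.mul_sum, Finset.mul_sum]
    refine Finset.sum_congr rfl fun z _ => ?_
    rw [stdChar_conj, ← AddChar.map_add_eq_mul, ← AddChar.map_add_eq_mul, ← AddChar.map_add_eq_mul]
    congr 1; ring
  have h2 : (p : ℝ) * N ≤ ∑ t : ZMod p, ‖powSum p k t‖ ^ 3 := by
    have : (p : ℝ) * N = ‖(p : ℂ) * N‖ := by simp
    rw [this, h1]
    refine (norm_sum_le _ _).trans (Finset.sum_le_sum fun t _ => ?_)
    rw [norm_mul, norm_mul, norm_mul, RCLike.norm_conj, AddChar.norm_apply]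
    apply le_of_eq; ring
  have h3 : ∑ t : ZMod p, ‖powSum p k t‖ ^ 3 ≤ (p : ℝ) ^ 3 +
      2 * k * Real.sqrt p * (k * p ^ 2) := by
    rw [← Finset.add_sum_erase Finset.univ _ (Finset.mem_univ (0 : ZMod p))]
    apply add_le_add
    · simp [powSum, ZMod.card]
    · have hb : ∀ t ∈ Finset.univ.erase (0 : ZMod p), ‖powSum p k t‖ ^ 3 ≤
          (2 * k * Real.sqrt p) * ‖powSum p k t‖ ^ 2 := by
        intro t ht
        have := powSum_bound p k hk t (Finset.ne_of_mem_erase ht)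
        have h4 : ‖powSum p k t‖ ≤ 2 * k * Real.sqrt p := by
          apply le_of_sq_le_sq _ (by positivity)
          rw [mul_pow, Real.sq_sqrt hp0.le]
          nlinarith [sq_nonneg (k : ℝ)]
        rw [pow_succ, mul_comm]
        gcongr
      refine (Finset.sum_le_sum hb).trans ?_
      rw [← Finset.mul_sum]
      gcongr
      refine le_trans ?_ (powSum_normSq_sum p k hk)
      apply Finset.sum_le_sum_of_subset_of_nonneg (Finset.erase_subset _ _)
      intros; positivity
  have h4 : (p : ℝ) * N ≤ p * ((p : ℝ) ^ 2 + 2 * (k : ℝ) ^ 2 * p * Real.sqrt p) := by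
    refine (h2.trans h3).trans (le_of_eq ?_); ring
  exact le_of_mul_le_mul_left h4 hp0

end

section
theorem log_factorial_lower (N : ℕ) (hN : 0 < N) :
    (N : ℝ) * Real.log N - N ≤ Real.log (N.factorial) := by
  have h := Real.pow_div_factorial_le_exp (N : ℝ) (Nat.cast_nonneg N) N
  have hf : (0 : ℝ) < N.factorial := by exact_mod_cast Nat.factorial_pos N
  have hN' : (0 : ℝ) < N := by exact_mod_cast hN
  have h2 := Real.log_le_log (by positivity) h
  rw [Real.log_exp, Real.log_div (by positivity) (by positivity), Real.log_pow] at h2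
  linarith

theorem log_factorial_upper (N : ℕ) (hN : 0 < N) :
    Real.log (N.factorial) ≤
      N * ∑ p ∈ (Finset.Icc 1 N).filter Nat.Prime, Real.log p / ((p : ℝ) - 1) := by
  have h1 : N.factorial = ∏ p ∈ (Finset.Icc 1 N).filter Nat.Prime,
      p ^ (N.factorial.factorization p) := by
    conv_lhs => rw [← Nat.prod_factorization_pow_eq_self (Nat.factorial_ne_zero N)]
    rw [Finsupp.prod]
    apply Finset.prod_subset
    · intro p hp
      rw [Nat.support_factorization, Nat.mem_primeFactors] at hp
      rw [Finset.mem_filter, Finset.mem_Icc]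
      exact ⟨⟨hp.1.pos, (hp.1.dvd_factorial).1 hp.2.1⟩, hp.1⟩
    · intro p _ hp
      rw [Finsupp.notMem_support_iff] at hp
      rw [hp, pow_zero]
  have h2 : Real.log (N.factorial) = ∑ p ∈ (Finset.Icc 1 N).filter Nat.Prime,
      (N.factorial.factorization p : ℝ) * Real.log p := by
    conv_lhs => rw [h1]
    rw [Nat.cast_prod, Real.log_prod]
    · refine Finset.sum_congr rfl fun p _ => ?_
      rw [Nat.cast_pow, Real.log_pow]
    · intro p hp
      have := (Finset.mem_filter.1 hp).2.pos
      positivity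
  rw [h2, Finset.mul_sum]
  refine Finset.sum_le_sum fun p hp => ?_
  have hpp := (Finset.mem_filter.1 hp).2
  haveI := Fact.mk hpp
  have h3 := sub_one_mul_padicValNat_factorial (p := p) N
  have h4 : (p - 1) * padicValNat p N.factorial ≤ N := by rw [h3]; exact Nat.sub_le _ _
  have h5 : ((p : ℝ) - 1) * (N.factorial.factorization p : ℝ) ≤ N := by
    have : N.factorial.factorization p = padicValNat p N.factorial :=
      Nat.factorization_def _ hpp
    rw [this]
    have h6 : (((p - 1) * padicValNat p N.factorial : ℕ) : ℝ) ≤ N := by exact_mod_cast h4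
    rwa [Nat.cast_mul, Nat.cast_sub hpp.one_le, Nat.cast_one] at h6
  have hp1 : (0 : ℝ) < (p : ℝ) - 1 := by
    have : (2 : ℝ) ≤ p := by exact_mod_cast hpp.two_le
    linarith
  have hl : 0 ≤ Real.log p := Real.log_natCast_nonneg p
  rw [← mul_div_assoc, le_div_iff₀ hp1]
  calc _ = (((p : ℝ) - 1) * (N.factorial.factorization p : ℝ)) * Real.log p := by ring
    _ ≤ _ := by gcongr

theorem mertens_lower : ∃ C : ℝ, 0 ≤ C ∧ ∀ N : ℕ, 0 < N → Real.log N - C ≤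
    ∑ p ∈ (Finset.Icc 1 N).filter Nat.Prime, Real.log p / (p : ℝ) := by
  have hs : Summable fun n : ℕ => 4 * (1 / (n : ℝ) ^ (3 / 2 : ℝ)) :=
    (Real.summable_one_div_nat_rpow.2 (by norm_num)).mul_left 4
  refine ⟨1 + ∑' n : ℕ, 4 * (1 / (n : ℝ) ^ (3 / 2 : ℝ)), ?_, ?_⟩
  · have : 0 ≤ ∑' n : ℕ, 4 * (1 / (n : ℝ) ^ (3 / 2 : ℝ)) := tsum_nonneg fun n => by positivity
    linarith
  intro N hN
  have hN' : (0 : ℝ) < N := by exact_mod_cast hN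
  have h1 := (log_factorial_lower N hN).trans (log_factorial_upper N hN)
  have h2 : Real.log N - 1 ≤
      ∑ p ∈ (Finset.Icc 1 N).filter Nat.Prime, Real.log p / ((p : ℝ) - 1) := by
    have : (N : ℝ) * (Real.log N - 1) ≤
      N * ∑ p ∈ (Finset.Icc 1 N).filter Nat.Prime, Real.log p / ((p : ℝ) - 1) := by linarith
    exact le_of_mul_le_mul_left this hN'
  have h3 : ∑ p ∈ (Finset.Icc 1 N).filter Nat.Prime, Real.log p / ((p : ℝ) - 1) ≤
      ∑ p ∈ (Finset.Icc 1 N).filter Nat.Prime, (Real.log p / (p : ℝ) +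
        4 * (1 / (p : ℝ) ^ (3 / 2 : ℝ))) := by
    refine Finset.sum_le_sum fun p hp => ?_
    have hpp := (Finset.mem_filter.1 hp).2
    have hp2 : (2 : ℝ) ≤ p := by exact_mod_cast hpp.two_le
    have hl : Real.log p ≤ 2 * (p : ℝ) ^ (1 / 2 : ℝ) := by
      have := Real.log_le_rpow_div (x := (p : ℝ)) (by linarith) (ε := 1 / 2) (by norm_num)
      linarith
    have hr : (p : ℝ) ^ (3 / 2 : ℝ) * (p : ℝ) ^ (1 / 2 : ℝ) = p ^ 2 := by
      rw [← Real.rpow_add (by linarith)]; norm_num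
    set a := (p : ℝ) ^ (3 / 2 : ℝ)
    set b := (p : ℝ) ^ (1 / 2 : ℝ)
    have ha : 0 < a := Real.rpow_pos_of_pos (by linarith) _
    have hb : 0 < b := Real.rpow_pos_of_pos (by linarith) _
    have e : Real.log p / ((p : ℝ) - 1) - Real.log p / p = Real.log p / (p * (p - 1)) := by
      have : (p : ℝ) - 1 ≠ 0 := by linarith
      field_simp; ring
    have e2 : Real.log p / (p * (p - 1)) ≤ 4 * (1 / a) := by
      rw [mul_one_div, div_le_div_iff₀ (by nlinarith) ha]
      calc Real.log p * a ≤ (2 * b) * a := by gcongr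
        _ = 2 * p ^ 2 := by rw [← hr]; ring
        _ ≤ 4 * (p * (p - 1)) := by nlinarith
    linarith
  rw [Finset.sum_add_distrib] at h3
  have h4 := hs.sum_le_tsum ((Finset.Icc 1 N).filter Nat.Prime) (fun n _ => by positivity)
  linarith

/-- loss from the primes dividing a number -/
theorem bad_primes_loss (P : ℕ) (hP : 0 < P) (m : ℕ) (hm : m ≠ 0) :
    ∑ p ∈ m.primeFactors, Real.log p / (p : ℝ) ≤ P * Real.log (P + 1) + Real.log m / P := by
  have hP' : (0 : ℝ) < P := by exact_mod_cast hP
  have hlm : ∑ p ∈ m.primeFactors, Real.log p ≤ Real.log m := by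
    rw [← Real.log_prod]
    · apply Real.log_le_log
      · apply Finset.prod_pos; intro p hp
        exact_mod_cast (Nat.prime_of_mem_primeFactors hp).pos
      · have := Nat.le_of_dvd (Nat.pos_of_ne_zero hm) (Nat.prod_primeFactors_dvd m)
        rw [← Nat.cast_prod, Nat.cast_le]; exact this
    · intro p hp
      have := (Nat.prime_of_mem_primeFactors hp).pos
      positivity
  rw [← Finset.sum_filter_add_sum_filter_not _ (fun p => p ≤ P)]
  apply add_le_add
  · calc _ ≤ ∑ p ∈ m.primeFactors.filter (fun p => p ≤ P), Real.log (P + 1) := by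
          refine Finset.sum_le_sum fun p hp => ?_
          have h1 := (Nat.prime_of_mem_primeFactors (Finset.mem_filter.1 hp).1).one_le
          have h2 := (Finset.mem_filter.1 hp).2
          have h1' : (1 : ℝ) ≤ p := by exact_mod_cast h1
          have h2' : (p : ℝ) ≤ P := by exact_mod_cast h2
          refine (div_le_self (Real.log_nonneg h1') h1').trans ?_
          exact Real.log_le_log (by linarith) (by linarith)
      _ ≤ _ := by
          rw [Finset.sum_const, nsmul_eq_mul]
          have : 0 ≤ Real.log ((P : ℝ) + 1) := Real.log_nonneg (by linarith)
          gcongr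
          calc _ ≤ (Finset.Icc 1 P).card := by
                apply Finset.card_le_card
                intro p hp
                have h1 := (Nat.prime_of_mem_primeFactors (Finset.mem_filter.1 hp).1).one_le
                have h2 := (Finset.mem_filter.1 hp).2
                exact Finset.mem_Icc.2 ⟨h1, h2⟩
            _ = P := by simp
  · calc _ ≤ ∑ p ∈ m.primeFactors.filter (fun p => ¬ p ≤ P), Real.log p / P := by
          refine Finset.sum_le_sum fun p hp => ?_
          have h2 := (Finset.mem_filter.1 hp).2
          have h2' : (P : ℝ) ≤ p := by exact_mod_cast (not_le.1 h2).le
          have : 0 ≤ Real.log p := Real.log_natCast_nonneg p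
          gcongr
      _ ≤ ∑ p ∈ m.primeFactors, Real.log p / P := by
          apply Finset.sum_le_sum_of_subset_of_nonneg (Finset.filter_subset _ _)
          intro p _ _
          have : 0 ≤ Real.log p := Real.log_natCast_nonneg p
          positivity
      _ ≤ _ := by rw [← Finset.sum_div]; gcongr

theorem sum_log_primes_le (N : ℕ) :
    ∑ p ∈ (Finset.Icc 1 N).filter Nat.Prime, Real.log p ≤ 2 * N := by
  have h := Chebyshev.theta_le_log4_mul_x (x := (N : ℝ)) (Nat.cast_nonneg N)
  rw [Chebyshev.theta_eq_sum_Icc, Nat.floor_natCast] at h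
  have : Real.log 4 ≤ 2 := by
    have h2 := Real.log_two_lt_d9
    have : Real.log 4 = 2 * Real.log 2 := by
      rw [show (4 : ℝ) = 2 ^ 2 by norm_num, Real.log_pow]; norm_num
    linarith
  calc _ ≤ ∑ p ∈ (Finset.Icc 0 N).filter Nat.Prime, Real.log p := by
        apply Finset.sum_le_sum_of_subset_of_nonneg
        · apply Finset.filter_subset_filter
          intro x hx; simp at hx ⊢; exact hx.2
        · intro p _ _; exact Real.log_natCast_nonneg p
    _ ≤ Real.log 4 * N := h
    _ ≤ _ := by gcongr

end

section
theorem exists_vanishing {M P : Type*} [Fintype M] [DecidableEq M] (f : P → M → ℤ) (Z : Set P)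
    (h : ∀ z : M → P, (∀ i, z i ∈ Z) → Matrix.det (Matrix.of fun i j => f (z i) j) = 0) :
    ∃ v : M → ℚ, v ≠ 0 ∧ ∀ z ∈ Z, ∑ m, v m * (f z m : ℚ) = 0 := by
  let g : Z → (M → ℚ) := fun z m => (f z m : ℚ)
  by_cases hs : Submodule.span ℚ (Set.range g) = ⊤
  · exfalso
    obtain ⟨b, hb1, hb2, hb3⟩ := exists_linearIndependent ℚ (Set.range g)
    rw [hs] at hb2
    let bas : Module.Basis b ℚ (M → ℚ) := Module.Basis.mk hb3 (by
      rw [Subtype.range_coe]; exact hb2.ge)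
    let bas' : Module.Basis M ℚ (M → ℚ) := Pi.basisFun ℚ M
    let e : M ≃ b := bas'.indexEquiv bas
    have hx : ∀ i : M, ∃ z : Z, g z = (e i : M → ℚ) := fun i => hb1 (e i).2
    choose z hz using hx
    have h0 := h (fun i => (z i : P)) (fun i => (z i).2)
    have hli : LinearIndependent ℚ (fun i : M => g (z i)) := by
      have : (fun i : M => g (z i)) = (fun x : b => (x : M → ℚ)) ∘ e := by
        funext i; exact hz i
      rw [this]
      exact hb3.comp e e.injective
    let A : Matrix M M ℚ := Matrix.of fun i => g (z i)
    have hu : IsUnit A := Matrix.linearIndependent_rows_iff_isUnit.1 hli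
    have hd : A.det ≠ 0 := ((Matrix.isUnit_iff_isUnit_det A).1 hu).ne_zero
    apply hd
    have hA : A = (Matrix.of fun i j => f (z i) j : Matrix M M ℤ).map (Int.castRingHom ℚ) := by
      ext i j; simp [A, g]
    rw [hA, ← RingHom.mapMatrix_apply, ← RingHom.map_det, h0, map_zero]
  · obtain ⟨φ, hφ, hker⟩ := Submodule.exists_le_ker_of_lt_top _ (lt_top_iff_ne_top.2 hs)
    refine ⟨fun m => φ (Pi.single m 1), ?_, ?_⟩
    · intro h0
      apply hφ
      apply LinearMap.pi_ext'
      intro m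
      ext
      simpa using congrFun h0 m
    · intro x hx
      have h1 : φ (g ⟨x, hx⟩) = 0 := hker (Submodule.subset_span ⟨⟨x, hx⟩, rfl⟩)
      have h2 : g ⟨x, hx⟩ = ∑ m, (f x m : ℚ) • (Pi.single m (1 : ℚ) : M → ℚ) := by
        funext m
        rw [Finset.sum_apply]
        simp [g, Pi.single_apply]
      rw [h2, map_sum] at h1
      simp only [map_smul, smul_eq_mul] at h1
      rw [← h1]
      exact Finset.sum_congr rfl fun m _ => mul_comm _ _

theorem det_abs_le {M : Type*} [Fintype M] [DecidableEq M] (A : Matrix M M ℤ) (w : M → ℝ)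
    (h : ∀ i j, |(A i j : ℝ)| ≤ w j) :
    |(A.det : ℝ)| ≤ (Fintype.card M).factorial * ∏ j, w j := by
  rw [Matrix.det_apply']
  push_cast
  refine (Finset.abs_sum_le_sum_abs _ _).trans ?_
  calc _ ≤ ∑ _σ : Equiv.Perm M, ∏ j, w j := by
        refine Finset.sum_le_sum fun σ _ => ?_
        rw [abs_mul]
        have h1 : |((Equiv.Perm.sign σ : ℤ) : ℝ)| = 1 := by
          rcases Int.units_eq_one_or (Equiv.Perm.sign σ) with h | h <;> simp [h]
        rw [h1, one_mul, Finset.abs_prod]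
        exact Finset.prod_le_prod (fun _ _ => abs_nonneg _) fun j _ => h _ _
    _ = _ := by
        rw [Finset.sum_const, Finset.card_univ, Fintype.card_perm, nsmul_eq_mul]

/-- Prime powers dividing a nonzero integer. -/
theorem log_ge_of_prime_pows (S : Finset ℕ) (hS : ∀ p ∈ S, p.Prime) (e : ℕ → ℕ) (d : ℤ)
    (hd : d ≠ 0) (h : ∀ p ∈ S, ((p : ℤ) ^ e p) ∣ d) :
    ∑ p ∈ S, (e p : ℝ) * Real.log p ≤ Real.log |(d : ℝ)| := by
  have h1 : (∏ p ∈ S, p ^ e p) ∣ d.natAbs := by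
    apply Finset.prod_dvd_of_isRelPrime
    · intro p hp q hq hpq
      rw [Function.onFun, ← Nat.coprime_iff_isRelPrime]
      exact Nat.Coprime.pow _ _ ((Nat.coprime_primes (hS p hp) (hS q hq)).2 hpq)
    · intro p hp
      have := Int.natAbs_dvd_natAbs.2 (h p hp)
      rwa [Int.natAbs_pow, Int.natAbs_natCast] at this
  have h2 := Nat.le_of_dvd (Int.natAbs_pos.2 hd) h1
  have h3 : |(d : ℝ)| = (d.natAbs : ℝ) := by rw [Nat.cast_natAbs]; simp
  have hpos : ∀ p ∈ S, (0 : ℝ) < p := fun p hp => by exact_mod_cast (hS p hp).pos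
  rw [h3]
  calc _ = Real.log (∏ p ∈ S, (p : ℝ) ^ e p) := by
        rw [Real.log_prod (fun p hp => (pow_pos (hpos p hp) _).ne')]
        exact Finset.sum_congr rfl fun p _ => (Real.log_pow _ _).symm
    _ ≤ _ := by
        apply Real.log_le_log (Finset.prod_pos fun p hp => pow_pos (hpos p hp) _)
        have : ((∏ p ∈ S, p ^ e p : ℕ) : ℝ) ≤ d.natAbs := Nat.cast_le.2 h2
        rwa [Nat.cast_prod, Finset.prod_congr rfl (fun p _ => Nat.cast_pow p (e p))] at this

theorem expQ_bound (s L : ℕ) (h1 : L ^ 2 ≤ 2 * s) :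
    (2 / 3 : ℝ) * s * L - 3 * s ≤ ((s * L - 1 * (L * (L + 1) * (L + 2) / 6) : ℕ) : ℝ) := by
  have h2 : ((s * L : ℕ) : ℝ) - ((1 * (L * (L + 1) * (L + 2) / 6) : ℕ) : ℝ) ≤
      ((s * L - 1 * (L * (L + 1) * (L + 2) / 6) : ℕ) : ℝ) := by
    rw [sub_le_iff_le_add, ← Nat.cast_add, Nat.cast_le]; omega
  refine le_trans ?_ h2
  rw [one_mul]
  have h3 : ((L * (L + 1) * (L + 2) / 6 : ℕ) : ℝ) ≤ ((L * (L + 1) * (L + 2) : ℕ) : ℝ) / 6 := by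
    exact_mod_cast Nat.cast_div_le
  push_cast at h3 ⊢
  have h4 : (L : ℝ) ^ 2 ≤ 2 * s := by exact_mod_cast h1
  have hL : (0 : ℝ) ≤ L := Nat.cast_nonneg L
  have h5 : (L : ℝ) ≤ L ^ 2 := by
    have : L ≤ L ^ 2 := Nat.le_self_pow (by norm_num) L
    exact_mod_cast this
  have h6 : (L : ℝ) * L ^ 2 ≤ L * (2 * s) := by gcongr
  nlinarith

theorem expP_bound (s L p N : ℕ) (δ : ℝ) (hδ : 0 ≤ δ) (hδ1 : δ ≤ 1) (h1 : L ^ 2 ≤ 2 * s)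
    (hp : 0 < p) (hpL : p ≤ L) (hN : (N : ℝ) ≤ (1 + δ) * p ^ 2) :
    (2 / 3 - δ / 3 : ℝ) * s * L / p - 5 * s ≤
      ((s * (L / p) - N * ((L / p) * (L / p + 1) * (L / p + 2) / 6) : ℕ) : ℝ) := by
  set T := L / p with hT
  have h2 : ((s * T : ℕ) : ℝ) - ((N * (T * (T + 1) * (T + 2) / 6) : ℕ) : ℝ) ≤
      ((s * T - N * (T * (T + 1) * (T + 2) / 6) : ℕ) : ℝ) := by
    rw [sub_le_iff_le_add, ← Nat.cast_add, Nat.cast_le]; omega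
  refine le_trans ?_ h2
  have h3 : ((T * (T + 1) * (T + 2) / 6 : ℕ) : ℝ) ≤ ((T * (T + 1) * (T + 2) : ℕ) : ℝ) / 6 := by
    exact_mod_cast Nat.cast_div_le
  have hp' : (0 : ℝ) < p := by exact_mod_cast hp
  have hpL' : (p : ℝ) ≤ L := by exact_mod_cast hpL
  have hs : (0 : ℝ) ≤ s := Nat.cast_nonneg s
  have h4 : (L : ℝ) ^ 2 ≤ 2 * s := by exact_mod_cast h1
  set x : ℝ := (L : ℝ) / p with hx
  have hx1 : 1 ≤ x := by rw [hx, le_div_iff₀ hp']; linarith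
  have hT1 : (T : ℝ) ≤ x := by exact_mod_cast Nat.cast_div_le
  have hT2 : x - 1 ≤ T := by
    have : L < (T + 1) * p := by
      have := Nat.lt_succ_iff.2 (le_refl (L / p))
      rw [Nat.div_lt_iff_lt_mul hp] at this
      exact this
    have h5 : (L : ℝ) < (T + 1) * p := by exact_mod_cast this
    have h6 : x < T + 1 := by rw [hx, div_lt_iff₀ hp']; exact h5
    linarith
  have hT0 : (0 : ℝ) ≤ T := Nat.cast_nonneg T
  push_cast at h3 ⊢
  have hLx : (L : ℝ) = x * p := by rw [hx]; field_simp
  have h7 : (x * p) ^ 2 ≤ 2 * s := by rw [← hLx]; exact h4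
  have h8 : (N : ℝ) * ((T * (T + 1) * (T + 2) / 6 : ℕ) : ℝ) ≤
      ((1 + δ) * p ^ 2) * (x * (x + 1) * (x + 2) / 6) := by
    refine mul_le_mul hN (h3.trans ?_) (Nat.cast_nonneg _) (by positivity)
    gcongr
  have h9 : ((1 + δ) * p ^ 2) * (x * (x + 1) * (x + 2) / 6) ≤ (1 + δ) * (s * x / 3) + 4 * s := by
    have e : ((1 + δ) * p ^ 2) * (x * (x + 1) * (x + 2) / 6) =
      (1 + δ) * ((x * p) ^ 2 * x / 6 + (x * p) ^ 2 / 2 + (x * p) * p / 3) := by ring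
    have a1 : (x * p) ^ 2 * x ≤ 2 * s * x := by gcongr
    have a2 : (x * p) * p ≤ 2 * s := by
      refine le_trans ?_ h7
      have : (p : ℝ) ≤ x * p := by nlinarith
      nlinarith [mul_nonneg (by linarith : (0 : ℝ) ≤ x) hp'.le]
    have a3 : (x * p) ^ 2 * x / 6 + (x * p) ^ 2 / 2 + (x * p) * p / 3 ≤
      s * x / 3 + 2 * s := by linarith
    rw [e]
    calc _ ≤ (1 + δ) * (s * x / 3 + 2 * s) := by gcongr
      _ ≤ _ := by nlinarith
  have h10 : (s : ℝ) * (x - 1) ≤ s * T := by gcongr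
  have e2 : (2 / 3 - δ / 3 : ℝ) * s * L / p = (2 / 3 - δ / 3 : ℝ) * s * x := by rw [hx]; ring
  rw [e2]
  linarith

theorem lemA_ineq (k : ℕ) (hk : 0 < k) (n : ℤ) (B : ℕ) (hB : 0 < B) (L : ℕ)
    {M : Type*} [Fintype M] [DecidableEq M] (hL1 : L ^ 2 ≤ 2 * Fintype.card M)
    (m z : M → ℕ × ℕ × ℕ) (hz : ∀ i, ((z i).1 : ℤ) ^ k + ((z i).2.1 : ℤ) ^ k = ((z i).2.2 : ℤ) ^ k + n)
    (hzB : ∀ i, (z i).1 ≤ B ∧ (z i).2.1 ≤ B ∧ (z i).2.2 ≤ B)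
    (hdet : (Matrix.of fun i j => ((z i).1 : ℤ) ^ (m j).1 * ((z i).2.1 : ℤ) ^ (m j).2.1 *
      ((z i).2.2 : ℤ) ^ (m j).2.2).det ≠ 0)
    (Q : Finset ℕ) (hQ : ∀ p ∈ Q, p.Prime ∧ ¬ p ∣ k ∧ ¬ (p : ℤ) ∣ n)
    (hQc : ∀ p ∈ Q, ∀ i i', (z i).1 ≡ (z i').1 [MOD p] ∧ (z i).2.1 ≡ (z i').2.1 [MOD p] ∧
      (z i).2.2 ≡ (z i').2.2 [MOD p])
    (δ : ℝ) (hδ : 0 ≤ δ) (hδ1 : δ ≤ 1)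
    (G : Finset ℕ) (hG : ∀ p ∈ G, p.Prime ∧ ¬ p ∣ k ∧ ¬ (p : ℤ) ∣ n ∧ p ∉ Q ∧ p ≤ L ∧
      2 * (k : ℝ) ^ 2 ≤ δ * Real.sqrt p) :
    ∑ p ∈ Q, ((2 / 3 : ℝ) * Fintype.card M * L - 3 * Fintype.card M) * Real.log p +
    ∑ p ∈ G, ((2 / 3 - δ / 3 : ℝ) * Fintype.card M * L / p - 5 * Fintype.card M) * Real.log p ≤
    Real.log (Fintype.card M).factorial + (∑ j, (((m j).1 + (m j).2.1 + (m j).2.2 : ℕ) : ℝ)) * Real.log B := by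
  set s := Fintype.card M with hs
  set A : Matrix M M ℤ := Matrix.of fun i j => ((z i).1 : ℤ) ^ (m j).1 * ((z i).2.1 : ℤ) ^ (m j).2.1 *
      ((z i).2.2 : ℤ) ^ (m j).2.2 with hA
  have hB1 : (1 : ℝ) ≤ B := by exact_mod_cast hB
  have hup : |(A.det : ℝ)| ≤ s.factorial * ∏ j, (B : ℝ) ^ ((m j).1 + (m j).2.1 + (m j).2.2) := by
    apply det_abs_le
    intro i j
    rw [hA]
    simp only [Matrix.of_apply]
    push_cast
    obtain ⟨b1, b2, b3⟩ := hzB i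
    rw [abs_of_nonneg (by positivity), pow_add, pow_add]
    gcongr
  have hup2 : Real.log |(A.det : ℝ)| ≤ Real.log s.factorial +
      (∑ j, (((m j).1 + (m j).2.1 + (m j).2.2 : ℕ) : ℝ)) * Real.log B := by
    have h0 : (0 : ℝ) < |(A.det : ℝ)| := abs_pos.2 (by exact_mod_cast hdet)
    have h1 := Real.log_le_log h0 hup
    have hf : (s.factorial : ℝ) ≠ 0 := by exact_mod_cast Nat.factorial_ne_zero s
    have hBp : ∀ j ∈ (Finset.univ : Finset M), (B : ℝ) ^ ((m j).1 + (m j).2.1 + (m j).2.2) ≠ 0 :=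
      fun j _ => by positivity
    rw [Real.log_mul hf (Finset.prod_ne_zero_iff.2 hBp), Real.log_prod hBp] at h1
    simp_rw [Real.log_pow] at h1
    rw [Finset.sum_mul]
    exact h1
  refine le_trans ?_ hup2
  -- exponents
  let N : ℕ → ℕ := fun p => Nat.card {x : ZMod p × ZMod p × ZMod p // x.1 ^ k + x.2.1 ^ k = x.2.2 ^ k + (n : ZMod p)}
  let e : ℕ → ℕ := fun p => if p ∈ Q then s * L - 1 * (L * (L + 1) * (L + 2) / 6) else
    s * (L / p) - N p * ((L / p) * (L / p + 1) * (L / p + 2) / 6)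
  have hdisj : Disjoint Q G := by
    rw [Finset.disjoint_left]; intro p hp hp'; exact (hG p hp').2.2.2.1 hp
  have hprime : ∀ p ∈ Q ∪ G, p.Prime := by
    intro p hp
    rcases Finset.mem_union.1 hp with h | h
    · exact (hQ p h).1
    · exact (hG p h).1
  have hmod : ∀ (p a b : ℕ), a ≡ b [MOD p] → (p : ℤ) ∣ (a : ℤ) - b := by
    intro p a b h
    exact (Nat.modEq_iff_dvd.1 h.symm)
  have hdvd : ∀ p ∈ Q ∪ G, ((p : ℤ) ^ e p) ∣ A.det := by
    intro p hp
    rcases Finset.mem_union.1 hp with h | h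
    · have := surf_det p (hQ p h).1 k (hQ p h).2.1 hk.ne' n (hQ p h).2.2 (fun i => ((z i).1 : ℤ))
        (fun i => ((z i).2.1 : ℤ)) (fun i => ((z i).2.2 : ℤ)) hz m (fun _ => ()) (fun i i' _ => ⟨
          hmod _ _ _ (hQc p h i i').1, hmod _ _ _ (hQc p h i i').2.1, hmod _ _ _ (hQc p h i i').2.2⟩) L
      rw [Fintype.card_unit] at this
      simp only [e, h, if_true]
      exact this
    · have hpp := (hG p h).1
      have : Fact p.Prime := ⟨hpp⟩
      have hc := surf_det (κ := {x : ZMod p × ZMod p × ZMod p // x.1 ^ k + x.2.1 ^ k = x.2.2 ^ k + (n : ZMod p)})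
        p hpp k (hG p h).2.1 hk.ne' n (hG p h).2.2.1 (fun i => ((z i).1 : ℤ))
        (fun i => ((z i).2.1 : ℤ)) (fun i => ((z i).2.2 : ℤ)) hz m
        (fun i => ⟨((z i).1, (z i).2.1, (z i).2.2), by
          have := congrArg (Int.cast : ℤ → ZMod p) (hz i)
          push_cast at this
          exact this⟩) (by
          intro i i' hii
          simp only [Subtype.mk.injEq, Prod.mk.injEq] at hii
          exact ⟨hmod _ _ _ ((ZMod.natCast_eq_natCast_iff _ _ _).1 hii.1),
            hmod _ _ _ ((ZMod.natCast_eq_natCast_iff _ _ _).1 hii.2.1),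
            hmod _ _ _ ((ZMod.natCast_eq_natCast_iff _ _ _).1 hii.2.2)⟩) (L / p)
      simp only [e, (hG p h).2.2.2.1, if_false, N]
      rw [Nat.card_eq_fintype_card]
      exact hc
  have hlow := log_ge_of_prime_pows (Q ∪ G) hprime e A.det hdet hdvd
  refine le_trans ?_ hlow
  rw [Finset.sum_union hdisj]
  apply add_le_add
  · refine Finset.sum_le_sum fun p hp => ?_
    have : 0 ≤ Real.log p := Real.log_natCast_nonneg p
    have h2 := expQ_bound s L hL1
    simp only [e, hp, if_true]
    gcongr
  · refine Finset.sum_le_sum fun p hp => ?_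
    have : 0 ≤ Real.log p := Real.log_natCast_nonneg p
    obtain ⟨hpp, -, -, hpQ, hpL, hpd⟩ := hG p hp
    have : Fact p.Prime := ⟨hpp⟩
    have h2 := expP_bound s L p (N p) δ hδ hδ1 hL1 hpp.pos hpL (by
      have := modp_count p k hk (n : ZMod p)
      simp only [N]
      rw [Nat.card_eq_fintype_card]
      refine this.trans ?_
      have h5 : Real.sqrt p * Real.sqrt p = p := Real.mul_self_sqrt (Nat.cast_nonneg p)
      have h6 : 2 * (k : ℝ) ^ 2 * p * Real.sqrt p ≤ δ * p ^ 2 := by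
        calc _ = (2 * (k : ℝ) ^ 2) * (p * Real.sqrt p) := by ring
          _ ≤ (δ * Real.sqrt p) * (p * Real.sqrt p) := by gcongr
          _ = δ * p * (Real.sqrt p * Real.sqrt p) := by ring
          _ = _ := by rw [h5]; ring
      linarith)
    simp only [e, hpQ, if_false]
    gcongr

end

section
def Mon (k D : ℕ) : Finset (ℕ × ℕ × ℕ) :=
  ((Finset.range k) ×ˢ (Finset.range (D + 1)) ×ˢ (Finset.range (D + 1))).filter
    fun m => m.1 + m.2.1 + m.2.2 ≤ D

theorem mem_Mon (k D : ℕ) (m : ℕ × ℕ × ℕ) :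
    m ∈ Mon k D ↔ m.1 < k ∧ m.1 + m.2.1 + m.2.2 ≤ D := by
  simp only [Mon, Finset.mem_filter, Finset.mem_product, Finset.mem_range]
  omega

theorem Mon_fiber_le (k D t : ℕ) :
    ((Mon k D).filter fun m => m.1 + m.2.1 + m.2.2 = t).card ≤ k * (t + 1) := by
  calc _ ≤ ((Finset.range k) ×ˢ (Finset.range (t + 1))).card := by
        apply Finset.card_le_card_of_injOn (fun m => (m.1, m.2.1))
        · intro m hm
          simp only [Finset.coe_filter, Set.mem_ofPred_eq, mem_Mon] at hm
          simp only [Finset.coe_product, Set.mem_prod, Finset.coe_range, Set.mem_Iio]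
          omega
        · rintro ⟨a, b, c⟩ hm ⟨a', b', c'⟩ hm' h
          simp only [Finset.coe_filter, Set.mem_ofPred_eq, mem_Mon, Prod.mk.injEq] at hm hm' h ⊢
          omega
    _ = _ := by simp

theorem Mon_fiber_ge (k D t : ℕ) (ht : k + t ≤ D) :
    k * (t + 1) ≤ ((Mon k D).filter fun m => m.1 + m.2.1 + m.2.2 = k + t).card := by
  calc _ = ((Finset.range k) ×ˢ (Finset.range (t + 1))).card := by simp
    _ ≤ _ := by
        apply Finset.card_le_card_of_injOn (fun m => (m.1, m.2, k + t - m.1 - m.2))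
        · intro m hm
          simp only [Finset.coe_product, Set.mem_prod, Finset.coe_range, Set.mem_Iio] at hm
          simp only [Finset.coe_filter, Set.mem_ofPred_eq, mem_Mon]
          omega
        · rintro ⟨a, b⟩ hm ⟨a', b'⟩ hm' h
          simp only [Prod.mk.injEq] at h ⊢
          omega

theorem Mon_deg_sum (k D : ℕ) :
    3 * ∑ m ∈ Mon k D, (m.1 + m.2.1 + m.2.2) ≤ k * (D * (D + 1) * (D + 2)) := by
  have h1 : ∑ m ∈ Mon k D, (m.1 + m.2.1 + m.2.2) =
      ∑ t ∈ Finset.range (D + 1), ∑ m ∈ Mon k D with m.1 + m.2.1 + m.2.2 = t, (m.1 + m.2.1 + m.2.2) := by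
    rw [Finset.sum_fiberwise_of_maps_to]
    intro m hm
    rw [mem_Mon] at hm
    rw [Finset.mem_range]; omega
  have h2 : ∑ m ∈ Mon k D, (m.1 + m.2.1 + m.2.2) ≤
      ∑ t ∈ Finset.range (D + 1), k * (t * (t + 1)) := by
    rw [h1]
    refine Finset.sum_le_sum fun t _ => ?_
    rw [Finset.sum_congr rfl (fun m hm => (Finset.mem_filter.1 hm).2), Finset.sum_const, smul_eq_mul]
    calc _ ≤ (k * (t + 1)) * t := Nat.mul_le_mul_right _ (Mon_fiber_le k D t)
      _ = _ := by ring
  have h3 : ∀ D : ℕ, 3 * ∑ t ∈ Finset.range (D + 1), (t * (t + 1)) = D * (D + 1) * (D + 2) := by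
    intro D
    induction D with
    | zero => simp
    | succ d ih => rw [Finset.sum_range_succ, mul_add, ih]; ring
  rw [← h3 D]
  rw [← Finset.mul_sum] at h2
  nlinarith

theorem Mon_card_ge (k t : ℕ) : k * (t * t) ≤ 2 * (Mon k (k + t)).card := by
  have h1 : ∑ u ∈ Finset.range (t + 1), k * (u + 1) ≤ (Mon k (k + t)).card := by
    calc _ ≤ ∑ u ∈ Finset.range (t + 1),
          ((Mon k (k + t)).filter fun m => m.1 + m.2.1 + m.2.2 = k + u).card := by
          refine Finset.sum_le_sum fun u hu => ?_
          rw [Finset.mem_range] at hu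
          exact Mon_fiber_ge k (k + t) u (by omega)
      _ = ∑ v ∈ (Finset.range (t + 1)).image (k + ·),
          ((Mon k (k + t)).filter fun m => m.1 + m.2.1 + m.2.2 = v).card := by
          rw [Finset.sum_image]
          intro a _ b _ h; simpa using h
      _ ≤ _ := by
          have := Finset.card_biUnion (s := (Finset.range (t + 1)).image (k + ·))
            (t := fun v => (Mon k (k + t)).filter fun m => m.1 + m.2.1 + m.2.2 = v) (by
              intro a _ b _ hab
              rw [Function.onFun, Finset.disjoint_left]
              intro m h1 h2
              rw [Finset.mem_filter] at h1 h2
              omega)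
          rw [← this]
          apply Finset.card_le_card
          intro m hm
          rw [Finset.mem_biUnion] at hm
          obtain ⟨v, _, hv⟩ := hm
          exact (Finset.mem_filter.1 hv).1
  have h2 : ∀ t : ℕ, t * t ≤ 2 * ∑ u ∈ Finset.range (t + 1), (u + 1) := by
    intro t
    induction t with
    | zero => simp
    | succ d ih => rw [Finset.sum_range_succ]; nlinarith
  rw [← Finset.mul_sum] at h1
  have := h2 t
  nlinarith

theorem ratio_bound (k : ℕ) (hk : 1 ≤ k) (ε : ℝ) (hε : 0 < ε) : ∃ D0 : ℕ, ∀ D ≥ D0,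
    ((∑ m ∈ Mon k D, (m.1 + m.2.1 + m.2.2) : ℕ) : ℝ) ≤
      (2 / (3 * Real.sqrt k) + ε / 6) * (Mon k D).card * (Nat.sqrt (2 * (Mon k D).card) : ℝ) := by
  obtain ⟨X0, hX0⟩ := exists_nat_ge (28 * (k + 3) / ε + (k + 3))
  refine ⟨k + 1 + X0, fun D hD => ?_⟩
  obtain ⟨X, rfl⟩ : ∃ X, D = k + (X + 1) := ⟨D - k - 1, by omega⟩
  have hX : X0 ≤ X := by omega
  set s := (Mon k (k + (X + 1))).card with hs
  have h1 := Mon_card_ge k (X + 1)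
  rw [← hs] at h1
  have hdeg := Mon_deg_sum k (k + (X + 1))
  set q := Real.sqrt k with hq
  have hk' : (1 : ℝ) ≤ k := by exact_mod_cast hk
  have hqq : q * q = k := Real.mul_self_sqrt (by linarith)
  have hq1 : 1 ≤ q := by rw [hq]; exact Real.one_le_sqrt.2 hk'
  have hXr : (X0 : ℝ) ≤ X := by exact_mod_cast hX
  have hXpos : (0 : ℝ) ≤ X := Nat.cast_nonneg X
  have h1' : (k : ℝ) * ((X + 1) * (X + 1)) ≤ 2 * s := by exact_mod_cast h1
  have hL : q * X ≤ (Nat.sqrt (2 * s) : ℝ) := by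
    have a1 : 2 * s < (Nat.sqrt (2 * s) + 1) * (Nat.sqrt (2 * s) + 1) := Nat.lt_succ_sqrt _
    have a2 : (2 * s : ℝ) < (Nat.sqrt (2 * s) + 1) * (Nat.sqrt (2 * s) + 1) := by exact_mod_cast a1
    have a3 : (q * (X + 1)) ^ 2 < ((Nat.sqrt (2 * s) : ℝ) + 1) ^ 2 := by
      calc (q * (X + 1)) ^ 2 = (q * q) * ((X + 1) * (X + 1)) := by ring
        _ = k * ((X + 1) * (X + 1)) := by rw [hqq]
        _ < _ := by rw [sq]; linarith
    have a4 := lt_of_pow_lt_pow_left₀ 2 (by positivity) a3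
    nlinarith
  have hs2 : (k : ℝ) / 2 * X ^ 2 ≤ s := by nlinarith
  have hsL : (k : ℝ) / 2 * X ^ 2 * (q * X) ≤ s * (Nat.sqrt (2 * s) : ℝ) := by
    apply mul_le_mul hs2 hL (by positivity) (by positivity)
  have hdeg' : 3 * ((∑ m ∈ Mon k (k + (X + 1)), (m.1 + m.2.1 + m.2.2) : ℕ) : ℝ) ≤
      k * ((k + (X + 1)) * (k + (X + 1) + 1) * (k + (X + 1) + 2)) := by exact_mod_cast hdeg
  have hcub : ((k : ℝ) + (X + 1)) * (k + (X + 1) + 1) * (k + (X + 1) + 2) ≤ (X + (k + 3)) ^ 3 := by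
    have : (X + ((k : ℝ) + 3)) ^ 3 = (X + (k + 3)) * (X + (k + 3)) * (X + (k + 3)) := by ring
    rw [this]
    refine mul_le_mul (mul_le_mul ?_ ?_ ?_ ?_) ?_ ?_ ?_ <;> first | positivity | linarith
  set c : ℝ := (k : ℝ) + 3 with hc
  have hc0 : 0 < c := by positivity
  have hXc : 28 * c / ε + c ≤ X := hX0.trans hXr
  have hXc1 : c ≤ X := by
    have : 0 ≤ 28 * c / ε := by positivity
    linarith
  have hXc2 : 28 * c ≤ ε * X := by
    have : 28 * c / ε ≤ X := by linarith
    rw [div_le_iff₀ hε] at this; linarith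
  have hcub2 : ((X : ℝ) + c) ^ 3 ≤ (1 + ε / 4) * X ^ 3 := by
    have b1 : ((X : ℝ) + c) ^ 3 ≤ X ^ 3 + 7 * c * X ^ 2 := by
      have : c * c ≤ c * X := by gcongr
      have : c * c * c ≤ c * X * X := by gcongr
      nlinarith
    have b2 : 28 * c * X ^ 2 ≤ ε * X * X ^ 2 := by gcongr
    nlinarith
  have hfin : (k : ℝ) / 3 * ((1 + ε / 4) * X ^ 3) ≤
      (2 / (3 * q) + ε / 6) * ((k : ℝ) / 2 * X ^ 2 * (q * X)) := by
    have e : (2 / (3 * q) + ε / 6) * ((k : ℝ) / 2 * X ^ 2 * (q * X)) =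
        (k : ℝ) / 3 * X ^ 3 + ε * k * q * X ^ 3 / 12 := by field_simp; ring
    rw [e]
    have : ε * k * 1 * X ^ 3 / 12 ≤ ε * k * q * X ^ 3 / 12 := by gcongr
    linarith
  calc _ ≤ (k : ℝ) / 3 * ((1 + ε / 4) * X ^ 3) := by
        have : (k : ℝ) * ((k + (X + 1)) * (k + (X + 1) + 1) * (k + (X + 1) + 2)) ≤
          k * ((1 + ε / 4) * X ^ 3) :=
          mul_le_mul_of_nonneg_left (hcub.trans hcub2) (by positivity)
        linarith
    _ ≤ _ := hfin
    _ ≤ (2 / (3 * q) + ε / 6) * (s * (Nat.sqrt (2 * s) : ℝ)) := by gcongr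
    _ = _ := by ring

theorem good_primes_sum : ∃ CM : ℝ, 0 ≤ CM ∧ ∀ (L y P m : ℕ) (Q : Finset ℕ), 0 < L → 0 < P → m ≠ 0 →
    (∀ p ∈ Q, p.Prime) →
    Real.log L - CM - y * Real.log (y + 1) - (P * Real.log (P + 1) + Real.log m / P) - Q.card ≤
    ∑ p ∈ (Finset.Icc 1 L).filter (fun p => p.Prime ∧ y < p ∧ ¬ p ∣ m ∧ p ∉ Q), Real.log p / (p : ℝ) := by
  obtain ⟨CM, hCM, hM⟩ := mertens_lower
  refine ⟨CM, hCM, fun L y P m Q hL hP hm hQ => ?_⟩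
  have h1 := hM L hL
  have h2 := bad_primes_loss P hP m hm
  set G := (Finset.Icc 1 L).filter (fun p => p.Prime ∧ y < p ∧ ¬ p ∣ m ∧ p ∉ Q) with hG
  have hnn : ∀ p : ℕ, 0 ≤ Real.log p / (p : ℝ) := fun p =>
    div_nonneg (Real.log_natCast_nonneg p) (Nat.cast_nonneg p)
  have hsub : (Finset.Icc 1 L).filter Nat.Prime ⊆ G ∪ ((Finset.Icc 1 y) ∪ (m.primeFactors ∪ Q)) := by
    intro p hp
    rw [Finset.mem_filter, Finset.mem_Icc] at hp
    rw [Finset.mem_union, Finset.mem_union, Finset.mem_union, hG, Finset.mem_filter, Finset.mem_Icc,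
      Finset.mem_Icc, Nat.mem_primeFactors]
    by_cases h1 : p ∈ Q
    · tauto
    by_cases h2 : p ∣ m
    · tauto
    by_cases h3 : y < p
    · tauto
    · right; left; exact ⟨hp.1.1, not_lt.1 h3⟩
  have hun : ∀ A B : Finset ℕ, ∑ p ∈ A ∪ B, Real.log p / (p : ℝ) ≤
      ∑ p ∈ A, Real.log p / (p : ℝ) + ∑ p ∈ B, Real.log p / (p : ℝ) := by
    intro A B
    rw [← Finset.sum_union_inter]
    have : 0 ≤ ∑ p ∈ A ∩ B, Real.log p / (p : ℝ) := Finset.sum_nonneg fun p _ => hnn p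
    linarith
  have h3 := Finset.sum_le_sum_of_subset_of_nonneg hsub (fun p _ _ => hnn p)
  have h4 := hun G ((Finset.Icc 1 y) ∪ (m.primeFactors ∪ Q))
  have h5 := hun (Finset.Icc 1 y) (m.primeFactors ∪ Q)
  have h6 := hun (m.primeFactors) Q
  have h7 : ∑ p ∈ Q, Real.log p / (p : ℝ) ≤ Q.card := by
    calc _ ≤ ∑ p ∈ Q, (1 : ℝ) := by
          refine Finset.sum_le_sum fun p hp => ?_
          have : (0 : ℝ) < p := by exact_mod_cast (hQ p hp).pos
          rw [div_le_one this]
          exact (Real.log_le_sub_one_of_pos this).trans (by linarith)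
      _ = _ := by simp
  have h8 : ∑ p ∈ Finset.Icc 1 y, Real.log p / (p : ℝ) ≤ y * Real.log (y + 1) := by
    calc _ ≤ ∑ p ∈ Finset.Icc 1 y, Real.log (y + 1) := by
          refine Finset.sum_le_sum fun p hp => ?_
          rw [Finset.mem_Icc] at hp
          have a1 : (1 : ℝ) ≤ p := by exact_mod_cast hp.1
          have a2 : (p : ℝ) ≤ y := by exact_mod_cast hp.2
          refine (div_le_self (Real.log_nonneg a1) a1).trans ?_
          exact Real.log_le_log (by linarith) (by linarith)
      _ = _ := by simp
  linarith

set_option maxHeartbeats 1000000 in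
theorem lemmaA (k : ℕ) (hk : 5 ≤ k) (ε : ℝ) (hε : 0 < ε) (hε1 : ε ≤ 1) (J : ℕ) :
    ∃ D0 : ℕ, ∃ C0 : ℝ, 0 < C0 ∧ ∀ B : ℕ, 0 < B → ∀ n : ℤ, n ≠ 0 → |(n : ℝ)| ≤ 2 * (B : ℝ) ^ k →
    ∀ Q : Finset ℕ, (∀ p ∈ Q, p.Prime ∧ ¬ p ∣ k ∧ ¬ (p : ℤ) ∣ n) → Q.card ≤ J →
    ∀ D : ℕ, D0 ≤ D → C0 * (B : ℝ) ^ (1 / Real.sqrt k + ε) ≤ D * ∏ p ∈ Q, (p : ℝ) →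
    ∀ Z : Set (ℕ × ℕ × ℕ), (∀ z ∈ Z, (z.1 : ℤ) ^ k + (z.2.1 : ℤ) ^ k = (z.2.2 : ℤ) ^ k + n) →
    (∀ z ∈ Z, z.1 ≤ B ∧ z.2.1 ≤ B ∧ z.2.2 ≤ B) →
    (∀ p ∈ Q, ∀ z ∈ Z, ∀ w ∈ Z, z.1 ≡ w.1 [MOD p] ∧ z.2.1 ≡ w.2.1 [MOD p] ∧ z.2.2 ≡ w.2.2 [MOD p]) →
    ∃ v : ℕ × ℕ × ℕ → ℚ, (∃ m ∈ Mon k D, v m ≠ 0) ∧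
      ∀ z ∈ Z, ∑ m ∈ Mon k D, v m * ((z.1 : ℚ) ^ m.1 * (z.2.1 : ℚ) ^ m.2.1 * (z.2.2 : ℚ) ^ m.2.2) = 0 := by
  obtain ⟨CM, hCM, hgood⟩ := good_primes_sum
  obtain ⟨D1, hD1⟩ := ratio_bound k (by omega) ε hε
  set δ := ε / 12 with hδ
  have hδ0 : 0 < δ := by positivity
  obtain ⟨P, hP⟩ := exists_nat_ge (6 * k / ε)
  obtain ⟨y, hy⟩ := exists_nat_ge ((2 * (k : ℝ) ^ 2 / δ) ^ 2)
  obtain ⟨D2, hD2⟩ := exists_nat_ge (3 / δ)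
  have hk' : (5 : ℝ) ≤ k := by exact_mod_cast hk
  have hPpos : 0 < P := by
    have : (0 : ℝ) < P := lt_of_lt_of_le (by positivity) hP
    exact_mod_cast this
  have hP' : (0 : ℝ) < P := by exact_mod_cast hPpos
  set K : ℝ := CM + y * Real.log (y + 1) + P * Real.log (P + 1) + Real.log (2 * k) / P + J with hK
  refine ⟨max D1 (max D2 (2 * k + 2)), Real.exp (K + 100), Real.exp_pos _, ?_⟩
  intro B hB n hn hnB Q hQ hQJ D hD hDQ Z hZ hZB hZQ
  have hDD1 : D1 ≤ D := le_trans (le_max_left _ _) hD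
  have hDD2 : D2 ≤ D := le_trans ((le_max_left _ _).trans (le_max_right _ _)) hD
  have hDD3 : 2 * k + 2 ≤ D := le_trans ((le_max_right _ _).trans (le_max_right _ _)) hD
  have hratio := hD1 D hDD1
  set s := (Mon k D).card with hs
  set L := Nat.sqrt (2 * s) with hL
  have hDpos : 0 < D := by omega
  have hDL : D ≤ L := by
    rw [hL, Nat.le_sqrt]
    obtain ⟨t, ht⟩ : ∃ t, D = k + t := ⟨D - k, by omega⟩
    have := Mon_card_ge k t
    rw [← ht, ← hs] at this
    have h2 : k + 2 ≤ t := by omega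
    calc D * D = (k + t) * (k + t) := by rw [ht]
      _ ≤ (2 * t) * (2 * t) := Nat.mul_le_mul (by omega) (by omega)
      _ = 4 * (t * t) := by ring
      _ ≤ k * (t * t) := Nat.mul_le_mul_right _ (by omega)
      _ ≤ _ := this
  have hLpos : 0 < L := by omega
  have hL' : (0 : ℝ) < L := by exact_mod_cast hLpos
  have hL2 : L ^ 2 ≤ 2 * s := by rw [sq]; exact Nat.sqrt_le _
  have hspos : 0 < s := by
    by_contra h
    have : s = 0 := by omega
    rw [this] at hL2
    have : 0 < L ^ 2 := by positivity
    omega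
  have hs' : (0 : ℝ) < s := by exact_mod_cast hspos
  by_contra hcon
  -- nonzero determinant
  have hdet : ∃ z : (Mon k D) → ℕ × ℕ × ℕ, (∀ i, z i ∈ Z) ∧
      (Matrix.of fun i j : (Mon k D) => ((z i).1 : ℤ) ^ (j : ℕ × ℕ × ℕ).1 * ((z i).2.1 : ℤ) ^ (j : ℕ × ℕ × ℕ).2.1 *
      ((z i).2.2 : ℤ) ^ (j : ℕ × ℕ × ℕ).2.2).det ≠ 0 := by
    by_contra hd
    push Not at hd
    obtain ⟨v, hv, hv2⟩ := exists_vanishing (fun (z : ℕ × ℕ × ℕ) (j : Mon k D) =>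
      (z.1 : ℤ) ^ (j : ℕ × ℕ × ℕ).1 * (z.2.1 : ℤ) ^ (j : ℕ × ℕ × ℕ).2.1 *
      (z.2.2 : ℤ) ^ (j : ℕ × ℕ × ℕ).2.2) Z hd
    apply hcon
    refine ⟨fun m => if h : m ∈ Mon k D then v ⟨m, h⟩ else 0, ?_, ?_⟩
    · obtain ⟨m, hm⟩ := Function.ne_iff.1 hv
      exact ⟨m, m.2, by simpa using hm⟩
    · intro z hz
      refine Eq.trans ?_ (hv2 z hz)
      rw [← Finset.sum_coe_sort (Mon k D)]
      refine Finset.sum_congr rfl fun m _ => ?_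
      simp only [m.2, dif_pos]
      push_cast
      rfl
  obtain ⟨z, hzZ, hdz⟩ := hdet
  have hcard : Fintype.card (Mon k D) = s := by rw [Fintype.card_coe]
  set m := (k * n).natAbs with hm
  have hm0 : m ≠ 0 := by
    rw [hm, Int.natAbs_ne_zero]
    exact mul_ne_zero (by exact_mod_cast (by omega : k ≠ 0)) hn
  set G := (Finset.Icc 1 L).filter (fun p => p.Prime ∧ y < p ∧ ¬ p ∣ m ∧ p ∉ Q) with hG
  have hgs := hgood L y P m Q hLpos hPpos hm0 (fun p hp => (hQ p hp).1)
  rw [← hG] at hgs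
  have hGp : ∀ p ∈ G, p.Prime ∧ ¬ p ∣ k ∧ ¬ (p : ℤ) ∣ n ∧ p ∉ Q ∧ p ≤ L ∧
      2 * (k : ℝ) ^ 2 ≤ δ * Real.sqrt p := by
    intro p hp
    rw [hG, Finset.mem_filter, Finset.mem_Icc] at hp
    obtain ⟨⟨h1, h2⟩, h3, h4, h5, h6⟩ := hp
    have h7 : ¬ (p : ℤ) ∣ k * n := by rwa [hm, ← Int.natCast_dvd] at h5
    refine ⟨h3, ?_, ?_, h6, h2, ?_⟩
    · intro h; exact h7 (Dvd.dvd.mul_right (by exact_mod_cast h) _)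
    · intro h; exact h7 (Dvd.dvd.mul_left h _)
    · have a1 : (2 * (k : ℝ) ^ 2 / δ) ^ 2 ≤ p := hy.trans (by exact_mod_cast h4.le)
      have a2 := Real.le_sqrt_of_sq_le a1
      rw [div_le_iff₀ hδ0] at a2; linarith
  have hmain := lemA_ineq k (by omega) n B hB L (by rw [hcard]; exact hL2) (fun j : Mon k D => (j : ℕ × ℕ × ℕ)) z
    (fun i => hZ _ (hzZ i)) (fun i => hZB _ (hzZ i)) hdz Q hQ (fun p hp i i' => hZQ p hp _ (hzZ i) _ (hzZ i'))
    δ hδ0.le (by linarith) G hGp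
  rw [hcard] at hmain
  set ℓ := Real.log B with hℓ
  have hB1 : (1 : ℝ) ≤ B := by exact_mod_cast hB
  have hℓ0 : 0 ≤ ℓ := Real.log_nonneg hB1
  set S := ∑ p ∈ Q, Real.log p with hS
  have hS0 : 0 ≤ S := Finset.sum_nonneg fun p _ => Real.log_natCast_nonneg p
  set Gs := ∑ p ∈ G, Real.log p / (p : ℝ) with hGs
  have hGs0 : 0 ≤ Gs := Finset.sum_nonneg fun p _ =>
    div_nonneg (Real.log_natCast_nonneg p) (Nat.cast_nonneg p)
  have hΘ : ∑ p ∈ G, Real.log p ≤ 2 * L := by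
    refine le_trans ?_ (sum_log_primes_le L)
    apply Finset.sum_le_sum_of_subset_of_nonneg
    · intro p hp
      rw [hG, Finset.mem_filter] at hp
      rw [Finset.mem_filter]; exact ⟨hp.1, hp.2.1⟩
    · intro p _ _; exact Real.log_natCast_nonneg p
  have e1 : ∑ p ∈ Q, ((2 / 3 : ℝ) * s * L - 3 * s) * Real.log p = ((2 / 3 : ℝ) * s * L - 3 * s) * S := by
    rw [hS, Finset.mul_sum]
  have e2 : ∑ p ∈ G, ((2 / 3 - δ / 3 : ℝ) * s * L / p - 5 * s) * Real.log p =
      (2 / 3 - δ / 3 : ℝ) * s * L * Gs - 5 * s * ∑ p ∈ G, Real.log p := by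
    rw [hGs, Finset.mul_sum, Finset.mul_sum, ← Finset.sum_sub_distrib]
    refine Finset.sum_congr rfl fun p _ => by ring
  have e3 : (∑ j : Mon k D, ((((j : ℕ × ℕ × ℕ)).1 + (j : ℕ × ℕ × ℕ).2.1 + (j : ℕ × ℕ × ℕ).2.2 : ℕ) : ℝ)) =
      ((∑ m ∈ Mon k D, (m.1 + m.2.1 + m.2.2) : ℕ) : ℝ) := by
    rw [Nat.cast_sum, ← Finset.sum_coe_sort (Mon k D)]
  rw [e1, e2, e3] at hmain
  have hfac : Real.log s.factorial ≤ 2 * s * L := by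
    have a1 : Real.log s.factorial ≤ s * Real.log s := by
      rw [← Real.log_pow]
      apply Real.log_le_log (by exact_mod_cast Nat.factorial_pos s)
      exact_mod_cast Nat.factorial_le_pow s
    have a2 : Real.log s ≤ 2 * L := by
      have b1 : 2 * s < (L + 1) * (L + 1) := Nat.lt_succ_sqrt _
      have b2 : (s : ℝ) ≤ (L + 1) ^ 2 := by
        have : s ≤ (L + 1) ^ 2 := by nlinarith
        exact_mod_cast this
      calc Real.log s ≤ Real.log ((L + 1) ^ 2) := Real.log_le_log hs' b2
        _ = 2 * Real.log (L + 1) := by rw [Real.log_pow]; norm_num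
        _ ≤ _ := by
          have := Real.log_le_sub_one_of_pos (x := (L : ℝ) + 1) (by linarith)
          linarith
    nlinarith
  have hLδ : 3 ≤ δ * L := by
    have : 3 / δ ≤ L := hD2.trans (by exact_mod_cast hDD2.trans hDL)
    rw [div_le_iff₀ hδ0] at this; linarith
  set κ := 1 / Real.sqrt k with hκ
  have hsq : 1 ≤ Real.sqrt k := Real.one_le_sqrt.2 (by linarith)
  have hκ1 : κ ≤ 1 := by rw [hκ, div_le_one (by linarith)]; exact hsq
  have hκ0 : 0 ≤ κ := by positivity
  have e4 : 2 / (3 * Real.sqrt k) = 2 / 3 * κ := by rw [hκ, div_mul_div_comm, mul_one]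
  rw [e4] at hratio
  have hsL : (0 : ℝ) < s * L := by positivity
  have hkey : (s * L) * ((2 / 3 - δ) * (S + Gs)) ≤ (s * L) * (12 + (2 / 3 * κ + ε / 6) * ℓ) := by
    have c1 : 3 * s * S ≤ δ * (s * L) * S := by
      calc 3 * s * S = 3 * (s * S) := by ring
        _ ≤ (δ * L) * (s * S) := by gcongr
        _ = _ := by ring
    have c2 : 5 * (s : ℝ) * ∑ p ∈ G, Real.log p ≤ 5 * s * (2 * L) := by gcongr
    have c3 := mul_le_mul_of_nonneg_right hratio hℓ0
    have c4 : 0 ≤ δ * (s * L) * Gs := by positivity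
    linarith only [c1, c2, c3, c4, hmain, hfac]
  have hkey2 := le_of_mul_le_mul_left hkey hsL
  -- lower bound for S + Gs
  have hlogD : K + 100 + (κ + ε) * ℓ ≤ Real.log D + S := by
    have b1 := Real.log_le_log (by positivity) hDQ
    have hDr : (D : ℝ) ≠ 0 := by exact_mod_cast hDpos.ne'
    have hQp : ∀ p ∈ Q, (p : ℝ) ≠ 0 := fun p hp => by exact_mod_cast (hQ p hp).1.ne_zero
    rw [Real.log_mul (Real.exp_pos _).ne' (by positivity), Real.log_exp, Real.log_rpow (by linarith),
      Real.log_mul hDr (Finset.prod_ne_zero_iff.2 hQp), Real.log_prod hQp] at b1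
    exact b1
  have hLD : Real.log D ≤ Real.log L :=
    Real.log_le_log (by exact_mod_cast hDpos) (by exact_mod_cast hDL)
  have hlogm : Real.log m / P ≤ Real.log (2 * k) / P + ε / 6 * ℓ := by
    have b1 : (m : ℝ) ≤ (2 * k) * (B : ℝ) ^ k := by
      have : (m : ℝ) = k * |(n : ℝ)| := by
        rw [hm, Nat.cast_natAbs]; push_cast; rw [abs_mul, abs_of_nonneg (by positivity)]
      rw [this]
      calc (k : ℝ) * |(n : ℝ)| ≤ k * (2 * (B : ℝ) ^ k) := by gcongr
        _ = _ := by ring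
    have b2 : Real.log m ≤ Real.log (2 * k) + k * ℓ := by
      have := Real.log_le_log (by exact_mod_cast Nat.pos_of_ne_zero hm0) b1
      rwa [Real.log_mul (by positivity) (by positivity), Real.log_pow] at this
    have b3 : (k : ℝ) / P ≤ ε / 6 := by
      rw [div_le_iff₀ hP']
      rw [div_le_iff₀ hε] at hP; linarith
    calc Real.log m / P ≤ (Real.log (2 * k) + k * ℓ) / P := by gcongr
      _ = Real.log (2 * k) / P + (k / P) * ℓ := by ring
      _ ≤ _ := by gcongr
  have hQJ' : (Q.card : ℝ) ≤ J := by exact_mod_cast hQJ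
  have hSG : 100 + (κ + ε - ε / 6) * ℓ ≤ S + Gs := by
    rw [hK] at hlogD
    linarith only [hlogD, hLD, hlogm, hQJ', hgs]
  have hδ2 : 0 ≤ 2 / 3 - δ := by linarith
  have hf := mul_le_mul_of_nonneg_left hSG hδ2
  have hf2 := hf.trans hkey2
  have g1 : (2 / 3 * κ + ε / 6) * ℓ ≤ (2 / 3 - δ) * ((κ + ε - ε / 6) * ℓ) := by
    rw [← mul_assoc]
    apply mul_le_mul_of_nonneg_right _ hℓ0
    rw [hδ]
    have q1 : ε * κ ≤ ε * 1 := by gcongr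
    have q2 : ε * ε ≤ ε * 1 := by gcongr
    linarith only [q1, q2, hε]
  linarith only [g1, hf2, hδ, hε1]

end

section
/-- The matrix of multiplication by `∑ g_t α^t` on `1, α, …, α^(k-1)`, with `α^k = φ`. -/
def normMat {R : Type*} [CommRing R] (k : ℕ) (φ : R) (g : ℕ → R) : Matrix (Fin k) (Fin k) R :=
  Matrix.of fun i j => if (i : ℕ) ≤ j then g (j - i) else φ * g (k + j - i)

theorem normMat_row {R : Type*} [CommRing R] (k : ℕ) (φ : R) (g : ℕ → R) (α : R) (hα : α ^ k = φ)
    (i : Fin k) : ∑ j, normMat k φ g i j * α ^ (j : ℕ) = α ^ (i : ℕ) * ∑ t ∈ Finset.range k, g t * α ^ t := by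
  have h1 : ∑ j, normMat k φ g i j * α ^ (j : ℕ) = ∑ j ∈ Finset.range k,
      (if (i : ℕ) ≤ j then g (j - i) else φ * g (k + j - i)) * α ^ j :=
    Fin.sum_univ_eq_sum_range (fun j => (if (i : ℕ) ≤ j then g (j - i) else φ * g (k + j - i)) * α ^ j) k
  rw [h1, Finset.mul_sum]
  have hi := i.2
  set m := (i : ℕ) with hm
  refine Finset.sum_bij' (fun j _ => if m ≤ j then j - m else k + j - m)
    (fun t _ => if t + m < k then t + m else t + m - k) ?_ ?_ ?_ ?_ ?_
  · intro j hj; rw [Finset.mem_range] at *; split_ifs <;> omega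
  · intro j hj; rw [Finset.mem_range] at *; split_ifs <;> omega
  · intro j hj; rw [Finset.mem_range] at *; split_ifs <;> omega
  · intro j hj; rw [Finset.mem_range] at *; split_ifs <;> omega
  · intro j hj
    rw [Finset.mem_range] at hj
    split_ifs with h
    · have : α ^ j = α ^ m * α ^ (j - m) := by rw [← pow_add]; congr 1; omega
      rw [this]; ring
    · have : α ^ m * α ^ (k + j - m) = α ^ k * α ^ j := by rw [← pow_add, ← pow_add]; congr 1; omega
      rw [← hα]
      linear_combination (-(g (k + j - m))) * this

theorem normMat_det_zero {R : Type*} [CommRing R] [IsDomain R] (k : ℕ) (hk : 0 < k) (φ : R) (g : ℕ → R) (α : R)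
    (hα : α ^ k = φ) (h : ∑ t ∈ Finset.range k, g t * α ^ t = 0) : (normMat k φ g).det = 0 := by
  rw [← Matrix.exists_mulVec_eq_zero_iff]
  refine ⟨fun j => α ^ (j : ℕ), ?_, ?_⟩
  · intro h0
    have := congrFun h0 ⟨0, hk⟩
    simp at this
  · funext i
    have := normMat_row k φ g α hα i
    rw [h, mul_zero] at this
    exact this

theorem normMat_map {R S : Type*} [CommRing R] [CommRing S] (f : R →+* S) (k : ℕ) (φ : R) (g : ℕ → R) :
    f (normMat k φ g).det = (normMat k (f φ) (fun t => f (g t))).det := by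
  rw [RingHom.map_det]
  congr 1
  ext i j
  simp only [normMat, RingHom.mapMatrix_apply, Matrix.map_apply, Matrix.of_apply]
  split_ifs <;> simp

open Polynomial in
theorem normMat_singular {K : Type*} [Field K] (k : ℕ) (hk : 0 < k) (φ : K) (g : ℕ → K)
    (h : (normMat k φ g).det = 0) :
    ∃ W : K[X], W ≠ 0 ∧ W.natDegree < k ∧
      (X ^ k - C φ) ∣ W * ∑ t ∈ Finset.range k, C (g t) * X ^ t := by
  obtain ⟨w, hw, hw2⟩ := Matrix.exists_vecMul_eq_zero_iff.2 h
  refine ⟨∑ i : Fin k, C (w i) * X ^ (i : ℕ), ?_, ?_, ?_⟩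
  · intro h0
    apply hw
    funext i
    have := congrArg (fun P => P.coeff i) h0
    simp only [finsetSum_coeff, coeff_C_mul, coeff_X_pow, coeff_zero] at this
    rw [Finset.sum_eq_single i] at this
    · simpa using this
    · intro j _ hj
      have : (i : ℕ) ≠ j := fun h => hj (Fin.ext h.symm)
      simp [this]
    · simp
  · have : (∑ i : Fin k, C (w i) * X ^ (i : ℕ)).degree < (k : WithBot ℕ) := by
      refine (degree_sum_le _ _).trans_lt ?_
      rw [Finset.sup_lt_iff (by simp)]
      intro i _
      exact (degree_C_mul_X_pow_le _ _).trans_lt (by exact_mod_cast i.2)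
    by_cases h0 : (∑ i : Fin k, C (w i) * X ^ (i : ℕ)) = 0
    · rw [h0, natDegree_zero]; exact hk
    · exact (natDegree_lt_iff_degree_lt h0).2 this
  · rw [← AdjoinRoot.mk_eq_zero]
    set α := AdjoinRoot.root (X ^ k - C φ) with hα
    have hαk : α ^ k = AdjoinRoot.of (X ^ k - C φ) φ := by
      have := AdjoinRoot.eval₂_root (X ^ k - C φ)
      simp only [eval₂_sub, eval₂_pow, eval₂_X, eval₂_C] at this
      exact sub_eq_zero.1 this
    rw [map_mul, map_sum, map_sum]
    simp only [map_mul, map_pow, AdjoinRoot.mk_C, AdjoinRoot.mk_X]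
    rw [Finset.sum_mul]
    rw [← hα]
    have h2 : ∀ i : Fin k, (AdjoinRoot.of (X ^ k - C φ) (w i) * α ^ (i : ℕ)) *
        (∑ t ∈ Finset.range k, AdjoinRoot.of (X ^ k - C φ) (g t) * α ^ t) =
        ∑ j : Fin k, AdjoinRoot.of (X ^ k - C φ) (w i * normMat k φ g i j) * α ^ (j : ℕ) := by
      intro i
      rw [mul_assoc, ← normMat_row k _ (fun t => AdjoinRoot.of (X ^ k - C φ) (g t)) α hαk i, Finset.mul_sum]
      refine Finset.sum_congr rfl fun j _ => ?_
      rw [map_mul, mul_assoc]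
      congr 2
      simp only [normMat, Matrix.of_apply]
      split_ifs <;> simp
    rw [Finset.sum_congr rfl fun i _ => h2 i, Finset.sum_comm]
    refine Finset.sum_eq_zero fun j _ => ?_
    rw [← Finset.sum_mul, ← map_sum]
    have : ∑ i, w i * normMat k φ g i j = 0 := congrFun hw2 j
    rw [this, map_zero, zero_mul]

abbrev R2 := MvPolynomial (Fin 2) ℚ

noncomputable def phi2 (k : ℕ) (n : ℤ) : R2 :=
  MvPolynomial.X 1 ^ k + MvPolynomial.C (n : ℚ) - MvPolynomial.X 0 ^ k

theorem normMat_degree (k D : ℕ) (hD : k ≤ D) (φ : R2) (hφ : φ.totalDegree ≤ k) (g : ℕ → R2)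
    (hg : ∀ t < k, (g t).totalDegree ≤ D - t) : (normMat k φ g).det.totalDegree ≤ k * D := by
  have hent : ∀ i j : Fin k, (normMat k φ g i j).totalDegree ≤ D + i - j := by
    intro i j
    have hi := i.2
    have hj := j.2
    simp only [normMat, Matrix.of_apply]
    split_ifs with h
    · exact (hg _ (by omega)).trans (by omega)
    · refine (MvPolynomial.totalDegree_mul _ _).trans ?_
      have := hg (k + j - i) (by omega)
      omega
  rw [Matrix.det_apply]
  refine MvPolynomial.totalDegree_finsetSum_le fun σ _ => ?_
  have h1 : (∏ i, normMat k φ g (σ i) i).totalDegree ≤ k * D := by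
    refine (MvPolynomial.totalDegree_finsetProd _ _).trans ?_
    refine (Finset.sum_le_sum fun i _ => hent (σ i) i).trans ?_
    have e1 : ∑ i : Fin k, (D + (σ i : ℕ) - i) + ∑ i : Fin k, (i : ℕ) = ∑ i : Fin k, (D + (σ i : ℕ)) := by
      rw [← Finset.sum_add_distrib]
      refine Finset.sum_congr rfl fun i _ => ?_
      have := i.2; omega
    have e2 : ∑ i : Fin k, (D + (σ i : ℕ)) = k * D + ∑ i : Fin k, (i : ℕ) := by
      rw [Finset.sum_add_distrib, Equiv.sum_comp σ (fun i : Fin k => (i : ℕ))]; simp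
    omega
  rcases Int.units_eq_one_or (Equiv.Perm.sign σ) with h | h
  · rw [h, one_smul]; exact h1
  · rw [h, Units.neg_smul, one_smul, MvPolynomial.totalDegree_neg]; exact h1

theorem phi2_degree (k : ℕ) (n : ℤ) : (phi2 k n).totalDegree ≤ k := by
  unfold phi2
  refine (MvPolynomial.totalDegree_sub _ _).trans (max_le ?_ ?_)
  · refine (MvPolynomial.totalDegree_add _ _).trans (max_le ?_ ?_)
    · rw [MvPolynomial.totalDegree_X_pow]
    · rw [MvPolynomial.totalDegree_C]; omega
  · rw [MvPolynomial.totalDegree_X_pow]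

theorem X_not_dvd : ¬ ((MvPolynomial.X 0 : R2) ∣ MvPolynomial.X 1) := by
  rintro ⟨q, hq⟩
  have := congrArg (MvPolynomial.eval ![0, 1]) hq
  simp at this

theorem phi2_sq (k : ℕ) (hk : 0 < k) (n : ℤ) (π : R2) (hπ : Irreducible π)
    (h : π ^ 2 ∣ phi2 k n) : False := by
  have hprime := hπ.prime
  obtain ⟨q, hq⟩ := h
  have hkq : IsUnit (MvPolynomial.C (k : ℚ) : R2) :=
    (isUnit_iff_ne_zero.2 (by exact_mod_cast hk.ne')).map MvPolynomial.C
  have hd : ∀ i : Fin 2, π ∣ MvPolynomial.pderiv i (phi2 k n) := by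
    intro i
    rw [hq, Derivation.leibniz, Derivation.leibniz_pow]
    simp only [smul_eq_mul]
    refine dvd_add ?_ ?_
    · exact Dvd.dvd.mul_right (dvd_pow_self _ (by norm_num)) _
    · refine Dvd.dvd.mul_left ?_ _
      rw [nsmul_eq_mul]
      refine Dvd.dvd.mul_left ?_ _
      exact Dvd.dvd.mul_right (by simp) _
  have h0 : π ∣ MvPolynomial.X 0 := by
    have := hd 0
    simp only [phi2, map_sub, map_add, Derivation.leibniz_pow, MvPolynomial.pderiv_X_self,
      MvPolynomial.pderiv_C, MvPolynomial.pderiv_X_of_ne (show (1 : Fin 2) ≠ 0 by decide)] at this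
    simp only [nsmul_eq_mul, smul_eq_mul, mul_one, mul_zero, zero_add, zero_sub, dvd_neg] at this
    have e : ((k : ℕ) : R2) = MvPolynomial.C (k : ℚ) := by simp
    rw [e] at this
    exact hprime.dvd_of_dvd_pow (hkq.dvd_mul_left.1 this)
  have h1 : π ∣ MvPolynomial.X 1 := by
    have := hd 1
    simp only [phi2, map_sub, map_add, Derivation.leibniz_pow, MvPolynomial.pderiv_X_self,
      MvPolynomial.pderiv_C, MvPolynomial.pderiv_X_of_ne (show (0 : Fin 2) ≠ 1 by decide)] at this
    simp only [nsmul_eq_mul, smul_eq_mul, mul_one, mul_zero, add_zero, sub_zero] at this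
    have e : ((k : ℕ) : R2) = MvPolynomial.C (k : ℚ) := by simp
    rw [e] at this
    exact hprime.dvd_of_dvd_pow (hkq.dvd_mul_left.1 this)
  have h2 : Irreducible (MvPolynomial.X 0 : R2) := (MvPolynomial.X_prime (R := ℚ) (i := (0 : Fin 2))).irreducible
  have h3 := (hπ.associated_of_dvd h2 h0).symm
  exact X_not_dvd (h3.dvd.trans h1)

open Polynomial in
theorem phi2_irred (k : ℕ) (hk : 0 < k) (n : ℤ) :
    Irreducible ((X : (FractionRing R2)[X]) ^ k - C (algebraMap R2 (FractionRing R2) (phi2 k n))) := by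
  have hφ0 : phi2 k n ≠ 0 := by
    intro h
    exact phi2_sq k hk n _ (MvPolynomial.X_prime (R := ℚ) (i := (0 : Fin 2))).irreducible (by rw [h]; exact dvd_zero _)
  have hφu : ¬ IsUnit (phi2 k n) := by
    intro h
    -- evaluate at a root over ℚ of degree : use totalDegree
    have h1 : ∃ c : ℚ, phi2 k n = MvPolynomial.C c := by
      obtain ⟨c, _, hc⟩ := MvPolynomial.isUnit_iff_eq_C_of_isReduced.1 h
      exact ⟨c, hc⟩
    obtain ⟨c, hc⟩ := h1
    have e1 := congrArg (MvPolynomial.eval ![0, 0]) hc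
    have e2 := congrArg (MvPolynomial.eval ![0, 1]) hc
    simp [phi2, hk.ne'] at e1 e2
    rw [e1] at e2
    linarith
  obtain ⟨π, hπ, hd⟩ := WfDvdMonoid.exists_irreducible_factor hφu hφ0
  have hprime := hπ.prime
  let I : Ideal R2 := Ideal.span {π}
  have hI : I.IsPrime := (Ideal.span_singleton_prime hprime.ne_zero).2 hprime
  have hmon : (X ^ k - C (phi2 k n) : R2[X]).Monic := monic_X_pow_sub_C _ hk.ne'
  have heis : (X ^ k - C (phi2 k n) : R2[X]).IsEisensteinAt I := by
    refine ⟨?_, ?_, ?_⟩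
    · rw [hmon.leadingCoeff]
      intro h; exact hI.ne_top ((Ideal.eq_top_iff_one _).2 h)
    · intro i hi
      rw [natDegree_X_pow_sub_C] at hi
      rw [coeff_sub, coeff_X_pow, if_neg (by omega), coeff_C, zero_sub]
      split_ifs
      · rw [Ideal.neg_mem_iff]; exact Ideal.mem_span_singleton.2 hd
      · simp
    · rw [coeff_sub, coeff_X_pow, if_neg (by omega), coeff_C, if_pos rfl, zero_sub, Ideal.neg_mem_iff]
      intro h
      rw [Ideal.span_singleton_pow, Ideal.mem_span_singleton] at h
      exact phi2_sq k hk n π hπ h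
  have hirr := heis.irreducible hI hmon.isPrimitive (by rw [natDegree_X_pow_sub_C]; exact hk)
  have := (hmon.irreducible_iff_irreducible_map_fraction_map (K := FractionRing R2)).1 hirr
  simpa using this

theorem normMat_ne_zero (k : ℕ) (hk : 0 < k) (n : ℤ) (g : ℕ → R2) (hg : ∃ t < k, g t ≠ 0) :
    (normMat k (phi2 k n) g).det ≠ 0 := by
  intro h
  have h1 := normMat_map (algebraMap R2 (FractionRing R2)) k (phi2 k n) g
  rw [h, map_zero] at h1
  obtain ⟨W, hW, hWd, hdiv⟩ := normMat_singular k hk _ _ h1.symm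
  have hirr := phi2_irred k hk n
  have hdeg : ((Polynomial.X : Polynomial (FractionRing R2)) ^ k -
      Polynomial.C (algebraMap R2 (FractionRing R2) (phi2 k n))).natDegree = k := Polynomial.natDegree_X_pow_sub_C
  rcases hirr.prime.dvd_or_dvd hdiv with h2 | h2
  · have := Polynomial.natDegree_le_of_dvd h2 hW
    omega
  · set P := ∑ t ∈ Finset.range k, Polynomial.C (algebraMap R2 (FractionRing R2) (g t)) * Polynomial.X ^ t with hP
    have hPdeg : P.degree < k := by
      refine (Polynomial.degree_sum_le _ _).trans_lt ?_
      rw [Finset.sup_lt_iff (by simp)]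
      intro i hi
      exact (Polynomial.degree_C_mul_X_pow_le _ _).trans_lt (by exact_mod_cast Finset.mem_range.1 hi)
    have hP0 : P ≠ 0 := by
      obtain ⟨t, ht, hgt⟩ := hg
      intro h0
      have := congrArg (fun Q => Polynomial.coeff Q t) h0
      simp only [hP, Polynomial.finsetSum_coeff, Polynomial.coeff_C_mul, Polynomial.coeff_X_pow,
        Polynomial.coeff_zero] at this
      rw [Finset.sum_eq_single t] at this
      · simp at this; exact hgt this
      · intro j _ hj; simp [hj.symm]
      · intro h; exact absurd (Finset.mem_range.2 ht) h
    have := Polynomial.natDegree_le_of_dvd h2 hP0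
    have h3 := (Polynomial.natDegree_lt_iff_degree_lt hP0).2 hPdeg
    omega

/-- the `t`-th coefficient of the auxiliary polynomial -/
noncomputable def auxCoeff (S : Finset (ℕ × ℕ × ℕ)) (v : ℕ × ℕ × ℕ → ℚ) (t : ℕ) : R2 :=
  ∑ m ∈ S.filter (fun m => m.1 = t), MvPolynomial.C (v m) *
    (MvPolynomial.X 0 ^ m.2.1 * MvPolynomial.X 1 ^ m.2.2)

theorem auxCoeff_monomial (a b : ℕ) (q : ℚ) : (MvPolynomial.C q *
    (MvPolynomial.X 0 ^ a * MvPolynomial.X 1 ^ b) : R2) =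
    MvPolynomial.monomial (Finsupp.single 0 a + Finsupp.single 1 b) q := by
  rw [MvPolynomial.X_pow_eq_monomial, MvPolynomial.X_pow_eq_monomial, MvPolynomial.monomial_mul,
    MvPolynomial.C_mul_monomial]
  simp

theorem fin2_single_inj (a b c d : ℕ) (h : (Finsupp.single 0 a + Finsupp.single 1 b : Fin 2 →₀ ℕ) =
    Finsupp.single 0 c + Finsupp.single 1 d) : a = c ∧ b = d := by
  have h0 := DFunLike.congr_fun h 0
  have h1 := DFunLike.congr_fun h 1
  simp at h0 h1
  exact ⟨h0, h1⟩

theorem auxCoeff_ne_zero (S : Finset (ℕ × ℕ × ℕ)) (v : ℕ × ℕ × ℕ → ℚ) (m : ℕ × ℕ × ℕ) (hm : m ∈ S)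
    (hv : v m ≠ 0) : auxCoeff S v m.1 ≠ 0 := by
  intro h
  have := congrArg (MvPolynomial.coeff (Finsupp.single 0 m.2.1 + Finsupp.single 1 m.2.2)) h
  rw [auxCoeff, MvPolynomial.coeff_sum, MvPolynomial.coeff_zero] at this
  rw [Finset.sum_eq_single m] at this
  · rw [auxCoeff_monomial, MvPolynomial.coeff_monomial, if_pos rfl] at this
    exact hv this
  · intro m' hm' hne
    rw [auxCoeff_monomial, MvPolynomial.coeff_monomial, if_neg]
    intro h2
    obtain ⟨h3, h4⟩ := fin2_single_inj _ _ _ _ h2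
    exact hne (Prod.ext (Finset.mem_filter.1 hm').2 (Prod.ext h3 h4))
  · intro h; exact (h (Finset.mem_filter.2 ⟨hm, rfl⟩)).elim

theorem auxCoeff_degree (S : Finset (ℕ × ℕ × ℕ)) (v : ℕ × ℕ × ℕ → ℚ) (t E : ℕ)
    (h : ∀ m ∈ S, m.1 = t → m.2.1 + m.2.2 ≤ E) : (auxCoeff S v t).totalDegree ≤ E := by
  refine MvPolynomial.totalDegree_finsetSum_le fun m hm => ?_
  rw [Finset.mem_filter] at hm
  refine le_trans ?_ (h m hm.1 hm.2)
  refine (MvPolynomial.totalDegree_mul _ _).trans ?_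
  rw [MvPolynomial.totalDegree_C, zero_add]
  refine (MvPolynomial.totalDegree_mul _ _).trans ?_
  rw [MvPolynomial.totalDegree_X_pow, MvPolynomial.totalDegree_X_pow]

theorem auxCoeff_eval (S : Finset (ℕ × ℕ × ℕ)) (v : ℕ × ℕ × ℕ → ℚ) (k : ℕ) (hS : ∀ m ∈ S, m.1 < k)
    (a b c : ℚ) : ∑ t ∈ Finset.range k, MvPolynomial.eval ![b, c] (auxCoeff S v t) * a ^ t =
    ∑ m ∈ S, v m * (a ^ m.1 * b ^ m.2.1 * c ^ m.2.2) := by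
  rw [← Finset.sum_fiberwise_of_maps_to (s := S) (t := Finset.range k) (g := fun m => m.1)
    (fun m hm => Finset.mem_range.2 (hS m hm))]
  refine Finset.sum_congr rfl fun t _ => ?_
  rw [auxCoeff, map_sum, Finset.sum_mul]
  refine Finset.sum_congr rfl fun m hm => ?_
  rw [← (Finset.mem_filter.1 hm).2]
  simp
  ring

theorem normMat_vanish (k : ℕ) (hk : 0 < k) (n : ℤ) (g : ℕ → R2) (a b c : ℚ)
    (h : a ^ k + b ^ k = c ^ k + n)
    (h0 : ∑ t ∈ Finset.range k, MvPolynomial.eval ![b, c] (g t) * a ^ t = 0) :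
    MvPolynomial.eval ![b, c] (normMat k (phi2 k n) g).det = 0 := by
  rw [normMat_map]
  refine normMat_det_zero k hk _ _ a ?_ h0
  simp [phi2]
  linarith

theorem plane_poly (k D : ℕ) (hk : 0 < k) (hD : k ≤ D) (n : ℤ) (v : ℕ × ℕ × ℕ → ℚ)
    (hv : ∃ m ∈ Mon k D, v m ≠ 0) :
    ∃ G : R2, G ≠ 0 ∧ G.totalDegree ≤ k * D ∧ ∀ a b c : ℚ, a ^ k + b ^ k = c ^ k + n →
      ∑ m ∈ Mon k D, v m * (a ^ m.1 * b ^ m.2.1 * c ^ m.2.2) = 0 →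
      MvPolynomial.eval ![b, c] G = 0 := by
  refine ⟨(normMat k (phi2 k n) (auxCoeff (Mon k D) v)).det, ?_, ?_, ?_⟩
  · obtain ⟨m, hm, hvm⟩ := hv
    exact normMat_ne_zero k hk n _ ⟨m.1, ((mem_Mon _ _ _).1 hm).1, auxCoeff_ne_zero _ v m hm hvm⟩
  · refine normMat_degree k D hD _ (phi2_degree k n) _ fun t _ => auxCoeff_degree _ _ _ _ ?_
    intro m hm hmt
    have := ((mem_Mon _ _ _).1 hm).2
    omega
  · intro a b c h h0
    refine normMat_vanish k hk n _ a b c h ?_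
    rw [auxCoeff_eval _ _ _ fun m hm => ((mem_Mon _ _ _).1 hm).1]
    exact h0

end

section
open MvPolynomial

noncomputable def VD (d : ℕ) : Submodule ℚ R2 := MvPolynomial.restrictTotalDegree (Fin 2) ℚ d

theorem mem_VD (d : ℕ) (p : R2) : p ∈ VD d ↔ p.totalDegree ≤ d :=
  MvPolynomial.mem_restrictTotalDegree _ _ _

instance (d : ℕ) : Module.Finite ℚ (VD d) :=
  inferInstanceAs (Module.Finite ℚ (MvPolynomial.restrictTotalDegree (Fin 2) ℚ d))

theorem tri_card (d : ℕ) :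
    2 * (((Finset.range (d + 1)) ×ˢ (Finset.range (d + 1))).filter fun x => x.1 + x.2 ≤ d).card =
      (d + 1) * (d + 2) := by
  have h1 : (((Finset.range (d + 1)) ×ˢ (Finset.range (d + 1))).filter fun x => x.1 + x.2 ≤ d) =
      (Finset.range (d + 1)).biUnion fun t => Finset.HasAntidiagonal.antidiagonal t := by
    ext ⟨a, b⟩
    simp only [Finset.mem_filter, Finset.mem_product, Finset.mem_range, Finset.mem_biUnion,
      Finset.HasAntidiagonal.mem_antidiagonal]
    constructor
    · rintro ⟨_, h⟩; exact ⟨a + b, by omega, rfl⟩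
    · rintro ⟨t, h1, h2⟩; omega
  rw [h1, Finset.card_biUnion]
  · simp only [Finset.Nat.card_antidiagonal]
    clear h1
    induction d with
    | zero => simp
    | succ e ih => rw [Finset.sum_range_succ, mul_add, ih]; ring
  · intro a _ b _ hab
    rw [Function.onFun, Finset.disjoint_left]
    rintro ⟨x, y⟩ h1 h2
    rw [Finset.HasAntidiagonal.mem_antidiagonal] at h1 h2
    exact hab (h1.symm.trans h2)

theorem finrank_VD (d : ℕ) : 2 * Module.finrank ℚ (VD d) = (d + 1) * (d + 2) := by
  rw [← tri_card d]
  congr 1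
  let s : Set (Fin 2 →₀ ℕ) := {n | (n.sum fun _ e => e) ≤ d}
  have hb : VD d = MvPolynomial.restrictSupport ℚ s := rfl
  have h1 : Module.finrank ℚ (VD d) = Nat.card s := by
    rw [hb]; exact Module.finrank_eq_nat_card_basis (MvPolynomial.basisRestrictSupport ℚ s)
  have hs : ∀ n : Fin 2 →₀ ℕ, (n.sum fun _ e => e) = n 0 + n 1 := by
    intro n
    rw [Finsupp.sum_fintype _ _ (fun _ => rfl), Fin.sum_univ_two]
  rw [h1, ← Fintype.card_coe, ← Nat.card_eq_fintype_card]
  refine Nat.card_congr ?_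
  refine Equiv.ofBijective (fun n => ⟨(n.1 0, n.1 1), ?_⟩) ⟨?_, ?_⟩
  · have h := n.2
    change (n.1.sum fun _ e => e) ≤ d at h
    rw [hs] at h
    simp only [Finset.mem_filter, Finset.mem_product, Finset.mem_range]
    omega
  · intro x y hxy
    simp only [Subtype.mk.injEq, Prod.mk.injEq] at hxy
    apply Subtype.ext
    ext i
    fin_cases i
    · exact hxy.1
    · exact hxy.2
  · rintro ⟨⟨x, y⟩, hxy⟩
    simp only [Finset.mem_filter, Finset.mem_product, Finset.mem_range] at hxy
    refine ⟨⟨Finsupp.equivFunOnFinite.symm ![x, y], ?_⟩, ?_⟩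
    · change (Finsupp.sum _ fun _ e => e) ≤ d
      rw [hs]
      simpa using hxy.2
    · simp

theorem bezout (F G : R2) (S : Finset (Fin 2 → ℚ)) (hF : F ≠ 0) (hG : G ≠ 0)
    (hrel : IsRelPrime F G) (h : ∀ s ∈ S, eval s F = 0 ∧ eval s G = 0) :
    S.card ≤ F.totalDegree * G.totalDegree := by
  set m := F.totalDegree with hm
  set n := G.totalDegree with hn
  set d := m + n + S.card with hd
  have hinj : ∀ P : R2, P ≠ 0 → Function.Injective (LinearMap.mulLeft ℚ P) := by
    intro P hP x y hxy
    exact mul_left_cancel₀ hP hxy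
  let W : R2 → ℕ → Submodule ℚ R2 := fun P j => (VD j).map (LinearMap.mulLeft ℚ P)
  have hrank : ∀ P : R2, P ≠ 0 → ∀ j, 2 * Module.finrank ℚ (W P j) = (j + 1) * (j + 2) := by
    intro P hP j
    rw [← finrank_VD j]
    congr 1
    exact (Submodule.equivMapOfInjective _ (hinj P hP) (VD j)).finrank_eq.symm
  have hWle : ∀ P : R2, ∀ j, P.totalDegree + j ≤ d → W P j ≤ VD d := by
    rintro P j hj x ⟨y, hy, rfl⟩
    rw [SetLike.mem_coe, mem_VD] at hy
    rw [mem_VD]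
    exact (totalDegree_mul _ _).trans (by omega)
  have hinf : W F (d - m) ⊓ W G (d - n) ≤ W (F * G) S.card := by
    rintro x ⟨⟨y, hy, rfl⟩, ⟨z, hz, hyz⟩⟩
    rw [SetLike.mem_coe, mem_VD] at hy hz
    rw [LinearMap.mulLeft_apply, LinearMap.mulLeft_apply] at hyz
    rw [LinearMap.mulLeft_apply]
    have h1 : F ∣ z := by
      refine hrel.dvd_of_dvd_mul_left ⟨y, ?_⟩
      exact hyz
    obtain ⟨w, rfl⟩ := h1
    refine ⟨w, ?_, ?_⟩
    · rw [SetLike.mem_coe, mem_VD]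
      by_cases hw : w = 0
      · simp [hw]
      · rw [totalDegree_mul_of_isDomain hF hw] at hz
        omega
    · rw [LinearMap.mulLeft_apply, ← hyz]; ring
  -- evaluation
  let ev : R2 →ₗ[ℚ] (S → ℚ) := LinearMap.pi fun s => (aeval (R := ℚ) (s : Fin 2 → ℚ)).toLinearMap
  have hev : ∀ P s, ev P s = eval (s : Fin 2 → ℚ) P := by
    intro P s
    simp [ev, coe_aeval_eq_eval]
  let evd := ev.domRestrict (VD d)
  have hsurj : Function.Surjective evd := by
    have key : ∀ s : S, ∃ P ∈ VD d, ∀ t : S, eval (t : Fin 2 → ℚ) P = if t = s then 1 else 0 := by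
      intro s
      have : ∀ t : Fin 2 → ℚ, ∃ i : Fin 2, t ≠ s → t i ≠ (s : Fin 2 → ℚ) i := by
        intro t
        by_cases ht : t = s
        · exact ⟨0, fun h => absurd ht h⟩
        · obtain ⟨i, hi⟩ := Function.ne_iff.mp ht
          exact ⟨i, fun _ => hi⟩
      choose i hi using this
      let P : R2 := ∏ t ∈ S.erase s, (C (((s : Fin 2 → ℚ) (i t) - t (i t))⁻¹) * (X (i t) - C (t (i t))))
      refine ⟨P, ?_, ?_⟩
      · rw [mem_VD]
        refine (totalDegree_finsetProd _ _).trans ?_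
        refine (Finset.sum_le_card_nsmul _ _ 1 ?_).trans ?_
        · intro t _
          refine (totalDegree_mul _ _).trans ?_
          rw [totalDegree_C, zero_add]
          refine (totalDegree_sub _ _).trans ?_
          rw [totalDegree_C, totalDegree_X]; simp
        · have := Finset.card_erase_le (s := S) (a := (s : Fin 2 → ℚ))
          simp only [smul_eq_mul, mul_one]; omega
      · intro t
        by_cases ht : t = s
        · subst ht
          rw [if_pos rfl, eval_prod]
          apply Finset.prod_eq_one
          intro u hu
          rw [Finset.mem_erase] at hu
          simp only [map_mul, eval_C, map_sub, eval_X]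
          exact inv_mul_cancel₀ (sub_ne_zero.mpr fun h => hi u hu.1 h.symm)
        · rw [if_neg ht, eval_prod]
          apply Finset.prod_eq_zero (i := (t : Fin 2 → ℚ))
          · exact Finset.mem_erase.mpr ⟨fun h => ht (Subtype.ext h), t.2⟩
          · simp
    choose P hP1 hP2 using key
    intro g
    refine ⟨⟨∑ s, g s • P s, Submodule.sum_mem _ fun s _ => Submodule.smul_mem _ _ (hP1 s)⟩, ?_⟩
    funext t
    change ev (∑ s, g s • P s) t = g t
    rw [hev]
    simp only [map_sum, smul_eval, hP2]
    simp
  have hker : Module.finrank ℚ (LinearMap.ker evd) + S.card = Module.finrank ℚ (VD d) := by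
    have h1 := LinearMap.finrank_range_add_finrank_ker evd
    rw [LinearMap.range_eq_top.mpr hsurj, finrank_top, Module.finrank_fintype_fun_eq_card, Fintype.card_coe] at h1
    omega
  have hsup : W F (d - m) ⊔ W G (d - n) ≤ (LinearMap.ker evd).map (VD d).subtype := by
    have hh : ∀ P : R2, (∀ s ∈ S, eval s P = 0) → ∀ j, P.totalDegree + j ≤ d →
        W P j ≤ (LinearMap.ker evd).map (VD d).subtype := by
      intro P hP j hj x hx
      refine ⟨⟨x, hWle P j hj hx⟩, ?_, rfl⟩
      rw [SetLike.mem_coe, LinearMap.mem_ker]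
      funext t
      change ev x t = 0
      obtain ⟨y, _, rfl⟩ := hx
      rw [hev, LinearMap.mulLeft_apply, map_mul, hP _ t.2, zero_mul]
    exact sup_le (hh F (fun s hs => (h s hs).1) _ (by omega)) (hh G (fun s hs => (h s hs).2) _ (by omega))
  have hfin : ∀ P j, Module.Finite ℚ (W P j) := fun P j => by
    change Module.Finite ℚ ((VD j).map _)
    infer_instance
  have := hfin F (d - m)
  have := hfin G (d - n)
  have := hfin (F * G) S.card
  have e1 := Submodule.finrank_sup_add_finrank_inf_eq (W F (d - m)) (W G (d - n))
  have e2 := Submodule.finrank_mono hinf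
  have e3 := Submodule.finrank_mono hsup
  have e4 : Module.finrank ℚ ((LinearMap.ker evd).map (VD d).subtype) = Module.finrank ℚ (LinearMap.ker evd) :=
    (Submodule.equivMapOfInjective _ (VD d).injective_subtype _).finrank_eq.symm
  have r1 := hrank F hF (d - m)
  have r2 := hrank G hG (d - n)
  have r3 := hrank (F * G) (mul_ne_zero hF hG) S.card
  have r4 := finrank_VD d
  have q1 : d - m = n + S.card := by omega
  have q2 : d - n = m + S.card := by omega
  rw [q1] at e1 e2 e3 r1
  rw [q2] at e1 e2 e3 r2
  rw [e4] at e3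
  generalize Module.finrank ℚ (W F (n + S.card)) = x1 at *
  generalize Module.finrank ℚ (W G (m + S.card)) = x2 at *
  generalize Module.finrank ℚ (W (F * G) S.card) = x3 at *
  generalize Module.finrank ℚ (LinearMap.ker evd) = x4 at *
  generalize Module.finrank ℚ (VD d) = x5 at *
  have : 2 * S.card + (n + S.card + 1) * (n + S.card + 2) + (m + S.card + 1) * (m + S.card + 2) ≤ (d + 1) * (d + 2) + (S.card + 1) * (S.card + 2) := by
    omega
  rw [hd] at this
  nlinarith [this]

end

section
theorem bertrand_list (M : ℕ) : ∀ N : ℕ, 0 < N → ∃ P : Finset ℕ, P.card = M ∧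
    ∀ p ∈ P, p.Prime ∧ N < p ∧ p ≤ 2 ^ M * N := by
  induction M with
  | zero => intro N _; exact ⟨∅, rfl, by simp⟩
  | succ M ih =>
    intro N hN
    obtain ⟨p, hp, h1, h2⟩ := Nat.exists_prime_lt_and_le_two_mul N hN.ne'
    obtain ⟨P, hc, hP⟩ := ih p hp.pos
    refine ⟨insert p P, ?_, ?_⟩
    · rw [Finset.card_insert_of_notMem, hc]
      intro h
      exact lt_irrefl _ (hP p h).2.1
    · intro r hr
      rcases Finset.mem_insert.1 hr with rfl | hr
      · refine ⟨hp, h1, h2.trans ?_⟩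
        rw [pow_succ]
        have : 1 ≤ 2 ^ M := Nat.one_le_two_pow
        nlinarith
      · obtain ⟨a, b, c⟩ := hP r hr
        refine ⟨a, h1.trans b, c.trans ?_⟩
        rw [pow_succ, mul_assoc]
        exact Nat.mul_le_mul_left _ h2

theorem bad_card (N s : ℕ) (m : ℤ) (hm : m ≠ 0) (hms : m.natAbs ≤ N ^ s) (hN : 0 < N)
    (P : Finset ℕ) (hP : ∀ p ∈ P, p.Prime ∧ N < p ∧ (p : ℤ) ∣ m) : P.card ≤ s := by
  by_contra hc
  push Not at hc
  have h1 : ∏ p ∈ P, p ∣ m.natAbs := by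
    apply Finset.prod_primes_dvd
    · intro p hp; exact (hP p hp).1.prime
    · intro p hp; exact Int.natCast_dvd.mp (hP p hp).2.2
  have h2 := Nat.le_of_dvd (Int.natAbs_pos.mpr hm) h1
  have h3 : (N + 1) ^ P.card ≤ ∏ p ∈ P, p := by
    rw [← Finset.prod_const]
    exact Finset.prod_le_prod' fun p hp => (hP p hp).2.1
  have h4 : N ^ s ≤ N ^ P.card := Nat.pow_le_pow_right hN hc.le
  have h5 : N ^ P.card < (N + 1) ^ P.card := Nat.pow_lt_pow_left (by omega) (by omega)
  omega

theorem good_primes (J s : ℕ) (N : ℕ) (hN : 0 < N) (m : ℤ) (hm : m ≠ 0) (hms : m.natAbs ≤ N ^ s) :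
    ∃ Q : Finset ℕ, Q.card = J ∧ ∀ p ∈ Q, p.Prime ∧ N < p ∧ p ≤ 2 ^ (J + s) * N ∧ ¬ (p : ℤ) ∣ m := by
  obtain ⟨P, hc, hP⟩ := bertrand_list (J + s) N hN
  have h1 := bad_card N s m hm hms hN (P.filter fun p => (p : ℤ) ∣ m) (by
    intro p hp
    rw [Finset.mem_filter] at hp
    exact ⟨(hP p hp.1).1, (hP p hp.1).2.1, hp.2⟩)
  have h2 := Finset.card_filter_add_card_filter_not (s := P) (fun p : ℕ => (p : ℤ) ∣ m)
  obtain ⟨Q, hQ, hQc⟩ := Finset.exists_subset_card_eq (show J ≤ (P.filter fun p : ℕ => ¬ (p : ℤ) ∣ m).card by omega)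
  refine ⟨Q, hQc, fun p hp => ?_⟩
  have := Finset.mem_filter.1 (hQ hp)
  exact ⟨(hP p this.1).1, (hP p this.1).2.1, (hP p this.1).2.2, this.2⟩

theorem mem_Zset (k U : ℕ) (n : ℤ) (z : ℕ × ℕ × ℕ) : z ∈ Zset k U n ↔
    ((1 ≤ z.1 ∧ z.1 ≤ U) ∧ (1 ≤ z.2.1 ∧ z.2.1 ≤ U) ∧ (1 ≤ z.2.2 ∧ z.2.2 ≤ U)) ∧
    (z.1 : ℤ) ^ k + (z.2.1 : ℤ) ^ k = (z.2.2 : ℤ) ^ k + n ∧ z.1 ≠ z.2.2 ∧ z.2.1 ≠ z.2.2 := by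
  simp only [Zset, Finset.mem_filter, Finset.mem_product, Finset.mem_Icc]

theorem Zset_n_le (k U : ℕ) (n : ℤ) (z : ℕ × ℕ × ℕ) (hz : z ∈ Zset k U n) : |n| ≤ 2 * (U : ℤ) ^ k := by
  rw [mem_Zset] at hz
  obtain ⟨⟨⟨_, h1⟩, ⟨_, h2⟩, ⟨_, h3⟩⟩, h, _⟩ := hz
  have e1 : (z.1 : ℤ) ^ k ≤ (U : ℤ) ^ k := pow_le_pow_left₀ (by positivity) (by exact_mod_cast h1) _
  have e2 : (z.2.1 : ℤ) ^ k ≤ (U : ℤ) ^ k := pow_le_pow_left₀ (by positivity) (by exact_mod_cast h2) _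
  have e3 : (z.2.2 : ℤ) ^ k ≤ (U : ℤ) ^ k := pow_le_pow_left₀ (by positivity) (by exact_mod_cast h3) _
  have e4 : (0 : ℤ) ≤ (z.1 : ℤ) ^ k := by positivity
  have e5 : (0 : ℤ) ≤ (z.2.1 : ℤ) ^ k := by positivity
  have e6 : (0 : ℤ) ≤ (z.2.2 : ℤ) ^ k := by positivity
  rw [abs_le]
  constructor <;> linarith

theorem Zset_inj (k U : ℕ) (hk : 0 < k) (n : ℤ) (z w : ℕ × ℕ × ℕ) (hz : z ∈ Zset k U n)
    (hw : w ∈ Zset k U n) (h : z.2 = w.2) : z = w := by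
  rw [mem_Zset] at hz hw
  have e : (z.1 : ℤ) ^ k = (w.1 : ℤ) ^ k := by
    have := hz.2.1
    have := hw.2.1
    rw [h] at *
    linarith
  have hpow : z.1 ^ k = w.1 ^ k := by exact_mod_cast e
  have hfst : z.1 = w.1 := Nat.pow_left_injective (Nat.pos_iff_ne_zero.1 hk) hpow
  exact Prod.ext hfst h

/-- residue triple -/
def red (p : ℕ) (z : ℕ × ℕ × ℕ) : ℕ × ℕ × ℕ := (z.1 % p, z.2.1 % p, z.2.2 % p)

def cls (p : ℕ → ℕ) (t : ℕ) (z : ℕ × ℕ × ℕ) : ℕ → ℕ × ℕ × ℕ :=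
  fun i => if i < t then red (p i) z else 0

def truncCls (t : ℕ) (κ : ℕ → ℕ × ℕ × ℕ) : ℕ → ℕ × ℕ × ℕ := fun i => if i < t then κ i else 0

theorem trunc_cls (p : ℕ → ℕ) (t : ℕ) (z : ℕ × ℕ × ℕ) : truncCls t (cls p (t + 1) z) = cls p t z := by
  funext i
  simp only [truncCls, cls]
  split_ifs <;> first | rfl | omega

theorem red_image_card (p k U : ℕ) (hp : p.Prime) (hk : 0 < k) (n : ℤ) :
    (((Zset k U n).image (red p)).card : ℝ) ≤ (1 + 2 * (k : ℝ) ^ 2) * (p : ℝ) ^ 2 := by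
  haveI : Fact p.Prime := ⟨hp⟩
  have h := modp_count p k hk (n : ZMod p)
  have h1 : ((Zset k U n).image (red p)).card ≤
      Fintype.card {x : ZMod p × ZMod p × ZMod p // x.1 ^ k + x.2.1 ^ k = x.2.2 ^ k + (n : ZMod p)} := by
    rw [Fintype.card_subtype]
    apply Finset.card_le_card_of_injOn (fun z => ((z.1 : ZMod p), (z.2.1 : ZMod p), (z.2.2 : ZMod p)))
    · intro z hz
      rw [Finset.mem_coe, Finset.mem_image] at hz
      obtain ⟨w, hw, rfl⟩ := hz
      rw [mem_Zset] at hw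
      simp only [red, Finset.coe_filter, Finset.mem_univ, true_and, Set.mem_ofPred_eq, ZMod.natCast_mod]
      have := congrArg (Int.cast : ℤ → ZMod p) hw.2.1
      push_cast at this
      exact this
    · intro z hz w hw hzw
      rw [Finset.mem_coe, Finset.mem_image] at hz hw
      obtain ⟨z, hz, rfl⟩ := hz
      obtain ⟨w, hw, rfl⟩ := hw
      simp only [red, Prod.mk.injEq, ZMod.natCast_mod, ZMod.natCast_eq_natCast_iff'] at hzw ⊢
      exact hzw
  have h2 : (((Zset k U n).image (red p)).card : ℝ) ≤ _ := Nat.cast_le.mpr h1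
  refine h2.trans (h.trans ?_)
  have hp1 : (1 : ℝ) ≤ p := by exact_mod_cast hp.one_lt.le
  have : Real.sqrt p ≤ p := by
    rw [Real.sqrt_le_left (by linarith)]
    nlinarith
  have h3 : 2 * (k : ℝ) ^ 2 * p * Real.sqrt p ≤ 2 * (k : ℝ) ^ 2 * p * p := by gcongr
  linarith only [h3]

theorem cls_image_card (p : ℕ → ℕ) (k U : ℕ) (hk : 0 < k) (n : ℤ) (J : ℕ) (hp : ∀ i < J, (p i).Prime) :
    ∀ t ≤ J, (((Zset k U n).image (cls p t)).card : ℝ) ≤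
      (1 + 2 * (k : ℝ) ^ 2) ^ t * (∏ i ∈ Finset.range t, (p i : ℝ)) ^ 2 := by
  intro t
  induction t with
  | zero =>
    intro _
    have : (Zset k U n).image (cls p 0) ⊆ {fun _ => 0} := by
      intro x hx
      rw [Finset.mem_image] at hx
      obtain ⟨z, _, rfl⟩ := hx
      rw [Finset.mem_singleton]
      funext i
      simp [cls]
    have := Finset.card_le_card this
    simp only [Finset.card_singleton] at this
    simp only [pow_zero, Finset.range_zero, Finset.prod_empty, one_pow, mul_one]
    exact_mod_cast this
  | succ t ih =>
    intro ht
    have ih := ih (by omega)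
    have h1 : (Zset k U n).image (cls p (t + 1)) ⊆
        (((Zset k U n).image (cls p t)) ×ˢ ((Zset k U n).image (red (p t)))).image
          (fun x i => if i = t then x.2 else x.1 i) := by
      intro x hx
      rw [Finset.mem_image] at hx
      obtain ⟨z, hz, rfl⟩ := hx
      rw [Finset.mem_image]
      refine ⟨(cls p t z, red (p t) z), ?_, ?_⟩
      · rw [Finset.mem_product]
        exact ⟨Finset.mem_image_of_mem _ hz, Finset.mem_image_of_mem _ hz⟩
      · funext i
        simp only [cls]
        rcases lt_trichotomy i t with h | h | h
        · rw [if_neg h.ne, if_pos h, if_pos (by omega)]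
        · subst h; simp
        · rw [if_neg h.ne', if_neg (by omega), if_neg (by omega)]
    have h2 := (Finset.card_le_card h1).trans Finset.card_image_le
    rw [Finset.card_product] at h2
    have h3 : (((Zset k U n).image (cls p (t + 1))).card : ℝ) ≤
        ((Zset k U n).image (cls p t)).card * ((Zset k U n).image (red (p t))).card := by
      rw [← Nat.cast_mul, Nat.cast_le]; exact h2
    refine h3.trans ((mul_le_mul ih (red_image_card (p t) k U (hp t (by omega)) hk n) (by positivity) (by positivity)).trans (le_of_eq ?_))
    rw [Finset.prod_range_succ, pow_succ]
    ring

end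

section
open MvPolynomial

theorem totalDegree_multiset_prod' (s : Multiset R2) (hs : ∀ x ∈ s, x ≠ 0) :
    s.prod.totalDegree = (s.map totalDegree).sum := by
  induction s using Multiset.induction_on with
  | empty => simp
  | cons a s ih =>
    rw [Multiset.prod_cons, Multiset.map_cons, Multiset.sum_cons,
      totalDegree_mul_of_isDomain (hs a (Multiset.mem_cons_self _ _)), ih fun x hx => hs x (Multiset.mem_cons_of_mem hx)]
    apply Multiset.prod_ne_zero
    intro h
    exact hs 0 (Multiset.mem_cons_of_mem h) rfl

theorem totalDegree_unit (u : R2ˣ) : (u : R2).totalDegree = 0 := by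
  have h : (u : R2) * (u⁻¹ : R2ˣ) = 1 := by simp
  have := totalDegree_mul_of_isDomain (u.ne_zero) ((u⁻¹).ne_zero)
  rw [h, totalDegree_one] at this
  omega

theorem totalDegree_assoc {F G : R2} (h : Associated F G) (hF : F ≠ 0) : G.totalDegree = F.totalDegree := by
  obtain ⟨u, rfl⟩ := h
  rw [totalDegree_mul_of_isDomain hF u.ne_zero, totalDegree_unit, add_zero]

theorem irr_totalDegree_pos (r : R2) (hr : Irreducible r) : 0 < r.totalDegree := by
  by_contra h
  have h0 : r.totalDegree = 0 := by omega
  rw [totalDegree_eq_zero_iff_eq_C] at h0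
  rw [h0] at hr
  apply hr.not_isUnit
  refine (Ne.isUnit ?_).map C
  intro hc
  rw [hc, C_0] at hr
  exact hr.ne_zero rfl

theorem sum_deg_factors (G : R2) (hG : G ≠ 0) :
    ((UniqueFactorizationMonoid.factors G).map totalDegree).sum = G.totalDegree := by
  rw [← totalDegree_multiset_prod']
  · exact (totalDegree_assoc (UniqueFactorizationMonoid.factors_prod hG)
      (Multiset.prod_ne_zero fun h => (UniqueFactorizationMonoid.irreducible_of_factor 0 h).ne_zero rfl)).symm
  · intro x hx
    exact (UniqueFactorizationMonoid.irreducible_of_factor x hx).ne_zero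

theorem sum_deg_factors_toFinset (G : R2) (hG : G ≠ 0) :
    ∑ r ∈ (UniqueFactorizationMonoid.factors G).toFinset, r.totalDegree ≤ G.totalDegree := by
  rw [← sum_deg_factors G hG, Finset.sum_multiset_map_count]
  apply Finset.sum_le_sum
  intro r hr
  rw [smul_eq_mul]
  apply Nat.le_mul_of_pos_left
  exact Multiset.count_pos.mpr (Multiset.mem_toFinset.1 hr)

theorem card_factors_toFinset (G : R2) (hG : G ≠ 0) :
    (UniqueFactorizationMonoid.factors G).toFinset.card ≤ G.totalDegree := by
  refine le_trans ?_ (sum_deg_factors_toFinset G hG)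
  rw [Finset.card_eq_sum_ones]
  apply Finset.sum_le_sum
  intro r hr
  exact irr_totalDegree_pos r (UniqueFactorizationMonoid.irreducible_of_factor r (Multiset.mem_toFinset.1 hr))

theorem exists_factor_zero (G : R2) (hG : G ≠ 0) (s : Fin 2 → ℚ) (h : eval s G = 0) :
    ∃ r ∈ (UniqueFactorizationMonoid.factors G).toFinset, eval s r = 0 := by
  obtain ⟨u, hu⟩ := UniqueFactorizationMonoid.factors_prod hG
  rw [← hu, map_mul, mul_eq_zero] at h
  rcases h with h | h
  · rw [map_multiset_prod, Multiset.prod_eq_zero_iff, Multiset.mem_map] at h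
    obtain ⟨r, hr, h⟩ := h
    exact ⟨r, Multiset.mem_toFinset.2 hr, h⟩
  · exact absurd h ((u.isUnit.map (eval s)).ne_zero)

theorem bezout_irr (r F : R2) (S : Finset (Fin 2 → ℚ)) (hr : Irreducible r) (hF : F ≠ 0)
    (hrF : ¬ r ∣ F) (h : ∀ s ∈ S, eval s r = 0 ∧ eval s F = 0) :
    S.card ≤ r.totalDegree * F.totalDegree :=
  bezout r F S hr.ne_zero hF ((Irreducible.isRelPrime_iff_not_dvd hr).2 hrF) h

theorem factor_points (G F : R2) (hG : G ≠ 0) (hF : F ≠ 0) (S : Finset (Fin 2 → ℚ))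
    (h : ∀ s ∈ S, ∃ r, Irreducible r ∧ r ∣ G ∧ ¬ r ∣ F ∧ eval s r = 0 ∧ eval s F = 0) :
    S.card ≤ G.totalDegree * F.totalDegree := by
  set Φ := (UniqueFactorizationMonoid.factors G).toFinset with hΦ
  have h1 : S ⊆ (Φ.filter fun r => ¬ r ∣ F).biUnion fun r => S.filter fun s => eval s r = 0 ∧ eval s F = 0 := by
    intro s hs
    obtain ⟨r, hr, h1, h2, h3, h4⟩ := h s hs
    obtain ⟨q, hq, hqr⟩ := UniqueFactorizationMonoid.exists_mem_factors_of_dvd hG hr h1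
    rw [Finset.mem_biUnion]
    refine ⟨q, ?_, ?_⟩
    · rw [Finset.mem_filter, hΦ, Multiset.mem_toFinset]
      exact ⟨hq, fun hh => h2 (hqr.dvd.trans hh)⟩
    · rw [Finset.mem_filter]
      refine ⟨hs, ?_, h4⟩
      obtain ⟨u, rfl⟩ := hqr
      rw [map_mul, h3, zero_mul]
  refine (Finset.card_le_card h1).trans (Finset.card_biUnion_le.trans ?_)
  calc _ ≤ ∑ r ∈ Φ.filter (fun r => ¬ r ∣ F), r.totalDegree * F.totalDegree := by
        apply Finset.sum_le_sum
        intro r hr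
        rw [Finset.mem_filter, hΦ, Multiset.mem_toFinset] at hr
        apply bezout_irr r F _ (UniqueFactorizationMonoid.irreducible_of_factor r hr.1) hF hr.2
        intro s hs
        exact (Finset.mem_filter.1 hs).2
    _ ≤ ∑ r ∈ Φ, r.totalDegree * F.totalDegree :=
        Finset.sum_le_sum_of_subset (Finset.filter_subset _ _)
    _ = (∑ r ∈ Φ, r.totalDegree) * F.totalDegree := by rw [Finset.sum_mul]
    _ ≤ _ := Nat.mul_le_mul_right _ (sum_deg_factors_toFinset G hG)

end

section
open MvPolynomial

def pt (z : ℕ × ℕ × ℕ) : Fin 2 → ℚ := ![(z.2.1 : ℚ), (z.2.2 : ℚ)]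

theorem pt_inj (k U : ℕ) (hk : 0 < k) (n : ℤ) : Set.InjOn pt (Zset k U n : Set (ℕ × ℕ × ℕ)) := by
  intro z hz w hw h
  have h0 := congrFun h 0
  have h1 := congrFun h 1
  simp only [pt, Matrix.cons_val_zero, Matrix.cons_val_one, Nat.cast_inj] at h0 h1
  exact Zset_inj k U hk n z w hz hw (Prod.ext h0 h1)

def CurveBound : Prop := ∀ k : ℕ, 5 ≤ k → ∀ ε : ℝ, 0 < ε → ∀ e : ℕ, ∃ C : ℝ, 0 < C ∧
  ∀ U : ℕ, 0 < U → ∀ n : ℤ, n ≠ 0 → ∀ r : R2, Irreducible r → r.totalDegree ≤ e →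
    (((Zset k U n).filter fun z => eval (pt z) r = 0).card : ℝ) ≤ C * (U : ℝ) ^ (1 / Real.sqrt k + ε)

theorem chain_comb (k U : ℕ) (hk : 0 < k) (n : ℤ) (J : ℕ) (p D : ℕ → ℕ) (G : ℕ → (ℕ → ℕ × ℕ × ℕ) → R2)
    (hG0 : ∀ t ≤ J, ∀ κ, G t κ ≠ 0) (hGd : ∀ t ≤ J, ∀ κ, (G t κ).totalDegree ≤ k * D t)
    (hGv : ∀ t ≤ J, ∀ z ∈ Zset k U n, eval (pt z) (G t (cls p t z)) = 0)
    (M : ℝ) (hM0 : 0 ≤ M) (hM : ∀ r : R2, Irreducible r → r.totalDegree ≤ k * D J →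
      (((Zset k U n).filter fun z => eval (pt z) r = 0).card : ℝ) ≤ M) :
    ((Zset k U n).card : ℝ) ≤ (k * D 0 : ℕ) * M +
      ∑ t ∈ Finset.range J, (((Zset k U n).image (cls p (t + 1))).card : ℝ) * ((k * D t) * (k * D (t + 1)) : ℕ) := by
  set Z := Zset k U n with hZ
  set G0 := G 0 (fun _ => 0) with hG00
  have hc0 : ∀ z, cls p 0 z = fun _ => 0 := by intro z; funext i; simp [cls]
  set Φ := (UniqueFactorizationMonoid.factors G0).toFinset with hΦ
  set A := (Φ.filter fun r => r.totalDegree ≤ k * D J).biUnion fun r => Z.filter fun z => eval (pt z) r = 0 with hA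
  let Bs : ℕ → (ℕ → ℕ × ℕ × ℕ) → Finset (ℕ × ℕ × ℕ) := fun t κ => Z.filter fun z =>
    ∃ r, Irreducible r ∧ r ∣ G t (truncCls t κ) ∧ ¬ r ∣ G (t + 1) κ ∧ eval (pt z) r = 0 ∧ eval (pt z) (G (t + 1) κ) = 0
  set B := (Finset.range J).biUnion fun t => (Z.image (cls p (t + 1))).biUnion fun κ => Bs t κ with hB
  have hcov : Z ⊆ A ∪ B := by
    intro z hz
    have h1 := hGv 0 (by omega) z hz
    rw [hc0] at h1
    obtain ⟨r, hr, hrz⟩ := exists_factor_zero G0 (hG0 0 (by omega) _) _ h1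
    have hrr := Multiset.mem_toFinset.1 hr
    have hirr := UniqueFactorizationMonoid.irreducible_of_factor r hrr
    rw [Finset.mem_union]
    by_cases hd : r.totalDegree ≤ k * D J
    · left
      rw [hA, Finset.mem_biUnion]
      exact ⟨r, Finset.mem_filter.2 ⟨hr, hd⟩, Finset.mem_filter.2 ⟨hz, hrz⟩⟩
    · right
      have hJ : ¬ r ∣ G J (cls p J z) := by
        intro h
        have := totalDegree_le_of_dvd_of_isDomain h (hG0 J le_rfl _)
        have := hGd J le_rfl (cls p J z)
        omega
      have h0 : r ∣ G 0 (cls p 0 z) := by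
        rw [hc0]; exact UniqueFactorizationMonoid.dvd_of_mem_factors hrr
      obtain ⟨t, htJ, ht1, ht2⟩ : ∃ t < J, r ∣ G t (cls p t z) ∧ ¬ r ∣ G (t + 1) (cls p (t + 1) z) := by
        by_contra hcon
        push Not at hcon
        have : ∀ t ≤ J, r ∣ G t (cls p t z) := by
          intro t
          induction t with
          | zero => intro _; exact h0
          | succ t ih => intro h; exact hcon t (by omega) (ih (by omega))
        exact hJ (this J le_rfl)
      rw [hB, Finset.mem_biUnion]
      refine ⟨t, Finset.mem_range.2 htJ, ?_⟩
      rw [Finset.mem_biUnion]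
      refine ⟨cls p (t + 1) z, Finset.mem_image_of_mem _ hz, ?_⟩
      rw [Finset.mem_filter]
      refine ⟨hz, r, hirr, ?_, ht2, hrz, hGv (t + 1) (by omega) z hz⟩
      rw [trunc_cls]; exact ht1
  have h1 : (Z.card : ℝ) ≤ A.card + B.card := by
    rw [← Nat.cast_add, Nat.cast_le]
    exact (Finset.card_le_card hcov).trans (Finset.card_union_le _ _)
  have h2 : (A.card : ℝ) ≤ (k * D 0 : ℕ) * M := by
    have a1 : (A.card : ℝ) ≤ ∑ r ∈ Φ.filter (fun r => r.totalDegree ≤ k * D J), ((Z.filter fun z => eval (pt z) r = 0).card : ℝ) := by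
      rw [← Nat.cast_sum, Nat.cast_le]; exact Finset.card_biUnion_le
    refine a1.trans ((Finset.sum_le_sum (g := fun _ => M) ?_).trans ?_)
    · intro r hr
      rw [Finset.mem_filter] at hr
      exact hM r (UniqueFactorizationMonoid.irreducible_of_factor r (Multiset.mem_toFinset.1 hr.1)) hr.2
    · rw [Finset.sum_const, nsmul_eq_mul]
      refine mul_le_mul_of_nonneg_right ?_ hM0
      rw [Nat.cast_le]
      exact (Finset.card_filter_le _ _).trans ((card_factors_toFinset G0 (hG0 0 (by omega) _)).trans (hGd 0 (by omega) _))
  have h3 : (B.card : ℝ) ≤ ∑ t ∈ Finset.range J, ((Z.image (cls p (t + 1))).card : ℝ) * ((k * D t) * (k * D (t + 1)) : ℕ) := by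
    have a1 : (B.card : ℝ) ≤ ∑ t ∈ Finset.range J, (((Z.image (cls p (t + 1))).biUnion fun κ => Bs t κ).card : ℝ) := by
      rw [← Nat.cast_sum, Nat.cast_le]; exact Finset.card_biUnion_le
    refine a1.trans (Finset.sum_le_sum fun t ht => ?_)
    rw [Finset.mem_range] at ht
    rw [← Nat.cast_mul, Nat.cast_le]
    refine Finset.card_biUnion_le.trans ((Finset.sum_le_card_nsmul _ _ ((k * D t) * (k * D (t + 1))) ?_).trans (le_of_eq ?_))
    · intro κ _
      have b1 : (Bs t κ).card = ((Bs t κ).image pt).card := by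
        rw [Finset.card_image_of_injOn]
        exact (pt_inj k U hk n).mono (by intro z hz; exact Finset.mem_coe.2 (Finset.mem_filter.1 (Finset.mem_coe.1 hz)).1)
      rw [b1]
      refine (factor_points (G t (truncCls t κ)) (G (t + 1) κ) (hG0 t (by omega) _) (hG0 (t + 1) (by omega) _) _ ?_).trans
        (Nat.mul_le_mul (hGd t (by omega) _) (hGd (t + 1) (by omega) _))
      intro s hs
      rw [Finset.mem_image] at hs
      obtain ⟨z, hz, rfl⟩ := hs
      exact (Finset.mem_filter.1 hz).2
    · rw [smul_eq_mul]
  linarith only [h1, h2, h3]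

end

section
open MvPolynomial

theorem class_poly (k : ℕ) (hk : 5 ≤ k) (ε : ℝ) (hε : 0 < ε) (hε1 : ε ≤ 1) (J : ℕ) :
    ∃ D0 : ℕ, ∃ C0 : ℝ, 0 < C0 ∧ ∀ U : ℕ, 0 < U → ∀ n : ℤ, n ≠ 0 → |n| ≤ 2 * (U : ℤ) ^ k →
    ∀ p : ℕ → ℕ, (∀ i < J, ∀ j < J, p i = p j → i = j) →
    (∀ i < J, (p i).Prime ∧ ¬ p i ∣ k ∧ ¬ (p i : ℤ) ∣ n) →
    ∀ t ≤ J, ∀ D : ℕ, D0 ≤ D → C0 * (U : ℝ) ^ (1 / Real.sqrt k + ε) ≤ D * ∏ i ∈ Finset.range t, (p i : ℝ) →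
    ∀ κ, ∃ G : R2, G ≠ 0 ∧ G.totalDegree ≤ k * D ∧ ∀ z ∈ Zset k U n, cls p t z = κ → eval (pt z) G = 0 := by
  obtain ⟨D0, C0, hC0, hA⟩ := lemmaA k hk ε hε hε1 J
  refine ⟨D0 + k, C0, hC0, fun U hU n hn hnU p hinj hp t ht D hD hCD κ => ?_⟩
  have hinj' : Set.InjOn p (Finset.range t : Set ℕ) := by
    intro i hi j hj h
    simp only [Finset.coe_range, Set.mem_Iio] at hi hj
    exact hinj i (by omega) j (by omega) h
  obtain ⟨v, hv, hvz⟩ := hA U hU n hn (by exact_mod_cast hnU) ((Finset.range t).image p)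
    (by
      intro q hq
      rw [Finset.mem_image] at hq
      obtain ⟨i, hi, rfl⟩ := hq
      exact hp i (by rw [Finset.mem_range] at hi; omega))
    (Finset.card_image_le.trans (by simpa using ht)) D (by omega)
    (by rwa [Finset.prod_image hinj']) {z | z ∈ Zset k U n ∧ cls p t z = κ}
    (by
      rintro z ⟨hz, _⟩
      rw [mem_Zset] at hz
      exact hz.2.1)
    (by
      rintro z ⟨hz, _⟩
      rw [mem_Zset] at hz
      exact ⟨hz.1.1.2, hz.1.2.1.2, hz.1.2.2.2⟩)
    (by
      rintro q hq z ⟨hz, hzκ⟩ w ⟨hw, hwκ⟩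
      rw [Finset.mem_image] at hq
      obtain ⟨i, hi, rfl⟩ := hq
      have := congrFun (hzκ.trans hwκ.symm) i
      rw [Finset.mem_range] at hi
      simp only [cls, if_pos hi, red, Prod.mk.injEq] at this
      exact this)
  obtain ⟨G, h1, h2, h3⟩ := plane_poly k D (by omega) (by omega) n v hv
  refine ⟨G, h1, h2, fun z hz hzκ => ?_⟩
  refine h3 (z.1 : ℚ) (z.2.1 : ℚ) (z.2.2 : ℚ) ?_ (hvz z ⟨hz, hzκ⟩)
  rw [mem_Zset] at hz
  exact_mod_cast hz.2.1

set_option maxHeartbeats 1000000 in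
theorem core_of_curve (hcurve : CurveBound) : CoreBound := by
  intro k hk ε hε
  set ε1 := min ε 1 with hε1
  have hε1p : 0 < ε1 := lt_min hε one_pos
  have hε1a : ε1 ≤ ε := min_le_left _ _
  have hε1b : ε1 ≤ 1 := min_le_right _ _
  set ε' := ε1 / 4 with hε'
  set η := ε1 / 8 with hη
  have hηp : 0 < η := by positivity
  set θ := 1 / Real.sqrt k + ε' with hθ
  have hθp : 0 < θ := by positivity
  set J := ⌈θ / η⌉₊ with hJ
  have hJ1 : θ ≤ η * J := by
    have := Nat.le_ceil (θ / η)
    rw [div_le_iff₀ hηp] at this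
    linarith only [this]
  have hJ2 : η * J ≤ θ + η := by
    have := Nat.ceil_lt_add_one (show 0 ≤ θ / η by positivity)
    have h2 : η * (J : ℝ) ≤ η * (θ / η + 1) := by gcongr
    rw [mul_add, mul_div_cancel₀ _ hηp.ne', mul_one] at h2
    exact h2
  obtain ⟨s, hs⟩ := exists_nat_ge ((k : ℝ) / η)
  rw [div_le_iff₀ hηp] at hs
  have hk0 : (0 : ℝ) < k := by exact_mod_cast (show 0 < k by omega)
  have hk1 : (1 : ℝ) ≤ k := by exact_mod_cast (show 1 ≤ k by omega)
  have hspos : 1 ≤ s := by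
    by_contra h
    have : s = 0 := by omega
    rw [this] at hs
    simp at hs
    linarith
  obtain ⟨D0, C0, hC0, hA⟩ := class_poly k hk ε' (by positivity) (by rw [hε']; linarith) J
  set E : ℝ := D0 + k + 1 + C0 with hE
  have hEp : 1 ≤ E := by
    have : (0 : ℝ) ≤ D0 := by positivity
    linarith
  set e := k * ⌈2 * E⌉₊ with he
  obtain ⟨Cc, hCc, hcv⟩ := hcurve k hk ε' (by positivity) e
  set L : ℝ := 2 ^ (J + s) * (3 * k) with hL
  have hL1 : 1 ≤ L := by
    have : (1 : ℝ) ≤ 2 ^ (J + s) := one_le_pow₀ (by norm_num)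
    nlinarith
  set c : ℝ := 1 + 2 * (k : ℝ) ^ 2 with hc
  have hc1 : 1 ≤ c := by rw [hc]; have : (0 : ℝ) ≤ (k : ℝ) ^ 2 := by positivity
                         linarith
  refine ⟨k * (2 * E) * Cc + J * (c ^ J * (k ^ 2 * (E ^ 2 * (L * (L ^ J + 1) ^ 2)))), by positivity, fun U hU n hn => ?_⟩
  have hU1 : (1 : ℝ) ≤ U := by exact_mod_cast hU
  have hU0 : (0 : ℝ) < U := by linarith
  by_cases hemp : Zset k U n = ∅
  · rw [hemp]; simp only [Finset.card_empty, Nat.cast_zero]; positivity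
  obtain ⟨z0, hz0⟩ := Finset.nonempty_iff_ne_empty.mpr hemp
  have hnU := Zset_n_le k U n z0 hz0
  set x := (U : ℝ) ^ θ with hx
  set y := (U : ℝ) ^ η with hy
  have hx1 : 1 ≤ x := Real.one_le_rpow hU1 hθp.le
  have hy1 : 1 ≤ y := Real.one_le_rpow hU1 hηp.le
  have hx0 : 0 < x := by linarith
  have hy0 : 0 < y := by linarith
  have hyJ : y ^ J ≤ x * y := by
    rw [hx, hy, ← Real.rpow_natCast, ← Real.rpow_mul hU0.le, ← Real.rpow_add hU0]
    exact Real.rpow_le_rpow_of_exponent_le hU1 hJ2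
  have hyJ' : x ≤ y ^ J := by
    rw [hx, hy, ← Real.rpow_natCast, ← Real.rpow_mul hU0.le]
    exact Real.rpow_le_rpow_of_exponent_le hU1 hJ1
  set N := ⌈2 * k * y⌉₊ with hN
  have hN1 : 2 * k * y ≤ N := Nat.le_ceil _
  have hN2 : (N : ℝ) ≤ 3 * k * y := by
    have := Nat.ceil_lt_add_one (show 0 ≤ 2 * k * y by positivity)
    have : 1 ≤ k * y := by nlinarith
    linarith
  have hNpos : 0 < N := by
    have : (0 : ℝ) < N := lt_of_lt_of_le (by positivity) hN1
    exact_mod_cast this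
  have hms : (n * k).natAbs ≤ N ^ s := by
    have h1 : (((n * k).natAbs : ℕ) : ℝ) = |(n : ℝ)| * k := by
      rw [Nat.cast_natAbs, abs_mul]; push_cast
      simp
    have h2 : |(n : ℝ)| ≤ 2 * (U : ℝ) ^ k := by exact_mod_cast hnU
    have h3 : (U : ℝ) ^ k ≤ y ^ s := by
      rw [hy, ← Real.rpow_natCast, ← Real.rpow_natCast, ← Real.rpow_mul hU0.le]
      apply Real.rpow_le_rpow_of_exponent_le hU1
      linarith only [hs]
    have h4 : (2 * k * y) ^ s ≤ (N : ℝ) ^ s := by gcongr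
    have h5 : (2 * (k : ℝ)) ≤ (2 * k) ^ s := le_self_pow₀ (by linarith) (by omega)
    have : (((n * k).natAbs : ℕ) : ℝ) ≤ ((N ^ s : ℕ) : ℝ) := by
      rw [h1, Nat.cast_pow]
      calc |(n : ℝ)| * k ≤ (2 * (U : ℝ) ^ k) * k := by gcongr
        _ = (2 * k) * (U : ℝ) ^ k := by ring
        _ ≤ (2 * k) ^ s * y ^ s := by gcongr
        _ = (2 * k * y) ^ s := by rw [mul_pow (2 * (k : ℝ))]
        _ ≤ _ := h4
    rwa [Nat.cast_le] at this
  obtain ⟨Q, hQc, hQ⟩ := good_primes J s N hNpos (n * k) (mul_ne_zero hn (by exact_mod_cast (show k ≠ 0 by omega))) hms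
  let p : ℕ → ℕ := fun i => if h : i < J then Q.orderEmbOfFin hQc ⟨i, h⟩ else 2
  have hpQ : ∀ i < J, p i ∈ Q := by
    intro i hi
    simp only [p, dif_pos hi]
    exact Finset.orderEmbOfFin_mem _ _ _
  have hpinj : ∀ i < J, ∀ j < J, p i = p j → i = j := by
    intro i hi j hj h
    simp only [p, dif_pos hi, dif_pos hj] at h
    have := (Q.orderEmbOfFin hQc).injective h
    simpa using this
  have hpr : ∀ i < J, (p i).Prime ∧ ¬ p i ∣ k ∧ ¬ (p i : ℤ) ∣ n := by
    intro i hi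
    obtain ⟨h1, h2, h3, h4⟩ := hQ _ (hpQ i hi)
    refine ⟨h1, fun h => h4 ?_, fun h => h4 (h.mul_right _)⟩
    exact (Int.natCast_dvd_natCast.mpr h).mul_left _
  have hply : ∀ i < J, y ≤ p i := by
    intro i hi
    obtain ⟨h1, h2, h3, h4⟩ := hQ _ (hpQ i hi)
    have : (N : ℝ) ≤ p i := by exact_mod_cast h2.le
    nlinarith
  have hpLy : ∀ i < J, (p i : ℝ) ≤ L * y := by
    intro i hi
    obtain ⟨h1, h2, h3, h4⟩ := hQ _ (hpQ i hi)
    have h5 : (p i : ℝ) ≤ 2 ^ (J + s) * N := by exact_mod_cast h3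
    calc (p i : ℝ) ≤ 2 ^ (J + s) * N := h5
      _ ≤ 2 ^ (J + s) * (3 * k * y) := by gcongr
      _ = L * y := by rw [hL]; ring
  let q : ℕ → ℝ := fun t => ∏ i ∈ Finset.range t, (p i : ℝ)
  have hq1 : ∀ t ≤ J, 1 ≤ q t := by
    intro t ht
    have : ∏ i ∈ Finset.range t, (1 : ℝ) ≤ q t := Finset.prod_le_prod (fun i _ => zero_le_one) fun i hi => hy1.trans (hply i (by rw [Finset.mem_range] at hi; omega))
    simpa using this
  have hqub : ∀ t ≤ J, q t ≤ L ^ J * (x * y) := by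
    intro t ht
    calc q t ≤ ∏ i ∈ Finset.range t, (L * y) :=
          Finset.prod_le_prod (fun i _ => by positivity) fun i hi => hpLy i (by rw [Finset.mem_range] at hi; omega)
      _ = (L * y) ^ t := by simp
      _ ≤ (L * y) ^ J := pow_le_pow_right₀ (by nlinarith) ht
      _ = L ^ J * y ^ J := mul_pow _ _ _
      _ ≤ _ := by gcongr
  have hqJ : x ≤ q J := by
    refine hyJ'.trans ?_
    calc y ^ J = ∏ i ∈ Finset.range J, y := by simp
      _ ≤ _ := Finset.prod_le_prod (fun i _ => hy0.le) fun i hi => hply i (by rw [Finset.mem_range] at hi; omega)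
  let D : ℕ → ℕ := fun t => D0 + k + ⌈C0 * x / q t⌉₊
  have hD1 : ∀ t ≤ J, C0 * x ≤ D t * q t := by
    intro t ht
    have h1 := hq1 t ht
    have h2 := Nat.le_ceil (C0 * x / q t)
    rw [div_le_iff₀ (by linarith)] at h2
    refine h2.trans ?_
    have : ((⌈C0 * x / q t⌉₊ : ℕ) : ℝ) ≤ (D t : ℝ) := by
      rw [Nat.cast_le]; exact Nat.le_add_left _ _
    gcongr
  have hD2 : ∀ t ≤ J, (D t : ℝ) * q t ≤ E * (q t + x) := by
    intro t ht
    have h1 := hq1 t ht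
    have h0 : 0 < q t := by linarith
    have h2 := Nat.ceil_lt_add_one (show 0 ≤ C0 * x / q t by positivity)
    have h3 : (D t : ℝ) ≤ D0 + k + (C0 * x / q t + 1) := by
      simp only [D]; push_cast; linarith
    have h4 : (D t : ℝ) * q t ≤ (D0 + k + (C0 * x / q t + 1)) * q t := by gcongr
    have h5 : (D0 + k + (C0 * x / q t + 1)) * q t = (D0 + k + 1) * q t + C0 * x := by
      field_simp
      ring
    have h6 : (0 : ℝ) ≤ (D0 + k + 1) * x := by positivity
    have h7 : (0 : ℝ) ≤ C0 * q t := by positivity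
    rw [hE]
    nlinarith only [h4, h5, h6, h7]
  have hq0 : q 0 = 1 := by simp [q]
  have hD00 : (D 0 : ℝ) ≤ 2 * E * x := by
    have := hD2 0 (by omega)
    rw [hq0, mul_one] at this
    nlinarith
  have hDJ : k * D J ≤ e := by
    have := hD2 J le_rfl
    have h1 := hq1 J le_rfl
    have h2 : (D J : ℝ) * q J ≤ (2 * E) * q J := by nlinarith only [this, hqJ, hEp]
    have h3 : (D J : ℝ) ≤ 2 * E := le_of_mul_le_mul_right h2 (by linarith)
    rw [he]
    apply Nat.mul_le_mul_left
    have := h3.trans (Nat.le_ceil _)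
    rwa [Nat.cast_le] at this
  have hG : ∀ t κ, ∃ G : R2, t ≤ J → (G ≠ 0 ∧ G.totalDegree ≤ k * D t ∧
      ∀ z ∈ Zset k U n, cls p t z = κ → eval (pt z) G = 0) := by
    intro t κ
    by_cases ht : t ≤ J
    · obtain ⟨G, hG⟩ := hA U hU n hn hnU p hpinj hpr t ht (D t) (by simp only [D]; omega) (hD1 t ht) κ
      exact ⟨G, fun _ => hG⟩
    · exact ⟨0, fun h => absurd h ht⟩
  choose G hG using hG
  have hmain := chain_comb k U (by omega) n J p D G (fun t ht κ => (hG t κ ht).1)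
    (fun t ht κ => (hG t κ ht).2.1) (fun t ht z hz => (hG t _ ht).2.2 z hz rfl) (Cc * x) (by positivity)
    (fun r hr hrd => hcv U hU n hn r hr (hrd.trans hDJ))
  refine hmain.trans ?_
  have hfin : x ^ 2 * y ^ 3 ≤ (U : ℝ) ^ (2 / Real.sqrt k + ε) := by
    rw [hx, hy, ← Real.rpow_natCast, ← Real.rpow_natCast, ← Real.rpow_mul hU0.le, ← Real.rpow_mul hU0.le,
      ← Real.rpow_add hU0]
    apply Real.rpow_le_rpow_of_exponent_le hU1
    rw [hθ, hε', hη]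
    have : 2 / Real.sqrt k = 2 * (1 / Real.sqrt k) := by ring
    rw [this]
    push_cast
    linarith only [hε1a, hε1p]
  have hterm : ∀ t ∈ Finset.range J, (((Zset k U n).image (cls p (t + 1))).card : ℝ) * ((k * D t) * (k * D (t + 1)) : ℕ) ≤
      c ^ J * (k ^ 2 * (E ^ 2 * (L * (L ^ J + 1) ^ 2))) * (x ^ 2 * y ^ 3) := by
    intro t ht
    rw [Finset.mem_range] at ht
    have h1 := cls_image_card p k U (by omega) n J (fun i hi => (hpr i hi).1) (t + 1) (by omega)
    have hq' : q (t + 1) = q t * p t := Finset.prod_range_succ _ _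
    change _ ≤ c ^ (t + 1) * q (t + 1) ^ 2 at h1
    have g1 := hq1 t (by omega)
    have g2 := hq1 (t + 1) (by omega)
    have h2 : c ^ (t + 1) * q (t + 1) ^ 2 ≤ c ^ J * q (t + 1) ^ 2 := by
      gcongr
      omega
    have h3 : ((((k * D t) * (k * D (t + 1)) : ℕ)) : ℝ) = k ^ 2 * (D t * D (t + 1)) := by
      push_cast; ring
    rw [h3]
    have u1 : q t + x ≤ (L ^ J + 1) * (x * y) := by
      have := hqub t (by omega)
      nlinarith
    have u2 : q (t + 1) + x ≤ (L ^ J + 1) * (x * y) := by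
      have := hqub (t + 1) (by omega)
      nlinarith
    calc _ ≤ (c ^ J * q (t + 1) ^ 2) * (k ^ 2 * (D t * D (t + 1))) := by
          gcongr; exact h1.trans h2
      _ = c ^ J * (k ^ 2 * ((p t : ℝ) * ((D t * q t) * (D (t + 1) * q (t + 1))))) := by rw [hq']; ring
      _ ≤ c ^ J * (k ^ 2 * ((L * y) * ((E * ((L ^ J + 1) * (x * y))) * (E * ((L ^ J + 1) * (x * y)))))) := by
          have v1 : (D t : ℝ) * q t ≤ E * ((L ^ J + 1) * (x * y)) := (hD2 t (by omega)).trans (by gcongr)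
          have v2 : (D (t + 1) : ℝ) * q (t + 1) ≤ E * ((L ^ J + 1) * (x * y)) :=
            (hD2 (t + 1) (by omega)).trans (by gcongr)
          have v3 := mul_le_mul v1 v2 (by positivity) (by positivity)
          have v4 := mul_le_mul (hpLy t ht) v3 (by positivity) (by positivity)
          exact mul_le_mul_of_nonneg_left (mul_le_mul_of_nonneg_left v4 (by positivity)) (by positivity)
      _ = _ := by ring
  have hsum := Finset.sum_le_sum hterm
  rw [Finset.sum_const, Finset.card_range, nsmul_eq_mul] at hsum
  have hfirst : ((k * D 0 : ℕ) : ℝ) * (Cc * x) ≤ (k * (2 * E) * Cc) * (x ^ 2 * y ^ 3) := by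
    have hy3 : 1 ≤ y ^ 3 := one_le_pow₀ hy1
    push_cast
    calc (k * D 0 : ℝ) * (Cc * x) ≤ (k * (2 * E * x)) * (Cc * x) := by gcongr
      _ = (k * (2 * E) * Cc) * (x ^ 2 * 1) := by ring
      _ ≤ _ := by gcongr
  refine (add_le_add hfirst hsum).trans ?_
  rw [← mul_assoc (J : ℝ), ← add_mul]
  gcongr

end

section
open MvPolynomial

/-- polynomials of total degree at most the integer `d` -/
def PD (d : ℤ) : Submodule ℚ R2 where
  carrier := {F | ∀ m, d < ((m.degree : ℕ) : ℤ) → coeff m F = 0}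
  add_mem' := by
    intro a b ha hb m hm
    rw [coeff_add, ha m hm, hb m hm, add_zero]
  zero_mem' := by
    intro m _
    exact coeff_zero m
  smul_mem' := by
    intro c a ha m hm
    rw [coeff_smul, ha m hm, smul_zero]

theorem mem_PD (d : ℤ) (F : R2) : F ∈ PD d ↔ ∀ m, d < ((m.degree : ℕ) : ℤ) → coeff m F = 0 := Iff.rfl

theorem PD_mono {d d' : ℤ} (h : d ≤ d') {F : R2} (hF : F ∈ PD d) : F ∈ PD d' :=
  fun m hm => hF m (lt_of_le_of_lt h hm)

theorem PD_neg {d : ℤ} (h : d < 0) {F : R2} (hF : F ∈ PD d) : F = 0 := by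
  ext m
  rw [coeff_zero]
  exact hF m (by have := Int.natCast_nonneg m.degree; linarith)

theorem PD_of_degree (F : R2) : F ∈ PD (F.totalDegree : ℤ) := by
  intro m hm
  by_contra hc
  have h1 := MvPolynomial.le_totalDegree (MvPolynomial.mem_support_iff.mpr hc)
  have h2 : (m.sum fun _ e => e) = m.degree := rfl
  rw [h2] at h1
  omega

theorem degree_of_PD {d : ℕ} {F : R2} (hF : F ∈ PD d) : F.totalDegree ≤ d := by
  apply Finset.sup_le
  intro m hm
  by_contra hc
  have h2 : (m.sum fun _ e => e) = m.degree := rfl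
  rw [h2] at hc
  exact (MvPolynomial.mem_support_iff.mp hm) (hF m (by omega))

theorem PD_mul {d d' : ℤ} {F G : R2} (hF : F ∈ PD d) (hG : G ∈ PD d') : F * G ∈ PD (d + d') := by
  intro m hm
  rw [coeff_mul]
  apply Finset.sum_eq_zero
  intro x hx
  have hx' := Finset.HasAntidiagonal.mem_antidiagonal.mp hx
  have h1 : m.degree = x.1.degree + x.2.degree := by rw [← hx', map_add]
  by_cases h : d < ((x.1.degree : ℕ) : ℤ)
  · rw [hF _ h, zero_mul]
  · rw [hG _ (by push_cast [h1] at hm; linarith), mul_zero]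

theorem PD_pow {d : ℤ} {F : R2} (hF : F ∈ PD d) (i : ℕ) : F ^ i ∈ PD (d * i) := by
  induction i with
  | zero =>
    have := PD_of_degree (1 : R2)
    simpa using this
  | succ i ih =>
    rw [pow_succ]
    have := PD_mul ih hF
    convert this using 2
    push_cast; ring

theorem PD_C (c : ℚ) : (C c : R2) ∈ PD 0 := by
  have := PD_of_degree (C c : R2)
  simpa using this

theorem PD_X (i : Fin 2) : (X i : R2) ∈ PD 1 := by
  have := PD_of_degree (X i : R2)
  simpa using this

theorem PD_pderiv {d : ℤ} {F : R2} (hF : F ∈ PD d) (i : Fin 2) : pderiv i F ∈ PD (d - 1) := by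
  intro m hm
  rw [coeff_pderiv, hF, zero_mul]
  rw [map_add, Finsupp.degree_single]
  push_cast; linarith

theorem coeff_euler (F : R2) (m : Fin 2 →₀ ℕ) :
    coeff m (X 0 * pderiv 0 F + X 1 * pderiv 1 F) = (m.degree : ℚ) * coeff m F := by
  have h2 : ((m.degree : ℕ) : ℚ) = m 0 + m 1 := by
    have : m.degree = m 0 + m 1 := by
      rw [Finsupp.degree_eq_sum]; simp
    rw [this]; push_cast; ring
  have key : ∀ i : Fin 2, coeff m (X i * pderiv i F) = (m i : ℚ) * coeff m F := by
    intro i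
    rw [coeff_X_mul']
    split_ifs with h
    · rw [coeff_pderiv]
      have h3 : m i ≠ 0 := Finsupp.mem_support_iff.mp h
      have h4 : m - Finsupp.single i 1 + Finsupp.single i 1 = m := by
        ext j
        by_cases hj : j = i
        · subst hj; simp; omega
        · simp [Finsupp.single_apply, Ne.symm hj]
      rw [h4]
      have h5 : (m - Finsupp.single i 1 : Fin 2 →₀ ℕ) i = m i - 1 := by simp
      rw [h5]
      have h6 : ((m i - 1 : ℕ) : ℚ) = m i - 1 := by
        rw [Nat.cast_sub (by omega)]; simp
      rw [h6]; ring
    · have h3 : m i = 0 := by simpa using h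
      rw [h3]; simp
  rw [coeff_add, key, key, h2]; ring

theorem PD_euler {d : ℤ} {F : R2} (hF : F ∈ PD d) :
    C (d : ℚ) * F - (X 0 * pderiv 0 F + X 1 * pderiv 1 F) ∈ PD (d - 1) := by
  intro m hm
  rw [coeff_sub, coeff_euler, coeff_C_mul]
  by_cases h : d < ((m.degree : ℕ) : ℤ)
  · rw [hF m h]; ring
  · have : d = ((m.degree : ℕ) : ℤ) := by omega
    rw [this]; push_cast; ring

/-- function field data of the curve `r = 0` -/
structure FF (r : R2) (K : Type) [Field K] [Algebra ℚ K] where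
  π : R2 →ₐ[ℚ] K
  D : Derivation ℚ K K
  ker : ∀ F, π F = 0 ↔ r ∣ F
  frac : ∀ x : K, ∃ G H, π G ≠ 0 ∧ x * π G = π H
  dπ : ∀ F, D (π F) = π (pderiv 1 r * pderiv 0 F - pderiv 0 r * pderiv 1 F)

theorem tau_formula {K : Type} [Field K] [Algebra ℚ K] (π : R2 →ₐ[ℚ] K) (u v : R2) (F : R2) :
    (aeval ![TrivSqZeroExt.inl (π (X 0)) + TrivSqZeroExt.inr (π u),
      TrivSqZeroExt.inl (π (X 1)) - TrivSqZeroExt.inr (π v)] F : TrivSqZeroExt K K) =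
      TrivSqZeroExt.inl (π F) + TrivSqZeroExt.inr (π (u * pderiv 0 F - v * pderiv 1 F)) := by
  induction F using MvPolynomial.induction_on with
  | C a =>
    have h1 : π (C a) = algebraMap ℚ _ a := by
      rw [← MvPolynomial.algebraMap_eq]; exact AlgHom.commutes π a
    rw [aeval_C, h1, TrivSqZeroExt.algebraMap_eq_inl']
    simp
  | add F G hF hG =>
    rw [map_add, hF, hG]
    ext <;> simp <;> ring
  | mul_X F i hF =>
    rw [map_mul, hF, aeval_X]
    fin_cases i
    · ext
      · simp
      · simp [Derivation.leibniz, pderiv_X]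
        ring
    · ext
      · simp
      · simp [Derivation.leibniz, pderiv_X]
        ring

theorem FF_of_frac (r : R2) (A : Type) [CommRing A] [IsDomain A] [Algebra ℚ A]
    (K : Type) [Field K] [Algebra ℚ K] [Algebra A K] [IsScalarTower ℚ A K] [IsFractionRing A K]
    (q : R2 →ₐ[ℚ] A) (hq : Function.Surjective q) (hqk : ∀ F, q F = 0 ↔ r ∣ F) :
    Nonempty (FF r K) := by
  let π : R2 →ₐ[ℚ] K := (IsScalarTower.toAlgHom ℚ A K).comp q
  have hπ : ∀ F, π F = algebraMap A K (q F) := fun F => rfl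
  have hker : ∀ F, π F = 0 ↔ r ∣ F := by
    intro F
    rw [hπ, map_eq_zero_iff _ (IsFractionRing.injective A K), hqk]
  obtain ⟨τ0, hτ⟩ : ∃ τ0 : R2 →ₐ[ℚ] TrivSqZeroExt K K, ∀ F, τ0 F = TrivSqZeroExt.inl (π F) +
      TrivSqZeroExt.inr (π (pderiv 1 r * pderiv 0 F - pderiv 0 r * pderiv 1 F)) :=
    ⟨_, tau_formula π _ _⟩
  have hτr : τ0 r = 0 := by
    rw [hτ, (hker r).mpr dvd_rfl, mul_comm, sub_self, map_zero]; simp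
  have hle : RingHom.ker q.toRingHom ≤ RingHom.ker τ0.toRingHom := by
    intro a ha
    obtain ⟨b, rfl⟩ := (hqk a).mp ha
    change τ0 (r * b) = 0
    rw [map_mul, hτr, zero_mul]
  let τ1 : A →+* TrivSqZeroExt K K := RingHom.liftOfSurjective q.toRingHom hq ⟨τ0.toRingHom, hle⟩
  have hτ1 : ∀ F, τ1 (q F) = τ0 F := fun F => RingHom.liftOfRightInverse_comp_apply _ _ (Function.rightInverse_surjInv hq) ⟨τ0.toRingHom, hle⟩ F
  have hunit : ∀ y : nonZeroDivisors A, IsUnit (τ1 y) := by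
    rintro ⟨y, hy⟩
    obtain ⟨F, rfl⟩ := hq y
    rw [hτ1, TrivSqZeroExt.isUnit_iff_isUnit_fst, hτ]
    simp only [TrivSqZeroExt.fst_add, TrivSqZeroExt.fst_inl, TrivSqZeroExt.fst_inr, add_zero]
    rw [isUnit_iff_ne_zero, hπ]
    exact IsLocalization.to_map_ne_zero_of_mem_nonZeroDivisors K le_rfl hy
  let τ : K →+* TrivSqZeroExt K K := IsLocalization.lift hunit
  have hτ2 : ∀ F, τ (π F) = τ0 F := by
    intro F
    rw [hπ, IsLocalization.lift_eq hunit, hτ1]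
  have hfrac : ∀ x : K, ∃ G H, π G ≠ 0 ∧ x * π G = π H := by
    intro x
    obtain ⟨⟨a, s⟩, h⟩ := IsLocalization.surj (nonZeroDivisors A) x
    obtain ⟨H, rfl⟩ := hq a
    obtain ⟨s, hs⟩ := s
    obtain ⟨G, rfl⟩ := hq s
    exact ⟨G, H, IsLocalization.to_map_ne_zero_of_mem_nonZeroDivisors K le_rfl hs, h⟩
  have hfst : ∀ x, (τ x).fst = x := by
    intro x
    obtain ⟨G, H, hG, h⟩ := hfrac x
    have h1 := congrArg (fun y => (τ y).fst) h
    simp only [map_mul, hτ2, hτ, TrivSqZeroExt.fst_mul, TrivSqZeroExt.fst_add, TrivSqZeroExt.fst_inl, TrivSqZeroExt.fst_inr, add_zero] at h1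
    rw [← h] at h1
    exact mul_right_cancel₀ hG h1
  let D0 : K →+ K :=
    { toFun := fun x => (τ x).snd
      map_zero' := by simp
      map_add' := by intro x y; simp }
  refine ⟨⟨π, Derivation.mk' D0.toRatLinearMap ?_, hker, hfrac, ?_⟩⟩
  · intro a b
    change (τ (a * b)).snd = a • (τ b).snd + b • (τ a).snd
    rw [map_mul, TrivSqZeroExt.snd_mul, hfst, hfst]
    simp [mul_comm]
  · intro F
    change (τ (π F)).snd = _
    rw [hτ2, hτ]
    simp

theorem exists_FF (r : R2) (hr : Irreducible r) :
    ∃ (K : Type) (_ : Field K) (_ : Algebra ℚ K), Nonempty (FF r K) := by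
  have hp : Prime r := hr.prime
  have hI : (Ideal.span {r}).IsPrime := (Ideal.span_singleton_prime hp.ne_zero).mpr hp
  refine ⟨FractionRing (R2 ⧸ Ideal.span {r}), inferInstance, inferInstance, ?_⟩
  refine FF_of_frac r (R2 ⧸ Ideal.span {r}) _ (Ideal.Quotient.mkₐ ℚ (Ideal.span {r}))
    Ideal.Quotient.mk_surjective ?_
  intro F
  rw [← Ideal.mem_span_singleton, ← Ideal.Quotient.eq_zero_iff_mem]
  rfl

end

section
open MvPolynomial

namespace FF
variable {r : R2} {K : Type} [Field K] [Algebra ℚ K] (S : FF r K)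

noncomputable def Fil (d : ℤ) : Submodule ℚ K := (PD d).map S.π.toLinearMap

theorem mem_Fil {d : ℤ} {x : K} : x ∈ S.Fil d ↔ ∃ F ∈ PD d, S.π F = x := by
  unfold Fil
  rw [Submodule.mem_map]
  rfl

theorem Fil_π {d : ℤ} {F : R2} (h : F ∈ PD d) : S.π F ∈ S.Fil d := S.mem_Fil.mpr ⟨F, h, rfl⟩

theorem Fil_mono {d d' : ℤ} (h : d ≤ d') {x : K} (hx : x ∈ S.Fil d) : x ∈ S.Fil d' := by
  obtain ⟨F, hF, rfl⟩ := S.mem_Fil.mp hx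
  exact S.Fil_π (PD_mono h hF)

theorem Fil_congr {d d' : ℤ} {x y : K} (hx : x ∈ S.Fil d) (h : d = d') (hy : x = y) : y ∈ S.Fil d' := by
  subst h; subst hy; exact hx

theorem Fil_neg {d : ℤ} (h : d < 0) {x : K} (hx : x ∈ S.Fil d) : x = 0 := by
  obtain ⟨F, hF, rfl⟩ := S.mem_Fil.mp hx
  rw [PD_neg h hF, map_zero]

theorem Fil_mul {d d' : ℤ} {x y : K} (hx : x ∈ S.Fil d) (hy : y ∈ S.Fil d') : x * y ∈ S.Fil (d + d') := by
  obtain ⟨F, hF, rfl⟩ := S.mem_Fil.mp hx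
  obtain ⟨G, hG, rfl⟩ := S.mem_Fil.mp hy
  rw [← map_mul]
  exact S.Fil_π (PD_mul hF hG)

theorem Fil_pow {d : ℤ} {x : K} (hx : x ∈ S.Fil d) (i : ℕ) : x ^ i ∈ S.Fil (d * i) := by
  obtain ⟨F, hF, rfl⟩ := S.mem_Fil.mp hx
  rw [← map_pow]
  exact S.Fil_π (PD_pow hF i)

theorem Fil_nat_mul {d : ℤ} (a : ℕ) {x : K} (hx : x ∈ S.Fil d) : (a : K) * x ∈ S.Fil d := by
  rw [← nsmul_eq_mul]
  exact Submodule.smul_of_tower_mem (S.Fil d) a hx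

/-- elements of filtered degree at most `d`, up to integral closure -/
def Gam (d : ℤ) (f : K) : Prop := ∃ g : K, g ≠ 0 ∧ ∃ m : ℤ, ∀ i : ℕ, g * f ^ i ∈ S.Fil (m + d * i)

theorem Gam_of_Fil {d : ℤ} {x : K} (hx : x ∈ S.Fil d) : S.Gam d x := by
  refine ⟨1, one_ne_zero, 0, fun i => ?_⟩
  rw [one_mul, zero_add]
  exact S.Fil_pow hx i

theorem Gam_mono {d d' : ℤ} (h : d ≤ d') {x : K} (hx : S.Gam d x) : S.Gam d' x := by
  obtain ⟨g, hg, m, H⟩ := hx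
  refine ⟨g, hg, m, fun i => S.Fil_mono ?_ (H i)⟩
  have : d * (i : ℤ) ≤ d' * i := mul_le_mul_of_nonneg_right h (by positivity)
  linarith

theorem Gam_neg {d : ℤ} (h : d < 0) {x : K} (hx : S.Gam d x) : x = 0 := by
  obtain ⟨g, hg, m, H⟩ := hx
  have h1 := H (m.toNat + 1)
  have h2 := S.Fil_neg (by
    push_cast
    have : m ≤ (m.toNat : ℤ) := Int.self_le_toNat m
    nlinarith [Int.natCast_nonneg m.toNat]) h1
  rcases mul_eq_zero.mp h2 with h3 | h3
  · exact absurd h3 hg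
  · exact pow_eq_zero_iff (by omega) |>.mp h3

theorem Gam_mul {d d' : ℤ} {x y : K} (hx : S.Gam d x) (hy : S.Gam d' y) : S.Gam (d + d') (x * y) := by
  obtain ⟨g, hg, m, H⟩ := hx
  obtain ⟨g', hg', m', H'⟩ := hy
  refine ⟨g * g', mul_ne_zero hg hg', m + m', fun i => ?_⟩
  exact S.Fil_congr (S.Fil_mul (H i) (H' i)) (by ring) (by ring)

theorem Gam_add {d : ℤ} {x y : K} (hx : S.Gam d x) (hy : S.Gam d y) : S.Gam d (x + y) := by
  obtain ⟨g, hg, m, H⟩ := hx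
  obtain ⟨g', hg', m', H'⟩ := hy
  refine ⟨g * g', mul_ne_zero hg hg', m + m', fun i => ?_⟩
  rw [add_pow, Finset.mul_sum]
  refine Submodule.sum_mem _ fun j hj => ?_
  have hj' : j ≤ i := by
    have := Finset.mem_range.mp hj; omega
  have h1 := S.Fil_nat_mul (i.choose j) (S.Fil_mul (H j) (H' (i - j)))
  refine S.Fil_congr h1 ?_ (by ring)
  push_cast [Nat.cast_sub hj']; ring

theorem Gam_smul {d : ℤ} (a : ℚ) {x : K} (hx : S.Gam d x) : S.Gam d (algebraMap ℚ K a * x) := by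
  have h0 : S.Gam 0 (algebraMap ℚ K a) := by
    apply S.Gam_of_Fil
    have h1 : S.π (C a) = algebraMap ℚ _ a := by
      rw [← MvPolynomial.algebraMap_eq]; exact AlgHom.commutes S.π a
    rw [← h1]
    exact S.Fil_π (PD_C a)
  have := S.Gam_mul h0 hx
  rwa [zero_add] at this

theorem Gam_neg' {d : ℤ} {x : K} (hx : S.Gam d x) : S.Gam d (-x) := by
  have := S.Gam_smul (-1) hx
  simpa using this

theorem Gam_sub {d : ℤ} {x y : K} (hx : S.Gam d x) (hy : S.Gam d y) : S.Gam d (x - y) := by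
  rw [sub_eq_add_neg]
  exact S.Gam_add hx (S.Gam_neg' hy)

theorem Gam_nat {d : ℤ} (a : ℕ) {x : K} (hx : S.Gam d x) : S.Gam d ((a : K) * x) := by
  have := S.Gam_smul (a : ℚ) hx
  simpa using this

theorem Gam_int {d : ℤ} (a : ℤ) {x : K} (hx : S.Gam d x) : S.Gam d ((a : K) * x) := by
  have := S.Gam_smul (a : ℚ) hx
  simpa using this

theorem Gam_pow {d : ℤ} {x : K} (hx : S.Gam d x) (i : ℕ) : S.Gam (d * i) (x ^ i) := by
  induction i with
  | zero =>
    apply S.Gam_of_Fil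
    have := S.Fil_π (PD_C 1)
    simpa using this
  | succ i ih =>
    rw [pow_succ]
    have := S.Gam_mul ih hx
    convert this using 1
    push_cast; ring

theorem Gam_sum {ι : Type*} (s : Finset ι) {d : ℤ} (f : ι → K) (h : ∀ i ∈ s, S.Gam d (f i)) :
    S.Gam d (∑ i ∈ s, f i) := by
  classical
  induction s using Finset.induction_on with
  | empty =>
    refine ⟨1, one_ne_zero, 0, fun i => ?_⟩
    rcases i with _ | i
    · have := S.Fil_π (PD_C 1)
      simpa using this
    · simp
  | insert a s ha ih =>
    rw [Finset.sum_insert ha]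
    exact S.Gam_add (h a (Finset.mem_insert_self a s)) (ih fun i hi => h i (Finset.mem_insert_of_mem hi))

theorem Gam_root {d : ℤ} {k : ℕ} (hk : 0 < k) {x : K} (hx : S.Gam (k * d) (x ^ k)) : S.Gam d x := by
  obtain ⟨g, hg, m, H⟩ := hx
  obtain ⟨G, F, hG, hF⟩ := S.frac x
  obtain ⟨e, he0, hG', hF'⟩ : ∃ e : ℤ, 0 ≤ e ∧ G ∈ PD e ∧ F ∈ PD e := by
    refine ⟨max G.totalDegree F.totalDegree, by positivity, PD_mono (le_max_left _ _) (PD_of_degree G),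
      PD_mono (le_max_right _ _) (PD_of_degree F)⟩
  refine ⟨g * (S.π G) ^ k, mul_ne_zero hg (pow_ne_zero _ hG), m + e * k + |d| * k, fun i => ?_⟩
  have hρ : i % k < k := Nat.mod_lt _ hk
  have hi := Nat.div_add_mod i k
  have h1 := S.Fil_mul (S.Fil_mul (H (i / k)) (S.Fil_pow (S.Fil_π hG') (k - i % k))) (S.Fil_pow (S.Fil_π hF') (i % k))
  rw [← hF] at h1
  have e1 : g * (x ^ k) ^ (i / k) * S.π G ^ (k - i % k) * (x * S.π G) ^ (i % k) = g * S.π G ^ k * x ^ i := by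
    have e2 : S.π G ^ k = S.π G ^ (k - i % k) * S.π G ^ (i % k) := by
      rw [← pow_add]; congr 1; omega
    have e3 : x ^ i = (x ^ k) ^ (i / k) * x ^ (i % k) := by
      rw [← pow_mul, ← pow_add, hi]
    rw [e2, e3, mul_pow]; ring
  rw [e1] at h1
  refine S.Fil_mono ?_ h1
  rw [Nat.cast_sub hρ.le]
  have hi' : (i : ℤ) = k * (i / k : ℕ) + (i % k : ℕ) := by exact_mod_cast hi.symm
  generalize hq : ((i / k : ℕ) : ℤ) = q at *
  generalize hs : ((i % k : ℕ) : ℤ) = s at *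
  rw [hi']
  have h3 : 0 ≤ s := by rw [← hs]; positivity
  have h4 : s ≤ k := by rw [← hs]; exact_mod_cast hρ.le
  have h5 : -(|d| * k) ≤ d * s := by
    have := neg_abs_le d
    have h6 : |d| * s ≤ |d| * k := mul_le_mul_of_nonneg_left h4 (abs_nonneg d)
    have h7 : -|d| * s ≤ d * s := mul_le_mul_of_nonneg_right this h3
    linarith
  linarith

/-- twisted derivation -/
noncomputable def nab (P : K) (w : ℤ) (f : K) : K := P * S.D f - (w : K) * S.D P * f

/-- polynomials `P` for which the twisted derivation respects the filtration -/
def Good (P : K) : Prop := ∀ (d : ℤ) (x : K), x ∈ S.Fil d → S.nab P d x ∈ S.Fil (d + (r.totalDegree : ℤ) - 2)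

theorem good_one : S.Good 1 := by
  intro d x hx
  obtain ⟨F, hF, rfl⟩ := S.mem_Fil.mp hx
  have hr := PD_of_degree r
  unfold nab
  rw [S.dπ, Derivation.map_one_eq_zero, mul_zero, zero_mul, sub_zero, one_mul]
  apply S.Fil_π
  refine Submodule.sub_mem _ ?_ ?_
  · refine PD_mono (le_of_eq ?_) (PD_mul (PD_pderiv hr 1) (PD_pderiv hF 0)); ring
  · refine PD_mono (le_of_eq ?_) (PD_mul (PD_pderiv hr 0) (PD_pderiv hF 1)); ring

theorem π_C (a : ℚ) : S.π (C a) = algebraMap ℚ K a := by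
  rw [← MvPolynomial.algebraMap_eq]; exact AlgHom.commutes S.π a

theorem π_int (a : ℤ) : S.π (C (a : ℚ)) = (a : K) := by
  rw [π_C]; simp

theorem π_r : S.π r = 0 := (S.ker r).mpr dvd_rfl

theorem D_X0 : S.D (S.π (X 0)) = S.π (pderiv 1 r) := by
  rw [S.dπ, pderiv_X_self, pderiv_X_of_ne (by decide)]; simp

theorem D_X1 : S.D (S.π (X 1)) = - S.π (pderiv 0 r) := by
  rw [S.dπ, pderiv_X_self, pderiv_X_of_ne (by decide)]; simp

theorem good_b : S.Good (S.π (X 0)) := by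
  intro d x hx
  obtain ⟨F, hF, rfl⟩ := S.mem_Fil.mp hx
  have hr := PD_of_degree r
  have e : S.nab (S.π (X 0)) d (S.π F) = S.π (- (pderiv 1 r * (C (d : ℚ) * F - (X 0 * pderiv 0 F + X 1 * pderiv 1 F)))
     + pderiv 1 F * (C ((r.totalDegree : ℤ) : ℚ) * r - (X 0 * pderiv 0 r + X 1 * pderiv 1 r))) := by
    unfold nab
    rw [S.dπ, S.D_X0]
    simp only [map_sub, map_add, map_neg, map_mul, S.π_int, S.π_r]
    ring
  rw [e]
  apply S.Fil_π
  refine Submodule.add_mem _ (Submodule.neg_mem _ ?_) ?_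
  · refine PD_mono (le_of_eq ?_) (PD_mul (PD_pderiv hr 1) (PD_euler hF)); ring
  · refine PD_mono (le_of_eq ?_) (PD_mul (PD_pderiv hF 1) (PD_euler hr)); ring

theorem good_c : S.Good (S.π (X 1)) := by
  intro d x hx
  obtain ⟨F, hF, rfl⟩ := S.mem_Fil.mp hx
  have hr := PD_of_degree r
  have e : S.nab (S.π (X 1)) d (S.π F) = S.π ((pderiv 0 r * (C (d : ℚ) * F - (X 0 * pderiv 0 F + X 1 * pderiv 1 F)))
     - pderiv 0 F * (C ((r.totalDegree : ℤ) : ℚ) * r - (X 0 * pderiv 0 r + X 1 * pderiv 1 r))) := by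
    unfold nab
    rw [S.dπ, S.D_X1]
    simp only [map_sub, map_add, map_neg, map_mul, S.π_int, S.π_r]
    ring
  rw [e]
  apply S.Fil_π
  refine Submodule.sub_mem _ ?_ ?_
  · refine PD_mono (le_of_eq ?_) (PD_mul (PD_pderiv hr 0) (PD_euler hF)); ring
  · refine PD_mono (le_of_eq ?_) (PD_mul (PD_pderiv hF 0) (PD_euler hr)); ring

theorem nab_mul (P : K) (w d : ℤ) (f F : K) :
    S.nab P (w + d) (f * F) = f * S.nab P w F + S.nab P d f * F := by
  unfold nab
  rw [Derivation.leibniz]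
  push_cast
  simp only [smul_eq_mul]
  ring

theorem nab_add (P : K) (w : ℤ) (F G : K) : S.nab P w (F + G) = S.nab P w F + S.nab P w G := by
  unfold nab
  rw [map_add]; ring

/-- iterated twisted derivations -/
noncomputable def NN (P : K) (s : ℤ) : ℕ → ℤ → K → K
  | 0, _, F => F
  | i + 1, w, F => NN P s i (w + s) (S.nab P w F)

/-- iterated commutators with multiplication by `f` -/
noncomputable def MM (P : K) (s d : ℤ) (f : K) (i : ℕ) : ℕ → ℤ → K → K
  | 0, w, F => S.NN P s i w F
  | j + 1, w, F => MM P s d f i j (w + d) (f * F) - f * MM P s d f i j w F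

theorem NN_add (P : K) (s : ℤ) (i : ℕ) : ∀ (w : ℤ) (F G : K), S.NN P s i w (F + G) = S.NN P s i w F + S.NN P s i w G := by
  induction i with
  | zero => intro w F G; rfl
  | succ i ih =>
    intro w F G
    simp only [NN]
    rw [S.nab_add, ih]

theorem MM_add (P : K) (s d : ℤ) (f : K) (i j : ℕ) : ∀ (w : ℤ) (F G : K),
    S.MM P s d f i j w (F + G) = S.MM P s d f i j w F + S.MM P s d f i j w G := by
  induction j with
  | zero => intro w F G; exact S.NN_add P s i w F G
  | succ j ih =>
    intro w F G
    simp only [MM]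
    rw [mul_add, ih, ih]; ring

theorem MM_rec0 (P : K) (s d : ℤ) (f : K) (i : ℕ) (w : ℤ) (F : K) :
    S.MM P s d f (i + 1) 0 w F = S.MM P s d f i 0 (w + s) (S.nab P w F) := rfl

theorem MM_rec (P : K) (s d : ℤ) (f : K) (i j : ℕ) : ∀ (w : ℤ) (F : K),
    S.MM P s d f (i + 1) (j + 1) w F = S.MM P s d f i (j + 1) (w + s) (S.nab P w F)
      + ((j : K) + 1) * S.MM P s d f i j (w + s + d) (S.nab P d f * F) := by
  induction j with
  | zero =>
    intro w F
    have e1 : S.MM P s d f (i + 1) (0 + 1) w F =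
      S.MM P s d f (i + 1) 0 (w + d) (f * F) - f * S.MM P s d f (i + 1) 0 w F := rfl
    have e2 : S.MM P s d f i (0 + 1) (w + s) (S.nab P w F) =
      S.MM P s d f i 0 (w + s + d) (f * S.nab P w F) - f * S.MM P s d f i 0 (w + s) (S.nab P w F) := rfl
    rw [e1, e2, MM_rec0, MM_rec0, nab_mul, MM_add]
    have e3 : w + d + s = w + s + d := by ring
    rw [e3]; push_cast; ring
  | succ j ih =>
    intro w F
    have e1 : S.MM P s d f (i + 1) (j + 1 + 1) w F =
      S.MM P s d f (i + 1) (j + 1) (w + d) (f * F) - f * S.MM P s d f (i + 1) (j + 1) w F := rfl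
    have e2 : S.MM P s d f i (j + 1 + 1) (w + s) (S.nab P w F) =
      S.MM P s d f i (j + 1) (w + s + d) (f * S.nab P w F) - f * S.MM P s d f i (j + 1) (w + s) (S.nab P w F) := rfl
    have e4 : S.MM P s d f i (j + 1) (w + s + d) (S.nab P d f * F) =
      S.MM P s d f i j (w + s + d + d) (f * (S.nab P d f * F)) - f * S.MM P s d f i j (w + s + d) (S.nab P d f * F) := rfl
    have e5 : S.nab P d f * (f * F) = f * (S.nab P d f * F) := by ring
    have e3 : w + d + s = w + s + d := by ring
    rw [e1, e2, ih, ih, nab_mul, MM_add, e3, e5]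
    push_cast
    linear_combination ((j : K) + 1) * (-e4)

theorem MM_zero (P : K) (s d : ℤ) (f : K) (i : ℕ) : ∀ (j : ℕ) (w : ℤ) (F : K), i < j → S.MM P s d f i j w F = 0 := by
  induction i with
  | zero =>
    intro j
    induction j with
    | zero => intro w F h; omega
    | succ j ih =>
      intro w F _
      have e1 : S.MM P s d f 0 (j + 1) w F = S.MM P s d f 0 j (w + d) (f * F) - f * S.MM P s d f 0 j w F := rfl
      rcases Nat.eq_zero_or_pos j with rfl | hj
      · rw [e1]
        change f * F - f * F = 0
        ring
      · rw [e1, ih _ _ hj, ih _ _ hj]; ring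
  | succ i ih =>
    intro j w F h
    obtain ⟨j, rfl⟩ : ∃ j', j = j' + 1 := ⟨j - 1, by omega⟩
    rw [MM_rec, ih _ _ _ (by omega), ih _ _ _ (by omega)]; ring

theorem MM_diag (P : K) (s d : ℤ) (f : K) (i : ℕ) : ∀ (w : ℤ) (F : K),
    S.MM P s d f i i w F = (i.factorial : K) * ((S.nab P d f) ^ i * F) := by
  induction i with
  | zero => intro w F; change F = _; simp
  | succ i ih =>
    intro w F
    rw [MM_rec, MM_zero _ _ _ _ _ _ _ _ _ (by omega), ih, Nat.factorial_succ]
    push_cast; ring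

theorem NN_Fil (P : K) (hP : S.Good P) (i : ℕ) : ∀ (w : ℤ) (F : K), F ∈ S.Fil w →
    S.NN P ((r.totalDegree : ℤ) - 2) i w F ∈ S.Fil (w + i * ((r.totalDegree : ℤ) - 2)) := by
  induction i with
  | zero => intro w F h; simpa [NN] using h
  | succ i ih =>
    intro w F h
    simp only [NN]
    have h1 := hP w F h
    rw [add_sub_assoc] at h1
    have h2 := ih _ _ h1
    convert h2 using 1
    push_cast; ring_nf

theorem MM_Fil (P : K) (hP : S.Good P) (d m : ℤ) (f g : K) (H : ∀ i : ℕ, g * f ^ i ∈ S.Fil (m + d * i)) (i j : ℕ) :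
    ∀ a b : ℕ, g * f ^ a * S.MM P ((r.totalDegree : ℤ) - 2) d f i j (m + d * b) (g * f ^ b) ∈
      S.Fil (2 * m + d * (a + b + j) + i * ((r.totalDegree : ℤ) - 2)) := by
  induction j with
  | zero =>
    intro a b
    exact S.Fil_congr (S.Fil_mul (H a) (S.NN_Fil P hP i _ _ (H b))) (by push_cast; ring) rfl
  | succ j ih =>
    intro a b
    have e1 : S.MM P ((r.totalDegree : ℤ) - 2) d f i (j + 1) (m + d * b) (g * f ^ b) =
      S.MM P ((r.totalDegree : ℤ) - 2) d f i j (m + d * b + d) (f * (g * f ^ b)) - f * S.MM P ((r.totalDegree : ℤ) - 2) d f i j (m + d * b) (g * f ^ b) := rfl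
    rw [e1, mul_sub (g * f ^ a)]
    apply Submodule.sub_mem
    · refine S.Fil_congr (ih a (b + 1)) (by push_cast; ring) ?_
      have e2 : m + d * ((b + 1 : ℕ) : ℤ) = m + d * b + d := by push_cast; ring
      have e3 : g * f ^ (b + 1) = f * (g * f ^ b) := by ring
      rw [e2, e3]
    · exact S.Fil_congr (ih (a + 1) b) (by push_cast; ring) (by ring)

theorem Gam_nab (P : K) (hP : S.Good P) {d : ℤ} {f : K} (hf : S.Gam d f) :
    S.Gam (d + (r.totalDegree : ℤ) - 2) (S.nab P d f) := by
  obtain ⟨g, hg, m, H⟩ := hf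
  refine ⟨g * g, mul_ne_zero hg hg, 2 * m, fun i => ?_⟩
  have h1 := S.MM_Fil P hP d m f g H i i 0 0
  rw [MM_diag] at h1
  have h2 : (((i.factorial : ℚ))⁻¹) • (g * f ^ 0 * ((i.factorial : K) * (S.nab P d f ^ i * (g * f ^ 0)))) = g * g * S.nab P d f ^ i := by
    have h3 : (i.factorial : K) ≠ 0 := by
      have : CharZero K := algebraRat.charZero K
      exact_mod_cast i.factorial_ne_zero
    rw [Algebra.smul_def, map_inv₀]
    have h4 : algebraMap ℚ K (i.factorial : ℚ) = (i.factorial : K) := by simp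
    rw [h4]
    field_simp
  rw [← h2]
  refine Submodule.smul_mem _ _ (S.Fil_mono (le_of_eq ?_) h1)
  push_cast; ring
end FF

end

section
open MvPolynomial

theorem hc_PD (u : ℕ) (F : R2) : homogeneousComponent u F ∈ PD u := by
  intro m hm
  rw [coeff_homogeneousComponent, if_neg]
  intro h; rw [h] at hm; omega

theorem hc_zero_of_PD {u : ℕ} {d : ℤ} (hd : d < u) {F : R2} (hF : F ∈ PD d) : homogeneousComponent u F = 0 := by
  ext m
  rw [coeff_homogeneousComponent, coeff_zero]
  split_ifs with h
  · exact hF m (by rw [h]; exact hd)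
  · rfl

theorem PD_of_hc_zero {u : ℕ} {F : R2} (hF : F ∈ PD u) (h : homogeneousComponent u F = 0) : F ∈ PD ((u : ℤ) - 1) := by
  intro m hm
  by_cases h1 : m.degree = u
  · have := congrArg (coeff m) h
    rwa [coeff_homogeneousComponent, if_pos h1, coeff_zero] at this
  · exact hF m (by omega)

theorem hc_hc (u : ℕ) (F : R2) : homogeneousComponent u (homogeneousComponent u F) = homogeneousComponent u F := by
  ext m
  rw [coeff_homogeneousComponent, coeff_homogeneousComponent]
  split_ifs <;> rfl

theorem PD_sub_hc {u : ℕ} {F : R2} (hF : F ∈ PD u) : F - homogeneousComponent u F ∈ PD ((u : ℤ) - 1) :=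
  PD_of_hc_zero (Submodule.sub_mem _ hF (hc_PD u F)) (by rw [map_sub, hc_hc, sub_self])

theorem hc_mul {u v : ℕ} {F G : R2} (hF : F ∈ PD u) (hG : G ∈ PD v) :
    homogeneousComponent (u + v) (F * G) = homogeneousComponent u F * homogeneousComponent v G := by
  have e : F * G = homogeneousComponent u F * homogeneousComponent v G +
    (homogeneousComponent u F * (G - homogeneousComponent v G) + (F - homogeneousComponent u F) * G) := by ring
  have h0 : homogeneousComponent u F * (G - homogeneousComponent v G) + (F - homogeneousComponent u F) * G ∈
      PD ((u : ℤ) + v - 1) := by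
    refine Submodule.add_mem _ ?_ ?_
    · exact PD_mono (by linarith) (PD_mul (hc_PD u F) (PD_sub_hc hG))
    · exact PD_mono (by linarith) (PD_mul (PD_sub_hc hF) hG)
  have h1 := hc_zero_of_PD (u := u + v) (by push_cast; linarith) h0
  conv_lhs => rw [e]
  rw [map_add, h1, add_zero]
  exact homogeneousComponent_eq_self
    ((homogeneousComponent_isHomogeneous u F).mul (homogeneousComponent_isHomogeneous v G))

theorem R0 (r l : R2) (hl : Prime l) (hl1 : l.IsHomogeneous 1)
    (hlr : ¬ l ∣ homogeneousComponent r.totalDegree r) (t : ℤ) (H : R2) (hH : H ∈ PD (t + 1)) (u : ℕ) :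
    ∀ F ∈ PD ((u : ℤ) - 1), r ∣ l * F - H → ∃ F' ∈ PD t, r ∣ F - F' := by
  induction u with
  | zero =>
    intro F hF _
    refine ⟨0, Submodule.zero_mem _, ?_⟩
    rw [PD_neg (by norm_num) hF]; simp
  | succ u ih =>
    intro F hF hd
    have hF' : F ∈ PD u := PD_mono (by push_cast; linarith) hF
    by_cases htu : (u : ℤ) ≤ t
    · exact ⟨F, PD_mono htu hF', by simp⟩
    push Not at htu
    have hr0 : r ≠ 0 := by
      rintro rfl; exact hlr (by simp)
    have hl0 : l ≠ 0 := hl.ne_zero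
    have hltd : l.totalDegree = 1 := hl1.totalDegree hl0
    have hlPD : l ∈ PD ((1 : ℕ) : ℤ) := by
      have := PD_of_degree l; rwa [hltd] at this
    have hlhc : homogeneousComponent 1 l = l := homogeneousComponent_eq_self hl1
    have hrPD := PD_of_degree r
    have hrhc : homogeneousComponent r.totalDegree r ≠ 0 := by
      intro h; rw [h] at hlr; exact hlr (dvd_zero _)
    have key : ∃ G1, F - r * G1 ∈ PD ((u : ℤ) - 1) := by
      obtain ⟨G, hG⟩ := hd
      have h1 : homogeneousComponent (1 + u) (l * F - H) = l * homogeneousComponent u F := by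
        rw [map_sub, hc_mul hlPD hF', hlhc, hc_zero_of_PD (d := t + 1) (by push_cast; linarith) hH, sub_zero]
      by_cases hG0 : G = 0
      · rw [hG, hG0, mul_zero, map_zero] at h1
        have h2 : homogeneousComponent u F = 0 := by
          rcases mul_eq_zero.mp h1.symm with h | h
          · exact absurd h hl0
          · exact h
        exact ⟨0, by rw [mul_zero, sub_zero]; exact PD_of_hc_zero hF' h2⟩
      have hrG : r * G ∈ PD ((1 + u : ℕ) : ℤ) := by
        rw [← hG]
        refine Submodule.sub_mem _ ?_ (PD_mono (by push_cast; linarith) hH)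
        push_cast
        exact PD_mul hlPD hF'
      have h3 := degree_of_PD hrG
      rw [totalDegree_mul_of_isDomain hr0 hG0] at h3
      obtain ⟨v, hv⟩ : ∃ v, 1 + u = r.totalDegree + v := ⟨1 + u - r.totalDegree, by omega⟩
      have hGv : G ∈ PD v := PD_mono (by exact_mod_cast (by omega : G.totalDegree ≤ v)) (PD_of_degree G)
      rw [hG, hv, hc_mul hrPD hGv] at h1
      have h4 : l ∣ homogeneousComponent v G := by
        rcases hl.dvd_or_dvd (Dvd.intro _ h1.symm) with h | h
        · exact absurd h hlr
        · exact h
      obtain ⟨G1, hG1⟩ := h4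
      have h5 : homogeneousComponent u F = homogeneousComponent r.totalDegree r * G1 := by
        apply mul_left_cancel₀ hl0
        rw [← h1, hG1]; ring
      by_cases hG10 : G1 = 0
      · rw [hG10, mul_zero] at h5
        exact ⟨0, by rw [mul_zero, sub_zero]; exact PD_of_hc_zero hF' h5⟩
      have h6 := degree_of_PD (hc_PD v G)
      rw [hG1, totalDegree_mul_of_isDomain hl0 hG10, hltd] at h6
      obtain ⟨w, rfl⟩ : ∃ w, v = w + 1 := ⟨v - 1, by omega⟩
      have hG1w : G1 ∈ PD w := PD_mono (by exact_mod_cast (by omega : G1.totalDegree ≤ w)) (PD_of_degree G1)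
      have hu : u = r.totalDegree + w := by omega
      refine ⟨G1, PD_of_hc_zero ?_ ?_⟩
      · refine Submodule.sub_mem _ hF' ?_
        refine PD_mono ?_ (PD_mul hrPD hG1w)
        rw [hu]; push_cast; linarith
      · rw [map_sub]
        have h7 : homogeneousComponent u (r * G1) = homogeneousComponent r.totalDegree r * homogeneousComponent w G1 := by
          rw [hu]; exact hc_mul hrPD hG1w
        have h8 : homogeneousComponent u (homogeneousComponent r.totalDegree r * G1) = homogeneousComponent r.totalDegree r * homogeneousComponent w G1 := by
          have := hc_mul (hc_PD r.totalDegree r) hG1w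
          rw [hc_hc] at this
          rw [hu]; exact this
        rw [h7, ← h8, ← h5, hc_hc, sub_self]
    obtain ⟨G1, hG1⟩ := key
    obtain ⟨F', hF'1, hF'2⟩ := ih (F - r * G1) hG1 (by
      have e : l * (F - r * G1) - H = (l * F - H) - r * (l * G1) := by ring
      rw [e]; exact dvd_sub hd (Dvd.intro _ rfl))
    refine ⟨F', hF'1, ?_⟩
    have e : F - F' = (F - r * G1 - F') + r * G1 := by ring
    rw [e]; exact dvd_add hF'2 (Dvd.intro _ rfl)

/-- linear form not dividing the top part of `r` -/
def GoodLine (r l : R2) : Prop := Prime l ∧ l.IsHomogeneous 1 ∧ ¬ l ∣ homogeneousComponent r.totalDegree r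

theorem line_prime (μ : ℚ) : (X 0 - C μ * X 1 : R2).IsHomogeneous 1 ∧ Prime (X 0 - C μ * X 1 : R2) := by
  have hh : (X 0 - C μ * X 1 : R2).IsHomogeneous 1 :=
    (isHomogeneous_X ℚ 0).sub (by simpa using (isHomogeneous_C (Fin 2) μ).mul (isHomogeneous_X ℚ (1 : Fin 2)))
  refine ⟨hh, ?_⟩
  let σ : R2 →ₐ[ℚ] R2 := aeval ![C μ * X 1, X 1]
  have h0 : σ (X 0) = C μ * X 1 := aeval_X _ _
  have h1 : σ (X 1) = X 1 := aeval_X _ _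
  have hC : ∀ a, σ (C a) = C a := fun a => AlgHom.commutes σ a
  have hdiv : ∀ F, (X 0 - C μ * X 1 : R2) ∣ F - σ F := by
    intro F
    induction F using MvPolynomial.induction_on with
    | C a => rw [hC, sub_self]; exact dvd_zero _
    | add F G hF hG =>
      rw [map_add]
      have e : F + G - (σ F + σ G) = (F - σ F) + (G - σ G) := by ring
      rw [e]; exact dvd_add hF hG
    | mul_X F i hF =>
      rw [map_mul]
      have e : F * X i - σ F * σ (X i) = (F - σ F) * X i + σ F * (X i - σ (X i)) := by ring
      rw [e]
      refine dvd_add (Dvd.dvd.mul_right hF _) (Dvd.dvd.mul_left ?_ _)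
      fin_cases i
      · change _ ∣ X 0 - σ (X 0)
        rw [h0]
      · change _ ∣ X 1 - σ (X 1)
        rw [h1, sub_self]; exact dvd_zero _
  have hiff : ∀ F, (X 0 - C μ * X 1 : R2) ∣ F ↔ σ F = 0 := by
    intro F
    constructor
    · rintro ⟨G, rfl⟩
      rw [map_mul, map_sub, map_mul, h0, h1, hC, sub_self, zero_mul]
    · intro h
      have := hdiv F
      rwa [h, sub_zero] at this
  refine ⟨?_, ?_, ?_⟩
  · intro h
    have := congrArg (eval ![1, 0]) h
    simp at this
  · intro h
    have := (hiff 1).mp h.dvd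
    simp at this
  · intro a b hab
    rw [hiff, map_mul, mul_eq_zero] at hab
    rwa [hiff, hiff]

theorem exists_goodLine (r : R2) (hr : r ≠ 0) : ∃ μ : ℚ, GoodLine r (X 0 - C μ * X 1) := by
  by_contra hcon
  push Not at hcon
  set T := homogeneousComponent r.totalDegree r with hT
  have hdvd : ∀ μ : ℚ, (X 0 - C μ * X 1 : R2) ∣ T := by
    intro μ
    by_contra h
    exact hcon μ ⟨(line_prime μ).2, (line_prime μ).1, h⟩
  have hTX : T * X 1 = 0 := by
    apply MvPolynomial.funext
    intro z
    rw [map_mul, map_zero, eval_X]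
    by_cases hz : z 1 = 0
    · rw [hz, mul_zero]
    · obtain ⟨G, hG⟩ := hdvd (z 0 / z 1)
      rw [hG, map_mul, map_sub, map_mul, eval_X, eval_X, eval_C]
      field_simp
      ring
  have hT0 : T = 0 := by
    rcases mul_eq_zero.mp hTX with h | h
    · exact h
    · exact absurd h (MvPolynomial.X_ne_zero _)
  have h1 := PD_of_hc_zero (PD_of_degree r) hT0
  rcases Nat.eq_zero_or_pos r.totalDegree with h | h
  · rw [h] at h1
    exact hr (PD_neg (by norm_num) h1)
  · obtain ⟨d, hd⟩ : ∃ d, r.totalDegree = d + 1 := ⟨r.totalDegree - 1, by omega⟩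
    rw [hd] at h1
    have := degree_of_PD (d := d) (PD_mono (by push_cast; linarith) h1)
    omega

namespace FF
variable {r : R2} {K : Type} [Field K] [Algebra ℚ K] (S : FF r K)

theorem Fil_R0 (l : R2) (hl : GoodLine r l) (t : ℤ) (F : R2) (h : S.π l * S.π F ∈ S.Fil (t + 1)) :
    S.π F ∈ S.Fil t := by
  obtain ⟨H, hH, hH2⟩ := S.mem_Fil.mp h
  obtain ⟨F', hF', hd⟩ := R0 r l hl.1 hl.2.1 hl.2.2 t H hH (F.totalDegree + 1) F
    (PD_mono (by push_cast; linarith) (PD_of_degree F))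
    ((S.ker _).mp (by rw [map_sub, map_mul, hH2, sub_self]))
  have := (S.ker _).mpr hd
  rw [map_sub, sub_eq_zero] at this
  rw [this]
  exact S.Fil_π hF'

theorem Fil_R0_pow (l : R2) (hl : GoodLine r l) (N : ℕ) : ∀ (t : ℤ) (F : R2), S.π l ^ N * S.π F ∈ S.Fil (t + N) →
    S.π F ∈ S.Fil t := by
  induction N with
  | zero => intro t F h; simpa using h
  | succ N ih =>
    intro t F h
    apply S.Fil_R0 l hl
    rw [← map_mul]
    apply ih
    refine S.Fil_congr h (by push_cast; ring) ?_
    rw [map_mul]; ring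

theorem Gam_R1 (l : R2) (hl : GoodLine r l) {D d : ℤ} {f : K} (M : ℕ) (h1 : S.Gam D f)
    (h2 : S.Gam (d + M) (S.π l ^ M * f)) : S.Gam d f := by
  obtain ⟨g, hg, m, H⟩ := h1
  obtain ⟨g', hg', m', H'⟩ := h2
  refine ⟨g * g', mul_ne_zero hg hg', m + m', fun i => ?_⟩
  have h3 := S.Fil_mul (H i) (H' 0)
  obtain ⟨F, hF, hF2⟩ := S.mem_Fil.mp h3
  have h4 := S.Fil_mul (H 0) (H' i)
  rw [pow_zero, mul_one] at hF2
  have e : g * f ^ i * g' = g * g' * f ^ i := by ring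
  rw [e] at hF2
  rw [← hF2]
  apply S.Fil_R0_pow l hl (M * i)
  rw [hF2]
  refine S.Fil_congr h4 (by push_cast; ring) ?_
  rw [mul_pow, ← pow_mul]; ring
end FF

end

section
open MvPolynomial

namespace FF
variable {r : R2} {K : Type} [Field K] [Algebra ℚ K] (S : FF r K)

theorem Gam_D {d : ℤ} {f : K} (hf : S.Gam d f) : S.Gam (d + (r.totalDegree : ℤ) - 2) (S.D f) := by
  have := S.Gam_nab 1 S.good_one hf
  unfold nab at this
  rwa [Derivation.map_one_eq_zero, mul_zero, zero_mul, sub_zero, one_mul] at this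

theorem Gam_congr {d d' : ℤ} {x y : K} (hx : S.Gam d x) (h : d = d') (hy : x = y) : S.Gam d' y := by
  subst h; subst hy; exact hx

theorem omega_key (P : K) (hP : S.Good P) (hP' : S.Gam ((r.totalDegree : ℤ) - 1) (S.D P))
    (k k' : ℕ) (hk' : 0 < k') (hk : 0 < k) (φ ψ Y : K) (hφ : φ ≠ 0) (hψ : ψ ≠ 0)
    (hψΓ : S.Gam k' ψ) (h1 : (k : K) * S.D ψ * φ = k' * S.D φ * ψ)
    (hY : S.D P * S.D (P * S.D φ - k * S.D P * φ) - S.D (S.D P) * (P * S.D φ - k * S.D P * φ) = k * Y) :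
    S.Gam (3 * (r.totalDegree : ℤ) - 5 + 2 * k') (Y * (ψ ^ 2 / φ)) := by
  have hcz : CharZero K := algebraRat.charZero K
  have hk0 : (k : K) ≠ 0 := by exact_mod_cast hk.ne'
  have hk0' : (k' : K) ≠ 0 := by exact_mod_cast hk'.ne'
  set e : ℤ := (r.totalDegree : ℤ) with he
  set h := S.nab P k' ψ with hh
  have hhΓ : S.Gam (k' + e - 2) h := S.Gam_nab P hP hψΓ
  have hψ'Γ := S.Gam_D hψΓ
  have hh'Γ := S.Gam_D hhΓ
  have hP''Γ := S.Gam_D hP'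
  rw [← he] at hψ'Γ hh'Γ hP''Γ
  set H := P * S.D φ - k * S.D P * φ with hH
  have h2 : (k' : K) * ψ * H = k * φ * h := by
    rw [hH, hh]; unfold nab
    push_cast
    linear_combination (-P) * h1
  have h3 : (k' : K) * (S.D ψ * H + ψ * S.D H) = k * (S.D φ * h + φ * S.D h) := by
    have h4 := congrArg S.D h2
    simp only [Derivation.leibniz, smul_eq_mul, Derivation.map_natCast] at h4
    linear_combination h4
  have main : (k' : K) ^ 2 * (Y * (ψ ^ 2 / φ)) = ((k : K) - k') * (S.D P * S.D ψ * h) + k' * (S.D P * ψ * S.D h)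
      - k' * (S.D (S.D P) * ψ * h) := by
    have h5 : (k : K) * φ * ((k' : K) ^ 2 * (Y * (ψ ^ 2 / φ))) = k * φ * (((k : K) - k') * (S.D P * S.D ψ * h) + k' * (S.D P * ψ * S.D h)
      - k' * (S.D (S.D P) * ψ * h)) := by
      have e1 : (k : K) * φ * ((k' : K) ^ 2 * (Y * (ψ ^ 2 / φ))) = k'^2 * ψ^2 * (k * Y) := by
        field_simp
      rw [e1, ← hY]
      linear_combination (k' * ψ * S.D P) * h3 - (k' * S.D P * S.D ψ + k' * S.D (S.D P) * ψ) * h2 - (k * S.D P * h) * h1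
    exact mul_left_cancel₀ (mul_ne_zero hk0 hφ) h5
  have hfin : S.Gam (3 * e - 5 + 2 * k') ((k' : K) ^ 2 * (Y * (ψ ^ 2 / φ))) := by
    rw [main]
    refine S.Gam_sub (S.Gam_add ?_ ?_) ?_
    · have := S.Gam_int ((k : ℤ) - k') (S.Gam_mul (S.Gam_mul hP' hψ'Γ) hhΓ)
      exact S.Gam_congr this (by ring) (by push_cast; ring)
    · have := S.Gam_nat k' (S.Gam_mul (S.Gam_mul hP' hψΓ) hh'Γ)
      exact S.Gam_congr this (by ring) rfl
    · have := S.Gam_nat k' (S.Gam_mul (S.Gam_mul hP''Γ hψΓ) hhΓ)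
      exact S.Gam_congr this (by ring) rfl
  have h6 := S.Gam_smul (((k' : ℚ) ^ 2)⁻¹) hfin
  refine S.Gam_congr h6 rfl ?_
  rw [map_inv₀, map_pow, map_natCast]
  field_simp

/-- the degeneracy determinant -/
noncomputable def XX (k : ℕ) : K :=
  S.π (X 0) * S.D (S.π (X 0)) * (((k : K) - 1) * S.D (S.π (X 1)) ^ 2 + S.π (X 1) * S.D (S.D (S.π (X 1))))
  - S.π (X 1) * S.D (S.π (X 1)) * (((k : K) - 1) * S.D (S.π (X 0)) ^ 2 + S.π (X 0) * S.D (S.D (S.π (X 0))))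

theorem pi_phi (k : ℕ) (n : ℤ) : S.π (phi2 k n) = S.π (X 1) ^ k + (n : K) - S.π (X 0) ^ k := by
  unfold phi2
  rw [map_sub, map_add, map_pow, map_pow, S.π_int]

theorem psi_deriv {k k' : ℕ} (hk : 0 < k) (hk' : 0 < k') {φ ψ : K} (hφ : φ ≠ 0) (hψ : ψ ≠ 0) (q : ℚ)
    (h : ψ ^ k = algebraMap ℚ K q * φ ^ k') : (k : K) * S.D ψ * φ = k' * S.D φ * ψ := by
  have h1 := congrArg S.D h
  simp only [Derivation.leibniz, Derivation.leibniz_pow, smul_eq_mul, nsmul_eq_mul, Derivation.map_algebraMap, mul_zero, add_zero] at h1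
  have e1 : ψ ^ k = ψ ^ (k - 1) * ψ := by rw [← pow_succ]; congr 1; omega
  have e2 : φ ^ k' = φ ^ (k' - 1) * φ := by rw [← pow_succ]; congr 1; omega
  rw [e1, e2] at h
  apply mul_left_cancel₀ (pow_ne_zero (k - 1) hψ)
  linear_combination φ * h1 - (k' : K) * S.D φ * h

theorem psi_Gam {k k' : ℕ} (hk : 0 < k) (n : ℤ) {ψ : K} (q : ℚ)
    (h : ψ ^ k = algebraMap ℚ K q * S.π (phi2 k n) ^ k') : S.Gam k' ψ := by
  apply S.Gam_root hk
  rw [h]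
  have h1 : phi2 k n ∈ PD k := PD_mono (by exact_mod_cast phi2_degree k n) (PD_of_degree _)
  exact S.Gam_congr (S.Gam_smul q (S.Gam_of_Fil (S.Fil_pow (S.Fil_π h1) k'))) rfl rfl

theorem Gam_b : S.Gam 1 (S.π (X 0)) := S.Gam_of_Fil (S.Fil_π (PD_X 0))
theorem Gam_c : S.Gam 1 (S.π (X 1)) := S.Gam_of_Fil (S.Fil_π (PD_X 1))

theorem Gam_Db : S.Gam ((r.totalDegree : ℤ) - 1) (S.D (S.π (X 0))) :=
  S.Gam_congr (S.Gam_D S.Gam_b) (by ring) rfl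
theorem Gam_Dc : S.Gam ((r.totalDegree : ℤ) - 1) (S.D (S.π (X 1))) :=
  S.Gam_congr (S.Gam_D S.Gam_c) (by ring) rfl

theorem XX_zero (hr : r ≠ 0) (k k' : ℕ) (n : ℤ) (hn : n ≠ 0) (hk : 2 ≤ k) (hk' : 0 < k') (ψ : K) (q : ℚ) (hq : q ≠ 0)
    (hφ : S.π (phi2 k n) ≠ 0)
    (h : ψ ^ k = algebraMap ℚ K q * S.π (phi2 k n) ^ k')
    (hnum : 3 * (r.totalDegree : ℤ) - 3 + 2 * k' - k < 0) : S.XX k = 0 := by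
  have hcz : CharZero K := algebraRat.charZero K
  have hq0 : algebraMap ℚ K q ≠ 0 := by
    rw [Ne, map_eq_zero]; exact hq
  have hψ : ψ ≠ 0 := by
    rintro rfl
    rw [zero_pow (by omega)] at h
    exact mul_ne_zero hq0 (pow_ne_zero _ hφ) h.symm
  have hψΓ := S.psi_Gam (by omega) n q h
  have h1 := S.psi_deriv (by omega) hk' hφ hψ q h
  have ephi := S.pi_phi k n
  set φ := S.π (phi2 k n) with hφd
  set b := S.π (X 0) with hb
  set c := S.π (X 1) with hc
  obtain ⟨j, rfl⟩ : ∃ j, k = j + 2 := ⟨k - 2, by omega⟩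
  have hDφ : S.D φ = ((j : K) + 2) * c ^ (j + 1) * S.D c - ((j : K) + 2) * b ^ (j + 1) * S.D b := by
    rw [ephi]
    simp only [map_sub, map_add, Derivation.leibniz_pow, smul_eq_mul, nsmul_eq_mul, Derivation.map_intCast]
    have : j + 2 - 1 = j + 1 := by omega
    rw [this]
    push_cast; ring
  set Ω := S.XX (j + 2) * (ψ ^ 2 / φ) with hΩ
  have hYc : S.Gam (3 * (r.totalDegree : ℤ) - 5 + 2 * k') (c ^ j * S.XX (j + 2) * (ψ ^ 2 / φ)) := by
    apply S.omega_key b S.good_b S.Gam_Db (j + 2) k' hk' (by omega) φ ψ _ hφ hψ hψΓ h1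
    have e1 : b * S.D φ - ((j + 2 : ℕ) : K) * S.D b * φ = ((j : K) + 2) * (c ^ (j + 1) * (b * S.D c - S.D b * c) - (n : K) * S.D b) := by
      rw [hDφ, ephi]; push_cast; ring
    rw [e1]
    unfold XX
    rw [← hb, ← hc]
    simp only [map_sub, map_add, Derivation.leibniz, Derivation.leibniz_pow, smul_eq_mul, nsmul_eq_mul, Derivation.map_intCast, Derivation.map_natCast]
    have e2 : S.D (2 : K) = 0 := by exact_mod_cast S.D.map_natCast 2
    rw [e2]
    simp only [Nat.add_sub_cancel]
    push_cast
    ring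
  have hYb : S.Gam (3 * (r.totalDegree : ℤ) - 5 + 2 * k') (b ^ j * S.XX (j + 2) * (ψ ^ 2 / φ)) := by
    apply S.omega_key c S.good_c S.Gam_Dc (j + 2) k' hk' (by omega) φ ψ _ hφ hψ hψΓ h1
    have e1 : c * S.D φ - ((j + 2 : ℕ) : K) * S.D c * φ = ((j : K) + 2) * (b ^ (j + 1) * (b * S.D c - S.D b * c) - (n : K) * S.D c) := by
      rw [hDφ, ephi]; push_cast; ring
    rw [e1]
    unfold XX
    rw [← hb, ← hc]
    simp only [map_sub, map_add, Derivation.leibniz, Derivation.leibniz_pow, smul_eq_mul, nsmul_eq_mul, Derivation.map_intCast, Derivation.map_natCast]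
    have e2 : S.D (2 : K) = 0 := by exact_mod_cast S.D.map_natCast 2
    rw [e2]
    simp only [Nat.add_sub_cancel]
    push_cast
    ring
  set E := 3 * (r.totalDegree : ℤ) - 5 + 2 * k' with hE
  have hYc' : S.Gam E (c ^ j * Ω) := S.Gam_congr hYc rfl (by rw [hΩ]; ring)
  have hYb' : S.Gam E (b ^ j * Ω) := S.Gam_congr hYb rfl (by rw [hΩ]; ring)
  -- some bound
  have hXany : ∃ D1, S.Gam D1 (S.XX (j + 2)) := by
    have hD2b := S.Gam_D S.Gam_Db
    have hD2c := S.Gam_D S.Gam_Dc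
    refine ⟨1 + ((r.totalDegree : ℤ) - 1) + (2 * ((r.totalDegree : ℤ) - 1)), ?_⟩
    unfold XX
    refine S.Gam_sub (S.Gam_mul (S.Gam_mul S.Gam_b S.Gam_Db) (S.Gam_add ?_ ?_)) (S.Gam_mul (S.Gam_mul S.Gam_c S.Gam_Dc) (S.Gam_add ?_ ?_))
    · exact S.Gam_congr (S.Gam_int ((j + 2 : ℕ) - 1 : ℤ) (S.Gam_pow S.Gam_Dc 2)) (by push_cast; ring) (by push_cast; ring)
    · exact S.Gam_congr (S.Gam_mul S.Gam_c hD2c) (by ring) rfl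
    · exact S.Gam_congr (S.Gam_int ((j + 2 : ℕ) - 1 : ℤ) (S.Gam_pow S.Gam_Db 2)) (by push_cast; ring) (by push_cast; ring)
    · exact S.Gam_congr (S.Gam_mul S.Gam_b hD2b) (by ring) rfl
  obtain ⟨D1, hD1⟩ := hXany
  have hφΩ : S.Gam (D1 + k' * 2) (φ * Ω) := by
    refine S.Gam_congr (S.Gam_mul hD1 (S.Gam_pow hψΓ 2)) rfl ?_
    rw [hΩ]; field_simp
  have hΩany : S.Gam (max (D1 + k' * 2) (2 + E)) Ω := by
    have h2 : S.Gam (max (D1 + k' * 2) (2 + E)) ((n : K) * Ω) := by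
      have e : (n : K) * Ω = φ * Ω - c ^ 2 * (c ^ j * Ω) + b ^ 2 * (b ^ j * Ω) := by
        rw [ephi]; ring
      rw [e]
      refine S.Gam_add (S.Gam_sub (S.Gam_mono (le_max_left _ _) hφΩ) (S.Gam_mono (le_max_right _ _) ?_)) (S.Gam_mono (le_max_right _ _) ?_)
      · exact S.Gam_congr (S.Gam_mul (S.Gam_pow S.Gam_c 2) hYc') (by push_cast; ring) rfl
      · exact S.Gam_congr (S.Gam_mul (S.Gam_pow S.Gam_b 2) hYb') (by push_cast; ring) rfl
    have h3 := S.Gam_smul ((n : ℚ)⁻¹) h2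
    refine S.Gam_congr h3 rfl ?_
    rw [map_inv₀, map_intCast]
    have : (n : K) ≠ 0 := by exact_mod_cast hn
    field_simp
  obtain ⟨μ, hμ⟩ := exists_goodLine r hr
  have hfin : S.Gam (E - j) Ω := by
    apply S.Gam_R1 _ hμ (2 * j) hΩany
    have e0 : S.π (X 0 - C μ * X 1) = b + (-(algebraMap ℚ K μ)) * c := by
      rw [map_sub, map_mul, S.π_C]; ring
    rw [e0, add_pow, Finset.sum_mul]
    apply S.Gam_sum
    intro i hi
    have hi' : i ≤ 2 * j := by
      have := Finset.mem_range.mp hi; omega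
    by_cases hij : j ≤ i
    · have h4 := S.Gam_nat ((2 * j).choose i) (S.Gam_smul ((-μ) ^ (2 * j - i)) (S.Gam_mul (S.Gam_mul (S.Gam_pow S.Gam_b (i - j)) (S.Gam_pow S.Gam_c (2 * j - i))) hYb'))
      refine S.Gam_congr h4 ?_ ?_
      · push_cast [Nat.cast_sub hij, Nat.cast_sub hi']; ring
      · have e3 : b ^ i = b ^ (i - j) * b ^ j := by rw [← pow_add]; congr 1; omega
        rw [e3, mul_pow, map_pow, map_neg]; ring
    · have hij2 : j ≤ 2 * j - i := by omega
      have h4 := S.Gam_nat ((2 * j).choose i) (S.Gam_smul ((-μ) ^ (2 * j - i)) (S.Gam_mul (S.Gam_mul (S.Gam_pow S.Gam_b i) (S.Gam_pow S.Gam_c (2 * j - i - j))) hYc'))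
      refine S.Gam_congr h4 ?_ ?_
      · push_cast [Nat.cast_sub hij2, Nat.cast_sub hi']; ring
      · have e3 : c ^ (2 * j - i) = c ^ (2 * j - i - j) * c ^ j := by rw [← pow_add]; congr 1; omega
        rw [mul_pow, e3, map_pow, map_neg]; ring
  have hz := S.Gam_neg (by rw [hE]; push_cast at hnum; linarith) hfin
  rw [hΩ] at hz
  rcases mul_eq_zero.mp hz with h5 | h5
  · exact h5
  · exact absurd h5 (div_ne_zero (pow_ne_zero _ hψ) hφ)

/-- linear case -/
theorem lin_contra (l : R2) (hl : GoodLine r l) (he : r.totalDegree = 1) (k k' : ℕ) (n : ℤ) (hk' : 0 < k') (hkk : k' < k)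
    (α β : ℚ) (hα : α ≠ 0) (hβ : β ≠ 0) (hφ : S.π (phi2 k n) = algebraMap ℚ K α * S.π l ^ k + algebraMap ℚ K β)
    (hφ0 : S.π (phi2 k n) ≠ 0) (hDl : S.D (S.π l) ≠ 0)
    (ψ : K) (q : ℚ) (hq : q ≠ 0)
    (h : ψ ^ k = algebraMap ℚ K q * S.π (phi2 k n) ^ k') : False := by
  have hcz : CharZero K := algebraRat.charZero K
  have hq0 : algebraMap ℚ K q ≠ 0 := by
    rw [Ne, map_eq_zero]; exact hq
  have hψ : ψ ≠ 0 := by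
    rintro rfl
    rw [zero_pow (by omega)] at h
    exact mul_ne_zero hq0 (pow_ne_zero _ hφ0) h.symm
  have hψΓ := S.psi_Gam (by omega) n q h
  have h1 := S.psi_deriv (by omega) hk' hφ0 hψ q h
  set φ := S.π (phi2 k n) with hφd
  set t := S.π l with ht
  have hlPD : l ∈ PD 1 := by
    have := PD_of_degree l
    rwa [hl.2.1.totalDegree hl.1.ne_zero] at this
  have htΓ : S.Gam 1 t := S.Gam_of_Fil (S.Fil_π hlPD)
  have hα0 : algebraMap ℚ K α ≠ 0 := by
    rw [Ne, map_eq_zero]; exact hα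
  have hβ0 : algebraMap ℚ K β ≠ 0 := by
    rw [Ne, map_eq_zero]; exact hβ
  have hk0 : (k : K) ≠ 0 := by exact_mod_cast (by omega : k ≠ 0)
  have hk0' : (k' : K) ≠ 0 := by exact_mod_cast (by omega : k' ≠ 0)
  obtain ⟨j, rfl⟩ : ∃ j, k = j + 1 := ⟨k - 1, by omega⟩
  have hDφ : S.D φ = algebraMap ℚ K α * (((j + 1 : ℕ) : K) * t ^ j * S.D t) := by
    rw [hφ]
    simp only [map_add, Derivation.leibniz, Derivation.leibniz_pow, smul_eq_mul, nsmul_eq_mul, Derivation.map_algebraMap, Nat.add_sub_cancel]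
    ring
  set Ω := S.D t * ψ / φ with hΩ
  have hDψ := S.Gam_D hψΓ
  have hDt := S.Gam_D htΓ
  rw [he] at hDψ hDt
  have hjΩ : S.Gam (k' - 1) (t ^ j * Ω) := by
    have h2 := S.Gam_smul (((k' : ℚ) * α)⁻¹) hDψ
    refine S.Gam_congr h2 (by push_cast; ring) ?_
    rw [map_inv₀, map_mul, map_natCast, hΩ]
    rw [hDφ] at h1
    have h3 : S.D ψ * φ = k' * algebraMap ℚ K α * (t ^ j * S.D t * ψ) := by
      apply mul_left_cancel₀ hk0
      linear_combination h1
    field_simp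
    linear_combination h3
  have hany : S.Gam (k' + 1) Ω := by
    have h2 : S.Gam (k' + 1) (algebraMap ℚ K β * Ω) := by
      have e : algebraMap ℚ K β * Ω = S.D t * ψ - algebraMap ℚ K α * (t * (t ^ j * Ω)) := by
        have : φ * Ω = S.D t * ψ := by rw [hΩ]; field_simp
        rw [← this, hφ]; ring
      rw [e]
      refine S.Gam_sub ?_ (S.Gam_smul α ?_)
      · exact S.Gam_mono (by push_cast; linarith) (S.Gam_mul hDt hψΓ)
      · exact S.Gam_mono (by push_cast; linarith) (S.Gam_mul htΓ hjΩ)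
    have h3 := S.Gam_smul (β⁻¹) h2
    refine S.Gam_congr h3 rfl ?_
    rw [map_inv₀]; field_simp
  have hfin : S.Gam (k' - 1 - j) Ω := S.Gam_R1 l hl j hany (S.Gam_congr hjΩ (by ring) rfl)
  have hz := S.Gam_neg (by push_cast; have : (k' : ℤ) < j + 1 := by exact_mod_cast hkk
                           linarith) hfin
  exact div_ne_zero (mul_ne_zero hDl hψ) hφ0 hz
end FF

end

section
open MvPolynomial

/-- tangential derivation along the curve -/
noncomputable def del (r : R2) (i j : Fin 2) (F : R2) : R2 := pderiv j r * pderiv i F - pderiv i r * pderiv j F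

theorem del_mul (r : R2) (i j : Fin 2) (F G : R2) : del r i j (F * G) = F * del r i j G + G * del r i j F := by
  unfold del
  rw [Derivation.leibniz, Derivation.leibniz]
  simp only [smul_eq_mul]; ring

theorem del_add (r : R2) (i j : Fin 2) (F G : R2) : del r i j (F + G) = del r i j F + del r i j G := by
  unfold del
  rw [map_add, map_add]; ring

theorem del_self (r : R2) (i j : Fin 2) : del r i j r = 0 := by
  unfold del; ring

theorem eval_sub_mem (z : Fin 2 → ℚ) (F : R2) : F - C (eval z F) ∈ RingHom.ker (eval z) := by
  rw [RingHom.mem_ker, map_sub, eval_C, sub_self]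

theorem taylor2 (z : Fin 2 → ℚ) (i j : Fin 2) (hij : i ≠ j) (F : R2) :
    F - (C (eval z F) + C (eval z (pderiv i F)) * (X i - C (z i)) + C (eval z (pderiv j F)) * (X j - C (z j)))
      ∈ (RingHom.ker (eval z)) ^ 2 := by
  have hX : ∀ l : Fin 2, (X l - C (z l) : R2) ∈ RingHom.ker (eval z) := by
    intro l; rw [RingHom.mem_ker]; simp
  induction F using MvPolynomial.induction_on with
  | C a => simp
  | add F G hF hG =>
    have := Ideal.add_mem _ hF hG
    convert this using 1
    simp only [map_add]; ring
  | mul_X F l hF =>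
    have h1 : ∀ d : ℚ, ∀ a b : R2, a ∈ RingHom.ker (eval z) → b ∈ RingHom.ker (eval z) → C d * (a * b) ∈ (RingHom.ker (eval z)) ^ 2 := by
      intro d a b ha hb
      rw [pow_two]
      exact Ideal.mul_mem_left _ _ (Ideal.mul_mem_mul ha hb)
    have h2 := Ideal.mul_mem_right (X l) _ hF
    have hl : l = i ∨ l = j := by omega
    rcases hl with rfl | rfl
    · have h3 := h1 (eval z (pderiv l F)) _ _ (hX l) (hX l)
      have h4 := h1 (eval z (pderiv j F)) _ _ (hX j) (hX l)
      have := Ideal.add_mem _ (Ideal.add_mem _ h2 h3) h4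
      convert this using 1
      simp only [Derivation.leibniz, pderiv_X_self, pderiv_X_of_ne hij, smul_eq_mul, map_mul, map_add, eval_X, map_one, map_zero, mul_zero]
      ring
    · have h3 := h1 (eval z (pderiv l F)) _ _ (hX l) (hX l)
      have h4 := h1 (eval z (pderiv i F)) _ _ (hX i) (hX l)
      have := Ideal.add_mem _ (Ideal.add_mem _ h2 h3) h4
      convert this using 1
      simp only [Derivation.leibniz, pderiv_X_self, pderiv_X_of_ne hij.symm, smul_eq_mul, map_mul, map_add, eval_X, map_one, map_zero, mul_zero]
      ring

theorem del_pow_mem (r : R2) (i j : Fin 2) (m : Ideal R2) (l : ℕ) : ∀ F ∈ m ^ (l + 1), del r i j F ∈ m ^ l := by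
  induction l with
  | zero => intro F _; simp
  | succ l ih =>
    intro F hF
    rw [pow_succ'] at hF
    refine Submodule.mul_induction_on hF ?_ ?_
    · intro a ha y hy
      rw [del_mul]
      refine Ideal.add_mem _ ?_ (Ideal.mul_mem_right _ _ hy)
      rw [pow_succ']
      exact Ideal.mul_mem_mul ha (ih y hy)
    · intro x y hx hy
      rw [del_add]; exact Ideal.add_mem _ hx hy

theorem uniq_aux (r : R2) (hr : Irreducible r) (A : Type) [CommRing A] [IsDomain A] [IsNoetherianRing A]
    (q : R2 →+* A) (hq : Function.Surjective q) (hqk : ∀ F, q F = 0 ↔ r ∣ F) (z : Fin 2 → ℚ) (i j : Fin 2) (hij : i ≠ j) (hz : eval z r = 0)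
    (hrj : eval z (pderiv j r) ≠ 0) (F G H : R2) (hG : eval z G ≠ 0) (hF : eval z F = 0)
    (h : r ∣ G * del r i j F - H * F) : r ∣ F := by
  set m : Ideal R2 := RingHom.ker (eval z) with hm
  set I : Ideal R2 := Ideal.span {r} with hI
  have hrI : r ∈ I := Ideal.subset_span rfl
  have hIdvd : ∀ F, F ∈ I ↔ r ∣ F := fun F => Ideal.mem_span_singleton
  have hp : Prime r := hr.prime
  have hmq : ∀ (l : ℕ) (F : R2), F ∈ m ^ l ⊔ I ↔ q F ∈ (m.map q) ^ l := by
    intro l F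
    rw [← Ideal.map_pow, Ideal.mem_map_iff_of_surjective q hq]
    constructor
    · intro hF
      obtain ⟨x, hx, y, hy, rfl⟩ := Submodule.mem_sup.mp hF
      refine ⟨x, hx, ?_⟩
      rw [map_add, (hqk y).mpr ((hIdvd y).mp hy), add_zero]
    · rintro ⟨x, hx, hxF⟩
      have e : F = x + (F - x) := by ring
      rw [e]
      refine Ideal.add_mem _ (Ideal.mem_sup_left hx) (Ideal.mem_sup_right ?_)
      rw [hIdvd, ← hqk, map_sub, hxF, sub_self]
  have hntop : m.map q ≠ ⊤ := by
    intro h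
    have h1 : (1 : R2) ∈ m ^ 1 ⊔ I := by
      rw [hmq, pow_one, h]; trivial
    have h2 : m ^ 1 ⊔ I ≤ m := by
      rw [pow_one]
      refine sup_le le_rfl ?_
      rw [hI, Ideal.span_singleton_le_iff_mem]; exact hz
    have := h2 h1
    rw [hm, RingHom.mem_ker, map_one] at this
    exact one_ne_zero this
  have hkrull : ∀ F, (∀ l, F ∈ m ^ l ⊔ I) → r ∣ F := by
    intro F hF
    have h1 := Ideal.iInf_pow_eq_bot_of_isDomain _ hntop
    have h2 : q F ∈ (⨅ l : ℕ, (m.map q) ^ l) := by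
      rw [Ideal.mem_iInf]
      intro l; exact (hmq l F).mp (hF l)
    rw [h1, Ideal.mem_bot, hqk] at h2
    exact h2
  set τ : R2 := X i - C (z i) with hτ
  have hτm : τ ∈ m := by rw [hm, RingHom.mem_ker, hτ]; simp
  have base : ∀ F ∈ m, ∃ u : ℚ, F - C u * τ ∈ m ^ 2 ⊔ I := by
    intro F hF
    have hF0 : eval z F = 0 := hF
    refine ⟨eval z (pderiv i F) - eval z (pderiv j F) * (eval z (pderiv i r) / eval z (pderiv j r)), ?_⟩
    have h1 := taylor2 z i j hij F
    have h2 := taylor2 z i j hij r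
    rw [hF0] at h1
    rw [hz] at h2
    have h3 : ∀ x ∈ m ^ 2, x ∈ m ^ 2 ⊔ I := fun x hx => Ideal.mem_sup_left hx
    have h4 := Ideal.add_mem _ (Ideal.sub_mem _ (h3 _ h1) (Ideal.mul_mem_left _ (C (eval z (pderiv j F) / eval z (pderiv j r))) (h3 _ h2)))
      (Ideal.mul_mem_left _ (C (eval z (pderiv j F) / eval z (pderiv j r))) (Ideal.mem_sup_right hrI : r ∈ m ^ 2 ⊔ I))
    convert h4 using 1
    have e1 : (C (eval z (pderiv j F)) : R2) = C (eval z (pderiv j F) / eval z (pderiv j r)) * C (eval z (pderiv j r)) := by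
      rw [← C_mul]; congr 1; field_simp
    have e2 : (C (eval z (pderiv i F) - eval z (pderiv j F) * (eval z (pderiv i r) / eval z (pderiv j r))) : R2)
      = C (eval z (pderiv i F)) - C (eval z (pderiv j F) / eval z (pderiv j r)) * C (eval z (pderiv i r)) := by
      rw [← C_mul, ← C_sub]; congr 1; field_simp
    rw [e2, C_0]
    rw [e1]
    ring
  have expand : ∀ l : ℕ, ∀ F ∈ m ^ l, ∃ u : ℚ, F - C u * τ ^ l ∈ m ^ (l + 1) ⊔ I := by
    intro l
    induction l with
    | zero =>
      intro F _
      refine ⟨eval z F, ?_⟩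
      rw [pow_zero, mul_one, zero_add, pow_one]
      exact Ideal.mem_sup_left (eval_sub_mem z F)
    | succ l ih =>
      intro F hF
      rw [pow_succ'] at hF
      refine Submodule.mul_induction_on hF ?_ ?_
      · intro a ha y hy
        obtain ⟨u, hu⟩ := base a ha
        obtain ⟨v, hv⟩ := ih y hy
        refine ⟨u * v, ?_⟩
        have e : a * y - C (u * v) * τ ^ (l + 1) = (a - C u * τ) * y + C u * (τ * (y - C v * τ ^ l)) := by
          rw [C_mul]; ring
        rw [e]
        have e2 : q y ∈ (m.map q) ^ l := (hmq l y).mp (Ideal.mem_sup_left hy)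
        have e3 : q τ ∈ (m.map q) ^ 1 := (hmq 1 τ).mp (by rw [pow_one]; exact Ideal.mem_sup_left hτm)
        rw [hmq] at hu hv
        rw [hmq, map_add, map_mul, map_mul, map_mul]
        refine Ideal.add_mem _ ?_ (Ideal.mul_mem_left _ _ ?_)
        · have := Ideal.mul_mem_mul hu e2
          rw [← pow_add] at this
          convert this using 2; ring
        · have := Ideal.mul_mem_mul e3 hv
          rw [← pow_add] at this
          convert this using 2; ring
      · rintro x y ⟨u, hu⟩ ⟨v, hv⟩
        refine ⟨u + v, ?_⟩
        have := Ideal.add_mem _ hu hv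
        convert this using 1
        rw [C_add]; ring
  have hτnot : ∀ l, τ ^ l ∉ m ^ (l + 1) ⊔ I := by
    intro l hl
    have h1 : m ^ l ≤ m ^ (l + 1) ⊔ I := by
      intro F hF
      obtain ⟨u, hu⟩ := expand l F hF
      have := Ideal.add_mem _ hu (Ideal.mul_mem_left _ (C u) hl)
      simpa using this
    have h2 : (m.map q) ^ l ≤ (m.map q) ^ (l + 1) := by
      rw [← Ideal.map_pow, Ideal.map_le_iff_le_comap]
      intro F hF
      rw [Ideal.mem_comap, ← hmq]; exact h1 hF
    have h3 : ∀ s, (m.map q) ^ l ≤ (m.map q) ^ (l + s) := by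
      intro s
      induction s with
      | zero => exact le_rfl
      | succ s ih =>
        refine ih.trans ?_
        rw [pow_add, show l + (s + 1) = (l + 1) + s by ring, pow_add _ (l + 1)]
        exact Ideal.mul_mono_left h2
    have h4 : r ∣ τ ^ l := by
      apply hkrull
      intro s
      rw [hmq]
      have h5 : q (τ ^ l) ∈ (m.map q) ^ l := (hmq l _).mp (Ideal.mem_sup_left (Ideal.pow_mem_pow hτm l))
      exact Ideal.pow_le_pow_right (by omega) (h3 s h5)
    have h5 : r ∣ τ := hp.dvd_of_dvd_pow h4
    obtain ⟨G', hG'⟩ := h5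
    have h6 := congrArg (fun F => eval z (pderiv j F)) hG'
    have h7 := congrArg (fun F => eval z (pderiv i F)) hG'
    simp only [hτ, map_sub, pderiv_X_of_ne hij, pderiv_X_self, pderiv_C, Derivation.leibniz, smul_eq_mul, map_add, map_mul, hz, map_zero, map_one, zero_mul, sub_zero, zero_add] at h6 h7
    have h8 : eval z G' = 0 := by
      rcases mul_eq_zero.mp h6.symm with h | h
      · exact h
      · exact absurd h hrj
    rw [h8, zero_mul] at h7
    exact one_ne_zero h7
  have step : ∀ l : ℕ, F ∈ m ^ (l + 1) ⊔ I → F ∈ m ^ (l + 1 + 1) ⊔ I := by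
    intro l hFl
    have hFl0 := hFl
    rw [sup_comm] at hFl
    obtain ⟨A0, hA, F1, hF1, hAF⟩ := Submodule.mem_sup.mp hFl
    obtain ⟨u, hu⟩ := expand (l + 1) F1 hF1
    have hFu : F - C u * τ ^ (l + 1) ∈ m ^ (l + 1 + 1) ⊔ I := by
      have := Ideal.add_mem _ hu (Ideal.mem_sup_right hA : A0 ∈ m ^ (l + 1 + 1) ⊔ I)
      convert this using 1
      rw [← hAF]; ring
    by_cases hu0 : u = 0
    · rw [hu0, C_0, zero_mul, sub_zero] at hFu; exact hFu
    exfalso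
    have hdel : ∀ x ∈ m ^ (l + 1 + 1) ⊔ I, del r i j x ∈ m ^ (l + 1) ⊔ I := by
      intro x hx
      obtain ⟨x1, hx1, x2, hx2, rfl⟩ := Submodule.mem_sup.mp hx
      rw [del_add]
      refine Ideal.add_mem _ (Ideal.mem_sup_left (del_pow_mem r i j m (l + 1) x1 hx1)) (Ideal.mem_sup_right ?_)
      obtain ⟨y, rfl⟩ := (hIdvd x2).mp hx2
      rw [del_mul, del_self, mul_zero, add_zero]
      exact Ideal.mul_mem_right _ _ hrI
    have h1 := hdel _ hFu
    have e1 : del r i j (F - C u * τ ^ (l + 1)) = del r i j F - C (u * ((l + 1 : ℕ) : ℚ)) * τ ^ l * pderiv j r := by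
      unfold del
      simp only [map_sub, Derivation.leibniz, Derivation.leibniz_pow, hτ, pderiv_X_self, pderiv_X_of_ne hij, pderiv_C, smul_eq_mul, nsmul_eq_mul, C_mul, Nat.add_sub_cancel, map_natCast]
      ring
    rw [e1] at h1
    have h2 : G * del r i j F ∈ m ^ (l + 1) ⊔ I := by
      have h3 : G * del r i j F - H * F ∈ m ^ (l + 1) ⊔ I := Ideal.mem_sup_right ((hIdvd _).mpr h)
      have := Ideal.add_mem _ h3 (Ideal.mul_mem_left _ H hFl0)
      simpa using this
    have h4 := Ideal.sub_mem _ h2 (Ideal.mul_mem_left _ G h1)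
    have h5 : (G * pderiv j r - C (eval z (G * pderiv j r))) * τ ^ l ∈ m ^ (l + 1) ⊔ I := by
      refine Ideal.mem_sup_left ?_
      rw [pow_succ']
      exact Ideal.mul_mem_mul (eval_sub_mem z _) (Ideal.pow_mem_pow hτm l)
    have h6 := Ideal.sub_mem _ h4 (Ideal.mul_mem_left _ (C (u * ((l + 1 : ℕ) : ℚ))) h5)
    set g0 := u * ((l + 1 : ℕ) : ℚ) * eval z (G * pderiv j r) with hg0
    have hg00 : g0 ≠ 0 := by
      rw [hg0, map_mul]
      refine mul_ne_zero (mul_ne_zero hu0 ?_) (mul_ne_zero hG hrj)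
      exact_mod_cast (by omega : l + 1 ≠ 0)
    apply hτnot l
    have h7 := Ideal.mul_mem_left _ (C g0⁻¹) h6
    convert h7 using 1
    have e3 : (C g0⁻¹ : R2) * (C (u * ((l + 1 : ℕ) : ℚ)) * C (eval z (G * pderiv j r))) = 1 := by
      rw [← C_mul, ← hg0, ← C_mul, inv_mul_cancel₀ hg00, C_1]
    linear_combination (-τ ^ l) * e3
  apply hkrull
  intro l
  have hall : ∀ l, F ∈ m ^ (l + 1) ⊔ I := by
    intro l
    induction l with
    | zero => rw [zero_add, pow_one]; exact Ideal.mem_sup_left hF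
    | succ l ih => exact step l ih
  rcases l with _ | l
  · rw [pow_zero]; rw [Ideal.one_eq_top]; exact Ideal.mem_sup_left trivial
  · exact hall l

theorem uniq (r : R2) (hr : Irreducible r) (z : Fin 2 → ℚ) (i j : Fin 2) (hij : i ≠ j) (hz : eval z r = 0)
    (hrj : eval z (pderiv j r) ≠ 0) (F G H : R2) (hG : eval z G ≠ 0) (hF : eval z F = 0)
    (h : r ∣ G * del r i j F - H * F) : r ∣ F := by
  have hp : Prime r := hr.prime
  have hI : (Ideal.span {r}).IsPrime := (Ideal.span_singleton_prime hp.ne_zero).mpr hp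
  refine uniq_aux r hr (R2 ⧸ Ideal.span {r}) (Ideal.Quotient.mk _) Ideal.Quotient.mk_surjective ?_ z i j hij hz hrj F G H hG hF h
  intro F
  rw [← Ideal.mem_span_singleton, ← Ideal.Quotient.eq_zero_iff_mem]

end

section
open MvPolynomial

/-- a positive rational point of the surface lying on the curve -/
def GoodPt (k : ℕ) (n : ℤ) (r : R2) (z : Fin 2 → ℚ) : Prop :=
  eval z r = 0 ∧ 0 < z 0 ∧ 0 < z 1 ∧ z 0 ≠ z 1 ∧ ∃ a : ℚ, 0 < a ∧ a ≠ z 1 ∧ a ^ k = z 1 ^ k + n - z 0 ^ k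

namespace FF
variable {r : R2} {K : Type} [Field K] [Algebra ℚ K] (S : FF r K)

theorem Gam_two (hr : r ≠ 0) {D E : ℤ} {Ω : K} (j : ℕ) (hany : S.Gam D Ω)
    (hb : S.Gam E (S.π (X 0) ^ j * Ω)) (hc : S.Gam E (S.π (X 1) ^ j * Ω)) : S.Gam (E - j) Ω := by
  obtain ⟨μ, hμ⟩ := exists_goodLine r hr
  apply S.Gam_R1 _ hμ (2 * j) hany
  have e0 : S.π (X 0 - C μ * X 1) = S.π (X 0) + (-(algebraMap ℚ K μ)) * S.π (X 1) := by
    rw [map_sub, map_mul, S.π_C]; ring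
  rw [e0, add_pow, Finset.sum_mul]
  apply S.Gam_sum
  intro i hi
  have hi' : i ≤ 2 * j := by
    have := Finset.mem_range.mp hi; omega
  by_cases hij : j ≤ i
  · have h4 := S.Gam_nat ((2 * j).choose i) (S.Gam_smul ((-μ) ^ (2 * j - i)) (S.Gam_mul (S.Gam_mul (S.Gam_pow S.Gam_b (i - j)) (S.Gam_pow S.Gam_c (2 * j - i))) hb))
    refine S.Gam_congr h4 ?_ ?_
    · push_cast [Nat.cast_sub hij, Nat.cast_sub hi']; ring
    · have e3 : S.π (X 0) ^ i = S.π (X 0) ^ (i - j) * S.π (X 0) ^ j := by rw [← pow_add]; congr 1; omega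
      rw [e3, mul_pow, map_pow, map_neg]; ring
  · have hij2 : j ≤ 2 * j - i := by omega
    have h4 := S.Gam_nat ((2 * j).choose i) (S.Gam_smul ((-μ) ^ (2 * j - i)) (S.Gam_mul (S.Gam_mul (S.Gam_pow S.Gam_b i) (S.Gam_pow S.Gam_c (2 * j - i - j))) hc))
    refine S.Gam_congr h4 ?_ ?_
    · push_cast [Nat.cast_sub hij2, Nat.cast_sub hi']; ring
    · have e3 : S.π (X 1) ^ (2 * j - i) = S.π (X 1) ^ (2 * j - i - j) * S.π (X 1) ^ j := by rw [← pow_add]; congr 1; omega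
      rw [mul_pow, e3, map_pow, map_neg]; ring

theorem dpi (F : R2) : S.D (S.π F) = S.π (del r 0 1 F) := S.dπ F

theorem degen_fermat (hr : Irreducible r) (k : ℕ) (hk : 2 ≤ k) (hX : S.XX k = 0) (z : Fin 2 → ℚ) (hz : eval z r = 0)
    (hz0 : z 0 ≠ 0) (hrc : eval z (pderiv 1 r) ≠ 0) :
    ∃ l : ℚ, r ∣ X 1 ^ k - C l * X 0 ^ k - C (z 1 ^ k - l * z 0 ^ k) := by
  have hcz : CharZero K := algebraRat.charZero K
  obtain ⟨j, rfl⟩ : ∃ j, k = j + 2 := ⟨k - 2, by omega⟩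
  set u : R2 := del r 0 1 (X 0 ^ (j + 2)) with hu
  set v : R2 := del r 0 1 (X 1 ^ (j + 2)) with hv
  have hu1 : u = C ((j : ℚ) + 2) * X 0 ^ (j + 1) * pderiv 1 r := by
    rw [hu]; unfold del
    simp only [Derivation.leibniz_pow, pderiv_X_self, pderiv_X_of_ne (show (0 : Fin 2) ≠ 1 by decide), smul_eq_mul, nsmul_eq_mul]
    have : j + 2 - 1 = j + 1 := by omega
    rw [this, C_add]
    have e1 : (C (j : ℚ) : R2) = (j : R2) := by simp
    have e2 : (C (2 : ℚ) : R2) = 2 := rfl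
    rw [e1, e2]
    push_cast; ring
  have hu0 : eval z u ≠ 0 := by
    rw [hu1, map_mul, map_mul, map_pow, eval_X, eval_C]
    refine mul_ne_zero (mul_ne_zero ?_ (pow_ne_zero _ hz0)) hrc
    positivity
  set l : ℚ := eval z v / eval z u with hl
  refine ⟨l, ?_⟩
  have hπu : S.π u = S.D (S.π (X 0) ^ (j + 2)) := by rw [hu, ← map_pow, S.dpi]
  have hπv : S.π v = S.D (S.π (X 1) ^ (j + 2)) := by rw [hv, ← map_pow, S.dpi]
  have h1 : r ∣ v - C l * u := by
    refine uniq r hr z 0 1 (by decide) hz hrc _ u (del r 0 1 u) hu0 ?_ ?_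
    · rw [map_sub, map_mul, eval_C, hl]; field_simp; ring
    · have hd1 : S.π (del r 0 1 u) = S.D (S.D (S.π (X 0) ^ (j + 2))) := by rw [← S.dpi, hπu]
      have hd2 : S.π (del r 0 1 (v - C l * u)) = S.D (S.D (S.π (X 1) ^ (j + 2))) - algebraMap ℚ K l * S.D (S.D (S.π (X 0) ^ (j + 2))) := by
        rw [← S.dpi, map_sub, map_mul, S.π_C, map_sub, Derivation.leibniz, hπu, hπv, Derivation.map_algebraMap, smul_zero, add_zero, smul_eq_mul]
      rw [← S.ker, map_sub, map_mul, map_mul, hd1, hd2, map_sub, map_mul, S.π_C, hπu, hπv]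
      have : S.XX (j + 2) = 0 := hX
      unfold XX at this
      have e1 : j + 2 - 1 = j + 1 := by omega
      simp only [map_pow, Derivation.leibniz, Derivation.leibniz_pow, smul_eq_mul, nsmul_eq_mul, Derivation.map_algebraMap, mul_zero, add_zero, e1, Nat.add_sub_cancel, Derivation.map_natCast]
      push_cast at this ⊢
      linear_combination (((j : K) + 2) ^ 2 * S.π (X 0) ^ j * S.π (X 1) ^ j) * this
  refine uniq r hr z 0 1 (by decide) hz hrc _ 1 0 (by simp) ?_ ?_
  · simp
  · have e : del r 0 1 (X 1 ^ (j + 2) - C l * X 0 ^ (j + 2) - C (z 1 ^ (j + 2) - l * z 0 ^ (j + 2))) = v - C l * u := by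
      rw [hu, hv]; unfold del
      simp only [map_sub, Derivation.leibniz, pderiv_C, smul_eq_mul]
      ring
    rw [e, zero_mul, sub_zero, one_mul]
    exact h1

theorem degen_linear (hr : Irreducible r) (k : ℕ) (hk : 2 ≤ k) (he : r.totalDegree < k) (hX : S.XX k = 0) (z : Fin 2 → ℚ) (hz : eval z r = 0)
    (hz0 : z 0 ≠ 0) (hz1 : z 1 ≠ 0) (hrc : eval z (pderiv 1 r) ≠ 0) :
    r ∣ X 1 - C (z 1) ∨ r ∣ X 1 - C (z 1 / z 0) * X 0 := by
  have hcz : CharZero K := algebraRat.charZero K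
  obtain ⟨l, hl⟩ := S.degen_fermat hr k hk hX z hz hz0 hrc
  set ν := z 1 ^ k - l * z 0 ^ k with hν
  have hp := hr.prime
  have split : ∀ B : R2, eval z B = z 1 → r ∣ X 1 ^ k - B ^ k → r ∣ X 1 - B := by
    intro B hB h
    rw [← (Commute.all _ _).mul_geom_sum₂] at h
    rcases hp.dvd_or_dvd h with h1 | h1
    · exact h1
    · exfalso
      obtain ⟨G, hG⟩ := h1
      have h2 := congrArg (eval z) hG
      rw [map_mul, hz, zero_mul, map_sum] at h2
      have h3 : ∀ i ∈ Finset.range k, eval z (X 1 ^ i * B ^ (k - 1 - i)) = z 1 ^ (k - 1) := by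
        intro i hi
        rw [map_mul, map_pow, map_pow, eval_X, hB, ← pow_add]
        congr 1
        have := Finset.mem_range.mp hi; omega
      rw [Finset.sum_congr rfl h3, Finset.sum_const, Finset.card_range, nsmul_eq_mul] at h2
      have h4 : (k : ℚ) ≠ 0 := by exact_mod_cast (by omega : k ≠ 0)
      exact mul_ne_zero h4 (pow_ne_zero _ hz1) h2
  by_cases hl0 : l = 0
  · left
    apply split _ (by simp)
    rw [hl0] at hν hl
    rw [hν] at hl
    simpa using hl
  by_cases hν0 : ν = 0
  · right
    apply split
    · rw [map_mul, eval_C, eval_X]; field_simp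
    · rw [hν0, C_0, sub_zero] at hl
      have : l = (z 1 / z 0) ^ k := by
        rw [div_pow]
        have h5 : z 0 ^ k ≠ 0 := pow_ne_zero _ hz0
        field_simp
        rw [hν0] at hν
        linarith
      rw [this] at hl
      rw [mul_pow, ← C_pow]; exact hl
  exfalso
  have hφ := (S.ker _).mpr hl
  rw [map_sub, map_sub, map_mul, map_pow, map_pow, S.π_C, S.π_C] at hφ
  set b := S.π (X 0) with hb
  set c := S.π (X 1) with hc
  obtain ⟨j, rfl⟩ : ∃ j, k = j + 1 := ⟨k - 1, by omega⟩
  have hl0' : algebraMap ℚ K l ≠ 0 := by rw [Ne, map_eq_zero]; exact hl0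
  have hν0' : algebraMap ℚ K ν ≠ 0 := by rw [Ne, map_eq_zero]; exact hν0
  have hD := congrArg S.D hφ
  simp only [map_sub, Derivation.leibniz, Derivation.leibniz_pow, smul_eq_mul, nsmul_eq_mul, Derivation.map_algebraMap, mul_zero, add_zero, map_zero, Nat.add_sub_cancel, sub_zero] at hD
  have hj0 : ((j + 1 : ℕ) : K) ≠ 0 := by exact_mod_cast (by omega : j + 1 ≠ 0)
  have hD' : c ^ j * S.D c = algebraMap ℚ K l * (b ^ j * S.D b) := by
    apply mul_left_cancel₀ hj0
    linear_combination hD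
  have hne : ∀ i : Fin 2, z i ≠ 0 → S.π (X i) ≠ 0 := by
    intro i hi h
    obtain ⟨G, hG⟩ := (S.ker _).mp h
    have := congrArg (eval z) hG
    rw [map_mul, hz, zero_mul, eval_X] at this
    exact hi this
  have hb0 : b ≠ 0 := hne 0 hz0
  have hc0 : c ≠ 0 := hne 1 hz1
  set Ω := S.D b / c ^ j with hΩ
  have hcΩ : S.Gam ((r.totalDegree : ℤ) - 1) (c ^ j * Ω) := S.Gam_congr S.Gam_Db rfl (by rw [hΩ, mul_comm, div_mul_cancel₀ _ (pow_ne_zero j hc0)])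
  have hbΩ : S.Gam ((r.totalDegree : ℤ) - 1) (b ^ j * Ω) := by
    refine S.Gam_congr (S.Gam_smul l⁻¹ S.Gam_Dc) rfl ?_
    rw [hΩ, map_inv₀]
    field_simp
    linear_combination hD'
  have hany : S.Gam (r.totalDegree : ℤ) Ω := by
    have h2 : S.Gam (r.totalDegree : ℤ) (algebraMap ℚ K ν * Ω) := by
      have e : algebraMap ℚ K ν * Ω = c * (c ^ j * Ω) - algebraMap ℚ K l * (b * (b ^ j * Ω)) := by
        linear_combination (-Ω) * hφ
      rw [e]
      refine S.Gam_sub ?_ (S.Gam_smul l ?_)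
      · exact S.Gam_congr (S.Gam_mul S.Gam_c hcΩ) (by ring) rfl
      · exact S.Gam_congr (S.Gam_mul S.Gam_b hbΩ) (by ring) rfl
    refine S.Gam_congr (S.Gam_smul ν⁻¹ h2) rfl ?_
    rw [map_inv₀]; field_simp
  have hfin := S.Gam_two hr.ne_zero j hany hbΩ hcΩ
  have hz' := S.Gam_neg (by have : (r.totalDegree : ℤ) < j + 1 := by exact_mod_cast he
                            linarith) hfin
  rw [hΩ, div_eq_zero_iff] at hz'
  rcases hz' with h | h
  · rw [S.D_X0, S.ker] at h
    obtain ⟨G, hG⟩ := h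
    apply hrc
    rw [hG, map_mul, hz, zero_mul]
  · exact pow_ne_zero _ hc0 h

theorem lin_final (hr : Irreducible r) (L l M : R2) (i : Fin 2) (hL : L = r * M) (hLd : L.totalDegree = 1)
    (hl : l = X i) (hLl : ¬ l ∣ homogeneousComponent 1 L) (hd : del L 0 1 (X i) ≠ 0)
    (k k' : ℕ) (n : ℤ) (hk' : 0 < k') (hkk : k' < k)
    (α β : ℚ) (hα : α ≠ 0) (hβ : β ≠ 0) (hφ : L ∣ phi2 k n - (C α * l ^ k + C β))
    (hφ0 : S.π (phi2 k n) ≠ 0)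
    (ψ : K) (q : ℚ) (hq : q ≠ 0)
    (h : ψ ^ k = algebraMap ℚ K q * S.π (phi2 k n) ^ k') : False := by
  have hL0 : L ≠ 0 := by
    rintro rfl; simp at hLd
  have hM0 : M ≠ 0 := by
    rintro rfl; rw [mul_zero] at hL; exact hL0 hL
  have hrd : 0 < r.totalDegree := by
    by_contra hc
    have h0 : r.totalDegree = 0 := by omega
    rw [totalDegree_eq_zero_iff_eq_C] at h0
    apply hr.not_isUnit
    rw [h0]
    apply IsUnit.map
    rw [isUnit_iff_ne_zero]
    intro hc2
    rw [hc2, C_0] at h0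
    exact hr.ne_zero h0
  have hdeg : L.totalDegree = r.totalDegree + M.totalDegree := by
    rw [hL, totalDegree_mul_of_isDomain hr.ne_zero hM0]
  have hrd1 : r.totalDegree = 1 := by omega
  have hMd : M.totalDegree = 0 := by omega
  rw [totalDegree_eq_zero_iff_eq_C] at hMd
  set m := coeff 0 M with hm
  have hLr : L = C m * r := by rw [hL, hMd]; ring
  have hgood : GoodLine r l := by
    refine ⟨by rw [hl]; exact MvPolynomial.X_prime, by rw [hl]; exact isHomogeneous_X _ _, ?_⟩
    intro hdv
    apply hLl
    rw [hLr, homogeneousComponent_C_mul]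
    rw [hrd1] at hdv
    exact Dvd.dvd.mul_left hdv _
  refine S.lin_contra l hgood hrd1 k k' n hk' hkk α β hα hβ ?_ hφ0 ?_ ψ q hq h
  · have h1 := (S.ker _).mpr ((Dvd.intro _ hL.symm : r ∣ L).trans hφ)
    rw [map_sub, map_add, map_mul, map_pow, S.π_C, S.π_C, sub_eq_zero] at h1
    exact h1
  · rw [hl, S.dpi, Ne, S.ker]
    intro hdv
    have e : del L 0 1 (X i) = C m * del r 0 1 (X i) := by
      rw [hLr]; unfold del
      simp only [Derivation.leibniz, pderiv_C, smul_eq_mul]; ring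
    have hne : del r 0 1 (X i) ≠ 0 := by
      intro h0; rw [e, h0, mul_zero] at hd; exact hd rfl
    have h2 := totalDegree_le_of_dvd_of_isDomain hdv hne
    have h3 : del r 0 1 (X i) ∈ PD ((0 : ℕ) : ℤ) := by
      have hrP := PD_of_degree r
      unfold del
      rw [hrd1] at hrP
      refine Submodule.sub_mem _ ?_ ?_
      · exact PD_mono (by norm_num) (PD_mul (PD_pderiv hrP 1) (PD_pderiv (PD_X i) 0))
      · exact PD_mono (by norm_num) (PD_mul (PD_pderiv hrP 0) (PD_pderiv (PD_X i) 1))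
    have h4 := degree_of_PD h3
    omega

end FF

end

section
open MvPolynomial

theorem irr_deg_pos {r : R2} (hr : Irreducible r) : 0 < r.totalDegree := by
  by_contra hc
  have h0 : r.totalDegree = 0 := by omega
  rw [totalDegree_eq_zero_iff_eq_C] at h0
  apply hr.not_isUnit
  rw [h0]
  apply IsUnit.map
  rw [isUnit_iff_ne_zero]
  intro hc2
  rw [hc2, C_0] at h0
  exact hr.ne_zero h0

theorem dvd_of_PD_lt {r F : R2} (hF : F ∈ PD ((r.totalDegree : ℤ) - 1)) (h : r ∣ F) : F = 0 := by
  by_contra hne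
  have h1 := totalDegree_le_of_dvd_of_isDomain h hne
  by_cases h0 : r.totalDegree = 0
  · rw [h0] at hF
    exact hne (PD_neg (by norm_num) hF)
  · have h2 : F ∈ PD ((r.totalDegree - 1 : ℕ) : ℤ) := PD_mono (by omega) hF
    have := degree_of_PD h2
    omega

theorem pderiv_PD (r : R2) (i : Fin 2) : pderiv i r ∈ PD ((r.totalDegree : ℤ) - 1) := PD_pderiv (PD_of_degree r) i

theorem pderiv_deg (r : R2) (i : Fin 2) : (pderiv i r).totalDegree ≤ r.totalDegree :=
  degree_of_PD (PD_mono (by linarith) (pderiv_PD r i))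

theorem pderiv_both {r : R2} (hr : Irreducible r) (h0 : pderiv 0 r = 0) (h1 : pderiv 1 r = 0) : False := by
  have h2 := PD_euler (PD_of_degree r)
  rw [h0, h1, mul_zero, mul_zero, add_zero, sub_zero] at h2
  have h3 := dvd_of_PD_lt h2 (Dvd.intro_left _ rfl)
  have h4 := irr_deg_pos hr
  rcases mul_eq_zero.mp h3 with h | h
  · rw [← C_0, C_inj] at h
    have : ((r.totalDegree : ℤ) : ℚ) ≠ 0 := by exact_mod_cast h4.ne'
    exact this h
  · exact hr.ne_zero h

theorem lin_hc (p q s : ℚ) : homogeneousComponent 1 (C p * X 0 + C q * X 1 + C s : R2) = C p * X 0 + C q * X 1 := by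
  rw [map_add, map_add, homogeneousComponent_C_mul, homogeneousComponent_C_mul]
  have e : ∀ i : Fin 2, homogeneousComponent 1 (X i : R2) = X i := by
    intro i
    rw [homogeneousComponent_of_mem (isHomogeneous_X ℚ i)]; simp
  rw [e, e, hc_zero_of_PD (d := 0) (by norm_num) (PD_C s), add_zero]

theorem lin_deg (p q s : ℚ) (h : (C p * X 0 + C q * X 1 : R2) ≠ 0) : (C p * X 0 + C q * X 1 + C s : R2).totalDegree = 1 := by
  apply le_antisymm
  · apply degree_of_PD
    refine Submodule.add_mem _ (Submodule.add_mem _ ?_ ?_) (PD_mono (by norm_num) (PD_C s))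
    · exact PD_mono (by norm_num) (PD_mul (PD_C p) (PD_X 0))
    · exact PD_mono (by norm_num) (PD_mul (PD_C q) (PD_X 1))
  · by_contra hc
    apply h
    rw [← lin_hc p q s]
    exact homogeneousComponent_eq_zero _ _ (by omega)

theorem X_not_dvd' : ¬ ((X 1 : R2) ∣ X 0) := by
  rintro ⟨q, hq⟩
  have := congrArg (MvPolynomial.eval ![1, 0]) hq
  simp at this

namespace FF
variable {r : R2} {K : Type} [Field K] [Algebra ℚ K] (S : FF r K)

theorem phi_ne {k : ℕ} {n : ℤ} {z : Fin 2 → ℚ} (hz : GoodPt k n r z) : S.π (phi2 k n) ≠ 0 := by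
  rw [Ne, S.ker]
  rintro ⟨G, hG⟩
  obtain ⟨h0, -, -, -, a, ha, -, hak⟩ := hz
  have := congrArg (eval z) hG
  rw [map_mul, h0, zero_mul] at this
  unfold phi2 at this
  simp only [map_sub, map_add, map_pow, eval_X, eval_C] at this
  have h2 : a ^ k = 0 := by rw [hak]; linarith
  exact absurd h2 (pow_pos ha k).ne'

theorem no_root_lin (hr : Irreducible r) (k k' : ℕ) (n : ℤ) (hn : n ≠ 0) (hk : 2 ≤ k) (hk' : 0 < k') (hkk : k' < k)
    (z : Fin 2 → ℚ) (hz : GoodPt k n r z)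
    (hcase : r ∣ X 1 - C (z 1) ∨ r ∣ X 1 - C (z 1 / z 0) * X 0 ∨ r ∣ X 0 - C (z 0))
    (ψ : K) (q : ℚ) (hq : q ≠ 0)
    (h : ψ ^ k = algebraMap ℚ K q * S.π (phi2 k n) ^ k') : False := by
  have hφ0 := S.phi_ne hz
  obtain ⟨h0, hz0, hz1, hz01, a, ha, hac, hak⟩ := hz
  have hak0 : 0 < a ^ k := pow_pos ha k
  have hk0 : k ≠ 0 := by omega
  rcases hcase with hc | hc | hc
  · obtain ⟨M, hM⟩ := hc
    have eL : (X 1 - C (z 1) : R2) = C 0 * X 0 + C 1 * X 1 + C (-(z 1)) := by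
      rw [C_0, C_1, C_neg]; ring
    have eh : (C 0 * X 0 + C 1 * X 1 : R2) = X 1 := by rw [C_0, C_1]; ring
    refine S.lin_final hr _ _ M 0 hM ?_ rfl ?_ ?_ k k' n hk' hkk (-1) (n + z 1 ^ k) (by norm_num) ?_ ?_ hφ0 ψ q hq h
    · rw [eL]; apply lin_deg; rw [eh]; exact X_ne_zero _
    · rw [eL, lin_hc, eh]; exact X_not_dvd
    · unfold del; simp
    · have : 0 < z 0 ^ k := pow_pos hz0 k
      have : (n : ℚ) + z 1 ^ k = a ^ k + z 0 ^ k := by rw [hak]; ring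
      rw [this]; positivity
    · have := sub_dvd_pow_sub_pow (X 1 : R2) (C (z 1)) k
      convert this using 1
      unfold phi2
      rw [C_add, C_neg, C_1, C_pow]; ring
  · obtain ⟨M, hM⟩ := hc
    set η := z 1 / z 0 with hη
    have eL : (X 1 - C η * X 0 : R2) = C (-η) * X 0 + C 1 * X 1 + C 0 := by
      rw [C_0, C_1, C_neg]; ring
    have eh : ¬ ((X 0 : R2) ∣ C (-η) * X 0 + C 1 * X 1) := by
      intro hd
      rw [Dvd.dvd.mul_left (dvd_refl _) _ |> dvd_add_right, C_1, one_mul] at hd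
      exact X_not_dvd hd
    refine S.lin_final hr _ _ M 0 hM ?_ rfl ?_ ?_ k k' n hk' hkk (η ^ k - 1) n ?_ (by exact_mod_cast hn) ?_ hφ0 ψ q hq h
    · rw [eL]; apply lin_deg; intro h0; rw [h0] at eh; exact eh (dvd_zero _)
    · rw [eL, lin_hc]; exact eh
    · unfold del; simp
    · rw [sub_ne_zero]
      intro h1
      have hη0 : 0 ≤ η := by rw [hη]; positivity
      have := (pow_eq_one_iff_of_nonneg hη0 hk0).mp h1
      rw [hη, div_eq_one_iff_eq hz0.ne'] at this
      exact hz01 this.symm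
    · have := sub_dvd_pow_sub_pow (X 1 : R2) (C η * X 0) k
      convert this using 1
      unfold phi2
      rw [C_sub, C_1, C_pow, mul_pow]; ring
  · obtain ⟨M, hM⟩ := hc
    have eL : (X 0 - C (z 0) : R2) = C 1 * X 0 + C 0 * X 1 + C (-(z 0)) := by
      rw [C_0, C_1, C_neg]; ring
    have eh : (C 1 * X 0 + C 0 * X 1 : R2) = X 0 := by rw [C_0, C_1]; ring
    refine S.lin_final hr _ _ M 1 hM ?_ rfl ?_ ?_ k k' n hk' hkk 1 (n - z 0 ^ k) (by norm_num) ?_ ?_ hφ0 ψ q hq h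
    · rw [eL]; apply lin_deg; rw [eh]; exact X_ne_zero _
    · rw [eL, lin_hc, eh]; exact X_not_dvd'
    · unfold del; simp
    · have : (n : ℚ) - z 0 ^ k = a ^ k - z 1 ^ k := by rw [hak]; ring
      rw [this, sub_ne_zero]
      intro h1
      exact hac ((pow_left_inj₀ ha.le hz1.le hk0).mp h1)
    · have := (sub_dvd_pow_sub_pow (X 0 : R2) (C (z 0)) k).neg_right
      convert this using 1
      unfold phi2
      rw [C_sub, C_1, C_pow]; ring

theorem no_root_gen (hr : Irreducible r) (k k' : ℕ) (n : ℤ) (hn : n ≠ 0) (hk : 2 ≤ k) (hk' : 0 < k') (hkk : k' < k)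
    (hek : r.totalDegree < k)
    (hnum : 3 * (r.totalDegree : ℤ) - 3 + 2 * k' - k < 0)
    (hpts : ∀ F : R2, ¬ r ∣ F → F.totalDegree ≤ r.totalDegree → ∃ z, GoodPt k n r z ∧ eval z F ≠ 0)
    (ψ : K) (q : ℚ) (hq : q ≠ 0)
    (h : ψ ^ k = algebraMap ℚ K q * S.π (phi2 k n) ^ k') : False := by
  by_cases h1 : pderiv 1 r = 0
  · have h0 : ¬ r ∣ pderiv 0 r := by
      intro h0
      exact pderiv_both hr (dvd_of_PD_lt (pderiv_PD r 0) h0) h1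
    obtain ⟨z, hz, hz2⟩ := hpts _ h0 (pderiv_deg r 0)
    refine S.no_root_lin hr k k' n hn hk hk' hkk z hz (Or.inr (Or.inr ?_)) ψ q hq h
    refine uniq r hr z 1 0 (by decide) hz.1 hz2 _ 1 0 (by simp) (by simp) ?_
    unfold del
    rw [h1]
    simp
  · have h0 : ¬ r ∣ pderiv 1 r := fun h0 => h1 (dvd_of_PD_lt (pderiv_PD r 1) h0)
    obtain ⟨z, hz, hz2⟩ := hpts _ h0 (pderiv_deg r 1)
    have hX := S.XX_zero hr.ne_zero k k' n hn hk hk' ψ q hq (S.phi_ne hz) h hnum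
    have h3 := S.degen_linear hr k hk hek hX z hz.1 hz.2.1.ne' hz.2.2.1.ne' hz2
    refine S.no_root_lin hr k k' n hn hk hk' hkk z hz ?_ ψ q hq h
    rcases h3 with h3 | h3
    · exact Or.inl h3
    · exact Or.inr (Or.inl h3)
end FF

end

section
open MvPolynomial

/-- centred quadratic polynomial -/
noncomputable def cq (z : Fin 2 → ℚ) (κ l m p q s : ℚ) : R2 :=
  C κ + C l * (X 0 - C (z 0)) + C m * (X 1 - C (z 1)) + C p * (X 0 - C (z 0)) ^ 2
    + C q * ((X 0 - C (z 0)) * (X 1 - C (z 1))) + C s * (X 1 - C (z 1)) ^ 2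

theorem cq_mono (z : Fin 2 → ℚ) (c : ℚ) (i j : ℕ) (h : i + j ≤ 2) :
    ∃ κ l m p q s, C c * X 0 ^ i * X 1 ^ j = cq z κ l m p q s := by
  unfold cq
  have hi : i ≤ 2 := by omega
  have hj : j ≤ 2 := by omega
  interval_cases i <;> interval_cases j
  · exact ⟨c, 0, 0, 0, 0, 0, by simp⟩
  · exact ⟨c * z 1, 0, c, 0, 0, 0, by simp only [C_0, C_mul]; ring⟩
  · exact ⟨c * z 1 * z 1, 0, c * z 1 + c * z 1, 0, 0, c, by simp only [C_0, C_mul, C_add]; ring⟩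
  · exact ⟨c * z 0, c, 0, 0, 0, 0, by simp only [C_0, C_mul]; ring⟩
  · exact ⟨c * z 0 * z 1, c * z 1, c * z 0, 0, c, 0, by simp only [C_0, C_mul]; ring⟩
  · omega
  · exact ⟨c * z 0 * z 0, c * z 0 + c * z 0, 0, c, 0, 0, by simp only [C_0, C_mul, C_add]; ring⟩
  · omega
  · omega

theorem cq_exists (z : Fin 2 → ℚ) (F : R2) (hF : F.totalDegree ≤ 2) : ∃ κ l m p q s, F = cq z κ l m p q s := by
  rw [F.as_sum]
  have key : ∀ T : Finset (Fin 2 →₀ ℕ), T ⊆ F.support → ∃ κ l m p q s, ∑ v ∈ T, monomial v (coeff v F) = cq z κ l m p q s := by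
    intro T
    induction T using Finset.induction_on with
    | empty => intro _; exact ⟨0, 0, 0, 0, 0, 0, by unfold cq; simp⟩
    | insert v T hv ih =>
      intro hT
      obtain ⟨κ, l, m, p, q, s, h1⟩ := ih (fun x hx => hT (Finset.mem_insert_of_mem hx))
      have hvF : v ∈ F.support := hT (Finset.mem_insert_self _ _)
      have hdeg : v 0 + v 1 ≤ 2 := by
        have := le_totalDegree hvF
        rw [Finsupp.sum_fintype _ _ (by simp), Fin.sum_univ_two] at this
        omega
      obtain ⟨κ', l', m', p', q', s', h2⟩ := cq_mono z (coeff v F) (v 0) (v 1) hdeg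
      refine ⟨κ + κ', l + l', m + m', p + p', q + q', s + s', ?_⟩
      rw [Finset.sum_insert hv, h1, monomial_eq, Finsupp.prod_fintype _ _ (by simp), Fin.prod_univ_two, ← mul_assoc, h2]
      unfold cq
      simp only [C_add]; ring
  exact key _ (Finset.Subset.refl _)

theorem cq_PD (z : Fin 2 → ℚ) (κ l m : ℚ) : cq z κ l m 0 0 0 ∈ PD 1 := by
  have hl : ∀ (c : ℚ) (i : Fin 2), C c * (X i - C (z i)) ∈ PD 1 := fun c i =>
    PD_mono (by norm_num) (PD_mul (PD_C c) (Submodule.sub_mem _ (PD_X i) (PD_mono (by norm_num) (PD_C (z i)))))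
  unfold cq
  simp only [C_0, zero_mul, add_zero]
  exact Submodule.add_mem _ (Submodule.add_mem _ (PD_mono (by norm_num) (PD_C κ)) (hl l 0)) (hl m 1)

/-- restriction to a line -/
noncomputable def rho (b1 d0 c1 d1 : ℚ) : R2 →ₐ[ℚ] Polynomial ℚ :=
  aeval ![Polynomial.C b1 + Polynomial.C d0 * Polynomial.X, Polynomial.C c1 + Polynomial.C d1 * Polynomial.X]

theorem rho_0 (b1 d0 c1 d1 : ℚ) : rho b1 d0 c1 d1 (X 0) = Polynomial.C b1 + Polynomial.C d0 * Polynomial.X := by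
  unfold rho; rw [aeval_X]; rfl
theorem rho_1 (b1 d0 c1 d1 : ℚ) : rho b1 d0 c1 d1 (X 1) = Polynomial.C c1 + Polynomial.C d1 * Polynomial.X := by
  unfold rho; rw [aeval_X]; rfl
theorem rho_C (b1 d0 c1 d1 c : ℚ) : rho b1 d0 c1 d1 (C c) = Polynomial.C c := by
  have := (rho b1 d0 c1 d1).commutes c
  rwa [MvPolynomial.algebraMap_eq, Polynomial.algebraMap_eq] at this

theorem rho_cq (z : Fin 2 → ℚ) (κ l m p q s b1 d0 c1 d1 : ℚ) : ∃ A B : ℚ, rho b1 d0 c1 d1 (cq z κ l m p q s) =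
    Polynomial.C A + Polynomial.C B * Polynomial.X + Polynomial.C (p * d0 ^ 2 + q * d0 * d1 + s * d1 ^ 2) * Polynomial.X ^ 2 := by
  refine ⟨κ + l * (b1 - z 0) + m * (c1 - z 1) + p * (b1 - z 0) ^ 2 + q * (b1 - z 0) * (c1 - z 1) + s * (c1 - z 1) ^ 2,
    l * d0 + m * d1 + (p * (b1 - z 0) * d0 + p * (b1 - z 0) * d0) + q * ((b1 - z 0) * d1 + (c1 - z 1) * d0) + (s * (c1 - z 1) * d1 + s * (c1 - z 1) * d1), ?_⟩
  unfold cq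
  simp only [map_add, map_mul, map_sub, map_pow, rho_0, rho_1, rho_C, Polynomial.C_add, Polynomial.C_mul, Polynomial.C_sub, Polynomial.C_pow]
  ring

theorem rho_natDegree (b1 d0 c1 d1 : ℚ) (F : R2) : (rho b1 d0 c1 d1 F).natDegree ≤ F.totalDegree := by
  unfold rho
  have := aeval_natDegree_le F le_rfl
    ![Polynomial.C b1 + Polynomial.C d0 * Polynomial.X, Polynomial.C c1 + Polynomial.C d1 * Polynomial.X] (n := 1) (by
      intro i
      have hd : ∀ u v : ℚ, (Polynomial.C u + Polynomial.C v * Polynomial.X).natDegree ≤ 1 := by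
        intro u v; compute_degree
      fin_cases i
      · exact hd _ _
      · exact hd _ _)
  simpa using this

theorem quad_quintic (u v w n : ℚ) (hn : n ≠ 0) (hw : w ≠ 0) (H : Polynomial ℚ)
    (h : Polynomial.X ^ 5 - Polynomial.C n = (Polynomial.C u + Polynomial.C v * Polynomial.X + Polynomial.C w * Polynomial.X ^ 2) * H) : False := by
  have hdeg : H.natDegree ≤ 3 := by
    have h1 : (Polynomial.X ^ 5 - Polynomial.C n : Polynomial ℚ).natDegree = 5 := by compute_degree!
    have h2 : (Polynomial.C u + Polynomial.C v * Polynomial.X + Polynomial.C w * Polynomial.X ^ 2 : Polynomial ℚ).natDegree = 2 := by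
      compute_degree!
    have hH : H ≠ 0 := by
      rintro rfl
      rw [mul_zero] at h; rw [h] at h1; simp at h1
    have hq : (Polynomial.C u + Polynomial.C v * Polynomial.X + Polynomial.C w * Polynomial.X ^ 2 : Polynomial ℚ) ≠ 0 := by
      intro h0; rw [h0] at h2; simp at h2
    have h3 := Polynomial.natDegree_mul hq hH
    rw [← h] at h3; omega
  obtain ⟨h0, h1, h2, h3, hH⟩ : ∃ h0 h1 h2 h3 : ℚ, H = Polynomial.C h0 + Polynomial.C h1 * Polynomial.X + Polynomial.C h2 * Polynomial.X ^ 2 + Polynomial.C h3 * Polynomial.X ^ 3 := by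
    refine ⟨H.coeff 0, H.coeff 1, H.coeff 2, H.coeff 3, ?_⟩
    conv_lhs => rw [H.as_sum_range' 4 (by omega)]
    simp only [Finset.sum_range_succ, Finset.sum_range_zero, ← Polynomial.C_mul_X_pow_eq_monomial]
    simp
  have e : Polynomial.X ^ 5 - Polynomial.C n = Polynomial.C (u * h0) + Polynomial.C (u * h1 + v * h0) * Polynomial.X + Polynomial.C (u * h2 + v * h1 + w * h0) * Polynomial.X ^ 2
      + Polynomial.C (u * h3 + v * h2 + w * h1) * Polynomial.X ^ 3 + Polynomial.C (v * h3 + w * h2) * Polynomial.X ^ 4 + Polynomial.C (w * h3) * Polynomial.X ^ 5 := by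
    rw [h, hH]; simp only [Polynomial.C_add, Polynomial.C_mul]; ring
  have c0 := congrArg (fun P => Polynomial.coeff P 0) e
  have c1 := congrArg (fun P => Polynomial.coeff P 1) e
  have c2 := congrArg (fun P => Polynomial.coeff P 2) e
  have c3 := congrArg (fun P => Polynomial.coeff P 3) e
  have c4 := congrArg (fun P => Polynomial.coeff P 4) e
  have c5 := congrArg (fun P => Polynomial.coeff P 5) e
  simp only [Polynomial.coeff_add, Polynomial.coeff_sub, Polynomial.coeff_C_mul, Polynomial.coeff_X_pow, Polynomial.coeff_C, Polynomial.coeff_X] at c0 c1 c2 c3 c4 c5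
  norm_num at c0 c1 c2 c3 c4 c5
  have key : (2 * u * w - 3 * v ^ 2) ^ 2 = 5 * (v ^ 2) ^ 2 := by
    have k1 : w ^ 4 * (u * h1 + v * h0) = 0 := by rw [← c1, mul_zero]
    have e3 : w * h3 = 1 := c5.symm
    have e2 : w ^ 2 * h2 = - v := by linear_combination v * e3 * (-1) - w * c4
    have e1 : w ^ 3 * h1 = v ^ 2 - u * w := by linear_combination (-(w ^ 2)) * c3 - u * w * e3 - v * e2
    have e0 : w ^ 4 * h0 = -(v ^ 3) + 2 * u * v * w := by linear_combination (-(w ^ 3)) * c2 - u * w * e2 - v * e1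
    have k2 : u * w * (v ^ 2 - u * w) + v * (-(v ^ 3) + 2 * u * v * w) = 0 := by
      linear_combination k1 - u * w * e1 - v * e0
    linear_combination (-4) * k2
  have hv : v = 0 := by
    by_contra hv
    have h5 : ((2 * u * w - 3 * v ^ 2) / v ^ 2) ^ 2 = 5 := by
      rw [div_pow, key]; field_simp
    have hirr : Irrational (√(5 : ℝ)) := by
      have : Nat.Prime 5 := by norm_num
      exact_mod_cast this.irrational_sqrt
    apply hirr
    refine ⟨|(2 * u * w - 3 * v ^ 2) / v ^ 2|, ?_⟩
    have h6 : ((((2 * u * w - 3 * v ^ 2) / v ^ 2 : ℚ) : ℝ)) ^ 2 = 5 := by exact_mod_cast h5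
    rw [← h6, Real.sqrt_sq_eq_abs]
    push_cast; rfl
  rw [hv] at key
  have hu : u = 0 := by
    have : u * w = 0 := by
      have : (2 * u * w) ^ 2 = 0 := by linear_combination key
      have := pow_eq_zero_iff (two_ne_zero) |>.mp this
      linarith
    exact (mul_eq_zero.mp this).resolve_right hw
  rw [hu, zero_mul] at c0
  apply hn; linarith

theorem line_key (z : Fin 2 → ℚ) (κ l m p q s b1 d0 c1 d1 g h n : ℚ) (hn : n ≠ 0) (G : R2) (hG : G.totalDegree ≤ 5)
    (hr : cq z κ l m p q s ∣ G) (hr2 : (cq z κ l m p q s).totalDegree = 2)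
    (hρ : rho b1 d0 c1 d1 G = (Polynomial.C g * Polynomial.X + Polynomial.C h) ^ 5 - Polynomial.C n) : g = 0 := by
  by_contra hg
  have h5 : ((Polynomial.C g * Polynomial.X + Polynomial.C h) ^ 5 - Polynomial.C n).natDegree = 5 := by
    rw [Polynomial.natDegree_sub_C, Polynomial.natDegree_pow, Polynomial.natDegree_linear hg]
  have hG0 : G ≠ 0 := by
    rintro rfl
    rw [map_zero] at hρ
    rw [← hρ] at h5; simp at h5
  obtain ⟨H, hH⟩ := hr
  have hr0 : cq z κ l m p q s ≠ 0 := by rintro h0; rw [h0] at hr2; simp at hr2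
  have hH0 : H ≠ 0 := by rintro rfl; rw [mul_zero] at hH; exact hG0 hH
  have hHd : H.totalDegree ≤ 3 := by
    have := totalDegree_mul_of_isDomain hr0 hH0
    rw [← hH] at this; omega
  obtain ⟨A, B, hAB⟩ := rho_cq z κ l m p q s b1 d0 c1 d1
  set w := p * d0 ^ 2 + q * d0 * d1 + s * d1 ^ 2 with hw
  have e1 : (Polynomial.C g * Polynomial.X + Polynomial.C h) ^ 5 - Polynomial.C n = (Polynomial.C A + Polynomial.C B * Polynomial.X + Polynomial.C w * Polynomial.X ^ 2) * rho b1 d0 c1 d1 H := by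
    rw [← hρ, ← hAB, ← map_mul, ← hH]
  have hHd' := (rho_natDegree b1 d0 c1 d1 H).trans hHd
  by_cases hw0 : w = 0
  · rw [e1, hw0, Polynomial.C_0, zero_mul, add_zero] at h5
    have h6 := Polynomial.natDegree_mul_le (p := Polynomial.C A + Polynomial.C B * Polynomial.X) (q := rho b1 d0 c1 d1 H)
    have h7 : (Polynomial.C A + Polynomial.C B * Polynomial.X).natDegree ≤ 1 := by compute_degree
    omega
  · have e2 := congrArg (fun P => Polynomial.comp P (Polynomial.C g⁻¹ * (Polynomial.X - Polynomial.C h))) e1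
    simp only [Polynomial.sub_comp, Polynomial.pow_comp, Polynomial.add_comp, Polynomial.mul_comp, Polynomial.C_comp, Polynomial.X_comp] at e2
    have e3 : Polynomial.C g * (Polynomial.C g⁻¹ * (Polynomial.X - Polynomial.C h)) + Polynomial.C h = (Polynomial.X : Polynomial ℚ) := by
      rw [← mul_assoc, ← Polynomial.C_mul, mul_inv_cancel₀ hg, Polynomial.C_1]; ring
    rw [e3] at e2
    have e4 : Polynomial.C A + Polynomial.C B * (Polynomial.C g⁻¹ * (Polynomial.X - Polynomial.C h)) +
        Polynomial.C w * (Polynomial.C g⁻¹ * (Polynomial.X - Polynomial.C h)) ^ 2 =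
        Polynomial.C (A - B * g⁻¹ * h + w * (g⁻¹ * h) ^ 2) + Polynomial.C (B * g⁻¹ - (w * g⁻¹ * g⁻¹ * h + w * g⁻¹ * g⁻¹ * h)) * Polynomial.X
          + Polynomial.C (w * g⁻¹ ^ 2) * Polynomial.X ^ 2 := by
      generalize g⁻¹ = g'
      simp only [Polynomial.C_add, Polynomial.C_mul, Polynomial.C_sub, Polynomial.C_pow]
      ring
    rw [e4] at e2
    exact quad_quintic _ _ (w * g⁻¹ ^ 2) n hn (mul_ne_zero hw0 (pow_ne_zero _ (inv_ne_zero hg))) _ e2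

end

section
open MvPolynomial

theorem lin_PD (α β γ : ℚ) : (C α * X 0 + C β * X 1 + C γ : R2) ∈ PD 1 :=
  Submodule.add_mem _ (Submodule.add_mem _ (PD_mono (by norm_num) (PD_mul (PD_C α) (PD_X 0)))
    (PD_mono (by norm_num) (PD_mul (PD_C β) (PD_X 1)))) (PD_mono (by norm_num) (PD_C γ))

theorem conic_const (z : Fin 2 → ℚ) (κ l m p q s b1 d0 c1 d1 e : ℚ) (he : e ≠ 0) (G : R2)
    (hr : cq z κ l m p q s ∣ G) (hρ : rho b1 d0 c1 d1 G = Polynomial.C e) : p * d0 ^ 2 + q * d0 * d1 + s * d1 ^ 2 = 0 := by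
  obtain ⟨H, hH⟩ := hr
  obtain ⟨A, B, hAB⟩ := rho_cq z κ l m p q s b1 d0 c1 d1
  set w := p * d0 ^ 2 + q * d0 * d1 + s * d1 ^ 2 with hw
  by_contra hw0
  have h1 : Polynomial.C e = (Polynomial.C A + Polynomial.C B * Polynomial.X + Polynomial.C w * Polynomial.X ^ 2) * rho b1 d0 c1 d1 H := by
    rw [← hρ, ← hAB, ← map_mul, ← hH]
  have hu : IsUnit (Polynomial.C e) := Polynomial.isUnit_C.mpr (isUnit_iff_ne_zero.mpr he)
  rw [h1] at hu
  have h2 := Polynomial.natDegree_eq_zero_of_isUnit (isUnit_of_mul_isUnit_left hu)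
  have h3 : (Polynomial.C A + Polynomial.C B * Polynomial.X + Polynomial.C w * Polynomial.X ^ 2 : Polynomial ℚ).natDegree = 2 := by
    compute_degree!
  omega

theorem conic_contra (r : R2) (hr : Irreducible r) (hr2 : r.totalDegree = 2) (n : ℤ) (hn : n ≠ 0) (z : Fin 2 → ℚ)
    (hz : GoodPt 5 n r z) (α β γ : ℚ)
    (hd : r ∣ (C α * X 0 + C β * X 1 + C γ) ^ 5 + X 0 ^ 5 - X 1 ^ 5 - C (n : ℚ)) : False := by
  have hn' : (n : ℚ) ≠ 0 := by exact_mod_cast hn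
  obtain ⟨κ, l, m, p, q, s, hrq⟩ := cq_exists z r hr2.le
  set G : R2 := (C α * X 0 + C β * X 1 + C γ) ^ 5 + X 0 ^ 5 - X 1 ^ 5 - C (n : ℚ) with hG
  have hGd : G.totalDegree ≤ 5 := by
    apply degree_of_PD
    have h5 : ∀ F : R2, F ∈ PD 1 → F ^ 5 ∈ PD ((5 : ℕ) : ℤ) := fun F hF => by
      have := PD_pow hF 5
      simpa using this
    exact Submodule.sub_mem _ (Submodule.sub_mem _ (Submodule.add_mem _ (h5 _ (lin_PD _ _ _)) (h5 _ (PD_X 0))) (h5 _ (PD_X 1))) (PD_mono (by norm_num) (PD_C _))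
  have hd' := hd
  rw [hrq] at hd'
  have hr2' := hr2
  rw [hrq] at hr2'
  have s1 : α + β = 0 := by
    refine line_key z κ l m p q s 0 1 0 1 (α + β) γ n hn' G hGd hd' hr2' ?_
    rw [hG]
    simp only [map_add, map_mul, map_sub, map_pow, rho_0, rho_1, rho_C, map_zero, map_one]
    ring
  have hβ : β = -α := by linarith
  have s2 : -(α + 1) = 0 := by
    refine line_key z κ l m p q s (-γ) α (-γ) (α + 1) (-(α + 1)) γ n hn' G hGd hd' hr2' ?_
    rw [hG, hβ]
    simp only [map_add, map_mul, map_sub, map_pow, rho_0, rho_1, rho_C, map_neg, map_one]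
    ring
  have hα : α = -1 := by linarith
  have hβ1 : β = 1 := by linarith
  rw [hα, hβ1] at hG
  clear s1 s2 hβ
  by_cases hnγ : (n : ℚ) = γ ^ 5
  · have hfac : G = (X 1 + C γ) * ((X 0 - C γ) * ((X 1 - X 0) * (C (-5/2) * ((X 1 + C γ) ^ 2 + (X 0 - C γ) ^ 2 + (X 1 - X 0) ^ 2)))) := by
      rw [hG, hnγ]
      have e2 : (C (-5/2) : R2) * 2 = -5 := by
        have : (2 : R2) = C 2 := rfl
        rw [this, ← C_mul, show (-5/2*2:ℚ) = -5 by norm_num, C_neg]; rfl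
      have e3 : (2 : R2) ≠ 0 := two_ne_zero
      apply mul_left_cancel₀ e3
      rw [C_neg, C_1, C_pow]
      linear_combination (-((X 1 + C γ) * ((X 0 - C γ) * ((X 1 - X 0) * ((X 1 + C γ) ^ 2 + (X 0 - C γ) ^ 2 + (X 1 - X 0) ^ 2))) : R2)) * e2
    have hlin : ∀ a b c : ℚ, r ∣ C a * X 0 + C b * X 1 + C c → C a * X 0 + C b * X 1 + C c = (0 : R2) := by
      intro a b c h
      exact dvd_of_PD_lt (by rw [hr2]; exact PD_mono (by norm_num) (lin_PD a b c)) h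
    rw [hfac] at hd
    rcases hr.prime.dvd_or_dvd hd with h | h
    · have := hlin 0 1 γ (by rw [C_0, C_1]; rw [show (0 * X 0 + 1 * X 1 + C γ : R2) = X 1 + C γ by ring]; exact h)
      have h1 := congrArg (eval ![0, 1 - γ]) this
      simp at h1
    rcases hr.prime.dvd_or_dvd h with h | h
    · have := hlin 1 0 (-γ) (by rw [C_0, C_1, C_neg]; ring_nf; exact h)
      have h1 := congrArg (eval ![1 + γ, 0]) this
      simp at h1
    rcases hr.prime.dvd_or_dvd h with h | h
    · have := hlin (-1) 1 0 (by rw [C_0, C_1, C_neg, C_1]; ring_nf; rw [show (-X 0 + X 1 : R2) = X 1 - X 0 by ring]; exact h)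
      have h1 := congrArg (eval ![0, 1]) this
      simp at h1
    · obtain ⟨M, hM⟩ := h
      have h1 := congrArg (eval z) hM
      rw [map_mul, map_mul, hz.1, zero_mul, eval_C] at h1
      simp only [map_add, map_sub, map_pow, eval_X, eval_C] at h1
      have h2 : (z 1 + γ) ^ 2 + (z 0 - γ) ^ 2 + (z 1 - z 0) ^ 2 = 0 := by linarith
      have h3 : (z 1 - z 0) ^ 2 = 0 := by nlinarith [sq_nonneg (z 1 + γ), sq_nonneg (z 0 - γ), sq_nonneg (z 1 - z 0)]
      have h4 := pow_eq_zero_iff (two_ne_zero) |>.mp h3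
      exact hz.2.2.2.1 (by linarith)
  · have he : γ ^ 5 - n ≠ 0 := by intro h; apply hnγ; linarith
    have hd2 := hd
    rw [hrq] at hd2
    have t1 := conic_const z κ l m p q s 0 1 (-γ) 0 _ he G hd2 (by
      rw [hG]
      simp only [map_add, map_mul, map_sub, map_pow, rho_0, rho_1, rho_C, map_neg, map_one, map_zero]
      ring)
    have t2 := conic_const z κ l m p q s γ 0 0 1 _ he G hd2 (by
      rw [hG]
      simp only [map_add, map_mul, map_sub, map_pow, rho_0, rho_1, rho_C, map_neg, map_one, map_zero]
      ring)
    have t3 := conic_const z κ l m p q s 0 1 0 1 _ he G hd2 (by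
      rw [hG]
      simp only [map_add, map_mul, map_sub, map_pow, rho_0, rho_1, rho_C, map_neg, map_one, map_zero]
      ring)
    have hp : p = 0 := by linarith
    have hs : s = 0 := by linarith
    have hq : q = 0 := by rw [hp, hs] at t3; linarith
    rw [hp, hs, hq] at hrq
    have := cq_PD z κ l m
    rw [← hrq] at this
    have := degree_of_PD (d := 1) (by exact_mod_cast this)
    omega

end

section
open MvPolynomial

theorem cq_z (z : Fin 2 → ℚ) (κ l m p q s : ℚ) : eval z (cq z κ l m p q s) = κ := by
  unfold cq; simp

theorem cq_z0 (z : Fin 2 → ℚ) (κ l m p q s : ℚ) : eval z (pderiv 0 (cq z κ l m p q s)) = l := by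
  unfold cq
  simp [Derivation.leibniz, Derivation.leibniz_pow, pderiv_X]

theorem cq_z1 (z : Fin 2 → ℚ) (κ l m p q s : ℚ) : eval z (pderiv 1 (cq z κ l m p q s)) = m := by
  unfold cq
  simp [Derivation.leibniz, Derivation.leibniz_pow, pderiv_X]

/-- solving for a quadratic in terms of `Q, l, X l`, or the conic is reducible -/
theorem cq_solve (l m p q s : ℚ) (hlm : l ≠ 0 ∨ m ≠ 0) :
    (∃ δ ε : ℚ, p = l * δ ∧ q = l * ε + m * δ ∧ s = m * ε) ∨
    ∀ a0 a1 a2 : ℚ, ∃ u v w : ℚ, a0 = u * p + v * l ∧ a1 = u * q + v * m + w * l ∧ a2 = u * s + w * m := by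
  by_cases hΔ : p * m ^ 2 - q * l * m + s * l ^ 2 = 0
  · left
    by_cases hl : l = 0
    · have hm : m ≠ 0 := by tauto
      refine ⟨q / m, s / m, ?_, ?_, ?_⟩
      · rw [hl] at hΔ ⊢
        have : p * m ^ 2 = 0 := by linarith
        rw [zero_mul]
        exact (mul_eq_zero.mp this).resolve_right (pow_ne_zero _ hm)
      · rw [hl]; field_simp; ring
      · field_simp
    · refine ⟨p / l, (q - m * (p / l)) / l, by field_simp, by field_simp; ring, ?_⟩
      field_simp
      linear_combination hΔ
  · right
    intro a0 a1 a2
    set u := (a0 * m ^ 2 - a1 * l * m + a2 * l ^ 2) / (p * m ^ 2 - q * l * m + s * l ^ 2) with hu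
    have hu' : u * (p * m ^ 2 - q * l * m + s * l ^ 2) = a0 * m ^ 2 - a1 * l * m + a2 * l ^ 2 := by
      rw [hu, div_mul_cancel₀ _ hΔ]
    clear_value u
    by_cases hl : l = 0
    · have hm : m ≠ 0 := by tauto
      refine ⟨u, (a1 - u * q) / m, (a2 - u * s) / m, ?_, ?_, ?_⟩
      · rw [hl] at hu' ⊢
        have : (a0 - u * p) * m ^ 2 = 0 := by linear_combination (-1) * hu'
        have := (mul_eq_zero.mp this).resolve_right (pow_ne_zero _ hm)
        linarith
      · rw [hl]; field_simp; ring
      · field_simp; ring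
    · refine ⟨u, (a0 - u * p) / l, (a1 - u * q - (a0 - u * p) / l * m) / l, by field_simp; ring, by field_simp; ring, ?_⟩
      field_simp
      linear_combination (-1) * hu'

namespace FF
variable {r : R2} {K : Type} [Field K] [Algebra ℚ K] (S : FF r K)

theorem transc (t : K) (ht : S.D t ≠ 0) : ∀ P : Polynomial ℚ, Polynomial.aeval t P = 0 → P = 0 := by
  have key : ∀ d : ℕ, ∀ P : Polynomial ℚ, P.natDegree ≤ d → Polynomial.aeval t P = 0 → P = 0 := by
    intro d
    induction d with
    | zero =>
      intro P hP h
      have h1 := Polynomial.eq_C_of_natDegree_le_zero hP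
      rw [h1, Polynomial.aeval_C, map_eq_zero] at h
      rw [h1, h, Polynomial.C_0]
    | succ d ih =>
      intro P hP h
      have h1 := S.D.map_aeval P t
      rw [h, map_zero, smul_eq_mul] at h1
      have h2 := (mul_eq_zero.mp h1.symm).resolve_right ht
      have h3 := ih _ ((Polynomial.natDegree_derivative_le P).trans (by omega)) h2
      have h4 := Polynomial.natDegree_eq_zero_of_derivative_eq_zero h3
      have h5 := Polynomial.eq_C_of_natDegree_eq_zero h4
      rw [h5, Polynomial.aeval_C, map_eq_zero] at h
      rw [h5, h, Polynomial.C_0]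
  exact fun P => key P.natDegree P le_rfl

theorem conic_lin (hr : Irreducible r) (hr2 : r.totalDegree = 2) (z : Fin 2 → ℚ) (hz : eval z r = 0)
    (hns : eval z (pderiv 0 r) ≠ 0 ∨ eval z (pderiv 1 r) ≠ 0) (n : ℤ) (ψ : K) (h : ψ ^ 5 = S.π (phi2 5 n)) :
    ∃ α β γ : ℚ, ψ = S.π (C α * X 0 + C β * X 1 + C γ) := by
  obtain ⟨κ, l, m, p, q, s, hrq⟩ := cq_exists z r hr2.le
  have hκ : κ = 0 := by rw [hrq, cq_z] at hz; exact hz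
  have hlm : l ≠ 0 ∨ m ≠ 0 := by rw [hrq, cq_z0, cq_z1] at hns; exact hns
  have hpqs : ¬ (p = 0 ∧ q = 0 ∧ s = 0) := by
    rintro ⟨hp, hq, hs⟩
    rw [hp, hs, hq] at hrq
    have := cq_PD z κ l m
    rw [← hrq] at this
    have := degree_of_PD (d := 1) (by exact_mod_cast this)
    omega
  have hlin : ∀ a b c : ℚ, r ∣ C a * X 0 + C b * X 1 + C c → C a * X 0 + C b * X 1 + C c = (0 : R2) := by
    intro a b c h
    exact dvd_of_PD_lt (by rw [hr2]; exact PD_mono (by norm_num) (lin_PD a b c)) h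
  have hlin2 : ∀ a b c : ℚ, algebraMap ℚ K a * S.π (X 0) + algebraMap ℚ K b * S.π (X 1) + algebraMap ℚ K c = 0 → a = 0 ∧ b = 0 := by
    intro a b c h0
    have h1 := hlin a b c (by rw [← S.ker, map_add, map_add, map_mul, map_mul, S.π_C, S.π_C, S.π_C]; exact h0)
    have e0 := congrArg (eval ![0, 0]) h1
    have e1 := congrArg (eval ![1, 0]) h1
    have e2 := congrArg (eval ![0, 1]) h1
    simp at e0 e1 e2
    constructor <;> linarith
  set b0 := algebraMap ℚ K (z 0) with hb0
  set c0 := algebraMap ℚ K (z 1) with hc0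
  set l' := algebraMap ℚ K l with hl'
  set m' := algebraMap ℚ K m with hm'
  set p' := algebraMap ℚ K p with hp'
  set q' := algebraMap ℚ K q with hq'
  set s' := algebraMap ℚ K s with hs'
  set x := S.π (X 0) - b0 with hx
  set y := S.π (X 1) - c0 with hy
  have hrel : l' * x + m' * y + p' * x ^ 2 + q' * (x * y) + s' * y ^ 2 = 0 := by
    have h1 : S.π (cq z κ l m p q s) = 0 := (S.ker _).mpr (by rw [← hrq])
    unfold cq at h1
    simp only [map_add, map_mul, map_sub, map_pow, S.π_C, hκ, map_zero, zero_add] at h1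
    exact h1
  have hx0 : x ≠ 0 := by
    intro h0
    have := (hlin2 1 0 (-(z 0)) (by rw [map_one, map_zero, map_neg, ← hb0]; linear_combination h0)).1
    exact one_ne_zero this
  set t := y / x with ht
  have hyt : y = t * x := by rw [ht]; field_simp
  set Qt := p' + q' * t + s' * t ^ 2 with hQt
  set lt := l' + m' * t with hlt
  have hxQ : x * Qt = -lt := by
    apply mul_left_cancel₀ hx0
    rw [hQt, hlt]
    rw [hyt] at hrel
    linear_combination hrel
  have hDt : S.D t ≠ 0 := by
    intro hD
    have hDQ : S.D Qt = 0 := by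
      rw [hQt]
      simp only [map_add, Derivation.leibniz, Derivation.leibniz_pow, hp', hq', hs', Derivation.map_algebraMap, hD]
      simp
    have hDl : S.D lt = 0 := by
      rw [hlt]
      simp only [map_add, Derivation.leibniz, hl', hm', Derivation.map_algebraMap, hD]
      simp
    have h1 := congrArg S.D hxQ
    rw [Derivation.leibniz, hDQ, map_neg, hDl] at h1
    simp only [smul_eq_mul, mul_zero, zero_add, neg_zero] at h1
    rcases mul_eq_zero.mp h1 with h2 | h2
    · rw [h2, mul_zero] at hxQ
      have h3 : lt = 0 := neg_eq_zero.mp hxQ.symm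
      have h4 : l' * x + m' * y = 0 := by rw [hlt] at h3; linear_combination x * h3 + m' * hyt
      have := hlin2 l m (-(l * z 0 + m * z 1)) (by
        rw [map_neg, map_add, map_mul, map_mul, ← hb0, ← hc0, ← hl', ← hm']
        linear_combination h4)
      tauto
    · have hDy : S.D y = 0 := by
        rw [hyt, Derivation.leibniz, hD, h2]; simp
      rw [hx, map_sub, hb0, Derivation.map_algebraMap, sub_zero, S.D_X0, S.ker] at h2
      rw [hy, map_sub, hc0, Derivation.map_algebraMap, sub_zero, S.D_X1] at hDy
      have h5 : r ∣ pderiv 0 r := by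
        rw [← S.ker]; first | exact neg_eq_zero.mp hDy | (rw [map_neg] at hDy; exact neg_eq_zero.mp hDy)
      exact pderiv_both hr (dvd_of_PD_lt (pderiv_PD r 0) h5) (dvd_of_PD_lt (pderiv_PD r 1) h2)
  have htr := S.transc t hDt
  set Qp : Polynomial ℚ := Polynomial.C p + Polynomial.C q * Polynomial.X + Polynomial.C s * Polynomial.X ^ 2 with hQp
  set lp : Polynomial ℚ := Polynomial.C l + Polynomial.C m * Polynomial.X with hlp
  have eQ : Polynomial.aeval t Qp = Qt := by
    rw [hQp]; simp only [map_add, map_mul, map_pow, Polynomial.aeval_C, Polynomial.aeval_X]; rfl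
  have el : Polynomial.aeval t lp = lt := by
    rw [hlp]; simp only [map_add, map_mul, map_pow, Polynomial.aeval_C, Polynomial.aeval_X]; rfl
  have hQ0 : Qt ≠ 0 := by
    rw [← eQ]
    intro h0
    have h1 := htr _ h0
    apply hpqs
    have c0 := congrArg (fun P => Polynomial.coeff P 0) h1
    have c1 := congrArg (fun P => Polynomial.coeff P 1) h1
    have c2 := congrArg (fun P => Polynomial.coeff P 2) h1
    rw [hQp] at c0 c1 c2
    simp only [Polynomial.coeff_add, Polynomial.coeff_C_mul, Polynomial.coeff_X_pow, Polynomial.coeff_C, Polynomial.coeff_X, Polynomial.coeff_zero] at c0 c1 c2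
    norm_num at c0 c1 c2
    exact ⟨c0, c1, c2⟩
  set Bp : Polynomial ℚ := Polynomial.C (z 0) * Qp - lp with hBp
  set Cp : Polynomial ℚ := Polynomial.C (z 1) * Qp - Polynomial.X * lp with hCp
  have eB : Polynomial.aeval t Bp = Qt * S.π (X 0) := by
    rw [hBp, map_sub, map_mul, eQ, el, Polynomial.aeval_C, ← hb0]
    linear_combination (-1) * hxQ
  have eC : Polynomial.aeval t Cp = Qt * S.π (X 1) := by
    rw [hCp, map_sub, map_mul, map_mul, eQ, el, Polynomial.aeval_C, Polynomial.aeval_X, ← hc0]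
    linear_combination (-t) * hxQ - Qt * hyt
  have hrat : ∀ F : R2, ∃ (f : Polynomial ℚ) (N : ℕ), Qt ^ N * S.π F = Polynomial.aeval t f := by
    intro F
    induction F using MvPolynomial.induction_on with
    | C a => exact ⟨Polynomial.C a, 0, by rw [S.π_C, Polynomial.aeval_C]; ring⟩
    | add F G hF hG =>
      obtain ⟨f, N, hf⟩ := hF
      obtain ⟨g, M, hg⟩ := hG
      refine ⟨Qp ^ M * f + Qp ^ N * g, N + M, ?_⟩
      rw [map_add, map_add, map_mul, map_mul, map_pow, map_pow, eQ, ← hf, ← hg]; ring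
    | mul_X F i hF =>
      obtain ⟨f, N, hf⟩ := hF
      have hi : ∃ g : Polynomial ℚ, Polynomial.aeval t g = Qt * S.π (X i) := by
        fin_cases i
        · exact ⟨Bp, eB⟩
        · exact ⟨Cp, eC⟩
      obtain ⟨g, hg⟩ := hi
      refine ⟨f * g, N + 1, ?_⟩
      rw [map_mul, map_mul, hg, ← hf]; ring
  obtain ⟨f, g, hg0, hfg⟩ : ∃ f g : Polynomial ℚ, g ≠ 0 ∧ ψ * Polynomial.aeval t g = Polynomial.aeval t f := by
    obtain ⟨G, H, hG, hGH⟩ := S.frac ψ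
    obtain ⟨g, N, hg⟩ := hrat G
    obtain ⟨f, M, hf⟩ := hrat H
    refine ⟨Qp ^ N * f, Qp ^ M * g, ?_, ?_⟩
    · intro h0
      have h1 := congrArg (Polynomial.aeval t) h0
      rw [map_mul, map_pow, eQ, ← hg, map_zero] at h1
      exact mul_ne_zero (pow_ne_zero _ hQ0) (mul_ne_zero (pow_ne_zero _ hQ0) hG) h1
    · rw [map_mul, map_mul, map_pow, map_pow, eQ, ← hf, ← hg, ← hGH]; ring
  set Np : Polynomial ℚ := Cp ^ 5 + Polynomial.C (n : ℚ) * Qp ^ 5 - Bp ^ 5 with hNp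
  have eN : Polynomial.aeval t Np = (Qt * ψ) ^ 5 := by
    rw [hNp, map_sub, map_add, map_mul, map_pow, map_pow, map_pow, eQ, eB, eC, Polynomial.aeval_C, mul_pow Qt ψ, h, S.pi_phi, map_intCast]
    ring
  have hpoly : g ^ 5 * Np = (Qp * f) ^ 5 := by
    rw [← sub_eq_zero]
    apply htr
    rw [map_sub, map_mul, map_pow, map_pow, map_mul, eQ, eN, ← hfg]; ring
  have hdvd : g ∣ Qp * f := by
    rw [← UniqueFactorizationMonoid.pow_dvd_pow_iff_dvd (show (5 : ℕ) ≠ 0 by norm_num)]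
    exact Dvd.intro _ hpoly
  obtain ⟨A, hA⟩ := hdvd
  have hA5 : Np = A ^ 5 := by
    rw [hA, mul_pow] at hpoly
    exact mul_left_cancel₀ (pow_ne_zero _ hg0) hpoly
  have eA : Polynomial.aeval t A = Qt * ψ := by
    have hgt : Polynomial.aeval t g ≠ 0 := fun h0 => hg0 (htr _ h0)
    apply mul_left_cancel₀ hgt
    rw [← map_mul, ← hA, map_mul, eQ, ← hfg]; ring
  have hdA : A.natDegree ≤ 2 := by
    have dQ : Qp.natDegree ≤ 2 := by rw [hQp]; compute_degree
    have dl : lp.natDegree ≤ 1 := by rw [hlp]; compute_degree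
    have dXl : (Polynomial.X * lp).natDegree ≤ 2 := by
      refine Polynomial.natDegree_mul_le.trans ?_
      rw [Polynomial.natDegree_X]; omega
    have dCQ : ∀ c : ℚ, (Polynomial.C c * Qp).natDegree ≤ 2 := fun c => (Polynomial.natDegree_C_mul_le _ _).trans dQ
    have dB : Bp.natDegree ≤ 2 := (Polynomial.natDegree_sub_le _ _).trans (max_le (dCQ _) (by omega))
    have dC : Cp.natDegree ≤ 2 := (Polynomial.natDegree_sub_le _ _).trans (max_le (dCQ _) dXl)
    have d5 : ∀ P : Polynomial ℚ, P.natDegree ≤ 2 → (P ^ 5).natDegree ≤ 10 := fun P hP => by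
      rw [Polynomial.natDegree_pow]; omega
    have dN : Np.natDegree ≤ 10 := (Polynomial.natDegree_sub_le _ _).trans (max_le ((Polynomial.natDegree_add_le _ _).trans
      (max_le (d5 _ dC) ((Polynomial.natDegree_C_mul_le _ _).trans (d5 _ dQ)))) (d5 _ dB))
    rw [hA5, Polynomial.natDegree_pow] at dN
    omega
  have hAe : A = Polynomial.C (A.coeff 0) + Polynomial.C (A.coeff 1) * Polynomial.X + Polynomial.C (A.coeff 2) * Polynomial.X ^ 2 := by
    conv_lhs => rw [A.as_sum_range' 3 (by omega)]
    simp only [Finset.sum_range_succ, Finset.sum_range_zero, ← Polynomial.C_mul_X_pow_eq_monomial]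
    simp
  rcases cq_solve l m p q s hlm with ⟨δ, ε, h1, h2, h3⟩ | hsol
  · exfalso
    have hfac : r = (C l * (X 0 - C (z 0)) + C m * (X 1 - C (z 1))) * (1 + C δ * (X 0 - C (z 0)) + C ε * (X 1 - C (z 1))) := by
      rw [hrq, hκ, h1, h2, h3]; unfold cq
      simp only [C_0, C_mul, C_add]; ring
    have hir := hr.isUnit_or_isUnit hfac
    rcases hir with hu | hu
    · have := hu.map (eval z)
      simp at this
    · obtain ⟨c, -, hc⟩ := MvPolynomial.isUnit_iff_eq_C_of_isReduced.1 hu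
      rw [hc] at hfac
      have : r ∈ PD 1 := by
        rw [hfac]
        have hl : ∀ (c : ℚ) (i : Fin 2), C c * (X i - C (z i)) ∈ PD 1 := fun c i =>
          PD_mono (by norm_num) (PD_mul (PD_C c) (Submodule.sub_mem _ (PD_X i) (PD_mono (by norm_num) (PD_C (z i)))))
        exact PD_mono (by norm_num) (PD_mul (Submodule.add_mem _ (hl l 0) (hl m 1)) (PD_C c))
      have := degree_of_PD (d := 1) (by exact_mod_cast this)
      omega
  · obtain ⟨u, v, w, h1, h2, h3⟩ := hsol (A.coeff 0) (A.coeff 1) (A.coeff 2)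
    have hAQ : A = Polynomial.C u * Qp + (Polynomial.C v + Polynomial.C w * Polynomial.X) * lp := by
      rw [hAe, h1, h2, h3, hQp, hlp]
      simp only [Polynomial.C_add, Polynomial.C_mul]; ring
    have h4 := congrArg (Polynomial.aeval t) hAQ
    rw [eA] at h4
    simp only [map_add, map_mul, Polynomial.aeval_C, Polynomial.aeval_X, eQ, el] at h4
    refine ⟨-v, -w, u + v * z 0 + w * z 1, ?_⟩
    apply mul_left_cancel₀ hQ0
    rw [h4]
    simp only [map_add, map_mul, map_neg, S.π_C]
    rw [← hb0, ← hc0]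
    linear_combination (algebraMap ℚ K v + algebraMap ℚ K w * t) * hxQ + (algebraMap ℚ K w * Qt) * hyt

theorem no_root_conic (hr : Irreducible r) (hr2 : r.totalDegree = 2) (n : ℤ) (hn : n ≠ 0)
    (hpts : ∀ F : R2, ¬ r ∣ F → F.totalDegree ≤ r.totalDegree → ∃ z, GoodPt 5 n r z ∧ eval z F ≠ 0)
    (ψ : K) (h : ψ ^ 5 = S.π (phi2 5 n)) : False := by
  obtain ⟨z, hz, hns⟩ : ∃ z, GoodPt 5 n r z ∧ (eval z (pderiv 0 r) ≠ 0 ∨ eval z (pderiv 1 r) ≠ 0) := by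
    by_cases h1 : pderiv 1 r = 0
    · have h0 : ¬ r ∣ pderiv 0 r := by
        intro h0
        exact pderiv_both hr (dvd_of_PD_lt (pderiv_PD r 0) h0) h1
      obtain ⟨z, hz, hz2⟩ := hpts _ h0 (pderiv_deg r 0)
      exact ⟨z, hz, Or.inl hz2⟩
    · have h0 : ¬ r ∣ pderiv 1 r := fun h0 => h1 (dvd_of_PD_lt (pderiv_PD r 1) h0)
      obtain ⟨z, hz, hz2⟩ := hpts _ h0 (pderiv_deg r 1)
      exact ⟨z, hz, Or.inr hz2⟩
  obtain ⟨α, β, γ, hψ⟩ := S.conic_lin hr hr2 z hz.1 hns n ψ h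
  refine conic_contra r hr hr2 n hn z hz α β γ ?_
  rw [← S.ker, map_sub, map_sub, map_add, map_pow, map_pow, map_pow, ← hψ, h, S.pi_phi, S.π_C, map_intCast]
  ring

theorem no_root (hr : Irreducible r) (k k' : ℕ) (n : ℤ) (hn : n ≠ 0) (hk : 5 ≤ k) (hk' : 0 < k')
    (hek : (k' * r.totalDegree) ^ 2 < k)
    (hpts : ∀ F : R2, ¬ r ∣ F → F.totalDegree ≤ r.totalDegree → ∃ z, GoodPt k n r z ∧ eval z F ≠ 0)
    (ψ : K) (q : ℚ) (hq : q = 1 ∨ q = -1)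
    (h : ψ ^ k = algebraMap ℚ K q * S.π (phi2 k n) ^ k') : False := by
  have he := irr_deg_pos hr
  set e := r.totalDegree with hee
  have hq0 : q ≠ 0 := by rcases hq with rfl | rfl <;> norm_num
  have h1 : k' ≤ k' * e := Nat.le_mul_of_pos_right _ he
  have h2 : e ≤ k' * e := Nat.le_mul_of_pos_left _ hk'
  have h3 : k' * e ≤ (k' * e) ^ 2 := by nlinarith
  by_cases hcase : 3 * (e : ℤ) - 3 + 2 * k' - k < 0
  · exact S.no_root_gen hr k k' n hn (by omega) hk' (by omega) (by omega) hcase hpts ψ q hq0 h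
  · have hm : k' + e ≤ k' * e + 1 := by nlinarith
    have hb : k' * e < 3 := by
      by_contra hc
      push Not at hcase hc
      have : (k' * e) * 3 ≤ (k' * e) ^ 2 := by nlinarith
      omega
    have : k' = 1 ∧ e = 2 ∧ k = 5 := by
      have hk3 : k' < 3 := by omega
      have he3 : e < 3 := by omega
      interval_cases k' <;> interval_cases e <;> omega
    obtain ⟨rfl, he2, rfl⟩ := this
    rw [pow_one] at h
    rcases hq with rfl | rfl
    · rw [map_one, one_mul] at h
      exact S.no_root_conic hr he2 n hn hpts ψ h
    · refine S.no_root_conic hr he2 n hn hpts (-ψ) ?_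
      rw [map_neg, map_one] at h
      linear_combination (-1) * h
end FF

end

section
open MvPolynomial

theorem monic_factor_root {K : Type*} [Field K] (k : ℕ) (φ : K) (d : Polynomial K) (hd : d.Monic)
    (hdvd : d ∣ Polynomial.X ^ k - Polynomial.C φ) :
    (d.coeff 0) ^ k = φ ^ d.natDegree ∨ (d.coeff 0) ^ k = -φ ^ d.natDegree := by
  set L := AlgebraicClosure K
  set f := algebraMap K L with hf
  have hs : (d.map f).Splits := IsAlgClosed.splits _
  have h1 := Polynomial.Splits.coeff_zero_eq_prod_roots_of_monic hs (hd.map f)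
  have hroot : ∀ x ∈ (d.map f).roots, x ^ k = f φ := by
    intro x hx
    have h2 := (Polynomial.mem_roots'.1 hx).2
    obtain ⟨q, hq⟩ := hdvd
    have h3 := congrArg (fun P => Polynomial.eval x (P.map f)) hq
    simp only [Polynomial.map_sub, Polynomial.map_pow, Polynomial.map_X, Polynomial.map_C, Polynomial.map_mul,
      Polynomial.eval_sub, Polynomial.eval_pow, Polynomial.eval_X, Polynomial.eval_C, Polynomial.eval_mul, h2.eq_zero, zero_mul] at h3
    exact sub_eq_zero.1 h3
  have h4 : ((d.map f).roots.prod) ^ k = f φ ^ d.natDegree := by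
    have e1 : ((d.map f).roots.prod) ^ k = (Multiset.map (fun x => x ^ k) (d.map f).roots).prod := by
      rw [Multiset.prod_map_pow, Multiset.map_id']
    rw [e1, Multiset.map_congr rfl hroot, Multiset.map_const', Multiset.prod_replicate]
    congr 1
    have := (Polynomial.splits_iff_card_roots.1 hs)
    rw [this, Polynomial.natDegree_map]
  have h5 : f (d.coeff 0) ^ k = ((-1) ^ d.natDegree) ^ k * f φ ^ d.natDegree := by
    rw [← h4, ← mul_pow, ← Polynomial.coeff_map, h1, Polynomial.natDegree_map]
  have hinj := f.injective
  rw [← pow_mul] at h5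
  rcases neg_one_pow_eq_or L (d.natDegree * k) with h6 | h6
  · left
    apply hinj
    rw [map_pow, map_pow, h5, h6, one_mul]
  · right
    apply hinj
    rw [map_pow, map_neg, map_pow, h5, h6]; ring

theorem sing_root {K : Type*} [Field K] (k I : ℕ) (hk : 0 < k) (hIk : I ≤ k) (φ : K) (g : ℕ → K)
    (hgI : ∀ t, I ≤ t → g t = 0) (hne : ∃ t < I, g t ≠ 0) (h : (normMat k φ g).det = 0) :
    ∃ (k' : ℕ) (ψ : K), 0 < k' ∧ k' < I ∧ (ψ ^ k = φ ^ k' ∨ ψ ^ k = -φ ^ k') := by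
  obtain ⟨W, hW, hWd, hdvd⟩ := normMat_singular k hk φ g h
  set H := ∑ t ∈ Finset.range k, Polynomial.C (g t) * Polynomial.X ^ t with hH
  have hHc : ∀ m, H.coeff m = if m < k then g m else 0 := by
    intro m
    rw [hH, Polynomial.finset_sum_coeff]
    simp only [Polynomial.coeff_C_mul, Polynomial.coeff_X_pow, mul_ite, mul_one, mul_zero]
    rw [Finset.sum_ite_eq]
    simp
  have hH0 : H ≠ 0 := by
    obtain ⟨t, ht, htn⟩ := hne
    intro h0
    have := hHc t
    rw [h0, if_pos (by omega)] at this
    exact htn (by simpa using this.symm)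
  have hI0 : 0 < I := by obtain ⟨t, ht, -⟩ := hne; omega
  have hHd : H.natDegree < I := by
    rw [Polynomial.natDegree_lt_iff_degree_lt hH0, Polynomial.degree_lt_iff_coeff_zero]
    intro m hm
    rw [hHc, hgI m hm]; simp
  set f := (Polynomial.X ^ k - Polynomial.C φ : Polynomial K) with hf
  have hfd : f.natDegree = k := Polynomial.natDegree_X_pow_sub_C
  have hf0 : f ≠ 0 := by intro h0; rw [h0] at hfd; simp at hfd; omega
  set d := normalize (gcd f H) with hd
  have hg0 : gcd f H ≠ 0 := fun h0 => hf0 ((gcd_eq_zero_iff _ _).1 h0).1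
  have hdm : d.Monic := Polynomial.monic_normalize hg0
  have hdf : d ∣ f := (normalize_dvd_iff.2 (gcd_dvd_left f H))
  have hdH : d ∣ H := (normalize_dvd_iff.2 (gcd_dvd_right f H))
  have hdd : d.natDegree < I := lt_of_le_of_lt (Polynomial.natDegree_le_of_dvd hdH hH0) hHd
  have hpos : 0 < d.natDegree := by
    by_contra hc
    have h1 : d = 1 := Polynomial.eq_one_of_monic_natDegree_zero hdm (by omega)
    have hu : IsUnit (gcd f H) := by
      rw [← normalize_eq_one]; exact h1
    have hrp : IsRelPrime f H := gcd_isUnit_iff_isRelPrime.1 hu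
    have := hrp.dvd_of_dvd_mul_right hdvd
    have := Polynomial.natDegree_le_of_dvd this hW
    omega
  exact ⟨d.natDegree, d.coeff 0, hpos, hdd, monic_factor_root k φ d hdm hdf⟩

theorem norm_not_dvd (r : R2) (hr : Irreducible r) (k I : ℕ) (n : ℤ) (hn : n ≠ 0) (hk : 5 ≤ k) (hIk : I ≤ k)
    (hI : ∀ k' < I, (k' * r.totalDegree) ^ 2 < k)
    (hpts : ∀ F : R2, ¬ r ∣ F → F.totalDegree ≤ r.totalDegree → ∃ z, GoodPt k n r z ∧ eval z F ≠ 0)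
    (g : ℕ → R2) (hgI : ∀ t, I ≤ t → g t = 0) (hne : ∃ t < I, ¬ r ∣ g t) :
    ¬ r ∣ (normMat k (phi2 k n) g).det := by
  intro hdvd
  obtain ⟨K, _, _, ⟨S⟩⟩ := exists_FF r hr
  have h0 := (S.ker _).2 hdvd
  have h1 := normMat_map (S.π : R2 →+* K) k (phi2 k n) g
  have h2 : (normMat k (S.π (phi2 k n)) (fun t => S.π (g t))).det = 0 := by
    rw [← h0]; exact h1.symm
  obtain ⟨k', ψ, hk', hk'I, hψ⟩ := sing_root k I (by omega) hIk _ _ (fun t ht => by rw [hgI t ht, map_zero])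
    (by obtain ⟨t, ht, h⟩ := hne; exact ⟨t, ht, fun h3 => h ((S.ker _).1 h3)⟩) h2
  rcases hψ with hψ | hψ
  · exact S.no_root hr k k' n hn hk hk' (hI k' hk'I) hpts ψ 1 (Or.inl rfl) (by rw [hψ]; simp)
  · exact S.no_root hr k k' n hn hk hk' (hI k' hk'I) hpts ψ (-1) (Or.inr rfl) (by rw [hψ]; simp)

end

section
open MvPolynomial

theorem lead_mon (r : R2) (hr : r ≠ 0) : ∃ α β : ℕ, α + β = r.totalDegree ∧
    ∀ F : R2, r ∣ F → (∀ m ∈ F.support, ¬ (α ≤ m 0 ∧ β ≤ m 1)) → F = 0 := by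
  refine ⟨MonomialOrder.degLex.degree r 0, MonomialOrder.degLex.degree r 1, ?_, ?_⟩
  · rw [← degree_degLexDegree, Finsupp.degree_eq_sum, Fin.sum_univ_two]
  · rintro F ⟨G, rfl⟩ h
    by_contra hF
    have h1 := MonomialOrder.degree_mem_support (m := MonomialOrder.degLex) hF
    refine h _ h1 ?_
    have hG : G ≠ 0 := right_ne_zero_of_mul hF
    rw [MonomialOrder.degree_mul hr hG]
    constructor <;> simp

/-- parametrisation of the standard monomials -/
def nmf (α β : ℕ) (x : ℕ × ℕ × ℕ) : ℕ × ℕ × ℕ :=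
  (x.1, if x.2.1 < α then (x.2.1, α + β + x.2.2 - x.2.1) else (α + β + x.2.2 - (x.2.1 - α), x.2.1 - α))

def NM (I α β T : ℕ) : Finset (ℕ × ℕ × ℕ) :=
  (Finset.range I ×ˢ Finset.range (α + β) ×ˢ Finset.range T).image (nmf α β)

theorem nmf_inj (I α β T : ℕ) : Set.InjOn (nmf α β)
    (Finset.range I ×ˢ Finset.range (α + β) ×ˢ Finset.range T : Finset (ℕ × ℕ × ℕ)) := by
  rintro ⟨i, u, t⟩ h1 ⟨i', u', t'⟩ h2 h
  simp only [Finset.coe_product, Set.mem_prod, Finset.coe_range, Set.mem_Iio] at h1 h2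
  unfold nmf at h
  simp only at h
  rw [Prod.mk.injEq] at h
  obtain ⟨h3, h4⟩ := h
  split_ifs at h4 <;> rw [Prod.mk.injEq] at h4 <;> simp only [Prod.mk.injEq] <;> omega

theorem NM_card (I α β T : ℕ) : (NM I α β T).card = I * ((α + β) * T) := by
  rw [NM, Finset.card_image_of_injOn (nmf_inj I α β T)]
  simp

theorem NM_prop (I α β T : ℕ) (m : ℕ × ℕ × ℕ) (hm : m ∈ NM I α β T) :
    m.1 < I ∧ ¬ (α ≤ m.2.1 ∧ β ≤ m.2.2) ∧ m.2.1 + m.2.2 ≤ α + β + T := by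
  simp only [NM, Finset.mem_image, Finset.mem_product, Finset.mem_range] at hm
  obtain ⟨x, ⟨h1, h2, h3⟩, rfl⟩ := hm
  unfold nmf
  split_ifs <;> simp only <;> omega

theorem NM_deg (I α β T : ℕ) : 2 * ∑ m ∈ NM I α β T, (m.1 + m.2.1 + m.2.2) ≤
    (I * ((α + β) * T)) * (2 * (I + (α + β)) + T) := by
  rw [NM, Finset.sum_image (nmf_inj I α β T), Finset.sum_product]
  have h1 : ∀ i ∈ Finset.range I, ∑ y ∈ Finset.range (α + β) ×ˢ Finset.range T,
      ((nmf α β (i, y)).1 + (nmf α β (i, y)).2.1 + (nmf α β (i, y)).2.2) ≤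
      (α + β) * (T * (I + (α + β)) + T * (T - 1) / 2) := by
    intro i hi
    rw [Finset.sum_product]
    rw [Finset.mem_range] at hi
    calc _ ≤ ∑ u ∈ Finset.range (α + β), (T * (I + (α + β)) + T * (T - 1) / 2) := by
          refine Finset.sum_le_sum fun u hu => ?_
          rw [Finset.mem_range] at hu
          calc _ ≤ ∑ t ∈ Finset.range T, ((I + (α + β)) + t) := by
                refine Finset.sum_le_sum fun t ht => ?_
                unfold nmf
                split_ifs <;> simp only <;> omega
            _ = _ := by
                rw [Finset.sum_add_distrib, Finset.sum_range_id]; simp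
      _ = _ := by simp
  have h2 := Finset.sum_le_sum h1
  have h3 : 2 * (T * (T - 1) / 2) ≤ T * T := (Nat.mul_div_le _ _).trans (Nat.mul_le_mul_left _ (Nat.sub_le _ _))
  calc _ ≤ 2 * ∑ i ∈ Finset.range I, (α + β) * (T * (I + (α + β)) + T * (T - 1) / 2) := Nat.mul_le_mul_left _ h2
    _ = I * (α + β) * (2 * (T * (I + (α + β))) + 2 * (T * (T - 1) / 2)) := by simp; ring
    _ ≤ I * (α + β) * (2 * (T * (I + (α + β))) + T * T) := by gcongr
    _ = _ := by ring

theorem auxCoeff_support (S : Finset (ℕ × ℕ × ℕ)) (v : ℕ × ℕ × ℕ → ℚ) (t : ℕ) (m : Fin 2 →₀ ℕ)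
    (hm : m ∈ (auxCoeff S v t).support) : (t, m 0, m 1) ∈ S := by
  rw [mem_support_iff, auxCoeff, coeff_sum] at hm
  obtain ⟨x, hx, hx0⟩ := Finset.exists_ne_zero_of_sum_ne_zero hm
  rw [Finset.mem_filter] at hx
  rw [auxCoeff_monomial, coeff_monomial] at hx0
  split_ifs at hx0 with h
  · have : (t, m 0, m 1) = x := by
      rw [← h, ← hx.2]; simp
    rw [this]; exact hx.1
  · exact absurd rfl hx0

/-- derivative of the specialisation -/
theorem derivative_spec {A : Type*} [CommRing A] (v : Fin 2) (y : Fin 2 → A) (F : MvPolynomial (Fin 2) ℤ) :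
    Polynomial.derivative (aeval (fun i => if i = v then Polynomial.X else Polynomial.C (y i)) F) =
      aeval (fun i => if i = v then Polynomial.X else Polynomial.C (y i)) (pderiv v F) := by
  induction F using MvPolynomial.induction_on with
  | C a => simp
  | add p q hp hq => simp only [map_add, hp, hq]
  | mul_X p i hp =>
    rw [map_mul, Polynomial.derivative_mul, hp, Derivation.leibniz, aeval_X]
    simp only [pderiv_X, map_add, smul_eq_mul, map_mul, aeval_X]
    by_cases h : i = v
    · subst h; simp; ring
    · rw [if_neg h, Pi.single_eq_of_ne h]; simp; ring

theorem curve_local {S : Type*} (p : ℕ) (hp : p.Prime) (T k : ℕ) (F : MvPolynomial (Fin 2) ℤ) (v w : Fin 2) (hvw : v ≠ w)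
    (x : Fin 2 → S → ℤ) (a : S → ℤ) (n : ℤ) (s0 : S) (hx : ∀ i s, (p : ℤ) ∣ x i s - x i s0)
    (ha : ∀ s, (p : ℤ) ∣ a s - a s0) (hF : ∀ s, eval (fun i => x i s) F = 0)
    (hFv : ¬ (p : ℤ) ∣ eval (fun i => x i s0) (pderiv v F)) (hka : ¬ (p : ℤ) ∣ k * a s0)
    (heq : ∀ s, a s ^ k = x 1 s ^ k + n - x 0 s ^ k) :
    ∃ t' : Fin 1 → S → ℤ, a ∈ analyticSubring (p : ℤ) T (fun l s => p * t' l s) ∧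
      ∀ i, x i ∈ analyticSubring (p : ℤ) T (fun l s => p * t' l s) := by
  have hpp : Prime (p : ℤ) := Nat.prime_iff_prime_int.1 hp
  choose x' hx' using hx
  refine ⟨fun _ => x' w, ?_⟩
  set R := analyticSubring (p : ℤ) T (fun (_ : Fin 1) s => p * x' w s) with hR
  have mw : x w ∈ R := by
    have e : x w = (fun s => (p : ℤ) * x' w s) + (fun _ => x w s0) := by
      funext s; simp only [Pi.add_apply]; linarith [hx' w s]
    rw [e]
    exact Subring.add_mem _ (analytic_param (p : ℤ) T _ (0 : Fin 1)) (analytic_const _ _ _ _)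
  have mv : x v ∈ R := by
    set G0 : Polynomial R := aeval (fun i => if i = v then Polynomial.X else Polynomial.C (⟨x w, mw⟩ : R)) F with hG0
    have hev : ∀ H : MvPolynomial (Fin 2) ℤ, ∀ s, (((aeval (fun i => if i = v then Polynomial.X else Polynomial.C (⟨x w, mw⟩ : R)) H : Polynomial R).map R.subtype).eval (x v)) s =
        eval (fun i => x i s) H := by
      intro H s
      induction H using MvPolynomial.induction_on with
      | C a => simp
      | add p q hp hq => simp only [map_add, Polynomial.map_add, Polynomial.eval_add, Pi.add_apply, hp, hq]
      | mul_X p i hp =>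
        rw [map_mul, Polynomial.map_mul, Polynomial.eval_mul, Pi.mul_apply, hp, map_mul, aeval_X, eval_X]
        congr 1
        by_cases h : i = v
        · rw [if_pos h, h]; simp
        · have : i = w := by omega
          rw [if_neg h, this]; simp
    have hcop : IsCoprime (p : ℤ) (eval (fun i => x i s0) (pderiv v F)) := by
      rw [Prime.coprime_iff_not_dvd hpp]; exact hFv
    obtain ⟨u, c, huc⟩ := hcop
    refine analytic_newton (G0.map R.subtype) ?_ ?_ (x v s0) c (fun s => ⟨x' v s, hx' v s⟩) ?_
    · intro m
      rw [Polynomial.coeff_map]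
      exact (G0.coeff m).2
    · funext s
      rw [hG0, hev F s, hF s]; rfl
    · intro s
      rw [Polynomial.derivative_map, hG0, derivative_spec v (fun _ => (⟨x w, mw⟩ : R)), hev]
      have h1 : (p : ℤ) ∣ eval (fun i => x i s) (pderiv v F) - eval (fun i => x i s0) (pderiv v F) := by
        induction (pderiv v F) using MvPolynomial.induction_on with
        | C a => simp
        | add P Q hp hq => rw [map_add, map_add, add_sub_add_comm]; exact dvd_add hp hq
        | mul_X P i hp =>
          rw [map_mul, map_mul, eval_X, eval_X]
          have := dvd_add (hp.mul_right (x i s)) ((Dvd.intro _ (hx' i s).symm).mul_left (eval (fun i => x i s0) P))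
          refine (dvd_congr_aux ?_).1 this
          ring
      obtain ⟨d, hd⟩ := h1
      refine ⟨c * d - u, ?_⟩
      have : eval (fun i => x i s) (pderiv v F) = eval (fun i => x i s0) (pderiv v F) + p * d := by linarith
      rw [this]
      linear_combination huc
  have mi : ∀ i, x i ∈ R := by
    intro i
    by_cases h : i = v
    · rw [h]; exact mv
    · have : i = w := by omega
      rw [this]; exact mw
  refine ⟨?_, mi⟩
  set φ : S → ℤ := x 1 ^ k + (fun _ => n) - x 0 ^ k with hφ
  have mφ : φ ∈ R := Subring.sub_mem _ (Subring.add_mem _ (Subring.pow_mem _ (mi 1) k) (analytic_const _ _ _ _))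
    (Subring.pow_mem _ (mi 0) k)
  have hcop : IsCoprime (p : ℤ) ((k : ℤ) * a s0 ^ (k - 1)) := by
    rw [Prime.coprime_iff_not_dvd hpp]
    intro hd
    rcases hpp.dvd_or_dvd hd with h1 | h1
    · exact hka (h1.mul_right _)
    · exact hka ((hpp.dvd_of_dvd_pow h1).mul_left _)
  obtain ⟨u, c, huc⟩ := hcop
  refine analytic_newton (Polynomial.X ^ k - Polynomial.C φ) ?_ ?_ (a s0) c ha ?_
  · intro m
    rw [Polynomial.coeff_sub, Polynomial.coeff_X_pow, Polynomial.coeff_C]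
    apply Subring.sub_mem
    · split_ifs
      · exact Subring.one_mem _
      · exact Subring.zero_mem _
    · split_ifs
      · exact mφ
      · exact Subring.zero_mem _
  · funext s
    simp [hφ, heq s]
  · intro s
    simp only [Polynomial.derivative_sub, Polynomial.derivative_X_pow, Polynomial.derivative_C,
      sub_zero, Polynomial.eval_mul, Polynomial.eval_pow, Polynomial.eval_X, Polynomial.eval_C,
      Pi.mul_apply, Pi.pow_apply, Pi.natCast_apply]
    have h1 : (p : ℤ) ∣ a s ^ (k - 1) - a s0 ^ (k - 1) := (ha s).trans (sub_dvd_pow_sub_pow _ _ _)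
    obtain ⟨v, hv⟩ := h1
    refine ⟨c * k * v - u, ?_⟩
    have : a s ^ (k - 1) = a s0 ^ (k - 1) + p * v := by linarith
    rw [this]
    linear_combination huc

end

section
set_option autoImplicit false
open MvPolynomial

def ipt (z : ℕ × ℕ × ℕ) : Fin 2 → ℤ := ![(z.2.1 : ℤ), (z.2.2 : ℤ)]

theorem ipt_cast (z : ℕ × ℕ × ℕ) (F : MvPolynomial (Fin 2) ℤ) :
    eval (pt z) (map (Int.castRingHom ℚ) F) = ((eval (ipt z) F : ℤ) : ℚ) := by
  have h : pt z = fun i => (Int.castRingHom ℚ) (ipt z i) := by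
    funext i; fin_cases i <;> simp [pt, ipt]
  rw [h, eval_map]
  exact (MvPolynomial.eval₂_comp_left (Int.castRingHom ℚ) (RingHom.id ℤ) (ipt z) F).symm

theorem class_det (k U : ℕ) (n : ℤ) (F : MvPolynomial (Fin 2) ℤ) (v w : Fin 2) (hvw : v ≠ w)
    (p : ℕ) (hp : p.Prime) (I α β T : ℕ) (s : ℕ) (hs : s = I * ((α + β) * T))
    (hnum : (s.factorial ^ 2) * U ^ (s * (2 * (I + (α + β)) + T)) < p ^ (s * (s - 1)))
    (Y : Finset (ℕ × ℕ × ℕ)) (hY : ∀ z ∈ Y, z ∈ Zset k U n)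
    (hYF : ∀ z ∈ Y, eval (ipt z) F = 0)
    (hcl : ∀ z ∈ Y, ∀ z' ∈ Y, (p : ℤ) ∣ z.1 - z'.1 ∧ (p : ℤ) ∣ z.2.1 - z'.2.1 ∧ (p : ℤ) ∣ z.2.2 - z'.2.2)
    (hka : ∀ z ∈ Y, ¬ (p : ℤ) ∣ k * z.1) (hFv : ∀ z ∈ Y, ¬ (p : ℤ) ∣ eval (ipt z) (pderiv v F))
    (zz : NM I α β T → ℕ × ℕ × ℕ) (hzz : ∀ i, zz i ∈ Y) :
    Matrix.det (Matrix.of fun (i j : NM I α β T) =>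
      ((zz i).1 : ℤ) ^ j.1.1 * ((zz i).2.1 : ℤ) ^ j.1.2.1 * ((zz i).2.2 : ℤ) ^ j.1.2.2) = 0 := by
  set A : Matrix (NM I α β T) (NM I α β T) ℤ := Matrix.of fun (i j : NM I α β T) =>
      ((zz i).1 : ℤ) ^ j.1.1 * ((zz i).2.1 : ℤ) ^ j.1.2.1 * ((zz i).2.2 : ℤ) ^ j.1.2.2 with hA
  have hcard : Fintype.card (NM I α β T) = s := by
    rw [Fintype.card_coe, NM_card, hs]
  have hdvd : (p : ℤ) ^ (s * s - 1 * ∑ m : Fin 1 → Fin s, (s - ∑ l, (m l : ℕ))) ∣ A.det := by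
    have := det_dvd_analytic (σ := Fin 1) (κ := Unit) A (p : ℤ) (fun _ => ()) s (by
      intro c
      by_cases hx : Nonempty {i : NM I α β T // () = c}
      swap
      · refine ⟨fun _ _ => 0, fun j => ⟨0, fun i => (hx ⟨i⟩).elim⟩⟩
      obtain ⟨s0⟩ := hx
      obtain ⟨t', h1, h2⟩ := curve_local (S := {i : NM I α β T // () = c}) p hp s k F v w hvw
        (fun i x => ipt (zz x.1) i) (fun x => ((zz x.1).1 : ℤ)) n s0 (by
          intro i x
          have := hcl _ (hzz x.1) _ (hzz s0.1)
          fin_cases i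
          · exact this.2.1
          · exact this.2.2)
        (fun x => (hcl _ (hzz x.1) _ (hzz s0.1)).1) (fun x => hYF _ (hzz x.1)) (hFv _ (hzz s0.1)) (hka _ (hzz s0.1))
        (fun x => by
          have := ((mem_Zset k U n _).1 (hY _ (hzz x.1))).2.1
          simp only [ipt, Matrix.cons_val_zero, Matrix.cons_val_one]
          linarith)
      refine ⟨t', fun j => ?_⟩
      have h3 := h2 0
      have h4 := h2 1
      exact Subring.mul_mem _ (Subring.mul_mem _ (Subring.pow_mem _ h1 j.1.1)
        (Subring.pow_mem _ h3 j.1.2.1)) (Subring.pow_mem _ h4 j.1.2.2))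
    rw [hcard, Fintype.card_unit] at this
    exact this
  have hw := weight_one s
  have hexp : 2 * (s * s - 1 * ∑ m : Fin 1 → Fin s, (s - ∑ l, (m l : ℕ))) = s * (s - 1) := by
    have : s * (s + 1) = s * s + s := by ring
    rw [Nat.mul_sub s s 1]
    omega
  have hbound := det_abs_le A (fun j => (U : ℝ) ^ (j.1.1 + j.1.2.1 + j.1.2.2)) (by
    intro i j
    obtain ⟨⟨⟨h1, h1'⟩, ⟨h2, h2'⟩, ⟨h3, h3'⟩⟩, -⟩ := (mem_Zset k U n _).1 (hY _ (hzz i))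
    simp only [hA, Matrix.of_apply]
    push_cast
    rw [abs_of_nonneg (by positivity), pow_add, pow_add]
    gcongr <;> assumption_mod_cast)
  rw [hcard] at hbound
  rw [Finset.prod_pow_eq_pow_sum] at hbound
  have hsum : ∑ j : NM I α β T, (j.1.1 + j.1.2.1 + j.1.2.2) = ∑ m ∈ NM I α β T, (m.1 + m.2.1 + m.2.2) :=
    Finset.sum_coe_sort (NM I α β T) (fun m => m.1 + m.2.1 + m.2.2)
  rw [hsum] at hbound
  have hdeg := NM_deg I α β T
  rw [← hs] at hdeg
  by_contra hne
  have h1 := Int.le_of_dvd (by positivity) ((pow_dvd_pow_of_dvd hdvd 2).trans (dvd_of_eq (sq_abs A.det).symm))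
  rw [← pow_mul, mul_comm _ 2, hexp] at h1
  have hU : 1 ≤ U := by
    by_contra hU
    have h0 : U = 0 := by omega
    have : NM I α β T = ∅ := by
      by_contra h
      obtain ⟨m, hm⟩ := Finset.nonempty_iff_ne_empty.2 h
      have := ((mem_Zset k U n _).1 (hY _ (hzz ⟨m, hm⟩))).1.1
      omega
    have h2 : s = 0 := by rw [hs, ← NM_card, this]; rfl
    rw [h2] at hnum
    simp at hnum
  have h2 : ((A.det.natAbs : ℕ) : ℝ) ≤ ((s.factorial * U ^ (∑ m ∈ NM I α β T, (m.1 + m.2.1 + m.2.2)) : ℕ) : ℝ) := by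
    rw [Nat.cast_natAbs, Int.cast_abs, Nat.cast_mul, Nat.cast_pow]; exact hbound
  rw [Nat.cast_le] at h2
  have h3 : p ^ (s * (s - 1)) ≤ A.det.natAbs ^ 2 := by
    zify; exact h1
  have h4 : A.det.natAbs ^ 2 ≤ (s.factorial ^ 2) * U ^ (s * (2 * (I + (α + β)) + T)) := by
    calc A.det.natAbs ^ 2 ≤ (s.factorial * U ^ (∑ m ∈ NM I α β T, (m.1 + m.2.1 + m.2.2))) ^ 2 := Nat.pow_le_pow_left h2 2
      _ = s.factorial ^ 2 * U ^ (2 * ∑ m ∈ NM I α β T, (m.1 + m.2.1 + m.2.2)) := by rw [mul_pow, ← pow_mul, mul_comm 2]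
      _ ≤ _ := Nat.mul_le_mul_left _ (Nat.pow_le_pow_right hU hdeg)
  omega

theorem class_bound (k U : ℕ) (hk : 5 ≤ k) (n : ℤ) (hn : n ≠ 0) (r : R2) (hr : Irreducible r)
    (F : MvPolynomial (Fin 2) ℤ) (v w : Fin 2) (hvw : v ≠ w)
    (p : ℕ) (hp : p.Prime) (I T : ℕ) (s : ℕ) (hs : s = I * (r.totalDegree * T)) (hIk : I ≤ k)
    (hI : ∀ k' < I, (k' * r.totalDegree) ^ 2 < k)
    (hpts : ∀ F : R2, ¬ r ∣ F → F.totalDegree ≤ r.totalDegree → ∃ z, GoodPt k n r z ∧ eval z F ≠ 0)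
    (hnum : (s.factorial ^ 2) * U ^ (s * (2 * (I + r.totalDegree) + T)) < p ^ (s * (s - 1)))
    (Y : Finset (ℕ × ℕ × ℕ)) (hY : ∀ z ∈ Y, z ∈ Zset k U n)
    (hYr : ∀ z ∈ Y, eval (pt z) r = 0)
    (hYF : ∀ z ∈ Y, eval (ipt z) F = 0)
    (hcl : ∀ z ∈ Y, ∀ z' ∈ Y, (p : ℤ) ∣ z.1 - z'.1 ∧ (p : ℤ) ∣ z.2.1 - z'.2.1 ∧ (p : ℤ) ∣ z.2.2 - z'.2.2)
    (hka : ∀ z ∈ Y, ¬ (p : ℤ) ∣ k * z.1) (hFv : ∀ z ∈ Y, ¬ (p : ℤ) ∣ eval (ipt z) (pderiv v F)) :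
    Y.card ≤ r.totalDegree * (k * (r.totalDegree + T + k)) := by
  obtain ⟨α, β, hαβ, hlead⟩ := lead_mon r hr.ne_zero
  rw [← hαβ] at hs hnum
  obtain ⟨c, hc0, hc⟩ := exists_vanishing (M := NM I α β T)
    (fun (z : ℕ × ℕ × ℕ) (j : NM I α β T) => (z.1 : ℤ) ^ j.1.1 * (z.2.1 : ℤ) ^ j.1.2.1 * (z.2.2 : ℤ) ^ j.1.2.2) (Y : Set (ℕ × ℕ × ℕ))
    (fun zz hzz => class_det k U n F v w hvw p hp I α β T s hs hnum Y hY hYF hcl hka hFv zz (fun i => hzz i))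
  obtain ⟨m0, hm0⟩ : ∃ m, c m ≠ 0 := by
    by_contra h
    push Not at h
    exact hc0 (funext h)
  set c' : ℕ × ℕ × ℕ → ℚ := fun m => if h : m ∈ NM I α β T then c ⟨m, h⟩ else 0 with hc'
  have hcc : ∀ m : NM I α β T, c' m.1 = c m := fun m => by rw [hc']; simp
  set g := auxCoeff (NM I α β T) c' with hg
  have hgI : ∀ t, I ≤ t → g t = 0 := by
    intro t ht
    rw [hg, auxCoeff]
    apply Finset.sum_eq_zero
    intro m hm
    rw [Finset.mem_filter] at hm
    have := (NM_prop _ _ _ _ _ hm.1).1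
    omega
  have hne : ∃ t < I, ¬ r ∣ g t := by
    refine ⟨m0.1.1, (NM_prop _ _ _ _ _ m0.2).1, fun hd => ?_⟩
    refine auxCoeff_ne_zero (NM I α β T) c' m0.1 m0.2 (by rw [hcc]; exact hm0) (hlead _ hd ?_)
    intro m hm
    exact (NM_prop _ _ _ _ _ (auxCoeff_support _ _ _ _ hm)).2.1
  have hnd := norm_not_dvd r hr k I n hn hk hIk hI hpts g hgI hne
  have hdegN := normMat_degree k (r.totalDegree + T + k) (by omega) (phi2 k n) (phi2_degree k n) g (by
    intro t ht
    refine (auxCoeff_degree _ _ _ (r.totalDegree + T) ?_).trans (by omega)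
    intro m hm _
    rw [← hαβ]
    exact (NM_prop _ _ _ _ _ hm).2.2)
  have hb := bezout_irr r (normMat k (phi2 k n) g).det (Y.image pt) hr (fun h0 => hnd (by rw [h0]; exact dvd_zero r)) hnd (by
    intro x hx
    obtain ⟨z, hz, rfl⟩ := Finset.mem_image.1 hx
    refine ⟨hYr z hz, ?_⟩
    refine normMat_vanish k (by omega) n g (z.1 : ℚ) _ _ ?_ ?_
    · exact_mod_cast ((mem_Zset k U n _).1 (hY z hz)).2.1
    · rw [hg, auxCoeff_eval _ _ _ (fun m hm => lt_of_lt_of_le (NM_prop _ _ _ _ _ hm).1 hIk)]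
      rw [← Finset.sum_coe_sort]
      rw [← hc z hz]
      refine Finset.sum_congr rfl fun m _ => ?_
      rw [hcc]; push_cast; ring)
  rw [Finset.card_image_of_injOn] at hb
  · exact hb.trans (Nat.mul_le_mul_left _ hdegN)
  · intro x hx y hy h
    exact pt_inj k U (by omega) n (hY x hx) (hY y hy) h

end

section
set_option autoImplicit false
open MvPolynomial

def Mset (e : ℕ) : Finset (ℕ × ℕ × ℕ) :=
  (Finset.range 1 ×ˢ Finset.range (e + 1) ×ˢ Finset.range (e + 1)).filter fun m => m.2.1 + m.2.2 ≤ e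

theorem mem_Mset (e : ℕ) (m : ℕ × ℕ × ℕ) : m ∈ Mset e ↔ m.1 = 0 ∧ m.2.1 + m.2.2 ≤ e := by
  simp only [Mset, Finset.mem_filter, Finset.mem_product, Finset.mem_range]
  omega

theorem Mset_card (e : ℕ) : (Mset e).card ≤ (e + 1) ^ 2 := by
  refine (Finset.card_filter_le _ _).trans ?_
  simp; ring_nf; rfl

theorem poly_eq_aux (r : R2) (e : ℕ) (he : r.totalDegree ≤ e) :
    r = auxCoeff (Mset e) (fun m => coeff (Finsupp.single 0 m.2.1 + Finsupp.single 1 m.2.2) r) 0 := by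
  ext d
  rw [auxCoeff, coeff_sum]
  simp only [auxCoeff_monomial, coeff_monomial]
  have hd : d = Finsupp.single 0 (d 0) + Finsupp.single 1 (d 1) := by
    ext i; fin_cases i <;> simp
  by_cases h : d 0 + d 1 ≤ e
  · rw [Finset.sum_eq_single (0, d 0, d 1)]
    · rw [if_pos hd.symm, ← hd]
    · intro m hm hne
      rw [Finset.mem_filter, mem_Mset] at hm
      rw [if_neg]
      intro h2
      apply hne
      rw [← h2]
      ext <;> simp [hm.2]
    · intro h2
      refine absurd ?_ h2
      rw [Finset.mem_filter, mem_Mset]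
      exact ⟨⟨rfl, h⟩, rfl⟩
  · rw [Finset.sum_eq_zero]
    · apply coeff_eq_zero_of_totalDegree_lt
      have : ∑ i ∈ d.support, d i = d 0 + d 1 := by
        have := Finsupp.degree_eq_sum d
        rw [Fin.sum_univ_two] at this
        exact this
      omega
    · intro m hm
      rw [Finset.mem_filter, mem_Mset] at hm
      rw [if_neg]
      intro h2
      apply h
      rw [← h2]; simp; exact hm.1.2

theorem aux_eval0 (e : ℕ) (v : ℕ × ℕ × ℕ → ℚ) (b c : ℚ) :
    eval ![b, c] (auxCoeff (Mset e) v 0) = ∑ m ∈ Mset e, v m * (b ^ m.2.1 * c ^ m.2.2) := by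
  have h := auxCoeff_eval (Mset e) v 1 (fun m hm => by rw [mem_Mset] at hm; omega) 1 b c
  simp only [Finset.range_one, Finset.sum_singleton, pow_zero, mul_one] at h
  rw [h]
  refine Finset.sum_congr rfl fun m _ => ?_
  rw [one_pow, one_mul]

noncomputable def intPoly (e : ℕ) (t : ℕ × ℕ × ℕ → ℤ) : MvPolynomial (Fin 2) ℤ :=
  ∑ m ∈ Mset e, C (t m) * (X 0 ^ m.2.1 * X 1 ^ m.2.2)

theorem intPoly_map (e : ℕ) (t : ℕ × ℕ × ℕ → ℤ) :
    map (Int.castRingHom ℚ) (intPoly e t) = auxCoeff (Mset e) (fun m => (t m : ℚ)) 0 := by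
  rw [intPoly, auxCoeff, map_sum]
  rw [Finset.filter_true_of_mem (fun m hm => ((mem_Mset _ _).1 hm).1)]
  refine Finset.sum_congr rfl fun m _ => ?_
  simp

theorem intPoly_degree (e : ℕ) (t : ℕ × ℕ × ℕ → ℤ) : (intPoly e t).totalDegree ≤ e := by
  refine totalDegree_finsetSum_le fun m hm => ?_
  rw [mem_Mset] at hm
  refine le_trans ?_ hm.2
  refine (totalDegree_mul _ _).trans ?_
  rw [totalDegree_C, zero_add]
  refine (totalDegree_mul _ _).trans ?_
  rw [totalDegree_X_pow, totalDegree_X_pow]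

theorem intPoly_pderiv (e U : ℕ) (t : ℕ × ℕ × ℕ → ℤ) (H : ℤ) (ht : ∀ m ∈ Mset e, |t m| ≤ H) (v : Fin 2) (z : ℕ × ℕ × ℕ)
    (h1 : 1 ≤ z.2.1 ∧ z.2.1 ≤ U) (h2 : 1 ≤ z.2.2 ∧ z.2.2 ≤ U) :
    |eval (ipt z) (pderiv v (intPoly e t))| ≤ (e + 1) ^ 2 * (H * (e * U ^ e)) := by
  have hH : 0 ≤ H := (abs_nonneg _).trans (ht (0, 0, 0) ((mem_Mset _ _).2 ⟨rfl, by simp⟩))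
  rw [intPoly, map_sum, map_sum]
  refine (Finset.abs_sum_le_sum_abs _ _).trans ?_
  have hU : (1 : ℤ) ≤ U := by omega
  have key : ∀ m ∈ Mset e, |eval (ipt z) (pderiv v (C (t m) * (X 0 ^ m.2.1 * X 1 ^ m.2.2)))| ≤ H * (e * U ^ e) := by
    intro m hm
    have htm := ht m hm
    rw [mem_Mset] at hm
    rw [pderiv_C_mul, map_mul, eval_C, abs_mul]
    refine mul_le_mul htm ?_ (abs_nonneg _) hH
    have b1 : ∀ j : ℕ, |(z.2.1 : ℤ) ^ j| ≤ (U : ℤ) ^ j := fun j => by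
      rw [abs_of_nonneg (by positivity)]
      exact pow_le_pow_left₀ (by positivity) (by exact_mod_cast h1.2) _
    have b2 : ∀ j : ℕ, |(z.2.2 : ℤ) ^ j| ≤ (U : ℤ) ^ j := fun j => by
      rw [abs_of_nonneg (by positivity)]
      exact pow_le_pow_left₀ (by positivity) (by exact_mod_cast h2.2) _
    rw [Derivation.leibniz, Derivation.leibniz_pow, Derivation.leibniz_pow, pderiv_X, pderiv_X]
    have hv : v = 0 ∨ v = 1 := by omega
    have hfin : ∀ (a i j : ℕ), a ≤ e → i + j ≤ e → (a : ℤ) * ((U : ℤ) ^ i * (U : ℤ) ^ j) ≤ e * U ^ e := by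
      intro a i j ha hij
      rw [← pow_add]
      exact mul_le_mul (by exact_mod_cast ha) (pow_le_pow_right₀ hU hij) (by positivity) (by positivity)
    rcases hv with rfl | rfl
    · simp only [ipt, Pi.single_eq_same, Pi.single_eq_of_ne (show (1 : Fin 2) ≠ 0 by decide), smul_zero, mul_zero, add_zero, zero_add, map_add, smul_eq_mul, nsmul_eq_mul, mul_one, map_mul, map_pow, eval_X, map_natCast, Matrix.cons_val_zero, Matrix.cons_val_one]
      calc _ = (m.2.1 : ℤ) * (|(z.2.1 : ℤ) ^ (m.2.1 - 1)| * |(z.2.2 : ℤ) ^ m.2.2|) := by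
            rw [abs_mul, abs_mul, Nat.abs_cast]; ring
        _ ≤ (m.2.1 : ℤ) * ((U : ℤ) ^ (m.2.1 - 1) * (U : ℤ) ^ m.2.2) := by
            gcongr
            · exact b1 _
            · exact b2 _
        _ ≤ _ := hfin _ _ _ (by omega) (by omega)
    · simp only [ipt, Pi.single_eq_same, Pi.single_eq_of_ne (show (0 : Fin 2) ≠ 1 by decide), smul_zero, mul_zero, add_zero, zero_add, map_add, smul_eq_mul, nsmul_eq_mul, mul_one, map_mul, map_pow, eval_X, map_natCast, Matrix.cons_val_zero, Matrix.cons_val_one]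
      calc _ = (m.2.2 : ℤ) * (|(z.2.1 : ℤ) ^ m.2.1| * |(z.2.2 : ℤ) ^ (m.2.2 - 1)|) := by
            rw [abs_mul, abs_mul, Nat.abs_cast]; ring
        _ ≤ (m.2.2 : ℤ) * ((U : ℤ) ^ m.2.1 * (U : ℤ) ^ (m.2.2 - 1)) := by
            gcongr
            · exact b1 _
            · exact b2 _
        _ ≤ _ := hfin _ _ _ (by omega) (by omega)
  refine (Finset.sum_le_sum key).trans ?_
  rw [Finset.sum_const, nsmul_eq_mul]
  refine mul_le_mul_of_nonneg_right ?_ (by positivity)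
  exact_mod_cast Mset_card e

section
attribute [local instance] Matrix.seminormedAddCommGroup

theorem siegel_nat {α β : Type*} [Fintype α] [Fintype β] (A : Matrix α β ℤ) (h : Fintype.card α < Fintype.card β)
    (h0 : 0 < Fintype.card α) (N B : ℕ) (hN : Fintype.card β ≤ N) (hB : 1 ≤ B) (hA : ∀ i j, |A i j| ≤ B) :
    ∃ t : β → ℤ, t ≠ 0 ∧ Matrix.mulVec A t = 0 ∧ ∀ j, |t j| ≤ ((N * B) ^ N : ℕ) := by
  obtain ⟨t, ht0, ht, hn⟩ := Int.Matrix.exists_ne_zero_int_vec_norm_le A h h0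
  refine ⟨t, ht0, ht, fun j => ?_⟩
  have hnA : ‖A‖ ≤ B := by
    rw [Matrix.norm_le_iff (by positivity)]
    intro i j
    rw [Int.norm_eq_abs]
    exact_mod_cast hA i j
  have hB' : (1 : ℝ) ≤ B := by exact_mod_cast hB
  have hm : max 1 ‖A‖ ≤ (B : ℝ) := max_le hB' hnA
  have hN' : ((Fintype.card β : ℕ) : ℝ) ≤ N := by exact_mod_cast hN
  have hβ : (1 : ℝ) ≤ Fintype.card β := by exact_mod_cast (by omega)
  have hm1 : (1 : ℝ) ≤ max 1 ‖A‖ := le_max_left _ _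
  have hbase1 : (1 : ℝ) ≤ (Fintype.card β : ℝ) * max 1 ‖A‖ := by nlinarith
  have hbase : (Fintype.card β : ℝ) * max 1 ‖A‖ ≤ (N : ℝ) * B := by
    exact mul_le_mul hN' hm (by linarith) (by positivity)
  have hd : (1 : ℝ) ≤ (Fintype.card β : ℝ) - Fintype.card α := by
    have : ((Fintype.card α + 1 : ℕ) : ℝ) ≤ Fintype.card β := by rw [Nat.cast_le]; exact h
    push_cast at this; linarith
  have hexp : (Fintype.card α : ℝ) / ((Fintype.card β : ℝ) - Fintype.card α) ≤ (N : ℕ) := by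
    have h2 : (Fintype.card α : ℝ) / ((Fintype.card β : ℝ) - Fintype.card α) ≤ Fintype.card α := div_le_self (by positivity) hd
    have h3 : (Fintype.card α : ℝ) ≤ Fintype.card β := by rw [Nat.cast_le]; omega
    linarith
  have h4 : ‖t j‖ ≤ ((N : ℝ) * B) ^ N := by
    calc ‖t j‖ ≤ ‖t‖ := norm_le_pi_norm t j
      _ ≤ _ := hn
      _ ≤ ((Fintype.card β : ℝ) * max 1 ‖A‖) ^ ((N : ℕ) : ℝ) := Real.rpow_le_rpow_of_exponent_le hbase1 hexp
      _ = ((Fintype.card β : ℝ) * max 1 ‖A‖) ^ N := Real.rpow_natCast _ _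
      _ ≤ _ := pow_le_pow_left₀ (by linarith) hbase _
  rw [Int.norm_eq_abs] at h4
  exact_mod_cast h4
end

theorem height (k U : ℕ) (hk : 0 < k) (hU : 0 < U) (n : ℤ) (r : R2) (hr : Irreducible r) (e : ℕ) (he : r.totalDegree = e)
    (hcard : e * e < ((Zset k U n).filter fun z => eval (pt z) r = 0).card) :
    ∃ (t : ℕ × ℕ × ℕ → ℤ) (c : ℚ), c ≠ 0 ∧ map (Int.castRingHom ℚ) (intPoly e t) = C c * r ∧
      ∀ m ∈ Mset e, |t m| ≤ (((e + 1) ^ 2 * U ^ e) ^ ((e + 1) ^ 2) : ℕ) := by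
  set Z := (Zset k U n).filter fun z => eval (pt z) r = 0 with hZ
  set f : Z → (Mset e → ℚ) := fun z m => (z.1.2.1 : ℚ) ^ m.1.2.1 * (z.1.2.2 : ℚ) ^ m.1.2.2 with hf
  obtain ⟨κ, a, ha, hspan, hli⟩ := exists_linearIndependent' ℚ f
  haveI : Finite κ := Finite.of_injective a ha
  haveI : Fintype κ := Fintype.ofFinite κ
  -- functional
  have hfun : ∀ w : ℕ × ℕ × ℕ → ℚ, ∀ z : Z, eval (pt z.1) (auxCoeff (Mset e) w 0) = ∑ m : Mset e, w m.1 * f z m := by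
    intro w z
    rw [pt, aux_eval0, ← Finset.sum_coe_sort]
  have hsp : ∀ w : ℕ × ℕ × ℕ → ℚ, (∀ i, ∑ m : Mset e, w m.1 * f (a i) m = 0) → ∀ x ∈ Submodule.span ℚ (Set.range f),
      ∑ m : Mset e, w m.1 * x m = 0 := by
    intro w hw x hx
    rw [← hspan] at hx
    induction hx using Submodule.span_induction with
    | mem x h => obtain ⟨i, rfl⟩ := h; exact hw i
    | zero => simp
    | add x y _ _ h1 h2 => simp only [Pi.add_apply, mul_add, Finset.sum_add_distrib, h1, h2, add_zero]
    | smul c x _ h1 =>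
      simp only [Pi.smul_apply, smul_eq_mul]
      rw [← mul_zero c, ← h1, Finset.mul_sum]
      exact Finset.sum_congr rfl fun m _ => by ring
  have hMr := poly_eq_aux r e he.le
  set wr : ℕ × ℕ × ℕ → ℚ := fun m => coeff (Finsupp.single 0 m.2.1 + Finsupp.single 1 m.2.2) r with hwr
  have hlt : Fintype.card κ < Fintype.card (Mset e) := by
    have h1 := hli.fintype_card_le_finrank
    rw [Module.finrank_fintype_fun_eq_card] at h1
    refine lt_of_le_of_ne h1 fun heq => ?_
    have htop := hli.span_eq_top_of_card_eq_finrank' (by rw [Module.finrank_fintype_fun_eq_card]; exact heq)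
    rw [hspan] at htop
    have hall := hsp wr (fun i => by
      rw [← hfun, ← hMr]
      exact (Finset.mem_filter.1 (a i).2).2)
    have hz : ∀ m : Mset e, wr m.1 = 0 := by
      intro m
      have := hall (Pi.single m 1) (by rw [htop]; trivial)
      simpa [Pi.single_apply] using this
    apply hr.ne_zero
    rw [hMr, auxCoeff]
    apply Finset.sum_eq_zero
    intro m hm
    rw [hz ⟨m, (Finset.mem_filter.1 hm).1⟩]; simp
  have hZne : Z.Nonempty := by
    rw [← Finset.card_pos]; omega
  have hpos : 0 < Fintype.card κ := by
    by_contra h0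
    haveI : IsEmpty κ := Fintype.card_eq_zero_iff.1 (by omega)
    obtain ⟨z, hz⟩ := hZne
    have h2 : f ⟨z, hz⟩ ∈ Submodule.span ℚ (Set.range f) := Submodule.subset_span ⟨_, rfl⟩
    rw [← hspan, Set.range_eq_empty, Submodule.span_empty, Submodule.mem_bot] at h2
    have h3 := congrFun h2 ⟨(0, 0, 0), (mem_Mset _ _).2 ⟨rfl, by simp⟩⟩
    simp [hf] at h3
  obtain ⟨t, ht0, hAt, htb⟩ := siegel_nat (Matrix.of fun (i : κ) (m : Mset e) =>
      ((a i).1.2.1 : ℤ) ^ m.1.2.1 * ((a i).1.2.2 : ℤ) ^ m.1.2.2) hlt hpos ((e + 1) ^ 2) (U ^ e)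
      (by rw [Fintype.card_coe]; exact Mset_card e) (Nat.one_le_pow _ _ hU) (by
    intro i m
    obtain ⟨⟨-, h1, h2⟩, -⟩ := (mem_Zset k U n _).1 (Finset.mem_filter.1 (a i).2).1
    have hm := (mem_Mset _ _).1 m.2
    rw [Matrix.of_apply, abs_of_nonneg (by positivity)]
    have : (a i).1.2.1 ^ m.1.2.1 * (a i).1.2.2 ^ m.1.2.2 ≤ U ^ e := by
      calc _ ≤ U ^ m.1.2.1 * U ^ m.1.2.2 := Nat.mul_le_mul (Nat.pow_le_pow_left h1.2 _) (Nat.pow_le_pow_left h2.2 _)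
        _ = U ^ (m.1.2.1 + m.1.2.2) := (pow_add _ _ _).symm
        _ ≤ _ := Nat.pow_le_pow_right hU hm.2
    exact_mod_cast this)
  set t' : ℕ × ℕ × ℕ → ℤ := fun m => if h : m ∈ Mset e then t ⟨m, h⟩ else 0 with ht'
  have htt : ∀ m : Mset e, t' m.1 = t m := fun m => by rw [ht']; simp
  have hG := intPoly_map e t'
  set G := map (Int.castRingHom ℚ) (intPoly e t') with hGdef
  have hG0 : G ≠ 0 := by
    obtain ⟨m, hm⟩ : ∃ m, t m ≠ 0 := by
      by_contra h
      push Not at h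
      exact ht0 (funext h)
    have hm1 := ((mem_Mset _ _).1 m.2).1
    have := auxCoeff_ne_zero (Mset e) (fun m => (t' m : ℚ)) m.1 m.2 (by simp only [htt]; exact_mod_cast hm)
    rw [hm1] at this
    rw [hG]; exact this
  have hGd : G.totalDegree ≤ e := by
    rw [hG]
    exact auxCoeff_degree _ _ _ _ fun m hm _ => ((mem_Mset _ _).1 hm).2
  have hGz : ∀ z ∈ Z, eval (pt z) G = 0 := by
    intro z hz
    rw [hG, hfun _ ⟨z, hz⟩]
    refine hsp (fun m => (t' m : ℚ)) (fun i => ?_) (f ⟨z, hz⟩) (Submodule.subset_span ⟨_, rfl⟩)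
    have h1 := congrFun hAt i
    simp only [Matrix.mulVec, dotProduct, Matrix.of_apply, Pi.zero_apply] at h1
    have h2 : ((∑ m : Mset e, ((a i).1.2.1 : ℤ) ^ m.1.2.1 * ((a i).1.2.2 : ℤ) ^ m.1.2.2 * t m : ℤ) : ℚ) = 0 := by
      rw [h1]; simp
    rw [← h2]
    push_cast
    refine Finset.sum_congr rfl fun m _ => ?_
    rw [htt]; simp only [hf]; ring
  have hdvd : r ∣ G := by
    by_contra hnd
    have hb := bezout_irr r G (Z.image pt) hr hG0 hnd (by
      intro x hx
      obtain ⟨z, hz, rfl⟩ := Finset.mem_image.1 hx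
      exact ⟨(Finset.mem_filter.1 hz).2, hGz z hz⟩)
    rw [Finset.card_image_of_injOn] at hb
    · rw [he] at hb
      have := Nat.mul_le_mul_left e hGd
      omega
    · intro x hx y hy h
      exact pt_inj k U hk n (Finset.mem_filter.1 hx).1 (Finset.mem_filter.1 hy).1 h
  obtain ⟨Q, hQ⟩ := hdvd
  have hQ0 : Q ≠ 0 := fun h => hG0 (by rw [hQ, h, mul_zero])
  have hQd : Q.totalDegree = 0 := by
    have := totalDegree_mul_of_isDomain hr.ne_zero hQ0
    rw [← hQ, he] at this
    omega
  rw [totalDegree_eq_zero_iff_eq_C] at hQd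
  refine ⟨t', coeff 0 Q, ?_, ?_, ?_⟩
  · intro h; rw [h, C_0] at hQd; exact hQ0 hQd
  · rw [← hQd, mul_comm]; exact hQ
  · intro m hm
    rw [htt ⟨m, hm⟩]
    exact htb _

end

section
open MvPolynomial
set_option autoImplicit false

theorem spec_natDegree {A : Type*} [CommRing A] (v : Fin 2) (y : Fin 2 → A) (F : MvPolynomial (Fin 2) ℤ) (e : ℕ)
    (he : F.totalDegree ≤ e) :
    (aeval (fun i => if i = v then (Polynomial.X : Polynomial A) else Polynomial.C (y i)) F).natDegree ≤ e := by
  rw [aeval_def, eval₂_eq]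
  refine Polynomial.natDegree_sum_le_of_forall_le _ _ fun d hd => ?_
  have hdeg : d.sum (fun _ e => e) ≤ e := (le_totalDegree hd).trans he
  have h1 : (algebraMap ℤ (Polynomial A)) (coeff d F) = Polynomial.C ((coeff d F : ℤ) : A) := by simp
  rw [h1]
  refine (Polynomial.natDegree_C_mul_le _ _).trans ?_
  refine (Polynomial.natDegree_prod_le _ _).trans ?_
  refine le_trans ?_ hdeg
  rw [Finsupp.sum]
  refine Finset.sum_le_sum fun i _ => ?_
  refine Polynomial.natDegree_pow_le.trans ?_
  split_ifs with h
  · calc _ ≤ d i * 1 := Nat.mul_le_mul_left _ Polynomial.natDegree_X_le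
      _ = _ := mul_one _
  · rw [Polynomial.natDegree_C]; omega

theorem spec_eval (p : ℕ) (v w : Fin 2) (hvw : v ≠ w) (y : Fin 2 → ℤ) (c : ZMod p) (hc : (y w : ZMod p) = c)
    (F : MvPolynomial (Fin 2) ℤ) :
    (aeval (fun i => if i = v then (Polynomial.X : Polynomial (ZMod p)) else Polynomial.C c) F).eval (y v : ZMod p)
      = ((eval y F : ℤ) : ZMod p) := by
  induction F using MvPolynomial.induction_on with
  | C a => simp
  | add p q hp hq => simp only [map_add, Polynomial.eval_add, hp, hq, Int.cast_add]
  | mul_X p i hp =>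
    rw [map_mul, Polynomial.eval_mul, hp, map_mul, aeval_X, eval_X, Int.cast_mul]
    congr 1
    split_ifs with h
    · rw [h, Polynomial.eval_X]
    · have : i = w := by omega
      rw [this, Polynomial.eval_C, hc]

theorem prime_count (k U : ℕ) (hk : 0 < k) (n : ℤ) (e : ℕ) (F : MvPolynomial (Fin 2) ℤ) (hF : F.totalDegree ≤ e)
    (v w : Fin 2) (hvw : v ≠ w) (p : ℕ) (hp : p.Prime) (A : Finset (ℕ × ℕ × ℕ)) (hA : ∀ z ∈ A, z ∈ Zset k U n)
    (hAF : ∀ z ∈ A, eval (ipt z) F = 0) (hFv : ∀ z ∈ A, ¬ (p : ℤ) ∣ eval (ipt z) (pderiv v F))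
    (M : ℕ) (hM : ∀ Y ⊆ A, (∀ z ∈ Y, ∀ z' ∈ Y, (p : ℤ) ∣ z.1 - z'.1 ∧ (p : ℤ) ∣ z.2.1 - z'.2.1 ∧
      (p : ℤ) ∣ z.2.2 - z'.2.2) → Y.card ≤ M) :
    (A.card : ℝ) ≤ p * (e * (k * M)) := by
  haveI : Fact p.Prime := ⟨hp⟩
  have h0 := card_le_fiber A (Finset.univ : Finset (ZMod p)) (fun z => ((ipt z w : ℤ) : ZMod p)) (e * (k * M)) (fun _ _ => Finset.mem_univ _) (by
    intro c _
    set A1 := A.filter fun z => ((ipt z w : ℤ) : ZMod p) = c with hA1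
    by_cases hne : A1.Nonempty
    swap
    · rw [Finset.not_nonempty_iff_eq_empty.1 hne, Finset.card_empty, Nat.cast_zero]; positivity
    set g : Polynomial (ZMod p) := aeval (fun i => if i = v then (Polynomial.X : Polynomial (ZMod p)) else Polynomial.C c) F with hg
    have hg0 : g ≠ 0 := by
      intro h
      obtain ⟨z, hz⟩ := hne
      obtain ⟨hz1, hz2⟩ := Finset.mem_filter.1 hz
      have h1 := spec_eval p v w hvw (ipt z) c hz2 (pderiv v F)
      rw [← derivative_spec v (fun _ => c), ← hg, h] at h1
      simp only [Polynomial.derivative_zero, Polynomial.eval_zero] at h1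
      exact hFv z hz1 ((ZMod.intCast_zmod_eq_zero_iff_dvd _ _).1 h1.symm)
    have hdeg : g.roots.toFinset.card ≤ e :=
      (Multiset.toFinset_card_le _).trans ((Polynomial.card_roots' g).trans (spec_natDegree v (fun _ => c) F e hF))
    have h1 := card_le_fiber A1 g.roots.toFinset (fun z => ((ipt z v : ℤ) : ZMod p)) (k * M) (by
      intro z hz
      obtain ⟨hz1, hz2⟩ := Finset.mem_filter.1 hz
      rw [Multiset.mem_toFinset, Polynomial.mem_roots hg0, Polynomial.IsRoot.def, hg, spec_eval p v w hvw (ipt z) c hz2 F,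
        hAF z hz1, Int.cast_zero]) (by
      intro b _
      set A2 := A1.filter fun z => ((ipt z v : ℤ) : ZMod p) = b with hA2
      by_cases hne2 : A2.Nonempty
      swap
      · rw [Finset.not_nonempty_iff_eq_empty.1 hne2, Finset.card_empty, Nat.cast_zero]; positivity
      obtain ⟨z0, hz0⟩ := hne2
      have hall : ∀ z ∈ A2, ∀ z' ∈ A2, ∀ i, ((ipt z i : ℤ) : ZMod p) = ((ipt z' i : ℤ) : ZMod p) := by
        intro z hz z' hz' i
        obtain ⟨hz1, hz2⟩ := Finset.mem_filter.1 hz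
        obtain ⟨_, hz3⟩ := Finset.mem_filter.1 hz1
        obtain ⟨hz1', hz2'⟩ := Finset.mem_filter.1 hz'
        obtain ⟨_, hz3'⟩ := Finset.mem_filter.1 hz1'
        have hi : i = v ∨ i = w := by omega
        rcases hi with rfl | rfl
        · rw [hz2, hz2']
        · rw [hz3, hz3']
      have hall0 : ∀ z ∈ A2, ∀ z' ∈ A2, (z.2.1 : ZMod p) = (z'.2.1 : ZMod p) ∧ (z.2.2 : ZMod p) = (z'.2.2 : ZMod p) := by
        intro z hz z' hz'
        have e0 := hall z hz z' hz' 0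
        have e1 := hall z hz z' hz' 1
        simp only [ipt, Matrix.cons_val_zero, Matrix.cons_val_one, Int.cast_natCast] at e0 e1
        exact ⟨e0, e1⟩
      have hA20 : ∀ z ∈ A2, z ∈ A := fun z hz => (Finset.mem_filter.1 (Finset.mem_filter.1 hz).1).1
      have heq : ∀ z ∈ A2, (z.1 : ZMod p) ^ k = (z.2.2 : ZMod p) ^ k + (n : ZMod p) - (z.2.1 : ZMod p) ^ k := by
        intro z hz
        have h1 := ((mem_Zset k U n z).1 (hA z (hA20 z hz))).2.1
        have h2 := congrArg (Int.cast : ℤ → ZMod p) h1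
        push_cast at h2
        linear_combination h2
      have hr : (Polynomial.nthRoots k ((z0.1 : ZMod p) ^ k)).toFinset.card ≤ k :=
        (Multiset.toFinset_card_le _).trans (Polynomial.card_nthRoots _ _)
      have h2 := card_le_fiber A2 (Polynomial.nthRoots k ((z0.1 : ZMod p) ^ k)).toFinset (fun z => (z.1 : ZMod p)) M (by
        intro z hz
        rw [Multiset.mem_toFinset, Polynomial.mem_nthRoots hk, heq z hz, heq z0 hz0, (hall0 z hz z0 hz0).1, (hall0 z hz z0 hz0).2]) (by
        intro a _
        rw [Nat.cast_le]
        apply hM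
        · exact fun z hz => hA20 z (Finset.mem_filter.1 hz).1
        · intro z hz z' hz'
          obtain ⟨hz1, hz2⟩ := Finset.mem_filter.1 hz
          obtain ⟨hz1', hz2'⟩ := Finset.mem_filter.1 hz'
          obtain ⟨e0, e1⟩ := hall0 z hz1 z' hz1'
          simp only [← ZMod.intCast_zmod_eq_zero_iff_dvd, Int.cast_sub, Int.cast_natCast, sub_eq_zero]
          exact ⟨hz2.trans hz2'.symm, e0, e1⟩)
      refine h2.trans ?_
      gcongr)
    refine h1.trans ?_
    gcongr)
  rw [Finset.card_univ, ZMod.card] at h0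
  exact h0

end

section
open MvPolynomial
set_option autoImplicit false

theorem good_pts (k U : ℕ) (hk : 0 < k) (n : ℤ) (r : R2) (hr : Irreducible r)
    (hcard : r.totalDegree * r.totalDegree < ((Zset k U n).filter fun z => eval (pt z) r = 0).card)
    (F : R2) (hF : ¬ r ∣ F) (hFd : F.totalDegree ≤ r.totalDegree) : ∃ z, GoodPt k n r z ∧ eval z F ≠ 0 := by
  by_contra hcon
  push Not at hcon
  set Z := (Zset k U n).filter fun z => eval (pt z) r = 0 with hZ
  have hF0 : F ≠ 0 := fun h => hF (by rw [h]; exact dvd_zero _)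
  have hb := bezout_irr r F (Z.image pt) hr hF0 hF (by
    intro x hx
    obtain ⟨z, hz, rfl⟩ := Finset.mem_image.1 hx
    obtain ⟨hz1, hz2⟩ := Finset.mem_filter.1 hz
    refine ⟨hz2, hcon _ ⟨hz2, ?_⟩⟩
    obtain ⟨⟨h1, h2, h3⟩, h4, h5, h6⟩ := (mem_Zset k U n z).1 hz1
    simp only [pt, Matrix.cons_val_zero, Matrix.cons_val_one]
    refine ⟨by exact_mod_cast h2.1, by exact_mod_cast h3.1, by exact_mod_cast h6, (z.1 : ℚ), by exact_mod_cast h1.1,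
      by exact_mod_cast h5, ?_⟩
    have h7 : (z.1 : ℚ) ^ k + (z.2.1 : ℚ) ^ k = (z.2.2 : ℚ) ^ k + n := by exact_mod_cast h4
    linarith)
  rw [Finset.card_image_of_injOn] at hb
  · have := Nat.mul_le_mul_left r.totalDegree hFd
    omega
  · intro x hx y hy h
    exact pt_inj k U hk n (Finset.mem_filter.1 hx).1 (Finset.mem_filter.1 hy).1 h

theorem curve_count (k U : ℕ) (hk : 5 ≤ k) (hU : 0 < U) (n : ℤ) (hn : n ≠ 0) (r : R2) (hr : Irreducible r)
    (e : ℕ) (he : r.totalDegree = e) (I T s : ℕ) (hs : s = I * (e * T)) (hIk : I ≤ k) (hI : ∀ k' < I, (k' * e) ^ 2 < k)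
    (N s1 : ℕ) (hN : 0 < N)
    (hnum : ∀ p, N < p → (s.factorial ^ 2) * U ^ (s * (2 * (I + e) + T)) < p ^ (s * (s - 1)))
    (hms : k * U * ((e + 1) ^ 2 * (((e + 1) ^ 2 * U ^ e) ^ ((e + 1) ^ 2) * (e * U ^ e))) ≤ N ^ s1) :
    (((Zset k U n).filter fun z => eval (pt z) r = 0).card : ℝ) ≤
      e * e + (s1 + 1) * ((2 ^ (s1 + 1) * N) * (e * (k * (e * (k * (e + T + k)))))) := by
  set Z := (Zset k U n).filter fun z => eval (pt z) r = 0 with hZ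
  by_cases hcard : Z.card ≤ e * e
  · have : (Z.card : ℝ) ≤ e * e := by exact_mod_cast hcard
    refine this.trans (le_add_of_nonneg_right (by positivity))
  push Not at hcard
  have hpts := good_pts k U (by omega) n r hr (by rw [he]; exact hcard)
  obtain ⟨t, c, hc, hmap, ht⟩ := height k U (by omega) hU n r hr e he hcard
  set F := intPoly e t with hF
  have hFd : F.totalDegree ≤ e := intPoly_degree e t
  have hZF : ∀ z ∈ Z, eval (ipt z) F = 0 := by
    intro z hz
    have h1 := ipt_cast z F
    rw [hmap, map_mul, (Finset.mem_filter.1 hz).2, mul_zero] at h1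
    exact_mod_cast h1.symm
  obtain ⟨v, w, hvw, hv⟩ : ∃ v w : Fin 2, v ≠ w ∧ pderiv v r ≠ 0 := by
    by_cases h0 : pderiv 0 r = 0
    · exact ⟨1, 0, by decide, fun h1 => pderiv_both hr h0 h1⟩
    · exact ⟨0, 1, by decide, h0⟩
  have hnd : ¬ r ∣ pderiv v r := fun h => hv (dvd_of_PD_lt (pderiv_PD r v) h)
  set S := Z.filter fun z => eval (pt z) (pderiv v r) = 0 with hS
  have hSc : S.card ≤ e * e := by
    have hb := bezout_irr r (pderiv v r) (S.image pt) hr hv hnd (by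
      intro x hx
      obtain ⟨z, hz, rfl⟩ := Finset.mem_image.1 hx
      obtain ⟨hz1, hz2⟩ := Finset.mem_filter.1 hz
      exact ⟨(Finset.mem_filter.1 hz1).2, hz2⟩)
    rw [Finset.card_image_of_injOn] at hb
    · have := Nat.mul_le_mul_left r.totalDegree (pderiv_deg r v)
      rw [he] at hb this
      omega
    · intro x hx y hy h
      exact pt_inj k U (by omega) n (Finset.mem_filter.1 (Finset.mem_filter.1 hx).1).1
        (Finset.mem_filter.1 (Finset.mem_filter.1 hy).1).1 h
  obtain ⟨P, hPc, hP⟩ := bertrand_list (s1 + 1) N hN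
  set B : ℕ → Finset (ℕ × ℕ × ℕ) := fun p => Z.filter fun z => ¬ (p : ℤ) ∣ (k * z.1) * eval (ipt z) (pderiv v F) with hB
  have hcov : Z ⊆ S ∪ P.biUnion B := by
    intro z hz
    rw [Finset.mem_union]
    by_cases hzs : eval (pt z) (pderiv v r) = 0
    · left; exact Finset.mem_filter.2 ⟨hz, hzs⟩
    right
    obtain ⟨⟨h1, h2, h3⟩, -⟩ := (mem_Zset k U n z).1 (Finset.mem_filter.1 hz).1
    have hm0 : eval (ipt z) (pderiv v F) ≠ 0 := by
      intro h
      have h4 := ipt_cast z (pderiv v F)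
      rw [h, ← pderiv_map, hmap, pderiv_C_mul, map_mul, eval_C, Int.cast_zero] at h4
      exact (mul_ne_zero hc hzs) h4
    have hb := intPoly_pderiv e U t _ ht v z h2 h3
    by_contra hcon
    have hall : ∀ p ∈ P, (p : ℤ) ∣ (k * z.1) * eval (ipt z) (pderiv v F) := by
      intro p hp
      by_contra h
      exact hcon (Finset.mem_biUnion.2 ⟨p, hp, Finset.mem_filter.2 ⟨hz, h⟩⟩)
    have := bad_card N s1 ((k * z.1) * eval (ipt z) (pderiv v F)) (mul_ne_zero (by
        have : (z.1 : ℤ) ≠ 0 := by omega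
        have : (k : ℤ) ≠ 0 := by omega
        positivity) hm0) (by
      refine le_trans ?_ hms
      rw [Int.natAbs_mul]
      refine Nat.mul_le_mul ?_ ?_
      · rw [Int.natAbs_mul, Int.natAbs_natCast, Int.natAbs_natCast]
        exact Nat.mul_le_mul_left _ h1.2
      · rw [← Int.natCast_natAbs] at hb
        exact_mod_cast hb) hN P (fun p hp => ⟨(hP p hp).1, (hP p hp).2.1, hall p hp⟩)
    omega
  have hBc : ∀ p ∈ P, ((B p).card : ℝ) ≤ (2 ^ (s1 + 1) * N) * (e * (k * (e * (k * (e + T + k))))) := by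
    intro p hp
    obtain ⟨hp1, hp2, hp3⟩ := hP p hp
    have hBz : ∀ z ∈ B p, z ∈ Z ∧ ¬ (p : ℤ) ∣ k * z.1 ∧ ¬ (p : ℤ) ∣ eval (ipt z) (pderiv v F) := by
      intro z hz
      obtain ⟨hz1, hz2⟩ := Finset.mem_filter.1 hz
      exact ⟨hz1, fun h => hz2 (Dvd.dvd.mul_right h _), fun h => hz2 (Dvd.dvd.mul_left h _)⟩
    have h1 := prime_count k U (by omega) n e F hFd v w hvw p hp1 (B p)
      (fun z hz => (Finset.mem_filter.1 (hBz z hz).1).1) (fun z hz => hZF z (hBz z hz).1)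
      (fun z hz => (hBz z hz).2.2) (e * (k * (e + T + k))) (by
        intro Y hY hcl
        have := class_bound k U hk n hn r hr F v w hvw p hp1 I T s (by rw [he]; exact hs) hIk
          (by rw [he]; exact hI) hpts (by rw [he]; exact hnum p hp2) Y
          (fun z hz => (Finset.mem_filter.1 (hBz z (hY hz)).1).1)
          (fun z hz => (Finset.mem_filter.1 (hBz z (hY hz)).1).2)
          (fun z hz => hZF z (hBz z (hY hz)).1) hcl (fun z hz => (hBz z (hY hz)).2.1)
          (fun z hz => (hBz z (hY hz)).2.2)
        rw [he] at this
        exact this)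
    have h2 : (p : ℝ) ≤ 2 ^ (s1 + 1) * N := by exact_mod_cast hp3
    refine h1.trans ?_
    push_cast
    exact mul_le_mul_of_nonneg_right h2 (by positivity)
  have h1 : (Z.card : ℝ) ≤ S.card + ∑ p ∈ P, ((B p).card : ℝ) := by
    have := (Finset.card_le_card hcov).trans ((Finset.card_union_le _ _).trans (Nat.add_le_add_left Finset.card_biUnion_le _))
    exact_mod_cast this
  have h2 := Finset.sum_le_sum hBc
  rw [Finset.sum_const, hPc, nsmul_eq_mul] at h2
  push_cast at h2
  have h3 : (S.card : ℝ) ≤ e * e := by exact_mod_cast hSc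
  linarith only [h1, h2, h3]

end

section
open MvPolynomial
set_option autoImplicit false

theorem rpow_pow_ge (U K : ℕ) (hU : 0 < U) (θ : ℝ) (m : ℕ) (a : ℕ) (h : (a : ℝ) ≤ θ * m) :
    (K : ℝ) ^ m * (U : ℝ) ^ a ≤ (K * (U : ℝ) ^ θ) ^ m := by
  have hU1 : (1 : ℝ) ≤ U := by exact_mod_cast hU
  rw [mul_pow, ← Real.rpow_natCast ((U : ℝ) ^ θ) m, ← Real.rpow_mul (by positivity), ← Real.rpow_natCast (U : ℝ) a]
  exact mul_le_mul_of_nonneg_left (Real.rpow_le_rpow_of_exponent_le hU1 h) (by positivity)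

theorem curve_deg (k : ℕ) (hk : 5 ≤ k) (ε : ℝ) (hε : 0 < ε) (e : ℕ) (he1 : 0 < e) : ∃ C : ℝ, 0 < C ∧
    ∀ U : ℕ, 0 < U → ∀ n : ℤ, n ≠ 0 → ∀ r : R2, Irreducible r → r.totalDegree = e →
    (((Zset k U n).filter fun z => eval (pt z) r = 0).card : ℝ) ≤ C * (U : ℝ) ^ (1 / Real.sqrt k + ε) := by
  set θ : ℝ := 1 / Real.sqrt k + ε with hθ
  have hk0 : (0 : ℝ) < k := by exact_mod_cast (show 0 < k by omega)
  have hsq : 0 < Real.sqrt k := Real.sqrt_pos.2 hk0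
  have hθ0 : 0 < θ := by positivity
  have hex : ∃ I : ℕ, k ≤ (I * e) ^ 2 := ⟨k, by nlinarith [Nat.mul_le_mul_left k he1]⟩
  obtain ⟨I, hI1, hIk, hI2⟩ : ∃ I : ℕ, k ≤ (I * e) ^ 2 ∧ I ≤ k ∧ ∀ k' < I, (k' * e) ^ 2 < k := by
    refine ⟨Nat.find hex, Nat.find_spec hex, Nat.find_min' hex (by nlinarith [Nat.mul_le_mul_left k he1]), ?_⟩
    intro k' hk'
    have := Nat.find_min hex hk'
    omega
  have hIe : Real.sqrt k ≤ (I : ℝ) * e := by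
    apply Real.sqrt_le_iff.2
    exact ⟨by positivity, by exact_mod_cast hI1⟩
  have hI0 : 0 < I := by
    rcases Nat.eq_zero_or_pos I with h | h
    · rw [h] at hI1; simp at hI1; omega
    · exact h
  obtain ⟨T0, hT0⟩ := exists_nat_ge ((2 * ((I : ℝ) + e) + θ) / ε)
  set T := T0 + 3 with hT
  set s := I * (e * T) with hs
  have hIe1 : 1 ≤ I * e := Nat.mul_pos hI0 he1
  have hs3 : 3 ≤ s := by
    have : s = (I * e) * T := by rw [hs]; ring
    rw [this]
    nlinarith
  have hTε : 2 * ((I : ℝ) + e) + θ ≤ ε * T := by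
    have h1 := (div_le_iff₀ hε).1 hT0
    have h2 : (T : ℝ) = T0 + 3 := by rw [hT]; push_cast; ring
    rw [h2]; nlinarith
  have hexp : (2 * ((I : ℝ) + e) + T) ≤ θ * ((s : ℝ) - 1) := by
    have h1 : (1 : ℝ) + ε ≤ θ * (I * e) := by
      have h2 : (1 : ℝ) ≤ I * e := by exact_mod_cast hIe1
      have h3 : 1 ≤ 1 / Real.sqrt k * (I * e) := by
        rw [div_mul_eq_mul_div, one_mul, le_div_iff₀ hsq, one_mul]; exact hIe
      have h4 : ε * 1 ≤ ε * (I * e) := mul_le_mul_of_nonneg_left h2 hε.le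
      rw [hθ, add_mul]; linarith only [h3, h4]
    have h5 : (1 + ε) * T ≤ θ * (I * e) * T := mul_le_mul_of_nonneg_right h1 (by positivity)
    have h6 : (s : ℝ) = I * e * T := by rw [hs]; push_cast; ring
    rw [h6]
    linarith only [h5, hTε]
  set E := (e + 1) ^ 2 with hE
  set C1 := k * E * (E ^ E * e) with hC1
  set C2 := 1 + e * E + e with hC2
  obtain ⟨s0, hs0⟩ := exists_nat_ge ((C2 : ℝ) / θ)
  set s1 := s0 + 1 with hs1
  have hs1θ : (C2 : ℝ) ≤ θ * s1 := by
    have h1 := (div_le_iff₀ hθ0).1 hs0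
    rw [hs1]; push_cast; nlinarith
  set K := s + C1 + 1 with hK
  refine ⟨e * e + (s1 + 1) * ((2 ^ (s1 + 1) * (K + 1)) * (e * (k * (e * (k * (e + T + k)))))), by positivity, ?_⟩
  intro U hU n hn r hr hre
  have hU1 : (1 : ℝ) ≤ U := by exact_mod_cast hU
  have hUθ : (1 : ℝ) ≤ (U : ℝ) ^ θ := Real.one_le_rpow hU1 hθ0.le
  set N := ⌈(K : ℝ) * (U : ℝ) ^ θ⌉₊ with hN
  have hNge : (K : ℝ) * (U : ℝ) ^ θ ≤ N := Nat.le_ceil _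
  have hNle : (N : ℝ) ≤ (K + 1) * (U : ℝ) ^ θ := by
    have := (Nat.ceil_lt_add_one (show 0 ≤ (K : ℝ) * (U : ℝ) ^ θ by positivity)).le
    rw [← hN] at this
    linarith only [this, hUθ]
  have hKpos : (1 : ℝ) ≤ K := by exact_mod_cast (show 1 ≤ K by omega)
  have hN0 : 0 < N := by
    have : (0 : ℝ) < N := lt_of_lt_of_le (by positivity) hNge
    exact_mod_cast this
  have hmain := curve_count k U hk hU n hn r hr e hre I T s hs hIk hI2 N s1 hN0 (by
    intro p hp
    have hp' : (K : ℝ) * (U : ℝ) ^ θ < p := lt_of_le_of_lt hNge (by exact_mod_cast hp)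
    have h1 : (s.factorial ^ 2) ≤ K ^ (s * (s - 1)) := by
      calc s.factorial ^ 2 ≤ (s ^ s) ^ 2 := Nat.pow_le_pow_left (Nat.factorial_le_pow s) 2
        _ = s ^ (s * 2) := by rw [← pow_mul]
        _ ≤ s ^ (s * (s - 1)) := Nat.pow_le_pow_right (by omega) (Nat.mul_le_mul_left _ (by omega))
        _ ≤ _ := Nat.pow_le_pow_left (by omega) _
    have h2 := rpow_pow_ge U K hU θ (s * (s - 1)) (s * (2 * (I + e) + T)) (by
      push_cast [Nat.cast_sub (show 1 ≤ s by omega)]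
      have := mul_le_mul_of_nonneg_left hexp (show (0 : ℝ) ≤ s by positivity)
      linarith only [this])
    have h3 : ((K : ℝ) * (U : ℝ) ^ θ) ^ (s * (s - 1)) < (p : ℝ) ^ (s * (s - 1)) :=
      pow_lt_pow_left₀ hp' (by positivity) (by
        have : 0 < s * (s - 1) := Nat.mul_pos (by omega) (by omega)
        omega)
    have h4 : ((s.factorial ^ 2 : ℕ) : ℝ) * (U : ℝ) ^ (s * (2 * (I + e) + T)) ≤ (K : ℝ) ^ (s * (s - 1)) * (U : ℝ) ^ (s * (2 * (I + e) + T)) :=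
      mul_le_mul_of_nonneg_right (by exact_mod_cast h1) (by positivity)
    have h5 := h4.trans_lt (h2.trans_lt h3)
    exact_mod_cast h5) (by
    have h2 := rpow_pow_ge U K hU θ s1 C2 hs1θ
    have h3 : ((K : ℝ) * (U : ℝ) ^ θ) ^ s1 ≤ (N : ℝ) ^ s1 := pow_le_pow_left₀ (by positivity) hNge _
    have h4 : C1 ≤ K ^ s1 := by
      calc C1 ≤ K := by omega
        _ = K ^ 1 := (pow_one _).symm
        _ ≤ _ := Nat.pow_le_pow_right (by omega) (by omega)
    have h5 : (C1 : ℝ) * (U : ℝ) ^ C2 ≤ (K : ℝ) ^ s1 * (U : ℝ) ^ C2 :=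
      mul_le_mul_of_nonneg_right (by exact_mod_cast h4) (by positivity)
    have h6 : C1 * U ^ C2 ≤ N ^ s1 := by exact_mod_cast h5.trans (h2.trans h3)
    refine le_trans (le_of_eq ?_) h6
    rw [hC1, hC2, mul_pow, ← pow_mul, pow_add, pow_add, pow_one]
    ring)
  refine hmain.trans ?_
  have h9 : (e : ℝ) * e ≤ e * e * (U : ℝ) ^ θ := le_mul_of_one_le_right (by positivity) hUθ
  have h7 : (2 : ℝ) ^ (s1 + 1) * N * (e * (k * (e * (k * (e + T + k))))) ≤
      2 ^ (s1 + 1) * ((K + 1) * (U : ℝ) ^ θ) * (e * (k * (e * (k * (e + T + k))))) := by gcongr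
  have h8 := mul_le_mul_of_nonneg_left h7 (show (0 : ℝ) ≤ s1 + 1 by positivity)
  refine (add_le_add h9 h8).trans (le_of_eq (by ring))

theorem curveBound : CurveBound := by
  intro k hk ε hε e0
  have h : ∀ e : ℕ, ∃ C : ℝ, 0 < C ∧ (0 < e →
    ∀ U : ℕ, 0 < U → ∀ n : ℤ, n ≠ 0 → ∀ r : R2, Irreducible r → r.totalDegree = e →
    (((Zset k U n).filter fun z => eval (pt z) r = 0).card : ℝ) ≤ C * (U : ℝ) ^ (1 / Real.sqrt k + ε)) := by
    intro e
    by_cases he : 0 < e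
    · obtain ⟨C, hC, h⟩ := curve_deg k hk ε hε e he
      exact ⟨C, hC, fun _ => h⟩
    · exact ⟨1, one_pos, fun h => absurd h he⟩
  choose C hC hb using h
  refine ⟨∑ e ∈ Finset.range (e0 + 1), C e, Finset.sum_pos (fun i _ => hC i) ⟨0, by simp⟩, ?_⟩
  intro U hU n hn r hr hre
  refine (hb r.totalDegree (irr_totalDegree_pos r hr) U hU n hn r hr rfl).trans ?_
  refine mul_le_mul_of_nonneg_right ?_ (by positivity)
  exact Finset.single_le_sum (f := C) (fun i _ => (hC i).le) (Finset.mem_range.2 (by omega))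

end

section
def quadSet (k U : ℕ) (h : ℤ) : Finset (ℕ × ℕ × ℕ × ℕ) :=
  ((Finset.Icc 1 U) ×ˢ (Finset.Icc 1 U) ×ˢ (Finset.Icc 1 U) ×ˢ (Finset.Icc 1 U)).filter
    fun x => (x.1 : ℤ) ^ k + (x.2.1 : ℤ) ^ k = (x.2.2.1 : ℤ) ^ k + (x.2.2.2 : ℤ) ^ k + h

theorem energy_le_quad (k U : ℕ) (h : ℤ) :
    addEnergyShift h ((Finset.Icc 1 U).image (fun u : ℕ => (u : ℤ) ^ k)) ≤ (quadSet k U h).card := by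
  unfold addEnergyShift
  have : ((((Finset.Icc 1 U).image (fun u : ℕ => (u : ℤ) ^ k)) ×ˢ ((Finset.Icc 1 U).image (fun u : ℕ => (u : ℤ) ^ k)) ×ˢ ((Finset.Icc 1 U).image (fun u : ℕ => (u : ℤ) ^ k)) ×ˢ ((Finset.Icc 1 U).image (fun u : ℕ => (u : ℤ) ^ k))).filter
      fun x => x.1 + x.2.1 = x.2.2.1 + x.2.2.2 + h) ⊆ (quadSet k U h).image
      (fun x => ((x.1 : ℤ) ^ k, (x.2.1 : ℤ) ^ k, (x.2.2.1 : ℤ) ^ k, (x.2.2.2 : ℤ) ^ k)) := by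
    rintro ⟨p, q, r, s⟩ hx
    simp only [Finset.mem_filter, Finset.mem_product, Finset.mem_image] at hx
    obtain ⟨⟨⟨a, ha, rfl⟩, ⟨b, hb, rfl⟩, ⟨c, hc, rfl⟩, ⟨d, hd, rfl⟩⟩, he⟩ := hx
    simp only [Finset.mem_image]
    refine ⟨(a, b, c, d), ?_, rfl⟩
    simp only [quadSet, Finset.mem_filter, Finset.mem_product]
    exact ⟨⟨ha, hb, hc, hd⟩, he⟩
  exact (Finset.card_le_card this).trans Finset.card_image_le

theorem quad_small (k : ℕ) (hk : 2 ≤ k) (ε : ℝ) (hε : 0 < ε) :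
    ∃ C : ℝ, 0 < C ∧ ∀ U : ℕ, 0 < U → ∀ h : ℤ, h ≠ 0 →
      ((quadSet k U h).card : ℝ) ≤ C * (U : ℝ) ^ (2 + ε) := by
  obtain ⟨C, hC1, hC⟩ := pow_diff_count k hk ε hε
  refine ⟨2 * C, by positivity, fun U hU h hh => ?_⟩
  have hU1 : (1 : ℝ) ≤ U := by exact_mod_cast hU
  have hk0 : k ≠ 0 := by omega
  set I := Finset.Icc 1 U with hI
  have cI : I.card = U := by simp [hI]
  set Q := quadSet k U h with hQ
  rw [← Finset.card_filter_add_card_filter_not (s := Q) (fun x => x.1 ^ k - (x.2.2.1 : ℤ) ^ k = h)]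
  have h1 : ((Q.filter (fun x => x.1 ^ k - (x.2.2.1 : ℤ) ^ k = h)).card : ℝ) ≤ U * (C * (U : ℝ) ^ ε) := by
    have := card_le_fiber (Q.filter (fun x => x.1 ^ k - (x.2.2.1 : ℤ) ^ k = h)) I (fun x => x.2.1)
      (C * (U : ℝ) ^ ε) ?_ ?_
    · rwa [cI] at this
    · rintro ⟨a, b, c, d⟩ hx
      simp only [hQ, quadSet, Finset.mem_filter, Finset.mem_product] at hx
      exact hx.1.1.2.1
    · intro t ht
      refine le_trans ?_ (hC U hU h hh)
      rw [Nat.cast_le]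
      apply Finset.card_le_card_of_injOn (fun x => (x.1, x.2.2.1))
      · rintro ⟨a, b, c, d⟩ hx
        simp only [hQ, quadSet, Finset.coe_filter, Finset.mem_filter, Finset.mem_product, Set.mem_ofPred_eq] at hx ⊢
        exact ⟨⟨hx.1.1.1.1, hx.1.1.1.2.2.1⟩, hx.1.2⟩
      · rintro ⟨a, b, c, d⟩ hx ⟨a', b', c', d'⟩ hy hxy
        simp only [hQ, quadSet, Finset.coe_filter, Finset.mem_filter, Finset.mem_product, Set.mem_ofPred_eq] at hx hy
        simp only [Prod.mk.injEq] at hxy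
        obtain ⟨rfl, rfl⟩ := hxy
        have e1 : b = b' := hx.2.trans hy.2.symm
        subst e1
        have e2 : (d : ℤ) ^ k = (d' : ℤ) ^ k := by linarith [hx.1.1.2, hy.1.1.2]
        have e3 : d = d' := Nat.pow_left_injective hk0 (by exact_mod_cast e2)
        rw [e3]
  have h2 : ((Q.filter (fun x => ¬ x.1 ^ k - (x.2.2.1 : ℤ) ^ k = h)).card : ℝ) ≤ (U * U) * (C * (U : ℝ) ^ ε) := by
    have := card_le_fiber (Q.filter (fun x => ¬ x.1 ^ k - (x.2.2.1 : ℤ) ^ k = h)) (I ×ˢ I) (fun x => (x.1, x.2.2.1))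
      (C * (U : ℝ) ^ ε) ?_ ?_
    · rw [Finset.card_product, cI] at this
      exact_mod_cast this
    · rintro ⟨a, b, c, d⟩ hx
      simp only [hQ, quadSet, Finset.mem_filter, Finset.mem_product] at hx ⊢
      exact ⟨hx.1.1.1, hx.1.1.2.2.1⟩
    · rintro ⟨a, c⟩ ht
      by_cases hac : (a : ℤ) ^ k - (c : ℤ) ^ k = h
      · rw [Finset.filter_eq_empty_iff.2 (by
          rintro ⟨a', b, c', d⟩ hx hxy
          simp only [Prod.mk.injEq] at hxy
          obtain ⟨rfl, rfl⟩ := hxy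
          simp only [Finset.mem_filter] at hx
          exact hx.2 hac)]
        simp; positivity
      refine le_trans ?_ (hC U hU ((a : ℤ) ^ k - (c : ℤ) ^ k - h) (sub_ne_zero.2 hac))
      rw [Nat.cast_le]
      apply Finset.card_le_card_of_injOn (fun x => (x.2.2.2, x.2.1))
      · rintro ⟨a', b, c', d⟩ hx
        simp only [hQ, quadSet, Finset.coe_filter, Finset.mem_filter, Finset.mem_product, Set.mem_ofPred_eq, Prod.mk.injEq] at hx ⊢
        obtain ⟨hx, rfl, rfl⟩ := hx
        exact ⟨⟨hx.1.1.2.2.2, hx.1.1.2.1⟩, by linarith [hx.1.2]⟩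
      · rintro ⟨a1, b, c1, d⟩ hx ⟨a', b', c', d'⟩ hy hxy
        simp only [hQ, quadSet, Finset.coe_filter, Finset.mem_filter, Finset.mem_product, Set.mem_ofPred_eq, Prod.mk.injEq] at hx hy hxy ⊢
        exact ⟨hx.2.1.trans hy.2.1.symm, hxy.2, hx.2.2.trans hy.2.2.symm, hxy.1⟩
  have e : (U : ℝ) ^ (2 + ε) = U * U * (U : ℝ) ^ ε := by
    rw [Real.rpow_add (by positivity)]
    norm_num [sq]
  push_cast
  rw [e]
  have : (U : ℝ) * (C * (U : ℝ) ^ ε) ≤ (U * U) * (C * (U : ℝ) ^ ε) := by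
    apply mul_le_mul_of_nonneg_right _ (by positivity)
    nlinarith
  nlinarith

theorem quad_large (core : CoreBound) (k : ℕ) (hk : 5 ≤ k) (ε : ℝ) (hε : 0 < ε) :
    ∃ C : ℝ, 0 < C ∧ ∀ U : ℕ, 0 < U → ∀ h : ℤ, h ≠ 0 →
      ((quadSet k U h).card : ℝ) ≤ C * (U : ℝ) ^ (1 + 2 / Real.sqrt k + ε) := by
  obtain ⟨C, hC1, hC⟩ := pow_diff_count k (by omega) ε hε
  obtain ⟨D, hD0, hD⟩ := core k hk ε hε
  refine ⟨3 * C + D, by positivity, fun U hU h hh => ?_⟩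
  have hU1 : (1 : ℝ) ≤ U := by exact_mod_cast hU
  have hk0 : k ≠ 0 := by omega
  set I := Finset.Icc 1 U with hI
  have cI : I.card = U := by simp [hI]
  set Q := quadSet k U h with hQ
  set Q1 := Q.filter (fun x => x.1 = x.2.2.1) with hQ1
  set Q2 := Q.filter (fun x => x.2.1 = x.2.2.1) with hQ2
  set Q3 := Q.filter (fun x => (x.2.2.2 : ℤ) ^ k + h = 0) with hQ3
  set Q4 := Q.filter (fun x => (x.2.2.2 : ℤ) ^ k + h ≠ 0 ∧ x.1 ≠ x.2.2.1 ∧ x.2.1 ≠ x.2.2.1) with hQ4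
  have hsub : Q ⊆ Q1 ∪ Q2 ∪ Q3 ∪ Q4 := by
    intro x hx
    simp only [hQ1, hQ2, hQ3, hQ4, Finset.mem_union, Finset.mem_filter, hx, true_and]
    tauto
  have hcard : (Q.card : ℝ) ≤ Q1.card + Q2.card + Q3.card + Q4.card := by
    have h1 := Finset.card_le_card hsub
    have h2 := Finset.card_union_le (Q1 ∪ Q2 ∪ Q3) Q4
    have h3 := Finset.card_union_le (Q1 ∪ Q2) Q3
    have h4 := Finset.card_union_le Q1 Q2
    norm_cast
    omega
  have b1 : (Q1.card : ℝ) ≤ U * (C * (U : ℝ) ^ ε) := by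
    have := card_le_fiber Q1 I (fun x => x.1) (C * (U : ℝ) ^ ε) ?_ ?_
    · rwa [cI] at this
    · rintro ⟨a, b, c, d⟩ hx
      simp only [hQ1, hQ, quadSet, Finset.mem_filter, Finset.mem_product] at hx
      exact hx.1.1.1
    · intro t ht
      refine le_trans ?_ (hC U hU h hh)
      rw [Nat.cast_le]
      apply Finset.card_le_card_of_injOn (fun x => (x.2.1, x.2.2.2))
      · rintro ⟨a, b, c, d⟩ hx
        simp only [hQ1, hQ, quadSet, Finset.coe_filter, Finset.mem_filter, Finset.mem_product, Set.mem_ofPred_eq] at hx ⊢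
        obtain ⟨⟨⟨h1, h2⟩, rfl⟩, h3⟩ := hx
        exact ⟨⟨h1.2.1, h1.2.2.2⟩, by linarith⟩
      · rintro ⟨a, b, c, d⟩ hx ⟨a', b', c', d'⟩ hy hxy
        simp only [hQ1, hQ, quadSet, Finset.coe_filter, Finset.mem_filter, Finset.mem_product, Set.mem_ofPred_eq, Prod.mk.injEq] at hx hy hxy ⊢
        have := hx.1.2
        have := hy.1.2
        have := hx.2
        have := hy.2
        omega
  have b2 : (Q2.card : ℝ) ≤ U * (C * (U : ℝ) ^ ε) := by
    have := card_le_fiber Q2 I (fun x => x.2.1) (C * (U : ℝ) ^ ε) ?_ ?_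
    · rwa [cI] at this
    · rintro ⟨a, b, c, d⟩ hx
      simp only [hQ2, hQ, quadSet, Finset.mem_filter, Finset.mem_product] at hx
      exact hx.1.1.2.1
    · intro t ht
      refine le_trans ?_ (hC U hU h hh)
      rw [Nat.cast_le]
      apply Finset.card_le_card_of_injOn (fun x => (x.1, x.2.2.2))
      · rintro ⟨a, b, c, d⟩ hx
        simp only [hQ2, hQ, quadSet, Finset.coe_filter, Finset.mem_filter, Finset.mem_product, Set.mem_ofPred_eq] at hx ⊢
        obtain ⟨⟨⟨h1, h2⟩, rfl⟩, h3⟩ := hx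
        exact ⟨⟨h1.1, h1.2.2.2⟩, by linarith⟩
      · rintro ⟨a, b, c, d⟩ hx ⟨a', b', c', d'⟩ hy hxy
        simp only [hQ2, hQ, quadSet, Finset.coe_filter, Finset.mem_filter, Finset.mem_product, Set.mem_ofPred_eq, Prod.mk.injEq] at hx hy hxy ⊢
        have := hx.1.2
        have := hy.1.2
        have := hx.2
        have := hy.2
        omega
  have b3 : (Q3.card : ℝ) ≤ U * (C * (U : ℝ) ^ ε) := by
    have := card_le_fiber Q3 I (fun x => x.1) (C * (U : ℝ) ^ ε) ?_ ?_
    · rwa [cI] at this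
    · rintro ⟨a, b, c, d⟩ hx
      simp only [hQ3, hQ, quadSet, Finset.mem_filter, Finset.mem_product] at hx
      exact hx.1.1.1
    · intro t ht
      have ht0 : (t : ℤ) ^ k ≠ 0 := by
        have : 1 ≤ t := (Finset.mem_Icc.1 ht).1
        positivity
      refine le_trans ?_ (hC U hU ((t : ℤ) ^ k) ht0)
      rw [Nat.cast_le]
      apply Finset.card_le_card_of_injOn (fun x => (x.2.2.1, x.2.1))
      · rintro ⟨a, b, c, d⟩ hx
        simp only [hQ3, hQ, quadSet, Finset.coe_filter, Finset.mem_filter, Finset.mem_product, Set.mem_ofPred_eq] at hx ⊢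
        obtain ⟨⟨⟨h1, h2⟩, h4⟩, rfl⟩ := hx
        exact ⟨⟨h1.2.2.1, h1.2.1⟩, by linarith⟩
      · rintro ⟨a, b, c, d⟩ hx ⟨a', b', c', d'⟩ hy hxy
        simp only [hQ3, hQ, quadSet, Finset.coe_filter, Finset.mem_filter, Finset.mem_product, Set.mem_ofPred_eq, Prod.mk.injEq] at hx hy hxy ⊢
        have e2 : (d : ℤ) ^ k = (d' : ℤ) ^ k := by linarith [hx.1.2, hy.1.2]
        have e3 : d = d' := Nat.pow_left_injective hk0 (by exact_mod_cast e2)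
        have := hx.2
        have := hy.2
        omega
  have b4 : (Q4.card : ℝ) ≤ U * (D * (U : ℝ) ^ (2 / Real.sqrt k + ε)) := by
    have := card_le_fiber Q4 I (fun x => x.2.2.2) (D * (U : ℝ) ^ (2 / Real.sqrt k + ε)) ?_ ?_
    · rwa [cI] at this
    · rintro ⟨a, b, c, d⟩ hx
      simp only [hQ4, hQ, quadSet, Finset.mem_filter, Finset.mem_product] at hx
      exact hx.1.1.2.2.2
    · intro t ht
      by_cases hn : (t : ℤ) ^ k + h = 0
      · rw [Finset.filter_eq_empty_iff.2 (by
          rintro ⟨a', b, c', d⟩ hx rfl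
          simp only [hQ4, Finset.mem_filter] at hx
          exact hx.2.1 hn)]
        simp; positivity
      refine le_trans ?_ (hD U hU _ hn)
      rw [Nat.cast_le]
      apply Finset.card_le_card_of_injOn (fun x => (x.1, x.2.1, x.2.2.1))
      · rintro ⟨a, b, c, d⟩ hx
        simp only [Zset, hQ4, hQ, quadSet, Finset.coe_filter, Finset.mem_filter, Finset.mem_product, Set.mem_ofPred_eq] at hx ⊢
        obtain ⟨⟨⟨h1, h2⟩, h4⟩, rfl⟩ := hx
        exact ⟨⟨h1.1, h1.2.1, h1.2.2.1⟩, by linarith, h4.2⟩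
      · rintro ⟨a, b, c, d⟩ hx ⟨a', b', c', d'⟩ hy hxy
        simp only [hQ4, hQ, quadSet, Finset.coe_filter, Finset.mem_filter, Finset.mem_product, Set.mem_ofPred_eq, Prod.mk.injEq] at hx hy hxy ⊢
        have := hx.2
        have := hy.2
        omega
  have s0 : 0 ≤ 2 / Real.sqrt k := by positivity
  have e1 : (U : ℝ) ^ (1 + 2 / Real.sqrt k + ε) = U * (U : ℝ) ^ (2 / Real.sqrt k + ε) := by
    rw [add_assoc, Real.rpow_add (by positivity), Real.rpow_one]
  have e2 : (U : ℝ) ^ ε ≤ (U : ℝ) ^ (2 / Real.sqrt k + ε) :=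
    Real.rpow_le_rpow_of_exponent_le hU1 (by linarith)
  rw [e1]
  have e3 : U * (C * (U : ℝ) ^ ε) ≤ U * (C * (U : ℝ) ^ (2 / Real.sqrt k + ε)) := by gcongr
  calc (Q.card : ℝ) ≤ _ := hcard
    _ ≤ 3 * (U * (C * (U : ℝ) ^ (2 / Real.sqrt k + ε))) + U * (D * (U : ℝ) ^ (2 / Real.sqrt k + ε)) := by linarith
    _ = _ := by ring

theorem main_of_core (core : CoreBound)
    (k : ℕ) (hk : 2 ≤ k) (ε : ℝ) (hε : 0 < ε) :
    ∃ C : ℝ, 0 < C ∧ ∀ U : ℕ, 0 < U → ∀ h : ℤ, h ≠ 0 →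
      (addEnergyShift h ((Finset.Icc 1 U).image (fun u : ℕ => (u : ℤ) ^ k)) : ℝ)
        ≤ C * (U : ℝ) ^ (1 + 2 / Real.sqrt k + ε) := by
  have : ∃ C : ℝ, 0 < C ∧ ∀ U : ℕ, 0 < U → ∀ h : ℤ, h ≠ 0 →
      ((quadSet k U h).card : ℝ) ≤ C * (U : ℝ) ^ (1 + 2 / Real.sqrt k + ε) := by
    by_cases h5 : 5 ≤ k
    · exact quad_large core k h5 ε hε
    · obtain ⟨C, hC, h⟩ := quad_small k hk ε hε
      refine ⟨C, hC, fun U hU m hm => (h U hU m hm).trans ?_⟩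
      have hU1 : (1 : ℝ) ≤ U := by exact_mod_cast hU
      gcongr
      have : Real.sqrt k ≤ 2 := by
        rw [Real.sqrt_le_left (by norm_num)]
        have : k ≤ 4 := by omega
        have : (k : ℝ) ≤ 4 := by exact_mod_cast this
        linarith
      have hs : 0 < Real.sqrt k := Real.sqrt_pos.2 (by positivity)
      have : 1 ≤ 2 / Real.sqrt k := by rw [le_div_iff₀ hs]; linarith
      linarith
  obtain ⟨C, hC, h⟩ := this
  exact ⟨C, hC, fun U hU m hm => le_trans (by exact_mod_cast energy_le_quad k U m) (h U hU m hm)⟩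

end

theorem asymmetric_energy_of_kth_powers
    (k : ℕ) (hk : 2 ≤ k) (ε : ℝ) (hε : 0 < ε) :
    ∃ C : ℝ, 0 < C ∧ ∀ U : ℕ, 0 < U → ∀ h : ℤ, h ≠ 0 →
      (addEnergyShift h ((Finset.Icc 1 U).image (fun u : ℕ => (u : ℤ) ^ k)) : ℝ)
        ≤ C * (U : ℝ) ^ (1 + 2 / Real.sqrt k + ε) := by
  exact main_of_core (core_of_curve curveBound) k hk ε hε
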